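/- There exists a function u ∈ C²(ℝ²) with |u| ≤ 1 that solves Δ_G u − W'(u) = 0 in all of ℝ², satisfies ∂_y u(ζ) > 0 for every ζ ∈ ℝ², and is NOT one-dimensional: there exist no g : ℝ → ℝ and a, b ∈ ℝ such that u(x, y) = g(a x + b y) for all (x, y) ∈ ℝ². -/

import Mathlib

open MeasureTheory

/-- A double-well potential as in the paper: `W ∈ C²`, even, `W(±1) = 0 ≤ W`,
`W''(0) ≠ 0`, `W''(±1) ≠ 0`, and `W'(s) = 0` iff `s ∈ {−1, 0, +1}`. -/
def DoubleWell (W : ℝ → ℝ) : Prop :=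
  ContDiff ℝ 2 W ∧ (∀ r : ℝ, W (-r) = W r) ∧ W 1 = 0 ∧ W (-1) = 0 ∧ (∀ r : ℝ, 0 ≤ W r) ∧
    deriv (deriv W) 0 ≠ 0 ∧ deriv (deriv W) 1 ≠ 0 ∧ deriv (deriv W) (-1) ≠ 0 ∧
    (∀ s : ℝ, deriv W s = 0 ↔ s = -1 ∨ s = 0 ∨ s = 1)

/-- Partial derivative in `x`. -/
noncomputable def pX (u : ℝ × ℝ → ℝ) (p : ℝ × ℝ) : ℝ := deriv (fun x => u (x, p.2)) p.1

/-- Partial derivative in `y`. -/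
noncomputable def pY (u : ℝ × ℝ → ℝ) (p : ℝ × ℝ) : ℝ := deriv (fun y => u (p.1, y)) p.2

/-- Second partial derivative in `x`. -/
noncomputable def pXX (u : ℝ × ℝ → ℝ) (p : ℝ × ℝ) : ℝ :=
  deriv (deriv (fun x => u (x, p.2))) p.1

/-- Second partial derivative in `y`. -/
noncomputable def pYY (u : ℝ × ℝ → ℝ) (p : ℝ × ℝ) : ℝ :=
  deriv (deriv (fun y => u (p.1, y))) p.2

/-- The Grushin Laplacian `Δ_G u = ∂_xx u + x² ∂_yy u`. -/
noncomputable def grushinLap (u : ℝ × ℝ → ℝ) (p : ℝ × ℝ) : ℝ := pXX u p + p.1 ^ 2 * pYY u p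

section
open MeasureTheory Filter Topology Set

lemma pX_eq_fderiv {u : ℝ × ℝ → ℝ} (hu : ContDiff ℝ 1 u) (p : ℝ × ℝ) :
    HasDerivAt (fun x => u (x, p.2)) (fderiv ℝ u p (1, 0)) p.1 := by
  have h1 : HasFDerivAt u (fderiv ℝ u p) (p.1, p.2) :=
    (hu.differentiable (by norm_num) p).hasFDerivAt
  have h2 : HasDerivAt (fun x : ℝ => (x, p.2)) ((1 : ℝ), (0 : ℝ)) p.1 :=
    (hasDerivAt_id p.1).prodMk (hasDerivAt_const p.1 p.2)
  exact h1.comp_hasDerivAt p.1 h2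

lemma pY_eq_fderiv {u : ℝ × ℝ → ℝ} (hu : ContDiff ℝ 1 u) (p : ℝ × ℝ) :
    HasDerivAt (fun y => u (p.1, y)) (fderiv ℝ u p (0, 1)) p.2 := by
  have h1 : HasFDerivAt u (fderiv ℝ u p) (p.1, p.2) :=
    (hu.differentiable (by norm_num) p).hasFDerivAt
  have h2 : HasDerivAt (fun y : ℝ => (p.1, y)) ((0 : ℝ), (1 : ℝ)) p.2 :=
    (hasDerivAt_const p.2 p.1).prodMk (hasDerivAt_id p.2)
  exact h1.comp_hasDerivAt p.2 h2

lemma pX_fun {u : ℝ × ℝ → ℝ} (hu : ContDiff ℝ 1 u) : pX u = fun p => fderiv ℝ u p (1, 0) :=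
  funext fun p => (pX_eq_fderiv hu p).deriv

lemma pY_fun {u : ℝ × ℝ → ℝ} (hu : ContDiff ℝ 1 u) : pY u = fun p => fderiv ℝ u p (0, 1) :=
  funext fun p => (pY_eq_fderiv hu p).deriv

lemma hasDerivAt_pX {u : ℝ × ℝ → ℝ} (hu : ContDiff ℝ 1 u) (x y : ℝ) :
    HasDerivAt (fun x => u (x, y)) (pX u (x, y)) x := by
  rw [pX_fun hu]; exact pX_eq_fderiv hu (x, y)

lemma hasDerivAt_pY {u : ℝ × ℝ → ℝ} (hu : ContDiff ℝ 1 u) (x y : ℝ) :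
    HasDerivAt (fun y => u (x, y)) (pY u (x, y)) y := by
  rw [pY_fun hu]; exact pY_eq_fderiv hu (x, y)

lemma contDiff_pX {u : ℝ × ℝ → ℝ} (hu : ContDiff ℝ 2 u) : ContDiff ℝ 1 (pX u) := by
  rw [pX_fun (hu.of_le (by norm_num))]
  exact (hu.fderiv_right (m := 1) (by norm_num)).clm_apply contDiff_const

lemma contDiff_pY {u : ℝ × ℝ → ℝ} (hu : ContDiff ℝ 2 u) : ContDiff ℝ 1 (pY u) := by
  rw [pY_fun (hu.of_le (by norm_num))]
  exact (hu.fderiv_right (m := 1) (by norm_num)).clm_apply contDiff_const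

lemma continuous_pX {u : ℝ × ℝ → ℝ} (hu : ContDiff ℝ 1 u) : Continuous (pX u) := by
  rw [pX_fun hu]
  exact (hu.continuous_fderiv (by norm_num)).clm_apply continuous_const

lemma continuous_pY {u : ℝ × ℝ → ℝ} (hu : ContDiff ℝ 1 u) : Continuous (pY u) := by
  rw [pY_fun hu]
  exact (hu.continuous_fderiv (by norm_num)).clm_apply continuous_const

lemma pXX_eq (u : ℝ × ℝ → ℝ) : pXX u = pX (pX u) := rfl
lemma pYY_eq (u : ℝ × ℝ → ℝ) : pYY u = pY (pY u) := rfl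

lemma continuous_pXX {u : ℝ × ℝ → ℝ} (hu : ContDiff ℝ 2 u) : Continuous (pXX u) :=
  continuous_pX (contDiff_pX hu)

lemma continuous_pYY {u : ℝ × ℝ → ℝ} (hu : ContDiff ℝ 2 u) : Continuous (pYY u) :=
  continuous_pY (contDiff_pY hu)

lemma continuous_lap {u : ℝ × ℝ → ℝ} (hu : ContDiff ℝ 2 u) : Continuous (grushinLap u) := by
  unfold grushinLap
  exact (continuous_pXX hu).add ((continuous_fst.pow 2).mul (continuous_pYY hu))

lemma hcs_pX {u : ℝ × ℝ → ℝ} (hu : ContDiff ℝ 1 u) (hc : HasCompactSupport u) :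
    HasCompactSupport (pX u) := by
  rw [pX_fun hu]; exact hc.fderiv_apply ℝ (1, 0)

lemma hcs_pY {u : ℝ × ℝ → ℝ} (hu : ContDiff ℝ 1 u) (hc : HasCompactSupport u) :
    HasCompactSupport (pY u) := by
  rw [pY_fun hu]; exact hc.fderiv_apply ℝ (0, 1)

lemma hcs_pXX {u : ℝ × ℝ → ℝ} (hu : ContDiff ℝ 2 u) (hc : HasCompactSupport u) :
    HasCompactSupport (pXX u) := by
  rw [pXX_eq]; exact hcs_pX (contDiff_pX hu) (hcs_pX (hu.of_le (by norm_num)) hc)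

lemma hcs_pYY {u : ℝ × ℝ → ℝ} (hu : ContDiff ℝ 2 u) (hc : HasCompactSupport u) :
    HasCompactSupport (pYY u) := by
  rw [pYY_eq]; exact hcs_pY (contDiff_pY hu) (hcs_pY (hu.of_le (by norm_num)) hc)

lemma hasDerivAt_pXX {u : ℝ × ℝ → ℝ} (hu : ContDiff ℝ 2 u) (x y : ℝ) :
    HasDerivAt (fun x => pX u (x, y)) (pXX u (x, y)) x := by
  rw [pXX_eq]; exact hasDerivAt_pX (contDiff_pX hu) x y

lemma hasDerivAt_pYY {u : ℝ × ℝ → ℝ} (hu : ContDiff ℝ 2 u) (x y : ℝ) :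
    HasDerivAt (fun y => pY u (x, y)) (pYY u (x, y)) y := by
  rw [pYY_eq]; exact hasDerivAt_pY (contDiff_pY hu) x y

lemma hcs_lap {u : ℝ × ℝ → ℝ} (hu : ContDiff ℝ 2 u) (hc : HasCompactSupport u) :
    HasCompactSupport (grushinLap u) := by
  have h3 : HasCompactSupport ((fun p : ℝ × ℝ => p.1 ^ 2) * pYY u) := (hcs_pYY hu hc).mul_left
  exact (hcs_pXX hu hc).add h3

lemma lap_add {u v : ℝ × ℝ → ℝ} (hu : ContDiff ℝ 2 u) (hv : ContDiff ℝ 2 v) (p : ℝ × ℝ) :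
    grushinLap (u + v) p = grushinLap u p + grushinLap v p := by
  have e1 : pX (u + v) = pX u + pX v := by
    funext q
    exact ((hasDerivAt_pX (hu.of_le (by norm_num)) q.1 q.2).add
      (hasDerivAt_pX (hv.of_le (by norm_num)) q.1 q.2)).deriv
  have e2 : pY (u + v) = pY u + pY v := by
    funext q
    exact ((hasDerivAt_pY (hu.of_le (by norm_num)) q.1 q.2).add
      (hasDerivAt_pY (hv.of_le (by norm_num)) q.1 q.2)).deriv
  have e3 : pX (pX u + pX v) p = pXX u p + pXX v p :=
    ((hasDerivAt_pX (contDiff_pX hu) p.1 p.2).add (hasDerivAt_pX (contDiff_pX hv) p.1 p.2)).deriv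
  have e4 : pY (pY u + pY v) p = pYY u p + pYY v p :=
    ((hasDerivAt_pY (contDiff_pY hu) p.1 p.2).add (hasDerivAt_pY (contDiff_pY hv) p.1 p.2)).deriv
  unfold grushinLap
  rw [pXX_eq, pYY_eq, e1, e2, e3, e4]; ring

lemma lap_smul {u : ℝ × ℝ → ℝ} (c : ℝ) (p : ℝ × ℝ) :
    grushinLap (c • u) p = c * grushinLap u p := by
  have e1 : ∀ g : ℝ → ℝ, deriv (c • g) = c • deriv g := fun g => by
    funext x; simp only [Pi.smul_apply]; exact deriv_const_smul_field c g
  have e2 : pXX (c • u) p = c * pXX u p := by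
    unfold pXX
    have : (fun x => (c • u) (x, p.2)) = c • (fun x => u (x, p.2)) := rfl
    rw [this, e1, e1]; rfl
  have e3 : pYY (c • u) p = c * pYY u p := by
    unfold pYY
    have : (fun x => (c • u) (p.1, x)) = c • (fun x => u (p.1, x)) := rfl
    rw [this, e1, e1]; rfl
  unfold grushinLap; rw [e2, e3]; ring

/-- distributional solutions of `Δ_G u = F`. -/
def DSol (u F : ℝ × ℝ → ℝ) : Prop :=
  ∀ φ : ℝ × ℝ → ℝ, ContDiff ℝ 2 φ → HasCompactSupport φ →
    ∫ p, u p * grushinLap φ p = ∫ p, F p * φ p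

/-- integration by parts in the `x` direction -/
lemma ibpX {f f' g g' : ℝ × ℝ → ℝ} (h1 : Integrable (fun p => f' p * g p))
    (h2 : Integrable (fun p => f p * g' p)) (h3 : Integrable (fun p => f p * g p))
    (hf : ∀ x y, HasDerivAt (fun x => f (x, y)) (f' (x, y)) x)
    (hg : ∀ x y, HasDerivAt (fun x => g (x, y)) (g' (x, y)) x) :
    ∫ p, f p * g' p = - ∫ p, f' p * g p := by
  have key : ∀ (f f' : ℝ × ℝ → ℝ), (∀ x y, HasDerivAt (fun x => f (x, y)) (f' (x, y)) x) →
      ∀ p, HasLineDerivAt ℝ f (f' p) p ((1 : ℝ), (0 : ℝ)) := by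
    intro f f' hf p
    have h := hf (p.1 + 0) p.2
    have h6 : HasDerivAt (fun t : ℝ => f (p.1 + t, p.2)) (f' p) 0 := by
      have := HasDerivAt.comp_const_add p.1 0 h
      simpa using this
    have e : (fun t : ℝ => f (p + t • ((1 : ℝ), (0 : ℝ)))) = fun t => f (p.1 + t, p.2) := by
      funext t; congr 1; ext <;> simp
    unfold HasLineDerivAt
    rw [e]; exact h6
  exact integral_bilinear_hasLineDerivAt_right_eq_neg_left_of_integrable
    (B := ContinuousLinearMap.mul ℝ ℝ) (μ := volume) h1 h2 h3
    (fun p _ => key f f' hf p) (fun p _ => key g g' hg p)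

lemma ibpY {f f' g g' : ℝ × ℝ → ℝ} (h1 : Integrable (fun p => f' p * g p))
    (h2 : Integrable (fun p => f p * g' p)) (h3 : Integrable (fun p => f p * g p))
    (hf : ∀ x y, HasDerivAt (fun y => f (x, y)) (f' (x, y)) y)
    (hg : ∀ x y, HasDerivAt (fun y => g (x, y)) (g' (x, y)) y) :
    ∫ p, f p * g' p = - ∫ p, f' p * g p := by
  have key : ∀ (f f' : ℝ × ℝ → ℝ), (∀ x y, HasDerivAt (fun y => f (x, y)) (f' (x, y)) y) →
      ∀ p, HasLineDerivAt ℝ f (f' p) p ((0 : ℝ), (1 : ℝ)) := by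
    intro f f' hf p
    have h := hf p.1 (p.2 + 0)
    have h6 : HasDerivAt (fun t : ℝ => f (p.1, p.2 + t)) (f' p) 0 := by
      have := HasDerivAt.comp_const_add p.2 0 h
      simpa using this
    have e : (fun t : ℝ => f (p + t • ((0 : ℝ), (1 : ℝ)))) = fun t => f (p.1, p.2 + t) := by
      funext t; congr 1; ext <;> simp
    unfold HasLineDerivAt
    rw [e]; exact h6
  exact integral_bilinear_hasLineDerivAt_right_eq_neg_left_of_integrable
    (B := ContinuousLinearMap.mul ℝ ℝ) (μ := volume) h1 h2 h3
    (fun p _ => key f f' hf p) (fun p _ => key g g' hg p)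

lemma int_of_cc {g : ℝ × ℝ → ℝ} (hg : Continuous g) (hc : HasCompactSupport g) : Integrable g :=
  hg.integrable_of_hasCompactSupport hc

lemma intc {f g : ℝ × ℝ → ℝ} (hf : Continuous f) (hg : Continuous g) (hc : HasCompactSupport g) :
    Integrable (fun p => f p * g p) := by
  have h3 : HasCompactSupport (f * g) := hc.mul_left
  exact int_of_cc (hf.mul hg) h3

lemma green {u φ : ℝ × ℝ → ℝ} (hu : ContDiff ℝ 2 u) (hφ : ContDiff ℝ 2 φ)
    (hc : HasCompactSupport φ) : ∫ p, u p * grushinLap φ p = ∫ p, grushinLap u p * φ p := by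
  have hu1 : ContDiff ℝ 1 u := hu.of_le (by norm_num)
  have hφ1 : ContDiff ℝ 1 φ := hφ.of_le (by norm_num)
  have cu := hu.continuous
  have cφ := hφ.continuous
  have cux := continuous_pX hu1
  have cuy := continuous_pY hu1
  have cφx := continuous_pX hφ1
  have cφy := continuous_pY hφ1
  have cuxx := continuous_pXX hu
  have cuyy := continuous_pYY hu
  have cφxx := continuous_pXX hφ
  have cφyy := continuous_pYY hφ
  have sx := hcs_pX hφ1 hc
  have sy := hcs_pY hφ1 hc
  have sxx := hcs_pXX hφ hc
  have syy := hcs_pYY hφ hc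
  have a1 : ∫ p, u p * pXX φ p = - ∫ p, pX u p * pX φ p :=
    ibpX (intc cux cφx sx) (intc cu cφxx sxx)
      (intc cu cφx sx) (hasDerivAt_pX hu1) (hasDerivAt_pXX hφ)
  have a2 : ∫ p, pX u p * pX φ p = - ∫ p, pXX u p * φ p :=
    ibpX (intc cuxx cφ hc) (intc cux cφx sx)
      (intc cux cφ hc) (hasDerivAt_pXX hu) (hasDerivAt_pX hφ1)
  have c2 : Continuous (fun p : ℝ × ℝ => p.1 ^ 2) := by fun_prop
  have b1 : ∫ p : ℝ × ℝ, (p.1 ^ 2 * u p) * pYY φ p = - ∫ p, (p.1 ^ 2 * pY u p) * pY φ p :=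
    ibpY (intc (c2.mul cuy) cφy sy)
      (intc (c2.mul cu) cφyy syy)
      (intc (c2.mul cu) cφy sy)
      (fun x y => (hasDerivAt_pY hu1 x y).const_mul (x ^ 2)) (hasDerivAt_pYY hφ)
  have b2 : ∫ p : ℝ × ℝ, (p.1 ^ 2 * pY u p) * pY φ p = - ∫ p, (p.1 ^ 2 * pYY u p) * φ p :=
    ibpY (intc (c2.mul cuyy) cφ hc)
      (intc (c2.mul cuy) cφy sy)
      (intc (c2.mul cuy) cφ hc)
      (fun x y => (hasDerivAt_pYY hu x y).const_mul (x ^ 2)) (hasDerivAt_pY hφ1)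
  have e1 : ∫ p, u p * grushinLap φ p
      = (∫ p, u p * pXX φ p) + ∫ p : ℝ × ℝ, (p.1 ^ 2 * u p) * pYY φ p := by
    refine Eq.trans ?_ (integral_add (intc cu cφxx sxx) (intc (c2.mul cu) cφyy syy))
    congr 1; funext p; simp only [grushinLap, Pi.mul_apply]; ring
  have e2 : ∫ p, grushinLap u p * φ p
      = (∫ p, pXX u p * φ p) + ∫ p : ℝ × ℝ, (p.1 ^ 2 * pYY u p) * φ p := by
    refine Eq.trans ?_ (integral_add (intc cuxx cφ hc) (intc (c2.mul cuyy) cφ hc))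
    congr 1; funext p; simp only [grushinLap, Pi.mul_apply]; ring
  rw [e1, e2, a1, a2, b1, b2]; ring

lemma dsol_of_contDiff {u : ℝ × ℝ → ℝ} (hu : ContDiff ℝ 2 u) : DSol u (grushinLap u) :=
  fun _ hφ hc => green hu hφ hc
end

section
open MeasureTheory Filter Topology Set

lemma ind_deriv (A : Set ℝ) (g : ℝ → ℝ) (g' x : ℝ) (hg : HasDerivAt g g' x)
    (hA : x ∈ frontier A → g x = 0 ∧ g' = 0) :
    HasDerivAt (A.indicator g) (A.indicator (fun _ => g') x) x := by
  by_cases hx : x ∈ frontier A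
  · obtain ⟨h0, h1⟩ := hA hx
    subst h1
    have e : A.indicator (fun _ : ℝ => (0 : ℝ)) x = 0 := by simp
    rw [e]
    rw [hasDerivAt_iff_isLittleO] at hg ⊢
    have hgx : A.indicator g x = 0 := by simp [indicator, h0]
    simp only [h0, hgx, smul_zero, sub_zero] at hg ⊢
    refine (Asymptotics.IsBigO.of_bound 1 (Eventually.of_forall fun t => ?_)).trans_isLittleO hg
    rw [one_mul]; exact norm_indicator_le_norm_self g t
  · by_cases hi : x ∈ interior A
    · rw [indicator_of_mem (interior_subset hi)]
      refine hg.congr_of_eventuallyEq ?_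
      filter_upwards [mem_interior_iff_mem_nhds.1 hi] with t ht using indicator_of_mem ht g
    · have hcl : x ∉ closure A := fun h => hx ⟨h, hi⟩
      have hxA : x ∉ A := fun h => hcl (subset_closure h)
      rw [indicator_of_notMem hxA]
      refine (hasDerivAt_const x (0 : ℝ)).congr_of_eventuallyEq ?_
      filter_upwards [isClosed_closure.isOpen_compl.mem_nhds hcl] with t ht
      exact indicator_of_notMem (fun h => ht (subset_closure h)) g

/-- smooth Heaviside approximations -/
noncomputable def heav (n : ℕ) (s : ℝ) : ℝ := Real.smoothTransition (n * s)

lemma heav_contDiff (n : ℕ) : ContDiff ℝ 1 (heav n) := by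
  unfold heav
  exact (Real.smoothTransition.contDiff (n := 1)).comp (contDiff_const.mul contDiff_id)

lemma heav_mono (n : ℕ) : Monotone (heav n) := fun _ _ h =>
  Real.smoothTransition.monotone (mul_le_mul_of_nonneg_left h (Nat.cast_nonneg n))

lemma heav_zero (n : ℕ) : heav n 0 = 0 := by simp [heav]

lemma heav_deriv_zero (n : ℕ) : deriv (heav n) 0 = 0 := by
  apply IsLocalMin.deriv_eq_zero
  refine Eventually.of_forall fun s => ?_
  rw [heav_zero]; exact Real.smoothTransition.nonneg _

lemma heav_hasDeriv (n : ℕ) (s : ℝ) : HasDerivAt (heav n) (deriv (heav n) s) s :=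
  ((heav_contDiff n).differentiable (by norm_num) s).hasDerivAt

lemma heav_deriv_nonneg (n : ℕ) (s : ℝ) : 0 ≤ deriv (heav n) s := (heav_mono n).deriv_nonneg

lemma ibp_sign (n : ℕ) {Ω : Set (ℝ × ℝ)} (hΩ : MeasurableSet Ω) {φ : ℝ × ℝ → ℝ}
    (hφ : ContDiff ℝ 2 φ) (hc : HasCompactSupport φ) (hfr : ∀ p ∈ frontier Ω, φ p = 0) :
    ∫ p in Ω, grushinLap φ p * heav n (φ p) ≤ 0 := by
  have hφ1 : ContDiff ℝ 1 φ := hφ.of_le (by norm_num)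
  have cd : Continuous (deriv (heav n)) := (heav_contDiff n).continuous_deriv (by norm_num)
  have ch : Continuous (fun p => heav n (φ p)) := (heav_contDiff n).continuous.comp hφ.continuous
  have cd' : Continuous (fun p => deriv (heav n) (φ p)) := cd.comp hφ.continuous
  set g : ℝ × ℝ → ℝ := Ω.indicator (fun p => heav n (φ p)) with hg
  have gx : ∀ x y, HasDerivAt (fun x => g (x, y))
      (Ω.indicator (fun p => deriv (heav n) (φ p) * pX φ p) (x, y)) x := by
    intro x y
    have h1 := (heav_hasDeriv n (φ (x, y))).comp x (hasDerivAt_pX hφ1 x y)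
    have h2 := ind_deriv ((fun x : ℝ => (x, y)) ⁻¹' Ω) _ _ x h1 (fun hx => by
      have : (x, y) ∈ frontier Ω :=
        (Continuous.frontier_preimage_subset (f := fun x : ℝ => (x, y)) (by fun_prop) Ω) hx
      simp [Function.comp, hfr _ this, heav_zero, heav_deriv_zero])
    exact h2
  have gy : ∀ x y, HasDerivAt (fun y => g (x, y))
      (Ω.indicator (fun p => deriv (heav n) (φ p) * pY φ p) (x, y)) y := by
    intro x y
    have h1 := (heav_hasDeriv n (φ (x, y))).comp y (hasDerivAt_pY hφ1 x y)
    have h2 := ind_deriv ((fun y : ℝ => (x, y)) ⁻¹' Ω) _ _ y h1 (fun hx => by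
      have : (x, y) ∈ frontier Ω :=
        (Continuous.frontier_preimage_subset (f := fun y : ℝ => (x, y)) (by fun_prop) Ω) hx
      simp [Function.comp, hfr _ this, heav_zero, heav_deriv_zero])
    exact h2
  have ii : ∀ {f h : ℝ × ℝ → ℝ}, Continuous f → Continuous h → HasCompactSupport h →
      Integrable (fun p => Ω.indicator f p * h p) := by
    intro f h hf hh hs
    have := (intc hf hh hs).indicator hΩ
    refine this.congr (Eventually.of_forall fun p => ?_)
    by_cases hp : p ∈ Ω <;> simp [hp]
  have sx := hcs_pX hφ1 hc
  have sy := hcs_pY hφ1 hc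
  have cx := continuous_pX hφ1
  have cy := continuous_pY hφ1
  have c2 : Continuous (fun p : ℝ × ℝ => p.1 ^ 2) := by fun_prop
  have s2 : HasCompactSupport (fun p : ℝ × ℝ => p.1 ^ 2 * pYY φ p) :=
    HasCompactSupport.mul_left (f := fun p : ℝ × ℝ => p.1 ^ 2) (hcs_pYY hφ hc)
  have s2' : HasCompactSupport (fun p : ℝ × ℝ => p.1 ^ 2 * pY φ p) :=
    HasCompactSupport.mul_left (f := fun p : ℝ × ℝ => p.1 ^ 2) sy
  have a1 : ∫ p, g p * pXX φ p =
      -∫ p, Ω.indicator (fun p => deriv (heav n) (φ p) * pX φ p) p * pX φ p :=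
    ibpX (ii (cd'.mul cx) cx sx) (ii ch (continuous_pXX hφ) (hcs_pXX hφ hc))
    (ii ch cx sx) gx (hasDerivAt_pXX hφ)
  have a2 : ∫ p : ℝ × ℝ, g p * (p.1 ^ 2 * pYY φ p) =
      -∫ p : ℝ × ℝ, Ω.indicator (fun p => deriv (heav n) (φ p) * pY φ p) p * (p.1 ^ 2 * pY φ p) :=
    ibpY (ii (cd'.mul cy) (c2.mul cy) s2') (ii ch (c2.mul (continuous_pYY hφ)) s2)
    (ii ch (c2.mul cy) s2') gy (fun x y => (hasDerivAt_pYY hφ x y).const_mul (x ^ 2))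
  have e : ∫ p in Ω, grushinLap φ p * heav n (φ p)
      = (∫ p, g p * pXX φ p) + ∫ p : ℝ × ℝ, g p * (p.1 ^ 2 * pYY φ p) := by
    rw [← integral_indicator hΩ]
    refine Eq.trans ?_ (integral_add (ii ch (continuous_pXX hφ) (hcs_pXX hφ hc))
      (ii ch (c2.mul (continuous_pYY hφ)) s2))
    congr 1; funext p
    by_cases hp : p ∈ Ω
    · simp only [hg, hp, indicator_of_mem, grushinLap]; ring
    · simp [hg, hp]
  rw [e, a1, a2]
  have p1 : 0 ≤ ∫ p, Ω.indicator (fun p => deriv (heav n) (φ p) * pX φ p) p * pX φ p := by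
    apply integral_nonneg; intro p
    by_cases hp : p ∈ Ω
    · simp only [hp, indicator_of_mem]
      have := mul_nonneg (heav_deriv_nonneg n (φ p)) (mul_self_nonneg (pX φ p))
      simp only [Pi.zero_apply]; nlinarith
    · simp [hp]
  have p2 : 0 ≤ ∫ p : ℝ × ℝ, Ω.indicator (fun p => deriv (heav n) (φ p) * pY φ p) p
      * (p.1 ^ 2 * pY φ p) := by
    apply integral_nonneg; intro p
    by_cases hp : p ∈ Ω
    · simp only [hp, indicator_of_mem]
      have := mul_nonneg (heav_deriv_nonneg n (φ p)) (mul_self_nonneg (p.1 * pY φ p))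
      simp only [Pi.zero_apply]; nlinarith
    · simp [hp]
  linarith

lemma kato {k : ℝ} (hk : 0 < k) {Ω : Set (ℝ × ℝ)} (hΩ : MeasurableSet Ω) {φ : ℝ × ℝ → ℝ}
    (hφ : ContDiff ℝ 2 φ) (hc : HasCompactSupport φ) (hfr : ∀ p ∈ frontier Ω, φ p = 0) :
    k * ∫ p in Ω, max (φ p) 0 ≤ ∫ p in Ω, max (k * φ p - grushinLap φ p) 0 := by
  have cφ := hφ.continuous
  have cl := continuous_lap hφ
  have ch : ∀ n, Continuous (fun p => heav n (φ p)) :=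
    fun n => (heav_contDiff n).continuous.comp cφ
  have hlim : Tendsto (fun n : ℕ => ∫ p in Ω, φ p * heav n (φ p)) atTop
      (𝓝 (∫ p in Ω, max (φ p) 0)) := by
    refine tendsto_integral_of_dominated_convergence (fun p => |φ p|)
      (fun n => (cφ.mul (ch n)).aestronglyMeasurable) ?_ ?_ ?_
    · exact (int_of_cc cφ hc).abs.integrableOn
    · intro n; refine Eventually.of_forall fun p => ?_
      rw [Real.norm_eq_abs, abs_mul]
      have h1 : |heav n (φ p)| ≤ 1 := by
        unfold heav
        rw [abs_of_nonneg (Real.smoothTransition.nonneg _)]; exact Real.smoothTransition.le_one _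
      nlinarith [abs_nonneg (φ p)]
    · refine Eventually.of_forall fun p => ?_
      rcases le_or_gt (φ p) 0 with h | h
      · have : ∀ n, heav n (φ p) = 0 := fun n =>
          Real.smoothTransition.zero_of_nonpos (mul_nonpos_of_nonneg_of_nonpos (Nat.cast_nonneg n) h)
        simp [this, max_eq_right h]
      · rw [max_eq_left h.le]
        refine tendsto_const_nhds.congr' ?_
        obtain ⟨N, hN⟩ := exists_nat_gt (1 / φ p)
        filter_upwards [eventually_ge_atTop N] with n hn
        have : heav n (φ p) = 1 := by
          apply Real.smoothTransition.one_of_one_le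
          have : 1 / φ p ≤ n := hN.le.trans (by exact_mod_cast hn)
          rwa [div_le_iff₀ h] at this
        rw [this, mul_one]
  refine le_of_tendsto (hlim.const_mul k) (Eventually.of_forall fun n => ?_)
  have h1 := ibp_sign n hΩ hφ hc hfr
  have i1 : Integrable (fun p => φ p * heav n (φ p)) := by
    have := intc (ch n) cφ hc
    exact this.congr (Eventually.of_forall fun p => mul_comm _ _)
  have i2 : Integrable (fun p => grushinLap φ p * heav n (φ p)) := by
    have := intc (ch n) cl (hcs_lap hφ hc)
    exact this.congr (Eventually.of_forall fun p => mul_comm _ _)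
  have i3 : Integrable (fun p => max (k * φ p - grushinLap φ p) 0) :=
    (((int_of_cc cφ hc).const_mul k).sub (int_of_cc cl (hcs_lap hφ hc))).pos_part
  have e : k * ∫ p in Ω, φ p * heav n (φ p) = (∫ p in Ω, (k * φ p - grushinLap φ p) * heav n (φ p))
      + ∫ p in Ω, grushinLap φ p * heav n (φ p) := by
    rw [← integral_const_mul, ← integral_add]
    · congr 1; funext p; ring
    · have := (i1.const_mul k).sub i2
      exact (this.congr (Eventually.of_forall fun p => by simp only [Pi.sub_apply]; ring)).integrableOn
    · exact i2.integrableOn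
  rw [e]
  have h2 : ∫ p in Ω, (k * φ p - grushinLap φ p) * heav n (φ p)
      ≤ ∫ p in Ω, max (k * φ p - grushinLap φ p) 0 := by
    apply integral_mono
    · have := (i1.const_mul k).sub i2
      exact (this.congr (Eventually.of_forall fun p => by simp only [Pi.sub_apply]; ring)).integrableOn
    · exact i3.integrableOn
    · intro p
      have a1 : 0 ≤ heav n (φ p) := Real.smoothTransition.nonneg _
      have a2 : heav n (φ p) ≤ 1 := Real.smoothTransition.le_one _
      simp only
      rcases le_or_gt (k * φ p - grushinLap φ p) 0 with h | h
      · rw [max_eq_right h]; exact mul_nonpos_of_nonpos_of_nonneg h a1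
      · rw [max_eq_left h.le]; nlinarith
  linarith
end

section
open MeasureTheory Filter Topology Set

lemma hb_abs {X V : Type} [MeasurableSpace X] (ν : Measure X) [IsFiniteMeasure ν]
    [AddCommGroup V] [Module ℝ V] (L : V →ₗ[ℝ] (X → ℝ)) (hm : ∀ φ, Measurable (L φ))
    (hb : ∀ φ, ∃ C, ∀ x, |L φ x| ≤ C) (l : V →ₗ[ℝ] ℝ) (c : ℝ) (hc : 0 ≤ c)
    (hl : ∀ φ, l φ ≤ c * ∫ x, max (L φ x) 0 ∂ν) :
    ∃ v : X → ℝ, Measurable v ∧ (∀ x, 0 ≤ v x ∧ v x ≤ c) ∧ ∀ φ, ∫ x, v x * L φ x ∂ν = l φ := by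
  have hmem : ∀ φ, MemLp (L φ) 2 ν := fun φ => by
    obtain ⟨C, hC⟩ := hb φ
    exact MemLp.of_bound (hm φ).aestronglyMeasurable C (Eventually.of_forall hC)
  let M : V →ₗ[ℝ] Lp ℝ 2 ν :=
    { toFun := fun φ => (hmem φ).toLp (L φ)
      map_add' := fun φ ψ => by
        rw [← MemLp.toLp_add]; congr 1; exact map_add L φ ψ
      map_smul' := fun r φ => by
        simp only [RingHom.id_apply]
        rw [← MemLp.toLp_const_smul]; congr 1; exact map_smul L r φ }
  have hMc : ∀ φ, (M φ : X → ℝ) =ᵐ[ν] L φ := fun φ => (hmem φ).coeFn_toLp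
  have hInt0 : ∀ ξ : Lp ℝ 2 ν, Integrable (ξ : X → ℝ) ν := fun ξ =>
    (Lp.memLp ξ).integrable (by norm_num)
  let N : Lp ℝ 2 ν → ℝ := fun ξ => c * ∫ x, max (ξ x) 0 ∂ν
  have hlN : ∀ φ, l φ ≤ N (M φ) := fun φ => by
    refine (hl φ).trans (le_of_eq ?_)
    simp only [N]; congr 1
    apply integral_congr_ae
    filter_upwards [hMc φ] with x hx
    rw [hx]
  have hN0 : N 0 = 0 := by
    simp only [N]
    have : ∫ x, max ((0 : Lp ℝ 2 ν) x) 0 ∂ν = 0 := by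
      rw [← integral_zero X ℝ (μ := ν)]
      apply integral_congr_ae
      filter_upwards [Lp.coeFn_zero ℝ 2 ν] with x hx
      rw [hx]; simp
    rw [this, mul_zero]
  have hker : ∀ φ, M φ = 0 → l φ = 0 := fun φ h => by
    have h1 := hlN φ
    have h2 := hlN (-φ)
    rw [map_neg, map_neg, h, neg_zero, hN0] at h2
    rw [h, hN0] at h1
    linarith
  obtain ⟨s, hs⟩ := M.rangeRestrict.exists_rightInverse_of_surjective M.range_rangeRestrict
  have hs' : ∀ ξ : LinearMap.range M, M (s ξ) = ξ := fun ξ => by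
    have := LinearMap.congr_fun hs ξ
    exact congrArg Subtype.val this
  let f : Lp ℝ 2 ν →ₗ.[ℝ] ℝ := ⟨LinearMap.range M, l ∘ₗ s⟩
  obtain ⟨G, hG1, hG2⟩ := exists_extension_of_le_sublinear f N
    (fun r hr ξ => by
      simp only [N]
      have : ∫ x, max ((r • ξ : Lp ℝ 2 ν) x) 0 ∂ν = r * ∫ x, max (ξ x) 0 ∂ν := by
        rw [← integral_const_mul]
        apply integral_congr_ae
        filter_upwards [Lp.coeFn_smul r ξ] with x hx
        rw [hx, Pi.smul_apply, smul_eq_mul, mul_max_of_nonneg _ _ hr.le, mul_zero]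
      rw [this]; ring)
    (fun ξ η => by
      simp only [N]
      rw [← mul_add, ← integral_add (hInt0 ξ).pos_part (hInt0 η).pos_part]
      apply mul_le_mul_of_nonneg_left _ hc
      apply integral_mono_ae (hInt0 _).pos_part ((hInt0 ξ).pos_part.add (hInt0 η).pos_part)
      filter_upwards [Lp.coeFn_add ξ η] with x hx
      rw [hx, Pi.add_apply]
      simp only [Pi.add_apply]
      exact max_le (add_le_add (le_max_left _ _) (le_max_left _ _))
        (add_nonneg (le_max_right _ _) (le_max_right _ _)))
    (fun ξ => by
      have := hlN (s ξ)
      rw [hs' ξ] at this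
      exact this)
  have hGM : ∀ φ, G (M φ) = l φ := fun φ => by
    have h1 := hG1 ⟨M φ, LinearMap.mem_range_self M φ⟩
    have h2 : M (s ⟨M φ, LinearMap.mem_range_self M φ⟩ - φ) = 0 := by
      rw [map_sub, hs']; simp
    have h3 := hker _ h2
    rw [map_sub] at h3
    have h4 : (f ⟨M φ, LinearMap.mem_range_self M φ⟩ : ℝ)
      = l (s ⟨M φ, LinearMap.mem_range_self M φ⟩) := rfl
    rw [h4] at h1
    simp only at h1
    linarith
  have hsq : ∀ ξ : Lp ℝ 2 ν, ∫ x, (ξ x) ^ 2 ∂ν = ‖ξ‖ ^ 2 := fun ξ => by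
    rw [← real_inner_self_eq_norm_sq, L2.inner_def]
    congr 1; funext x; simp [sq]
  have hsqi : ∀ ξ : Lp ℝ 2 ν, Integrable (fun x => (ξ x) ^ 2) ν := fun ξ =>
    (Lp.memLp ξ).integrable_sq
  set m := ν.real univ with hmdef
  have hm0 : 0 ≤ m := measureReal_nonneg
  have hNb : ∀ ξ : Lp ℝ 2 ν, ‖ξ‖ = 1 → G ξ ≤ c * (m + 1) := fun ξ h => by
    refine (hG2 ξ).trans ?_
    apply mul_le_mul_of_nonneg_left _ hc
    have h1 : ∫ x, max (ξ x) 0 ∂ν ≤ ∫ x, (1 + (ξ x) ^ 2) ∂ν := by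
      apply integral_mono (hInt0 _).pos_part ((integrable_const 1).add (hsqi ξ))
      intro x
      simp only [Pi.add_apply]
      rcases le_total (ξ x) 0 with h | h
      · rw [max_eq_right h]; positivity
      · rw [max_eq_left h]; nlinarith [sq_nonneg (ξ x - 1), sq_nonneg (ξ x)]
    rw [integral_add (integrable_const 1) (hsqi ξ), hsq, h] at h1
    simpa using h1
  have hGb' : ∀ ξ : Lp ℝ 2 ν, G ξ ≤ c * (m + 1) * ‖ξ‖ := fun ξ => by
    by_cases h : ξ = 0
    · simp [h]
    · have hn : 0 < ‖ξ‖ := norm_pos_iff.2 h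
      have := hNb (‖ξ‖⁻¹ • ξ) (by rw [norm_smul, norm_inv, norm_norm]; field_simp)
      rw [map_smul, smul_eq_mul, inv_mul_le_iff₀ hn] at this
      linarith
  have hGb : ∀ ξ : Lp ℝ 2 ν, ‖G ξ‖ ≤ c * (m + 1) * ‖ξ‖ := fun ξ => by
    rw [Real.norm_eq_abs, abs_le]
    have h2 := hGb' (-ξ)
    rw [map_neg, norm_neg] at h2
    exact ⟨by linarith, hGb' ξ⟩
  let Gc : StrongDual ℝ (Lp ℝ 2 ν) := G.mkContinuous _ hGb
  let w : Lp ℝ 2 ν := (InnerProductSpace.toDual ℝ (Lp ℝ 2 ν)).symm Gc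
  have hw : ∀ ξ : Lp ℝ 2 ν, inner ℝ w ξ = G ξ := fun ξ => by
    have := InnerProductSpace.toDual_symm_apply (𝕜 := ℝ) (x := ξ) (y := Gc)
    rw [this]; rfl
  have hset : ∀ A, (hA : MeasurableSet A) →
      G (indicatorConstLp 2 hA (measure_ne_top ν A) (1 : ℝ)) = ∫ x in A, w x ∂ν := fun A hA => by
    rw [← hw, real_inner_comm, L2.inner_indicatorConstLp_one]
  have hnon : 0 ≤ᵐ[ν] (w : X → ℝ) := by
    apply ae_nonneg_of_forall_setIntegral_nonneg (hInt0 w)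
    intro A hA _
    rw [← hset A hA]
    have h1 := hG2 (-(indicatorConstLp 2 hA (measure_ne_top ν A) (1 : ℝ)))
    have h2 : N (-(indicatorConstLp 2 hA (measure_ne_top ν A) (1 : ℝ))) = 0 := by
      simp only [N]
      have : ∫ x, max ((-(indicatorConstLp 2 hA (measure_ne_top ν A) (1 : ℝ)) : Lp ℝ 2 ν) x) 0 ∂ν
          = 0 := by
        rw [← integral_zero X ℝ (μ := ν)]
        apply integral_congr_ae
        filter_upwards [Lp.coeFn_neg (indicatorConstLp 2 hA (measure_ne_top ν A) (1 : ℝ)),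
          indicatorConstLp_coeFn (p := 2) (hs := hA) (hμs := measure_ne_top ν A) (c := (1 : ℝ))]
          with x h1 h2
        rw [h1, Pi.neg_apply, h2]
        by_cases hx : x ∈ A <;> simp [hx]
      rw [this, mul_zero]
    rw [h2, map_neg] at h1
    linarith
  have hle : (w : X → ℝ) ≤ᵐ[ν] fun _ => c := by
    apply ae_le_of_forall_setIntegral_le (hInt0 w) (integrable_const c)
    intro A hA _
    rw [← hset A hA]
    refine (hG2 _).trans (le_of_eq ?_)
    simp only [N]
    have : ∫ x, max ((indicatorConstLp 2 hA (measure_ne_top ν A) (1 : ℝ) : Lp ℝ 2 ν) x) 0 ∂ν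
          = ∫ x in A, (1 : ℝ) ∂ν := by
      rw [← integral_indicator hA]
      apply integral_congr_ae
      filter_upwards [
          indicatorConstLp_coeFn (p := 2) (hs := hA) (hμs := measure_ne_top ν A) (c := (1 : ℝ))]
          with x h2
      rw [h2]
      by_cases hx : x ∈ A <;> simp [hx]
    rw [this, ← integral_const_mul]; simp
  refine ⟨fun x => max 0 (min c (w x)), ?_, fun x => ⟨le_max_left _ _, max_le hc (min_le_left _ _)⟩, ?_⟩
  · exact measurable_const.max (measurable_const.min (Lp.stronglyMeasurable w).measurable)
  · intro φ
    rw [← hGM φ, ← hw, L2.inner_def]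
    apply integral_congr_ae
    filter_upwards [hnon, hle, hMc φ] with x h1 h2 h3
    rw [h3, min_eq_right h2, max_eq_right (show (0 : ℝ) ≤ w x from h1)]
    simp [mul_comm]
end

section
open MeasureTheory Filter Topology Set

lemma gauss_int : Integrable (fun p : ℝ × ℝ => Real.exp (-p.1 ^ 2) * Real.exp (-p.2 ^ 2)) := by
  have h : Integrable (fun x : ℝ => Real.exp (-x ^ 2)) := by
    simpa using integrable_exp_neg_mul_sq (b := 1) one_pos
  exact h.mul_prod h

lemma hb_exist {k : ℝ} (hk : 0 < k) {Ω : Set (ℝ × ℝ)} (hΩ : MeasurableSet Ω)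
    (V : Submodule ℝ (ℝ × ℝ → ℝ))
    (hV : ∀ φ ∈ V, ContDiff ℝ 2 φ ∧ HasCompactSupport φ ∧ ∀ p ∈ frontier Ω, φ p = 0)
    {h : ℝ × ℝ → ℝ} (hh : Measurable h) {H : ℝ} (hH : ∀ p, 0 ≤ h p ∧ h p ≤ H) :
    ∃ v : ℝ × ℝ → ℝ, Measurable v ∧ (∀ p, 0 ≤ v p ∧ v p ≤ H / k) ∧
      ∀ φ ∈ V, ∫ p in Ω, v p * (k * φ p - grushinLap φ p) = ∫ p in Ω, h p * φ p := by
  have hH0 : 0 ≤ H := (hH (0, 0)).1.trans (hH (0, 0)).2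
  set ρ : ℝ × ℝ → ℝ := fun p => Real.exp (-p.1 ^ 2) * Real.exp (-p.2 ^ 2) with hρ
  have ρpos : ∀ p, 0 < ρ p := fun p => by positivity
  have ρc : Continuous ρ := by fun_prop
  let ν : Measure (ℝ × ℝ) := (volume.restrict Ω).withDensity (fun p => ENNReal.ofReal (ρ p))
  haveI : IsFiniteMeasure ν := isFiniteMeasure_withDensity_ofReal gauss_int.integrableOn.2
  have hν : ∀ f : ℝ × ℝ → ℝ, ∫ p, f p ∂ν = ∫ p in Ω, ρ p * f p := fun f => by
    have := integral_withDensity_eq_integral_toReal_smul (μ := volume.restrict Ω)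
      (f := fun p => ENNReal.ofReal (ρ p)) ρc.measurable.ennreal_ofReal
      (Eventually.of_forall fun p => ENNReal.ofReal_lt_top) f
    rw [this]
    congr 1; funext p
    rw [ENNReal.toReal_ofReal (ρpos p).le, smul_eq_mul]
  let L : V →ₗ[ℝ] (ℝ × ℝ → ℝ) :=
    { toFun := fun φ p => (k * φ.1 p - grushinLap φ.1 p) / ρ p
      map_add' := fun φ ψ => by
        funext p
        have := lap_add (hV _ φ.2).1 (hV _ ψ.2).1 p
        simp only [Submodule.coe_add, Pi.add_apply, this]; ring
      map_smul' := fun c φ => by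
        funext p
        have := lap_smul (u := φ.1) c p
        simp only [Submodule.coe_smul, Pi.smul_apply, this, smul_eq_mul, RingHom.id_apply]; ring }
  have int1 : ∀ φ : V, Integrable (fun p => h p * φ.1 p) := fun φ => by
    refine (int_of_cc (hV _ φ.2).1.continuous (hV _ φ.2).2.1).bdd_mul (c := H)
      hh.aestronglyMeasurable (Eventually.of_forall fun p => ?_)
    rw [Real.norm_eq_abs, abs_of_nonneg (hH p).1]; exact (hH p).2
  let l : V →ₗ[ℝ] ℝ :=
    { toFun := fun φ => ∫ p in Ω, h p * φ.1 p
      map_add' := fun φ ψ => by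
        rw [← integral_add (int1 φ).integrableOn (int1 ψ).integrableOn]
        congr 1; funext p; simp only [Submodule.coe_add, Pi.add_apply]; ring
      map_smul' := fun c φ => by
        simp only [RingHom.id_apply, smul_eq_mul]
        rw [← integral_const_mul]
        congr 1; funext p; simp only [Submodule.coe_smul, Pi.smul_apply, smul_eq_mul]; ring }
  have cL : ∀ φ : V, Continuous (fun p => k * φ.1 p - grushinLap φ.1 p) := fun φ =>
    ((hV _ φ.2).1.continuous.const_mul k).sub (continuous_lap (hV _ φ.2).1)
  have sL : ∀ φ : V, HasCompactSupport (fun p => k * φ.1 p - grushinLap φ.1 p) := fun φ => by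
    have h1 : HasCompactSupport ((fun _ => k) * φ.1) := (hV _ φ.2).2.1.mul_left
    exact h1.sub (hcs_lap (hV _ φ.2).1 (hV _ φ.2).2.1)
  have cL' : ∀ φ : V, Continuous (L φ) := fun φ => (cL φ).div ρc (fun p => (ρpos p).ne')
  obtain ⟨v, hv1, hv2, hv3⟩ := hb_abs ν L (fun φ => (cL' φ).measurable)
    (fun φ => by
      have : HasCompactSupport (L φ) := by
        have e : L φ = (fun p => k * φ.1 p - grushinLap φ.1 p) * (fun p => (ρ p)⁻¹) := by
          funext p; rfl
        rw [e]; exact (sL φ).mul_right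
      obtain ⟨C, hC⟩ := (cL' φ).bounded_above_of_compact_support this
      exact ⟨C, fun p => hC p⟩) l (H / k) (by positivity)
    (fun φ => by
      rw [hν]
      have e : ∫ p in Ω, ρ p * max (L φ p) 0 = ∫ p in Ω, max (k * φ.1 p - grushinLap φ.1 p) 0 := by
        congr 1; funext p
        rw [mul_max_of_nonneg _ _ (ρpos p).le, mul_zero]
        congr 1
        exact mul_div_cancel₀ _ (ρpos p).ne'
      rw [e]
      have h1 := kato hk hΩ (hV _ φ.2).1 (hV _ φ.2).2.1 (hV _ φ.2).2.2
      have h2 : l φ ≤ ∫ p in Ω, H * max (φ.1 p) 0 := by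
        apply integral_mono (int1 φ).integrableOn
        · exact ((int_of_cc (hV _ φ.2).1.continuous (hV _ φ.2).2.1).pos_part.const_mul H).integrableOn
        · intro p
          have := hH p
          simp only
          rcases le_total (φ.1 p) 0 with h | h
          · rw [max_eq_right h]; nlinarith
          · rw [max_eq_left h]; nlinarith
      rw [integral_const_mul] at h2
      have h3 := mul_le_mul_of_nonneg_left h1 (show 0 ≤ H / k by positivity)
      have h4 : H / k * (k * ∫ p in Ω, max (φ.1 p) 0) = H * ∫ p in Ω, max (φ.1 p) 0 := by
        field_simp
      linarith)
  refine ⟨v, hv1, hv2, fun φ hφ => ?_⟩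
  have := hv3 ⟨φ, hφ⟩
  rw [hν] at this
  have e : ∫ p in Ω, ρ p * (v p * L ⟨φ, hφ⟩ p) = ∫ p in Ω, v p * (k * φ p - grushinLap φ p) := by
    congr 1; funext p
    have h0 := (ρpos p).ne'
    simp only [L, LinearMap.coe_mk, AddHom.coe_mk]
    field_simp
  rw [← e, this]; rfl

/-- space of test functions -/
def testSub : Submodule ℝ (ℝ × ℝ → ℝ) where
  carrier := {φ | ContDiff ℝ 2 φ ∧ HasCompactSupport φ}
  add_mem' := fun h1 h2 => ⟨h1.1.add h2.1, h1.2.add h2.2⟩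
  zero_mem' := ⟨contDiff_const, HasCompactSupport.zero⟩
  smul_mem' := fun c φ h => ⟨h.1.const_smul c, by
    have : HasCompactSupport ((fun _ => c) * φ) := h.2.mul_left
    exact this⟩

/-- odd test functions -/
def oddSub : Submodule ℝ (ℝ × ℝ → ℝ) where
  carrier := {φ | (ContDiff ℝ 2 φ ∧ HasCompactSupport φ) ∧ ∀ x y, φ (-x, y) = - φ (x, y)}
  add_mem' := fun h1 h2 => ⟨testSub.add_mem h1.1 h2.1, fun x y => by
    simp only [Pi.add_apply, h1.2, h2.2]; ring⟩
  zero_mem' := ⟨testSub.zero_mem, fun x y => by simp⟩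
  smul_mem' := fun c φ h => ⟨testSub.smul_mem c h.1, fun x y => by
    simp only [Pi.smul_apply, h.2, smul_eq_mul]; ring⟩

lemma intbm {v g : ℝ × ℝ → ℝ} {C : ℝ} (hv : Measurable v) (hb : ∀ p, |v p| ≤ C)
    (hg : Continuous g) (hc : HasCompactSupport g) : Integrable (fun p => v p * g p) :=
  (int_of_cc hg hc).bdd_mul (c := C) hv.aestronglyMeasurable
    (Eventually.of_forall fun p => hb p)

/-- existence for the resolvent equation, nonnegative right hand side. -/
lemma exist_nonneg {k : ℝ} (hk : 0 < k) {h : ℝ × ℝ → ℝ} (hh : Measurable h) {H : ℝ}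
    (hH : ∀ p, 0 ≤ h p ∧ h p ≤ H) :
    ∃ v : ℝ × ℝ → ℝ, Measurable v ∧ (∀ p, 0 ≤ v p ∧ v p ≤ H / k) ∧
      DSol v (fun p => k * v p - h p) := by
  obtain ⟨v, h1, h2, h3⟩ := hb_exist hk (Ω := univ) MeasurableSet.univ testSub
    (fun φ hφ => ⟨hφ.1, hφ.2, by simp⟩) hh hH
  refine ⟨v, h1, h2, fun φ hφ hc => ?_⟩
  have h4 := h3 φ ⟨hφ, hc⟩
  simp only [Measure.restrict_univ] at h4
  have bv : ∀ p, |v p| ≤ H / k := fun p => by rw [abs_of_nonneg (h2 p).1]; exact (h2 p).2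
  have bh : ∀ p, |h p| ≤ H := fun p => by rw [abs_of_nonneg (hH p).1]; exact (hH p).2
  have i1 := intbm h1 bv hφ.continuous hc
  have i2 := intbm h1 bv (continuous_lap hφ) (hcs_lap hφ hc)
  have i3 := intbm hh bh hφ.continuous hc
  have e1 : ∫ p, v p * (k * φ p - grushinLap φ p)
      = k * (∫ p, v p * φ p) - ∫ p, v p * grushinLap φ p := by
    rw [← integral_const_mul, ← integral_sub (i1.const_mul k) i2]
    congr 1; funext p; ring
  have e2 : ∫ p, (k * v p - h p) * φ p = k * (∫ p, v p * φ p) - ∫ p, h p * φ p := by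
    rw [← integral_const_mul, ← integral_sub (i1.const_mul k) i3]
    congr 1; funext p; ring
  rw [e2, ← h4, e1]; ring
end

section
open MeasureTheory Filter Topology Set

noncomputable def H0 (δ s : ℝ) : ℝ := s ^ (-(1/2) : ℝ) * Real.smoothTransition (2 - 2 * s / δ)
noncomputable def H1 (δ : ℝ) : ℝ → ℝ := deriv (H0 δ)
noncomputable def H2 (δ : ℝ) : ℝ → ℝ := deriv (H1 δ)

theorem cd_H0 (δ : ℝ) : ContDiffOn ℝ (⊤ : ℕ∞) (H0 δ) (Ioi 0) := by
  unfold H0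
  apply ContDiffOn.mul
  · intro s hs
    exact (Real.contDiffAt_rpow_const_of_ne (ne_of_gt hs)).contDiffWithinAt
  · apply ContDiff.contDiffOn
    apply Real.smoothTransition.contDiff.comp
    fun_prop

theorem cd_H1 (δ : ℝ) : ContDiffOn ℝ (⊤ : ℕ∞) (H1 δ) (Ioi 0) :=
  (cd_H0 δ).deriv_of_isOpen isOpen_Ioi (by simp)

theorem cd_H2 (δ : ℝ) : ContDiffOn ℝ (⊤ : ℕ∞) (H2 δ) (Ioi 0) :=
  (cd_H1 δ).deriv_of_isOpen isOpen_Ioi (by simp)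

theorem hd_H0 (δ : ℝ) {s : ℝ} (hs : 0 < s) : HasDerivAt (H0 δ) (H1 δ s) s :=
  (((cd_H0 δ).contDiffAt (Ioi_mem_nhds hs)).differentiableAt (by simp)).hasDerivAt

theorem hd_H1 (δ : ℝ) {s : ℝ} (hs : 0 < s) : HasDerivAt (H1 δ) (H2 δ s) s :=
  (((cd_H1 δ).contDiffAt (Ioi_mem_nhds hs)).differentiableAt (by simp)).hasDerivAt

theorem H0_zero {δ : ℝ} (hδ : 0 < δ) {s : ℝ} (hs : δ < s) : H0 δ s = 0 := by
  unfold H0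
  rw [Real.smoothTransition.zero_of_nonpos, mul_zero]
  have : 1 < s / δ := (one_lt_div hδ).2 hs
  have h2 : 2 * s / δ = 2 * (s / δ) := by ring
  linarith

theorem H1_zero {δ : ℝ} (hδ : 0 < δ) {s : ℝ} (hs : δ < s) : H1 δ s = 0 := by
  unfold H1
  have : H0 δ =ᶠ[𝓝 s] fun _ => 0 := by
    filter_upwards [Ioi_mem_nhds hs] with r hr using H0_zero hδ hr
  rw [this.deriv_eq]; simp

theorem H2_zero {δ : ℝ} (hδ : 0 < δ) {s : ℝ} (hs : δ < s) : H2 δ s = 0 := by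
  unfold H2
  have : H1 δ =ᶠ[𝓝 s] fun _ => 0 := by
    filter_upwards [Ioi_mem_nhds hs] with r hr using H1_zero hδ hr
  rw [this.deriv_eq]; simp

theorem H0_small {δ : ℝ} (hδ : 0 < δ) {s : ℝ} (hs : s < δ / 2) :
    H0 δ s = s ^ (-(1/2) : ℝ) := by
  unfold H0
  rw [Real.smoothTransition.one_of_one_le, mul_one]
  have : s / δ < 1 / 2 := by rw [div_lt_iff₀ hδ]; linarith
  have h2 : 2 * s / δ = 2 * (s / δ) := by ring
  linarith

theorem H1_small {δ : ℝ} (hδ : 0 < δ) {s : ℝ} (h0 : 0 < s) (hs : s < δ / 2) :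
    H1 δ s = -(1/2) * s ^ (-(3/2) : ℝ) := by
  unfold H1
  have : H0 δ =ᶠ[𝓝 s] fun r => r ^ (-(1/2) : ℝ) := by
    filter_upwards [Iio_mem_nhds hs] with r hr using H0_small hδ hr
  rw [this.deriv_eq, (Real.hasDerivAt_rpow_const (Or.inl h0.ne')).deriv]
  norm_num

theorem H2_small {δ : ℝ} (hδ : 0 < δ) {s : ℝ} (h0 : 0 < s) (hs : s < δ / 2) :
    H2 δ s = (3/4) * s ^ (-(5/2) : ℝ) := by
  unfold H2
  have : H1 δ =ᶠ[𝓝 s] fun r => -(1/2) * r ^ (-(3/2) : ℝ) := by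
    filter_upwards [Iio_mem_nhds hs, Ioi_mem_nhds h0] with r hr h using H1_small hδ h hr
  rw [this.deriv_eq, ((Real.hasDerivAt_rpow_const (Or.inl h0.ne')).const_mul _).deriv]
  norm_num
  ring

theorem H_bound_aux {δ : ℝ} (hδ : 0 < δ) (h : ℝ → ℝ) (hc : ContinuousOn h (Ioi 0)) (α c : ℝ)
    (hz : ∀ s, δ < s → h s = 0) (hs : ∀ s, 0 < s → s < δ / 2 → h s = c * s ^ (-α)) :
    ∃ C, 0 < C ∧ ∀ s, 0 < s → |h s| ≤ C * s ^ (-α) := by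
  have hk : IsCompact (Icc (δ/2) δ) := isCompact_Icc
  have hcc : ContinuousOn (fun s => h s * s ^ α) (Icc (δ/2) δ) := by
    apply ContinuousOn.mul (hc.mono _)
    · intro s hs
      exact (Real.continuousAt_rpow_const _ _ (Or.inl (by have := hs.1; linarith))).continuousWithinAt
    · intro s hs; have := hs.1; simp only [mem_Ioi]; linarith
  obtain ⟨C, hC⟩ := hk.exists_bound_of_continuousOn hcc
  refine ⟨|C| + |c| + 1, by positivity, fun s h0 => ?_⟩
  have hp : 0 < s ^ (-α) := Real.rpow_pos_of_pos h0 _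
  rcases lt_or_ge s (δ/2) with h1 | h1
  · rw [hs s h0 h1, abs_mul, abs_of_pos hp]
    gcongr
    have := abs_nonneg C; linarith
  rcases lt_or_ge δ s with h2 | h2
  · rw [hz s h2, abs_zero]; positivity
  · have := hC s ⟨h1, h2⟩
    have h3 : h s = (h s * s ^ α) * s ^ (-α) := by
      rw [mul_assoc, ← Real.rpow_add h0]; simp
    rw [h3, abs_mul, abs_of_pos hp]
    gcongr
    rw [Real.norm_eq_abs] at this
    have := le_abs_self C; have := abs_nonneg c; linarith

theorem H0_bound {δ : ℝ} (hδ : 0 < δ) : ∃ C, 0 < C ∧ ∀ s, 0 < s → |H0 δ s| ≤ C * s ^ (-(1/2) : ℝ) :=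
  H_bound_aux hδ _ (cd_H0 δ).continuousOn _ 1 (fun _ h => H0_zero hδ h)
    (fun _ _ h => by rw [H0_small hδ h, one_mul])
theorem H1_bound {δ : ℝ} (hδ : 0 < δ) : ∃ C, 0 < C ∧ ∀ s, 0 < s → |H1 δ s| ≤ C * s ^ (-(3/2) : ℝ) :=
  H_bound_aux hδ _ (cd_H1 δ).continuousOn _ _ (fun _ h => H1_zero hδ h)
    (fun _ h0 h => H1_small hδ h0 h)
theorem H2_bound {δ : ℝ} (hδ : 0 < δ) : ∃ C, 0 < C ∧ ∀ s, 0 < s → |H2 δ s| ≤ C * s ^ (-(5/2) : ℝ) :=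
  H_bound_aux hδ _ (cd_H2 δ).continuousOn _ _ (fun _ h => H2_zero hδ h)
    (fun _ h0 h => H2_small hδ h0 h)

theorem J_small {δ : ℝ} (hδ : 0 < δ) {s : ℝ} (h0 : 0 < s) (hs : s < δ / 2) :
    16 * s * H2 δ s + 24 * H1 δ s = 0 := by
  rw [H2_small hδ h0 hs, H1_small hδ h0 hs]
  have : s ^ (-(3/2) : ℝ) = s * s ^ (-(5/2) : ℝ) := by
    rw [← Real.rpow_one_add' h0.le (by norm_num)]; norm_num
  rw [this]; ring
end

section
open MeasureTheory Filter Topology Set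

noncomputable def shf (p : ℝ × ℝ) (q : ℝ × ℝ × ℝ) : ℝ × ℝ :=
  (p.1 + q.1, p.2 + q.2.2 + (2 * p.1 + q.1) * q.2.1 / 2)

noncomputable def Psi (p : ℝ × ℝ) (z : ℝ × ℝ × ℝ) : ℝ × ℝ × ℝ :=
  (z.2.1 - p.1, z.1, z.2.2 - p.2 - (p.1 + z.2.1) * z.1 / 2)

noncomputable def CK (K : ℝ × ℝ × ℝ → ℝ) (h : ℝ × ℝ → ℝ) (p : ℝ × ℝ) : ℝ :=
  ∫ q, h (shf p q) * K q

theorem continuous_shf (p : ℝ × ℝ) : Continuous (shf p) := by unfold shf; fun_prop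
theorem continuous_shf' (q : ℝ × ℝ × ℝ) : Continuous (fun p => shf p q) := by unfold shf; fun_prop
theorem continuous_Psi (p : ℝ × ℝ) : Continuous (Psi p) := by unfold Psi; fun_prop
theorem continuous_Psi' (z : ℝ × ℝ × ℝ) : Continuous (fun p => Psi p z) := by unfold Psi; fun_prop

noncomputable def PsiE (p : ℝ × ℝ) : (ℝ × ℝ × ℝ) ≃ᵐ (ℝ × ℝ × ℝ) where
  toFun := Psi p
  invFun := fun q => (q.2.1, shf p q)
  left_inv := fun z => by
    rcases z with ⟨b, x', y'⟩
    simp only [Psi, shf, Prod.mk.injEq, true_and]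
    exact ⟨by ring, by ring⟩
  right_inv := fun z => by
    rcases z with ⟨b, x', y'⟩
    simp only [Psi, shf, Prod.mk.injEq, true_and]
    exact ⟨by ring, by ring⟩
  measurable_toFun := (continuous_Psi p).measurable
  measurable_invFun := by
    have := (continuous_shf p)
    change Measurable fun q : ℝ × ℝ × ℝ => (q.2.1, shf p q)
    exact (Continuous.prodMk (by fun_prop) this).measurable

theorem mp_swap : MeasurePreserving (fun q : ℝ × ℝ × ℝ => (q.2.1, q.1, q.2.2)) := by
  have h1 : MeasurePreserving (MeasurableEquiv.prodAssoc : (ℝ × ℝ) × ℝ ≃ᵐ ℝ × ℝ × ℝ)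
      ((volume.prod volume).prod volume) (volume.prod (volume.prod volume)) :=
    measurePreserving_prodAssoc _ _ _
  have h2 : MeasurePreserving (Prod.map (Prod.swap : ℝ × ℝ → ℝ × ℝ) (id : ℝ → ℝ))
      ((volume.prod volume).prod volume) ((volume.prod volume).prod volume) :=
    (Measure.measurePreserving_swap).prod (MeasurePreserving.id _)
  exact (h1.comp h2).comp h1.symm

theorem mp_inv (p : ℝ × ℝ) :
    MeasurePreserving (fun q : ℝ × ℝ × ℝ => (q.2.1, shf p q)) := by
  have h3 : ∀ b : ℝ, MeasurePreserving (fun z : ℝ × ℝ => (p.1 + z.1, p.2 + z.2 + (2 * p.1 + z.1) * b / 2))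
      (volume.prod volume) (volume.prod volume) := by
    intro b
    refine MeasurePreserving.skew_product (f := fun a : ℝ => p.1 + a)
      (g := fun a t : ℝ => p.2 + t + (2 * p.1 + a) * b / 2) (measurePreserving_add_left _ _) ?_ ?_
    · unfold Function.uncurry; fun_prop
    · refine Eventually.of_forall fun a => ?_
      have : (fun t : ℝ => p.2 + t + (2 * p.1 + a) * b / 2)
          = fun t => (p.2 + (2 * p.1 + a) * b / 2) + t := by funext t; ring
      rw [this]
      exact (measurePreserving_add_left _ _).map_eq
  have h4 : MeasurePreserving (fun z : ℝ × ℝ × ℝ =>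
      (z.1, p.1 + z.2.1, p.2 + z.2.2 + (2 * p.1 + z.2.1) * z.1 / 2))
      (volume.prod (volume.prod volume)) (volume.prod (volume.prod volume)) := by
    refine MeasurePreserving.skew_product (f := id)
      (g := fun (b : ℝ) (z : ℝ × ℝ) => (p.1 + z.1, p.2 + z.2 + (2 * p.1 + z.1) * b / 2))
      (MeasurePreserving.id _) ?_ (Eventually.of_forall fun b => (h3 b).map_eq)
    unfold Function.uncurry; fun_prop
  exact h4.comp mp_swap

theorem mp_Psi (p : ℝ × ℝ) : MeasurePreserving (Psi p) :=
  MeasurePreserving.symm (e := (PsiE p).symm) (mp_inv p)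

theorem CK_eq (K : ℝ × ℝ × ℝ → ℝ) (h : ℝ × ℝ → ℝ) (p : ℝ × ℝ) :
    CK K h p = ∫ z : ℝ × ℝ × ℝ, h z.2 * K (Psi p z) := by
  have := (mp_Psi p).integral_comp (PsiE p).measurableEmbedding (fun q => h (shf p q) * K q)
  unfold CK
  rw [← this]
  congr 1; funext z
  have e : (z.1, shf p (Psi p z)) = z := (PsiE p).left_inv z
  have e2 : shf p (Psi p z) = z.2 := by rw [Prod.ext_iff] at e; exact e.2
  rw [e2]

/-- bounded measurable -/
def BM (h : ℝ × ℝ → ℝ) (C : ℝ) : Prop := Measurable h ∧ ∀ p, |h p| ≤ C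

theorem BM.nonneg {h : ℝ × ℝ → ℝ} {C : ℝ} (hh : BM h C) : 0 ≤ C :=
  (abs_nonneg _).trans (hh.2 (0,0))

theorem CK_int {K : ℝ × ℝ × ℝ → ℝ} {h : ℝ × ℝ → ℝ} {C : ℝ} (hK : Integrable K) (hh : BM h C)
    (p : ℝ × ℝ) : Integrable (fun q => h (shf p q) * K q) :=
  hK.bdd_mul (c := C) (hh.1.comp (continuous_shf p).measurable).aestronglyMeasurable
    (Eventually.of_forall fun q => hh.2 _)

theorem CK_int' {K : ℝ × ℝ × ℝ → ℝ} {h : ℝ × ℝ → ℝ} {C : ℝ} (hK : Integrable K) (hh : BM h C)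
    (p : ℝ × ℝ) : Integrable (fun z : ℝ × ℝ × ℝ => h z.2 * K (Psi p z)) :=
  ((mp_Psi p).integrable_comp_of_integrable hK).bdd_mul (c := C)
    (hh.1.comp measurable_snd).aestronglyMeasurable
    (Eventually.of_forall fun q => hh.2 _)

theorem CK_le {K : ℝ × ℝ × ℝ → ℝ} {h : ℝ × ℝ → ℝ} {C : ℝ} (hK : Integrable K) (hh : BM h C)
    (p : ℝ × ℝ) : |CK K h p| ≤ C * ∫ q, |K q| := by
  rw [← integral_const_mul]
  unfold CK
  refine norm_integral_le_of_norm_le (G := ℝ) (hK.abs.const_mul C) (Eventually.of_forall fun q => ?_)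
  rw [Real.norm_eq_abs, abs_mul]
  exact mul_le_mul_of_nonneg_right (hh.2 _) (abs_nonneg _)

theorem CK_sub_K {K L : ℝ × ℝ × ℝ → ℝ} {h : ℝ × ℝ → ℝ} {C : ℝ} (hK : Integrable K)
    (hL : Integrable L) (hh : BM h C) (p : ℝ × ℝ) :
    CK (fun q => K q - L q) h p = CK K h p - CK L h p := by
  unfold CK
  rw [← integral_sub (CK_int hK hh p) (CK_int hL hh p)]
  congr 1; funext q; ring

theorem CK_sub_h {K : ℝ × ℝ × ℝ → ℝ} {h g : ℝ × ℝ → ℝ} {C D : ℝ} (hK : Integrable K)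
    (hh : BM h C) (hg : BM g D) (p : ℝ × ℝ) :
    CK K (fun p => h p - g p) p = CK K h p - CK K g p := by
  unfold CK
  rw [← integral_sub (CK_int hK hh p) (CK_int hK hg p)]
  congr 1; funext q; ring

theorem CK_add_h {K : ℝ × ℝ × ℝ → ℝ} {h g : ℝ × ℝ → ℝ} {C D : ℝ} (hK : Integrable K)
    (hh : BM h C) (hg : BM g D) (p : ℝ × ℝ) :
    CK K (fun p => h p + g p) p = CK K h p + CK K g p := by
  unfold CK
  rw [← integral_add (CK_int hK hh p) (CK_int hK hg p)]
  congr 1; funext q; ring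

theorem CK_congr_ae (K : ℝ × ℝ × ℝ → ℝ) {h g : ℝ × ℝ → ℝ} (e : h =ᵐ[volume] g) (p : ℝ × ℝ) :
    CK K h p = CK K g p := by
  rw [CK_eq, CK_eq]
  apply integral_congr_ae
  have : (fun z : ℝ × ℝ × ℝ => h z.2) =ᵐ[volume] fun z => g z.2 :=
    (Measure.quasiMeasurePreserving_snd (μ := (volume : Measure ℝ)) (ν := (volume : Measure (ℝ × ℝ)))).ae_eq_comp e
  filter_upwards [this] with z hz
  rw [hz]

/-- support in a box -/
def BS (R : ℝ) (K : ℝ × ℝ × ℝ → ℝ) : Prop := ∀ q, R < |q.1| ∨ R < |q.2.1| ∨ R < |q.2.2| → K q = 0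

theorem BS.hcs {R : ℝ} {K : ℝ × ℝ × ℝ → ℝ} (h : BS R K) : HasCompactSupport K := by
  refine HasCompactSupport.intro (isCompact_closedBall 0 R) fun q hq => h q ?_
  by_contra hn
  push Not at hn
  apply hq
  rw [mem_closedBall_zero_iff, Prod.norm_def, Prod.norm_def]
  simp only [Real.norm_eq_abs]
  exact max_le hn.1 (max_le hn.2.1 hn.2.2)

theorem hcs_BS {K : ℝ × ℝ × ℝ → ℝ} (h : HasCompactSupport K) : ∃ R, BS R K := by
  obtain ⟨R, hR⟩ := h.isCompact.isBounded.subset_closedBall 0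
  refine ⟨R, fun q hq => ?_⟩
  by_contra hn
  have := hR (subset_tsupport _ hn)
  rw [mem_closedBall_zero_iff, Prod.norm_def, Prod.norm_def, max_le_iff, max_le_iff] at this
  simp only [Real.norm_eq_abs] at this
  rcases hq with h | h | h <;> linarith [this.1, this.2.1, this.2.2]

theorem Psi_box {R : ℝ} {K : ℝ × ℝ × ℝ → ℝ} (h : BS R K) (p0 : ℝ × ℝ) : ∃ R', ∀ p, dist p p0 ≤ 1 →
    ∀ z, z ∉ Metric.closedBall (0 : ℝ × ℝ × ℝ) R' → K (Psi p z) = 0 := by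
  refine ⟨|p0.2| + |p0.1| + 3 + 2 * |R| + (|p0.1| + 1 + |R|) * |R|, fun p hp z hz => h _ ?_⟩
  by_contra hn
  push Not at hn
  apply hz
  have hR : R ≤ |R| := le_abs_self R
  have h0 : 0 ≤ |p0.1| := abs_nonneg _
  have h0' : 0 ≤ |p0.2| := abs_nonneg _
  have h0'' : 0 ≤ |R| := abs_nonneg _
  have hm : 0 ≤ (|p0.1| + 1 + |R|) * |R| := by positivity
  rw [Prod.dist_eq, max_le_iff, Real.dist_eq, Real.dist_eq] at hp
  simp only [Psi] at hn
  obtain ⟨h1, h2, h3⟩ := hn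
  have hp1 : |p.1| ≤ |p0.1| + 1 := by
    have := abs_sub_abs_le_abs_sub p.1 p0.1; linarith [hp.1]
  have hp2 : |p.2| ≤ |p0.2| + 1 := by
    have := abs_sub_abs_le_abs_sub p.2 p0.2; linarith [hp.2]
  have hx : |z.2.1| ≤ |p0.1| + 1 + |R| := by
    have := abs_sub_abs_le_abs_sub z.2.1 p.1; linarith
  have hxx : |(p.1 + z.2.1) * z.1 / 2| ≤ (|p0.1| + 1 + |R|) * |R| := by
    rw [abs_div, abs_mul, abs_two]
    have : |p.1 + z.2.1| * |z.1| ≤ (2 * (|p0.1| + 1 + |R|)) * |R| := by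
      apply mul_le_mul _ (by linarith) (abs_nonneg _) (by positivity)
      have := abs_add_le p.1 z.2.1; linarith
    linarith
  have hy : |z.2.2| ≤ |p0.2| + 1 + |R| + (|p0.1| + 1 + |R|) * |R| := by
    have e1 := abs_sub_abs_le_abs_sub (z.2.2 - p.2) ((p.1 + z.2.1) * z.1 / 2)
    have e2 := abs_sub_abs_le_abs_sub z.2.2 p.2
    linarith
  rw [mem_closedBall_zero_iff, Prod.norm_def, Prod.norm_def, max_le_iff, max_le_iff]
  simp only [Real.norm_eq_abs]
  exact ⟨by linarith, by linarith, by linarith⟩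

theorem CK_cont_cc {K : ℝ × ℝ × ℝ → ℝ} {h : ℝ × ℝ → ℝ} {C : ℝ} (hK : Continuous K)
    (hc : HasCompactSupport K) (hh : BM h C) : Continuous (CK K h) := by
  rw [continuous_iff_continuousAt]
  intro p0
  obtain ⟨R, hR⟩ := hcs_BS hc
  obtain ⟨R', hR'⟩ := Psi_box hR p0
  obtain ⟨M, hM⟩ := hc.exists_bound_of_continuous hK
  have : CK K h = fun p => ∫ z : ℝ × ℝ × ℝ, h z.2 * K (Psi p z) := funext fun p => CK_eq K h p
  rw [this]
  refine continuousAt_of_dominated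
    (bound := (Metric.closedBall (0 : ℝ × ℝ × ℝ) R').indicator fun _ => C * M) ?_ ?_ ?_ ?_
  · exact Eventually.of_forall fun p => (CK_int' (hK.integrable_of_hasCompactSupport hc) hh p).1
  · filter_upwards [Metric.closedBall_mem_nhds p0 one_pos] with p hp
    refine Eventually.of_forall fun z => ?_
    by_cases hz : z ∈ Metric.closedBall (0 : ℝ × ℝ × ℝ) R'
    · rw [indicator_of_mem hz, norm_mul]
      exact mul_le_mul (hh.2 _) (hM _) (norm_nonneg _) hh.nonneg
    · rw [indicator_of_notMem hz, hR' p hp z hz]; simp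
  · rw [integrable_indicator_iff measurableSet_closedBall]
    refine integrableOn_const ?_
    exact (measure_closedBall_lt_top).ne
  · refine Eventually.of_forall fun z => ContinuousAt.mul continuousAt_const ?_
    exact (hK.comp (continuous_Psi' z)).continuousAt

theorem CK_cont {K : ℝ × ℝ × ℝ → ℝ} {h : ℝ × ℝ → ℝ} {C : ℝ} (hK : Integrable K)
    (hh : BM h C) : Continuous (CK K h) := by
  have key : ∀ ε > 0, ∃ g, Continuous g ∧ ∀ p, |CK K h p - g p| ≤ ε := by
    intro ε hε
    have hC := hh.nonneg
    obtain ⟨G, h1, h2, h3, h4⟩ := hK.exists_hasCompactSupport_integral_sub_le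
      (ε := ε / (C + 1)) (by positivity)
    refine ⟨CK G h, CK_cont_cc h3 h1 hh, fun p => ?_⟩
    rw [← CK_sub_K hK h4 hh]
    refine (CK_le (hK.sub h4) hh p).trans ?_
    have : C * (∫ q, |K q - G q|) ≤ C * (ε / (C + 1)) := by gcongr; exact h2
    refine le_trans this ?_
    rw [mul_div_assoc', div_le_iff₀ (by linarith)]; nlinarith
  choose! g hg1 hg2 using key
  refine TendstoUniformly.continuous (F := fun (n : ℕ) => g (1 / ((n : ℝ) + 1))) (p := atTop) ?_
    (Frequently.of_forall fun n => hg1 _ (by positivity))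
  rw [Metric.tendstoUniformly_iff]
  intro ε hε
  have := tendsto_one_div_add_atTop_nhds_zero_nat (𝕜 := ℝ)
  filter_upwards [this.eventually_lt_const hε] with n hn p
  rw [Real.dist_eq]
  exact (hg2 _ (by positivity) p).trans_lt hn
end

section
open MeasureTheory Filter Topology Set

theorem int_zero_fst {E : Type*} [MeasureSpace E] [SFinite (volume : Measure E)] {f G : ℝ × E → ℝ}
    (hf : Integrable f) (hG : Integrable G)
    (hd : ∀ x w, HasDerivAt (fun x => f (x, w)) (G (x, w)) x) : ∫ z, G z = 0 := by
  have hf' : Integrable f (volume.prod volume) := hf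
  have hG' : Integrable G (volume.prod volume) := hG
  have e : ∫ z, G z = ∫ z, G z ∂(volume.prod volume) := rfl
  rw [e, integral_prod_symm _ hG']
  rw [← integral_zero E ℝ]
  apply integral_congr_ae
  filter_upwards [hf'.prod_left_ae, hG'.prod_left_ae] with w h1 h2
  exact integral_eq_zero_of_hasDerivAt_of_integrable (fun x => hd x w) h2 h1

theorem hd_comp_curve {K : ℝ × ℝ × ℝ → ℝ} (hK : ContDiff ℝ 1 K) {c1 c2 c3 : ℝ → ℝ} {v1 v2 v3 s : ℝ}
    (h1 : HasDerivAt c1 v1 s) (h2 : HasDerivAt c2 v2 s) (h3 : HasDerivAt c3 v3 s) :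
    HasDerivAt (fun s => K (c1 s, c2 s, c3 s)) (fderiv ℝ K (c1 s, c2 s, c3 s) (v1, v2, v3)) s := by
  have hF : HasFDerivAt K (fderiv ℝ K (c1 s, c2 s, c3 s)) (c1 s, c2 s, c3 s) :=
    (hK.differentiable (by norm_num) _).hasFDerivAt
  have hc : HasDerivAt (fun s => (c1 s, c2 s, c3 s)) (v1, v2, v3) s := h1.prodMk (h2.prodMk h3)
  exact hF.comp_hasDerivAt s hc

theorem fd_line {K : ℝ × ℝ × ℝ → ℝ} (hK : ContDiff ℝ 1 K) {a b t v1 v2 v3 val : ℝ}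
    (h : HasDerivAt (fun s => K (a + s * v1, b + s * v2, t + s * v3)) val 0) :
    fderiv ℝ K (a, b, t) (v1, v2, v3) = val := by
  have e : ∀ c v : ℝ, HasDerivAt (fun s : ℝ => c + s * v) v 0 := fun c v => by
    simpa using ((hasDerivAt_id (0:ℝ)).mul_const v).const_add c
  have := hd_comp_curve hK (e a v1) (e b v2) (e t v3)
  simp only [zero_mul, add_zero] at this
  exact this.unique h

theorem fd_cont {K : ℝ × ℝ × ℝ → ℝ} (hK : ContDiff ℝ 1 K) {v : ℝ × ℝ × ℝ → ℝ × ℝ × ℝ}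
    (hv : Continuous v) : Continuous fun q => fderiv ℝ K q (v q) :=
  (hK.continuous_fderiv (by norm_num)).clm_apply hv

theorem fd_hcs {K : ℝ × ℝ × ℝ → ℝ} (hc : HasCompactSupport K) (v : ℝ × ℝ × ℝ → ℝ × ℝ × ℝ) :
    HasCompactSupport fun q => fderiv ℝ K q (v q) := by
  refine (hc.fderiv (𝕜 := ℝ)).mono' ?_
  intro q hq
  apply subset_tsupport
  intro h0
  apply hq
  simp [h0]

theorem hd_CK {K : ℝ × ℝ × ℝ → ℝ} (hK : ContDiff ℝ 1 K) (hc : HasCompactSupport K)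
    {h : ℝ × ℝ → ℝ} {C : ℝ} (hh : BM h C) (x y α β s : ℝ) :
    HasDerivAt (fun s => CK K h (x + s * α, y + s * β))
      (CK (fun q => fderiv ℝ K q (-α, 0, -β - α * q.2.1 / 2)) h (x + s * α, y + s * β)) s := by
  set D : ℝ × ℝ × ℝ → ℝ := fun q => fderiv ℝ K q (-α, 0, -β - α * q.2.1 / 2) with hD
  have cD : Continuous D := fd_cont hK (by fun_prop)
  have hcD : HasCompactSupport D := fd_hcs hc _
  obtain ⟨R, hR⟩ := hcs_BS hcD
  obtain ⟨R', hR'⟩ := Psi_box hR (x + s * α, y + s * β)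
  obtain ⟨M, hM⟩ := hcD.exists_bound_of_continuous cD
  simp only [CK_eq]
  have cont : Continuous fun r : ℝ => (x + r * α, y + r * β) := by fun_prop
  have hs : (fun r : ℝ => (x + r * α, y + r * β)) ⁻¹' (Metric.closedBall (x + s * α, y + s * β) 1) ∈ 𝓝 s :=
    cont.continuousAt.preimage_mem_nhds (Metric.closedBall_mem_nhds _ one_pos)
  refine (hasDerivAt_integral_of_dominated_loc_of_deriv_le hs
    (bound := (Metric.closedBall (0 : ℝ × ℝ × ℝ) R').indicator fun _ => C * M)
    (F := fun r z => h z.2 * K (Psi (x + r * α, y + r * β) z))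
    (F' := fun r z => h z.2 * D (Psi (x + r * α, y + r * β) z)) ?_ ?_ ?_ ?_ ?_ ?_).2
  · exact Eventually.of_forall fun p =>
      (CK_int' (hK.continuous.integrable_of_hasCompactSupport hc) hh _).1
  · exact CK_int' (hK.continuous.integrable_of_hasCompactSupport hc) hh _
  · exact (CK_int' (cD.integrable_of_hasCompactSupport hcD) hh _).1
  · refine Eventually.of_forall fun z r hr => ?_
    by_cases hz : z ∈ Metric.closedBall (0 : ℝ × ℝ × ℝ) R'
    · rw [indicator_of_mem hz, norm_mul]
      exact mul_le_mul (hh.2 _) (hM _) (norm_nonneg _) hh.nonneg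
    · rw [indicator_of_notMem hz, hR' _ hr z hz]; simp
  · rw [integrable_indicator_iff measurableSet_closedBall]
    refine integrableOn_const ?_
    exact (measure_closedBall_lt_top).ne
  · refine Eventually.of_forall fun z r hr => HasDerivAt.const_mul _ ?_
    simp only [Psi, hD]
    refine hd_comp_curve (c1 := fun r => z.2.1 - (x + r * α)) (c2 := fun r => z.1)
      (c3 := fun r => z.2.2 - (y + r * β) - (x + r * α + z.2.1) * z.1 / 2) hK ?_ (hasDerivAt_const _ _) ?_
    · have := (((hasDerivAt_id r).mul_const α).const_add x).const_sub z.2.1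
      simpa using this
    · have h1 := (((hasDerivAt_id r).mul_const β).const_add y).const_sub z.2.2
      have h2 := ((((hasDerivAt_id r).mul_const α).const_add x).add_const z.2.1).mul_const z.1 |>.div_const 2
      exact (h1.sub h2).congr_deriv (by ring)

/-- derivative in y -/
theorem hd_CK_y {K Kt : ℝ × ℝ × ℝ → ℝ} (hK : ContDiff ℝ 1 K) (hc : HasCompactSupport K)
    (hKt : ∀ q, fderiv ℝ K q (0, 0, 1) = Kt q)
    {h : ℝ × ℝ → ℝ} {C : ℝ} (hh : BM h C) (x y : ℝ) :
    HasDerivAt (fun y => CK K h (x, y)) (-CK Kt h (x, y)) y := by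
  have := hd_CK hK hc hh x 0 0 1 y
  simp only [mul_zero, add_zero, mul_one, zero_add] at this
  refine this.congr_deriv ?_
  unfold CK
  rw [← integral_neg]
  congr 1; funext q
  beta_reduce
  have : ((-0 : ℝ), (0 : ℝ), -1 - 0 * q.2.1 / 2) = -((0 : ℝ), (0 : ℝ), (1 : ℝ)) := by
    ext <;> simp
  rw [this, map_neg, hKt]; ring

/-- derivative in x -/
theorem hd_CK_x {K Kx : ℝ × ℝ × ℝ → ℝ} (hK : ContDiff ℝ 1 K) (hc : HasCompactSupport K)
    (hKx : ∀ q, fderiv ℝ K q (1, 0, q.2.1 / 2) = Kx q)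
    {h : ℝ × ℝ → ℝ} {C : ℝ} (hh : BM h C) (x y : ℝ) :
    HasDerivAt (fun x => CK K h (x, y)) (-CK Kx h (x, y)) x := by
  have := hd_CK hK hc hh 0 y 1 0 x
  simp only [mul_zero, add_zero, mul_one, zero_add] at this
  refine this.congr_deriv ?_
  unfold CK
  rw [← integral_neg]
  congr 1; funext q
  beta_reduce
  have : ((-1 : ℝ), (0 : ℝ), -0 - 1 * q.2.1 / 2) = -((1 : ℝ), (0 : ℝ), q.2.1 / 2) := by
    ext <;> simp
  rw [this, map_neg, hKx]; ring

theorem CK_Y {K Kt Ky : ℝ × ℝ × ℝ → ℝ} (hK : ContDiff ℝ 1 K) (hc : HasCompactSupport K)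
    (hKt : ∀ q, fderiv ℝ K q (0, 0, 1) = Kt q)
    (hKy : ∀ q, fderiv ℝ K q (0, 1, -q.1 / 2) = Ky q)
    {h : ℝ × ℝ → ℝ} {C : ℝ} (hh : BM h C) (p : ℝ × ℝ) :
    p.1 * CK Kt h p = CK Ky h p := by
  have iK := hK.continuous.integrable_of_hasCompactSupport hc (μ := volume)
  have ct : Continuous Kt := by
    rw [← funext hKt]; exact fd_cont hK continuous_const
  have cy : Continuous Ky := by
    rw [← funext hKy]; exact fd_cont hK (by fun_prop)
  have hct : HasCompactSupport Kt := by rw [← funext hKt]; exact fd_hcs hc _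
  have hcy : HasCompactSupport Ky := by rw [← funext hKy]; exact fd_hcs hc _
  have it := CK_int' (ct.integrable_of_hasCompactSupport hct) hh p
  have iy := CK_int' (cy.integrable_of_hasCompactSupport hcy) hh p
  have key := int_zero_fst (CK_int' iK hh p)
    (G := fun z => h z.2 * Ky (Psi p z) - p.1 * (h z.2 * Kt (Psi p z))) (iy.sub (it.const_mul p.1)) (by
      intro b w
      have : HasDerivAt (fun b => K (Psi p (b, w)))
          (fderiv ℝ K (Psi p (b, w)) (0, 1, -(p.1 + w.1) / 2)) b := by
        simp only [Psi]
        refine hd_comp_curve (c1 := fun b => w.1 - p.1) (c2 := fun b => b)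
          (c3 := fun b => w.2 - p.2 - (p.1 + w.1) * b / 2) hK (hasDerivAt_const _ _) (hasDerivAt_id _) ?_
        have := (((hasDerivAt_id b).const_mul (p.1 + w.1)).div_const 2).const_sub (w.2 - p.2)
        exact this.congr_deriv (by ring)
      have h2 := this.const_mul (h w)
      refine h2.congr_deriv ?_
      beta_reduce
      rw [← hKy, ← hKt]
      have : ((0 : ℝ), (1 : ℝ), -(p.1 + w.1) / 2)
          = ((0 : ℝ), (1 : ℝ), -(Psi p (b, w)).1 / 2) - p.1 • ((0 : ℝ), (0 : ℝ), (1 : ℝ)) := by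
        simp only [Psi]
        ext <;> simp; ring
      rw [this, map_sub, map_smul]
      simp only [smul_eq_mul]; ring)
  rw [integral_sub iy (it.const_mul p.1), integral_const_mul] at key
  rw [CK_eq, CK_eq]; linarith

theorem CK_hx {K K3 : ℝ × ℝ × ℝ → ℝ} (hK : ContDiff ℝ 1 K) (hc : HasCompactSupport K)
    (hK3 : ∀ q, fderiv ℝ K q (1, 0, -q.2.1 / 2) = K3 q)
    {h hx : ℝ × ℝ → ℝ} {C D : ℝ} (hh : BM h C) (hhx : BM hx D)
    (hd : ∀ x y, HasDerivAt (fun x => h (x, y)) (hx (x, y)) x) (p : ℝ × ℝ) :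
    CK K hx p = - CK K3 h p := by
  have iK := hK.continuous.integrable_of_hasCompactSupport hc (μ := volume)
  have c3 : Continuous K3 := by
    rw [← funext hK3]; exact fd_cont hK (by fun_prop)
  have hc3 : HasCompactSupport K3 := by rw [← funext hK3]; exact fd_hcs hc _
  have i3 := CK_int' (c3.integrable_of_hasCompactSupport hc3) hh p
  have i1 := CK_int' iK hhx p
  have i0 := CK_int' iK hh p
  have j0 := mp_swap.integrable_comp_of_integrable i0
  have j1 := mp_swap.integrable_comp_of_integrable i1
  have j3 := mp_swap.integrable_comp_of_integrable i3
  have key := int_zero_fst j0 (j1.add j3) (by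
      intro x' w
      have h1 : HasDerivAt (fun x' => K (Psi p (w.1, x', w.2)))
          (fderiv ℝ K (Psi p (w.1, x', w.2)) (1, 0, - w.1 / 2)) x' := by
        simp only [Psi]
        refine hd_comp_curve (c1 := fun x' => x' - p.1) (c2 := fun _ => w.1)
          (c3 := fun x' => w.2 - p.2 - (p.1 + x') * w.1 / 2) hK ?_ (hasDerivAt_const _ _) ?_
        · simpa using (hasDerivAt_id x').sub_const p.1
        · have := ((((hasDerivAt_id x').const_add p.1).mul_const w.1).div_const 2).const_sub (w.2 - p.2)
          exact this.congr_deriv (by ring)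
      have e : fderiv ℝ K (Psi p (w.1, x', w.2)) (1, 0, - w.1 / 2) = K3 (Psi p (w.1, x', w.2)) := by
        rw [← hK3]; rfl
      rw [e] at h1
      exact (hd x' w.2).mul h1)
  have key2 := integral_add j1 j3
  have em : Measurable fun q : ℝ × ℝ × ℝ => (q.2.1, q.1, q.2.2) := by fun_prop
  have e1 : ∀ g : ℝ × ℝ × ℝ → ℝ, _ := mp_swap.integral_comp' (f := ⟨⟨fun q : ℝ × ℝ × ℝ => (q.2.1, q.1, q.2.2),
    fun q : ℝ × ℝ × ℝ => (q.2.1, q.1, q.2.2), fun _ => rfl, fun _ => rfl⟩, em, em⟩) 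
  have e2 := e1 (fun z => hx z.2 * K (Psi p z))
  have e3 := e1 (fun z => h z.2 * K3 (Psi p z))
  rw [CK_eq, CK_eq, ← e2, ← e3]
  have key3 : (∫ (a : ℝ × ℝ × ℝ), ((fun z : ℝ × ℝ × ℝ => hx z.2 * K (Psi p z)) ∘ fun q => (q.2.1, q.1, q.2.2)) a) +
      ∫ (a : ℝ × ℝ × ℝ), ((fun z : ℝ × ℝ × ℝ => h z.2 * K3 (Psi p z)) ∘ fun q => (q.2.1, q.1, q.2.2)) a = 0 :=
    key2.symm.trans key
  exact eq_neg_of_add_eq_zero_left key3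
end

section
open MeasureTheory Filter Topology Set

noncomputable def NN (ε : ℝ) (q : ℝ × ℝ × ℝ) : ℝ := (q.1 ^ 2 + q.2.1 ^ 2 + ε ^ 2) ^ 2 + 16 * q.2.2 ^ 2
noncomputable def w0 (q : ℝ × ℝ × ℝ) : ℝ := √(NN 0 q)

noncomputable def k0 (δ ε : ℝ) (q : ℝ × ℝ × ℝ) : ℝ := H0 δ (NN ε q)
noncomputable def kt (δ ε : ℝ) (q : ℝ × ℝ × ℝ) : ℝ := 32 * q.2.2 * H1 δ (NN ε q)
noncomputable def k1 (δ ε : ℝ) (q : ℝ × ℝ × ℝ) : ℝ :=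
  (4 * q.1 * (q.1 ^ 2 + q.2.1 ^ 2 + ε ^ 2) + 16 * q.2.1 * q.2.2) * H1 δ (NN ε q)
noncomputable def k2 (δ ε : ℝ) (q : ℝ × ℝ × ℝ) : ℝ :=
  (4 * q.2.1 * (q.1 ^ 2 + q.2.1 ^ 2 + ε ^ 2) - 16 * q.1 * q.2.2) * H1 δ (NN ε q)
noncomputable def k3 (δ ε : ℝ) (q : ℝ × ℝ × ℝ) : ℝ :=
  (4 * q.1 * (q.1 ^ 2 + q.2.1 ^ 2 + ε ^ 2) - 16 * q.2.1 * q.2.2) * H1 δ (NN ε q)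
noncomputable def k1t (δ ε : ℝ) (q : ℝ × ℝ × ℝ) : ℝ :=
  16 * q.2.1 * H1 δ (NN ε q) +
  (4 * q.1 * (q.1 ^ 2 + q.2.1 ^ 2 + ε ^ 2) + 16 * q.2.1 * q.2.2) * (H2 δ (NN ε q) * (32 * q.2.2))
noncomputable def k2t (δ ε : ℝ) (q : ℝ × ℝ × ℝ) : ℝ :=
  -16 * q.1 * H1 δ (NN ε q) +
  (4 * q.2.1 * (q.1 ^ 2 + q.2.1 ^ 2 + ε ^ 2) - 16 * q.1 * q.2.2) * (H2 δ (NN ε q) * (32 * q.2.2))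
noncomputable def k3t (δ ε : ℝ) (q : ℝ × ℝ × ℝ) : ℝ :=
  -16 * q.2.1 * H1 δ (NN ε q) +
  (4 * q.1 * (q.1 ^ 2 + q.2.1 ^ 2 + ε ^ 2) - 16 * q.2.1 * q.2.2) * (H2 δ (NN ε q) * (32 * q.2.2))

structure KF (μ C : ℝ) (K Kt : ℝ → ℝ × ℝ × ℝ → ℝ) : Prop where
  sm : ∀ ε, 0 < ε → ContDiff ℝ 1 (K ε)
  bs : ∀ ε, BS 1 (K ε)
  bst : ∀ ε, BS 1 (Kt ε)
  fd : ∀ ε, 0 < ε → ∀ q, fderiv ℝ (K ε) q (0, 0, 1) = Kt ε q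
  bd : ∀ ε q, 0 < w0 q → |K ε q| ≤ C * (w0 q) ^ (-μ)
  bdt : ∀ ε q, 0 < w0 q → |Kt ε q| ≤ C * (w0 q) ^ (-μ - 1)
  lim : ∀ q, 0 < w0 q → Tendsto (fun ε => K ε q) (𝓝 0) (𝓝 (K 0 q))
  limt : ∀ q, 0 < w0 q → Tendsto (fun ε => Kt ε q) (𝓝 0) (𝓝 (Kt 0 q))

theorem NN_pos {ε : ℝ} (hε : 0 < ε) (q : ℝ × ℝ × ℝ) : 0 < NN ε q := by
  unfold NN; positivity

theorem NN_pos' {ε : ℝ} {q : ℝ × ℝ × ℝ} (h : 0 < w0 q) : 0 < NN ε q := by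
  have h1 : 0 < NN 0 q := Real.sqrt_pos.1 h
  unfold NN at *
  have : (q.1 ^ 2 + q.2.1 ^ 2 + 0 ^ 2) ^ 2 ≤ (q.1 ^ 2 + q.2.1 ^ 2 + ε ^ 2) ^ 2 := by
    apply pow_le_pow_left₀ (by positivity); nlinarith [sq_nonneg ε]
  linarith

theorem NN_le {ε : ℝ} {q : ℝ × ℝ × ℝ} : NN 0 q ≤ NN ε q := by
  unfold NN at *
  have : (q.1 ^ 2 + q.2.1 ^ 2 + 0 ^ 2) ^ 2 ≤ (q.1 ^ 2 + q.2.1 ^ 2 + ε ^ 2) ^ 2 := by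
    apply pow_le_pow_left₀ (by positivity); nlinarith [sq_nonneg ε]
  linarith

theorem NN_out {ε : ℝ} {q : ℝ × ℝ × ℝ} (h : 1 < |q.1| ∨ 1 < |q.2.1| ∨ 1 < |q.2.2|) : 1 < NN ε q := by
  unfold NN
  have e1 := sq_nonneg ε
  have e2 := sq_nonneg q.1
  have e3 := sq_nonneg q.2.1
  have e4 := sq_nonneg q.2.2
  rcases h with h | h | h
  · have : 1 < q.1 ^ 2 := (one_lt_sq_iff_one_lt_abs _).2 h
    nlinarith
  · have : 1 < q.2.1 ^ 2 := (one_lt_sq_iff_one_lt_abs _).2 h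
    nlinarith
  · have : 1 < q.2.2 ^ 2 := (one_lt_sq_iff_one_lt_abs _).2 h
    nlinarith

theorem NN_contDiff (ε : ℝ) : ContDiff ℝ (⊤ : ℕ∞) (NN ε) := by unfold NN; fun_prop

theorem NN_cont_eps (q : ℝ × ℝ × ℝ) : Continuous fun ε => NN ε q := by unfold NN; fun_prop

theorem N_facts {ε : ℝ} {q : ℝ × ℝ × ℝ} (h : 0 < w0 q) : ∃ n, 0 < n ∧ |q.1| ≤ n ∧ |q.2.1| ≤ n ∧
    |q.1 ^ 2 + q.2.1 ^ 2 + ε ^ 2| ≤ n ^ 2 ∧ 4 * |q.2.2| ≤ n ^ 2 ∧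
    (NN ε q) ^ (-(1/2) : ℝ) = 1 / n ^ 2 ∧ (NN ε q) ^ (-(3/2) : ℝ) = 1 / n ^ 6 ∧
    (NN ε q) ^ (-(5/2) : ℝ) = 1 / n ^ 10 ∧
    (∀ j : ℕ, 1 / n ^ j ≤ (w0 q) ^ (-(j / 2) : ℝ)) := by
  have hN : 0 < NN ε q := NN_pos' h
  obtain ⟨n, hn, hn4⟩ : ∃ n : ℝ, 0 < n ∧ n ^ 4 = NN ε q :=
    ⟨(NN ε q) ^ ((1/4 : ℝ)), Real.rpow_pos_of_pos hN _, by
      rw [← Real.rpow_natCast, ← Real.rpow_mul hN.le]; norm_num⟩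
  have hA : 0 ≤ q.1 ^ 2 + q.2.1 ^ 2 + ε ^ 2 := by positivity
  have hAn : q.1 ^ 2 + q.2.1 ^ 2 + ε ^ 2 ≤ n ^ 2 := by
    apply le_of_sq_le_sq _ (by positivity)
    have : (n ^ 2) ^ 2 = NN ε q := by rw [← hn4]; ring
    rw [this]; unfold NN; nlinarith [sq_nonneg q.2.2]
  have hpow : ∀ r : ℝ, (NN ε q) ^ r = n ^ (4 * r) := fun r => by
    rw [← hn4, ← Real.rpow_natCast, ← Real.rpow_mul hn.le]; norm_num
  have hpw : ∀ j : ℕ, n ^ (-(j : ℝ)) = 1 / n ^ j := fun j => by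
    rw [Real.rpow_neg hn.le, Real.rpow_natCast, one_div]
  refine ⟨n, hn, ?_, ?_, ?_, ?_, ?_, ?_, ?_, ?_⟩
  · apply abs_le_of_sq_le_sq _ hn.le
    nlinarith [sq_nonneg q.2.1, sq_nonneg ε]
  · apply abs_le_of_sq_le_sq _ hn.le
    nlinarith [sq_nonneg q.1, sq_nonneg ε]
  · rwa [abs_of_nonneg hA]
  · apply le_of_sq_le_sq _ (by positivity)
    have : (n ^ 2) ^ 2 = NN ε q := by rw [← hn4]; ring
    rw [this, mul_pow, sq_abs]; unfold NN; nlinarith [sq_nonneg (q.1 ^ 2 + q.2.1 ^ 2 + ε ^ 2)]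
  · rw [hpow, ← hpw]; norm_num
  · rw [hpow, ← hpw]; norm_num
  · rw [hpow, ← hpw]; norm_num
  · intro j
    have hw : w0 q ≤ n ^ 2 := by
      unfold w0
      apply Real.sqrt_le_iff.2 ⟨by positivity, ?_⟩
      have : (n ^ 2) ^ 2 = NN ε q := by rw [← hn4]; ring
      rw [this]; exact NN_le
    have e : (n ^ 2) ^ (-(j / 2) : ℝ) = 1 / n ^ j := by
      rw [← hpw, ← Real.rpow_natCast, ← Real.rpow_mul hn.le]; congr 1; push_cast; ring
    rw [← e]
    exact Real.rpow_le_rpow_of_nonpos h hw (by have : (0:ℝ) ≤ j := Nat.cast_nonneg j; linarith)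

theorem tend_H {h : ℝ → ℝ} (hc : ContinuousOn h (Ioi 0)) {q : ℝ × ℝ × ℝ} (hq : 0 < w0 q) :
    Tendsto (fun ε => h (NN ε q)) (𝓝 0) (𝓝 (h (NN 0 q))) := by
  have h1 : ContinuousAt h (NN 0 q) := hc.continuousAt (Ioi_mem_nhds (NN_pos' hq))
  exact h1.tendsto.comp (NN_cont_eps q).continuousAt

theorem cd_comp {h : ℝ → ℝ} (hc : ContDiffOn ℝ (⊤ : ℕ∞) h (Ioi 0)) {ε : ℝ} (hε : 0 < ε) :
    ContDiff ℝ (⊤ : ℕ∞) (fun q => h (NN ε q)) := by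
  rw [contDiff_iff_contDiffAt]
  intro q
  exact (hc.contDiffAt (Ioi_mem_nhds (NN_pos hε q))).comp q (NN_contDiff ε).contDiffAt
end

section
open MeasureTheory Filter Topology Set

theorem hd_NN (ε a b t v1 v2 v3 : ℝ) :
    HasDerivAt (fun s => NN ε (a + s * v1, b + s * v2, t + s * v3))
      (4 * (a ^ 2 + b ^ 2 + ε ^ 2) * (a * v1 + b * v2) + 32 * t * v3) 0 := by
  unfold NN
  have e : ∀ c v : ℝ, HasDerivAt (fun s : ℝ => c + s * v) v 0 := fun c v => by
    simpa using ((hasDerivAt_id (0:ℝ)).mul_const v).const_add c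
  have h := ((((((e a v1).pow 2).add ((e b v2).pow 2)).add_const (ε ^ 2)).pow 2).add
    (((e t v3).pow 2).const_mul 16))
  refine h.congr_deriv ?_
  simp; ring

theorem hd_H0N (δ : ℝ) {ε : ℝ} (hε : 0 < ε) (a b t v1 v2 v3 : ℝ) :
    HasDerivAt (fun s => H0 δ (NN ε (a + s * v1, b + s * v2, t + s * v3)))
      (H1 δ (NN ε (a, b, t)) * (4 * (a ^ 2 + b ^ 2 + ε ^ 2) * (a * v1 + b * v2) + 32 * t * v3)) 0 := by
  have h1 := hd_H0 δ (NN_pos hε (a, b, t))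
  refine HasDerivAt.comp (h₂ := H0 δ) 0 ?_ (hd_NN ε a b t v1 v2 v3)
  simpa using h1

theorem hd_H1N (δ : ℝ) {ε : ℝ} (hε : 0 < ε) (a b t v1 v2 v3 : ℝ) :
    HasDerivAt (fun s => H1 δ (NN ε (a + s * v1, b + s * v2, t + s * v3)))
      (H2 δ (NN ε (a, b, t)) * (4 * (a ^ 2 + b ^ 2 + ε ^ 2) * (a * v1 + b * v2) + 32 * t * v3)) 0 := by
  have h1 := hd_H1 δ (NN_pos hε (a, b, t))
  refine HasDerivAt.comp (h₂ := H1 δ) 0 ?_ (hd_NN ε a b t v1 v2 v3)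
  simpa using h1

theorem k0_sm (δ : ℝ) {ε : ℝ} (hε : 0 < ε) : ContDiff ℝ (⊤ : ℕ∞) (k0 δ ε) := cd_comp (cd_H0 δ) hε
theorem k1_sm (δ : ℝ) {ε : ℝ} (hε : 0 < ε) : ContDiff ℝ (⊤ : ℕ∞) (k1 δ ε) := by
  have := cd_comp (cd_H1 δ) hε
  unfold k1; fun_prop
theorem k2_sm (δ : ℝ) {ε : ℝ} (hε : 0 < ε) : ContDiff ℝ (⊤ : ℕ∞) (k2 δ ε) := by
  have := cd_comp (cd_H1 δ) hε
  unfold k2; fun_prop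
theorem k3_sm (δ : ℝ) {ε : ℝ} (hε : 0 < ε) : ContDiff ℝ (⊤ : ℕ∞) (k3 δ ε) := by
  have := cd_comp (cd_H1 δ) hε
  unfold k3; fun_prop

theorem k0_fd (δ : ℝ) {ε : ℝ} (hε : 0 < ε) (q : ℝ × ℝ × ℝ) (v1 v2 v3 : ℝ) :
    fderiv ℝ (k0 δ ε) q (v1, v2, v3) = H1 δ (NN ε q) *
      (4 * (q.1 ^ 2 + q.2.1 ^ 2 + ε ^ 2) * (q.1 * v1 + q.2.1 * v2) + 32 * q.2.2 * v3) :=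
  fd_line ((k0_sm δ hε).of_le (by simp)) (hd_H0N δ hε q.1 q.2.1 q.2.2 v1 v2 v3)

theorem k0_fdt (δ : ℝ) {ε : ℝ} (hε : 0 < ε) (q : ℝ × ℝ × ℝ) :
    fderiv ℝ (k0 δ ε) q (0, 0, 1) = kt δ ε q := by rw [k0_fd δ hε]; unfold kt; ring
theorem k0_fdx (δ : ℝ) {ε : ℝ} (hε : 0 < ε) (q : ℝ × ℝ × ℝ) :
    fderiv ℝ (k0 δ ε) q (1, 0, q.2.1 / 2) = k1 δ ε q := by rw [k0_fd δ hε]; unfold k1; ring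
theorem k0_fdy (δ : ℝ) {ε : ℝ} (hε : 0 < ε) (q : ℝ × ℝ × ℝ) :
    fderiv ℝ (k0 δ ε) q (0, 1, -q.1 / 2) = k2 δ ε q := by rw [k0_fd δ hε]; unfold k2; ring
theorem k0_fd3 (δ : ℝ) {ε : ℝ} (hε : 0 < ε) (q : ℝ × ℝ × ℝ) :
    fderiv ℝ (k0 δ ε) q (1, 0, -q.2.1 / 2) = k3 δ ε q := by rw [k0_fd δ hε]; unfold k3; ring

theorem k_fd_aux (δ : ℝ) {ε : ℝ} (hε : 0 < ε) {P : ℝ → ℝ} {P' a b t : ℝ}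
    (hP : HasDerivAt (fun s => P (t + s * 1)) P' 0) :
    HasDerivAt (fun s => P (t + s * 1) * H1 δ (NN ε (a + s * 0, b + s * 0, t + s * 1)))
      (P' * H1 δ (NN ε (a, b, t)) + P t * (H2 δ (NN ε (a, b, t)) * (32 * t))) 0 := by
  refine (hP.mul (hd_H1N δ hε a b t 0 0 1)).congr_deriv ?_
  simp

theorem k1_fdt (δ : ℝ) {ε : ℝ} (hε : 0 < ε) (q : ℝ × ℝ × ℝ) :
    fderiv ℝ (k1 δ ε) q (0, 0, 1) = k1t δ ε q := by
  obtain ⟨a, b, t⟩ := q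
  refine fd_line ((k1_sm δ hε).of_le (by simp)) ?_
  have e : HasDerivAt (fun s : ℝ => t + s * 1) 1 0 := by
    simpa using ((hasDerivAt_id (0:ℝ)).mul_const 1).const_add t
  have := k_fd_aux (a := a) (b := b) δ hε (P := fun t => 4 * a * (a ^ 2 + b ^ 2 + ε ^ 2) + 16 * b * t)
    ((e.const_mul (16 * b)).const_add (4 * a * (a ^ 2 + b ^ 2 + ε ^ 2)))
  simp only [mul_zero, add_zero, mul_one] at this ⊢
  exact this
theorem k2_fdt (δ : ℝ) {ε : ℝ} (hε : 0 < ε) (q : ℝ × ℝ × ℝ) :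
    fderiv ℝ (k2 δ ε) q (0, 0, 1) = k2t δ ε q := by
  obtain ⟨a, b, t⟩ := q
  refine fd_line ((k2_sm δ hε).of_le (by simp)) ?_
  have e : HasDerivAt (fun s : ℝ => t + s * 1) 1 0 := by
    simpa using ((hasDerivAt_id (0:ℝ)).mul_const 1).const_add t
  have := k_fd_aux (a := a) (b := b) δ hε (P := fun t => 4 * b * (a ^ 2 + b ^ 2 + ε ^ 2) - 16 * a * t)
    ((e.const_mul (16 * a)).const_sub (4 * b * (a ^ 2 + b ^ 2 + ε ^ 2)))
  simp only [mul_zero, add_zero, mul_one] at this ⊢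
  refine this.congr_deriv ?_
  unfold k2t; ring
theorem k3_fdt (δ : ℝ) {ε : ℝ} (hε : 0 < ε) (q : ℝ × ℝ × ℝ) :
    fderiv ℝ (k3 δ ε) q (0, 0, 1) = k3t δ ε q := by
  obtain ⟨a, b, t⟩ := q
  refine fd_line ((k3_sm δ hε).of_le (by simp)) ?_
  have e : HasDerivAt (fun s : ℝ => t + s * 1) 1 0 := by
    simpa using ((hasDerivAt_id (0:ℝ)).mul_const 1).const_add t
  have := k_fd_aux (a := a) (b := b) δ hε (P := fun t => 4 * a * (a ^ 2 + b ^ 2 + ε ^ 2) - 16 * b * t)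
    ((e.const_mul (16 * b)).const_sub (4 * a * (a ^ 2 + b ^ 2 + ε ^ 2)))
  simp only [mul_zero, add_zero, mul_one] at this ⊢
  refine this.congr_deriv ?_
  unfold k3t; ring

theorem pbd {x y X Y : ℝ} (hx : |x| ≤ X) (hy : |y| ≤ Y) : |x * y| ≤ X * Y := by
  rw [abs_mul]; exact mul_le_mul hx hy (abs_nonneg _) ((abs_nonneg _).trans hx)

theorem k0_KF {δ : ℝ} (hδ : 0 < δ) (hδ1 : δ ≤ 1) : ∃ C, KF 1 C (k0 δ) (kt δ) := by
  obtain ⟨C0, p0, b0⟩ := H0_bound hδ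
  obtain ⟨C1, p1, b1⟩ := H1_bound hδ
  refine ⟨C0 + 8 * C1, ?_, ?_, ?_, ?_, ?_, ?_, ?_, ?_⟩
  · exact fun ε hε => (k0_sm δ hε).of_le (by simp)
  · exact fun ε q hq => H0_zero hδ (hδ1.trans_lt (NN_out hq))
  · intro ε q hq; unfold kt; rw [H1_zero hδ (hδ1.trans_lt (NN_out hq)), mul_zero]
  · exact fun ε hε q => k0_fdt δ hε q
  · intro ε q hq
    obtain ⟨n, hn, ha, hb, hA, ht, e0, e1, e2, hw⟩ := N_facts (ε := ε) hq
    have h0 := b0 _ (NN_pos' (ε := ε) hq)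
    rw [e0] at h0
    have := hw 2
    norm_num at this
    refine h0.trans ?_
    have h3 : 1 / n ^ 2 ≤ w0 q ^ (-1 : ℝ) := by simpa using this
    apply mul_le_mul _ h3 (by positivity) (by positivity)
    linarith
  · intro ε q hq
    obtain ⟨n, hn, ha, hb, hA, ht, e0, e1, e2, hw⟩ := N_facts (ε := ε) hq
    have h0 := b1 _ (NN_pos' (ε := ε) hq)
    rw [e1] at h0
    have := hw 4
    norm_num at this
    unfold kt
    have h4 : |32 * q.2.2| ≤ 8 * n ^ 2 := by
      rw [abs_mul]; norm_num; linarith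
    refine (pbd h4 h0).trans ?_
    have e : 8 * n ^ 2 * (C1 * (1 / n ^ 6)) = 8 * C1 * (1 / n ^ 4) := by
      field_simp
    rw [e]
    have h3 : 1 / n ^ 4 ≤ w0 q ^ (-1 - 1 : ℝ) := by norm_num; exact this
    apply mul_le_mul _ h3 (by positivity) (by positivity)
    linarith
  · exact fun q hq => tend_H (cd_H0 δ).continuousOn hq
  · exact fun q hq => tendsto_const_nhds.mul (tend_H (cd_H1 δ).continuousOn hq)

theorem kP_KF {δ : ℝ} (hδ : 0 < δ) (hδ1 : δ ≤ 1) {P : ℝ → ℝ × ℝ × ℝ → ℝ} {Pt : ℝ × ℝ × ℝ → ℝ} {K Kt : ℝ → ℝ × ℝ × ℝ → ℝ}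
    (hK : ∀ ε q, K ε q = P ε q * H1 δ (NN ε q))
    (hKt : ∀ ε q, Kt ε q = Pt q * H1 δ (NN ε q) + P ε q * (H2 δ (NN ε q) * (32 * q.2.2)))
    (hPc : ∀ q, Continuous fun ε => P ε q)
    (sm : ∀ ε, 0 < ε → ContDiff ℝ 1 (K ε)) (fd : ∀ ε, 0 < ε → ∀ q, fderiv ℝ (K ε) q (0, 0, 1) = Kt ε q)
    (hP : ∀ ε q n, 0 < n → |q.1| ≤ n → |q.2.1| ≤ n → |q.1 ^ 2 + q.2.1 ^ 2 + ε ^ 2| ≤ n ^ 2 →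
      4 * |q.2.2| ≤ n ^ 2 → |P ε q| ≤ 8 * n ^ 3)
    (hPt : ∀ q n, 0 < n → |q.1| ≤ n → |q.2.1| ≤ n → |Pt q| ≤ 16 * n) : ∃ C, KF (3/2) C K Kt := by
  obtain ⟨C1, p1, b1⟩ := H1_bound hδ
  obtain ⟨C2, p2, b2⟩ := H2_bound hδ
  refine ⟨16 * C1 + 64 * C2, sm, ?_, ?_, fd, ?_, ?_, ?_, ?_⟩
  · intro ε q hq; rw [hK, H1_zero hδ (hδ1.trans_lt (NN_out hq)), mul_zero]
  · intro ε q hq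
    rw [hKt, H1_zero hδ (hδ1.trans_lt (NN_out hq)), H2_zero hδ (hδ1.trans_lt (NN_out hq))]; ring
  · intro ε q hq
    obtain ⟨n, hn, ha, hb, hA, ht, e0, e1, e2, hw⟩ := N_facts (ε := ε) hq
    have h0 := b1 _ (NN_pos' (ε := ε) hq)
    rw [e1] at h0
    have := hw 3
    norm_num at this
    rw [hK]
    refine (pbd (hP ε q n hn ha hb hA ht) h0).trans ?_
    have e : 8 * n ^ 3 * (C1 * (1 / n ^ 6)) = 8 * C1 * (1 / n ^ 3) := by
      field_simp
    rw [e]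
    have h3 : 1 / n ^ 3 ≤ w0 q ^ (-(3/2) : ℝ) := by norm_num; exact this
    apply mul_le_mul _ h3 (by positivity) (by positivity)
    linarith
  · intro ε q hq
    obtain ⟨n, hn, ha, hb, hA, ht, e0, e1, e2, hw⟩ := N_facts (ε := ε) hq
    have h0 := b1 _ (NN_pos' (ε := ε) hq)
    rw [e1] at h0
    have h00 := b2 _ (NN_pos' (ε := ε) hq)
    rw [e2] at h00
    have := hw 5
    norm_num at this
    rw [hKt]
    have h4 : |32 * q.2.2| ≤ 8 * n ^ 2 := by
      rw [abs_mul]; norm_num; linarith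
    refine (abs_add_le _ _).trans ((add_le_add (pbd (hPt q n hn ha hb) h0)
      (pbd (hP ε q n hn ha hb hA ht) (pbd h00 h4))).trans ?_)
    have e : 16 * n * (C1 * (1 / n ^ 6)) + 8 * n ^ 3 * (C2 * (1 / n ^ 10) * (8 * n ^ 2))
        = (16 * C1 + 64 * C2) * (1 / n ^ 5) := by
      field_simp; ring
    rw [e]
    have h3 : 1 / n ^ 5 ≤ w0 q ^ (-(3/2) - 1 : ℝ) := by norm_num; exact this
    apply mul_le_mul le_rfl h3 (by positivity) (by positivity)
  · intro q hq
    simp only [hK]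
    exact ((hPc q).tendsto 0).mul (tend_H (cd_H1 δ).continuousOn hq)
  · intro q hq
    simp only [hKt]
    exact (tendsto_const_nhds.mul (tend_H (cd_H1 δ).continuousOn hq)).add
      (((hPc q).tendsto 0).mul ((tend_H (cd_H2 δ).continuousOn hq).mul tendsto_const_nhds))

theorem poly_bd {x y A t n : ℝ} (hn : 0 < n) (hx : |x| ≤ n) (hy : |y| ≤ n) (hA : |A| ≤ n ^ 2)
    (ht : 4 * |t| ≤ n ^ 2) : |4 * x * A| + |16 * y * t| ≤ 8 * n ^ 3 := by
  have h1 := pbd hx hA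
  have h2 := pbd hy (y := 4 * t) (Y := n ^ 2) (by rw [abs_mul]; simpa using ht)
  have e1 : |4 * x * A| = 4 * |x * A| := by rw [mul_assoc, abs_mul]; norm_num
  have e2 : |16 * y * t| = 4 * |y * (4 * t)| := by
    rw [show 16 * y * t = 4 * (y * (4 * t)) by ring, abs_mul]; norm_num
  rw [e1, e2]; nlinarith

theorem k1_KF {δ : ℝ} (hδ : 0 < δ) (hδ1 : δ ≤ 1) : ∃ C, KF (3/2) C (k1 δ) (k1t δ) := by
  refine kP_KF hδ hδ1 (P := fun ε q => 4 * q.1 * (q.1 ^ 2 + q.2.1 ^ 2 + ε ^ 2) + 16 * q.2.1 * q.2.2)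
    (Pt := fun q => 16 * q.2.1) (fun _ _ => rfl) (fun _ _ => rfl) (fun q => by fun_prop)
    (fun ε hε => (k1_sm δ hε).of_le (by simp)) (fun ε hε => k1_fdt δ hε) ?_ ?_
  · intro ε q n hn ha hb hA ht
    exact (abs_add_le _ _).trans (poly_bd hn ha hb hA ht)
  · intro q n hn ha hb; rw [abs_mul]; norm_num; linarith
theorem k2_KF {δ : ℝ} (hδ : 0 < δ) (hδ1 : δ ≤ 1) : ∃ C, KF (3/2) C (k2 δ) (k2t δ) := by
  refine kP_KF hδ hδ1 (P := fun ε q => 4 * q.2.1 * (q.1 ^ 2 + q.2.1 ^ 2 + ε ^ 2) - 16 * q.1 * q.2.2)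
    (Pt := fun q => -16 * q.1) (fun _ _ => rfl) (fun _ _ => rfl) (fun q => by fun_prop)
    (fun ε hε => (k2_sm δ hε).of_le (by simp)) (fun ε hε => k2_fdt δ hε) ?_ ?_
  · intro ε q n hn ha hb hA ht
    exact (abs_sub _ _).trans (poly_bd hn hb ha hA ht)
  · intro q n hn ha hb; rw [abs_mul]; norm_num; linarith
theorem k3_KF {δ : ℝ} (hδ : 0 < δ) (hδ1 : δ ≤ 1) : ∃ C, KF (3/2) C (k3 δ) (k3t δ) := by
  refine kP_KF hδ hδ1 (P := fun ε q => 4 * q.1 * (q.1 ^ 2 + q.2.1 ^ 2 + ε ^ 2) - 16 * q.2.1 * q.2.2)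
    (Pt := fun q => -16 * q.2.1) (fun _ _ => rfl) (fun _ _ => rfl) (fun q => by fun_prop)
    (fun ε hε => (k3_sm δ hε).of_le (by simp)) (fun ε hε => k3_fdt δ hε) ?_ ?_
  · intro ε q n hn ha hb hA ht
    exact (abs_sub _ _).trans (poly_bd hn ha hb hA ht)
  · intro q n hn ha hb; rw [abs_mul]; norm_num; linarith
end

section
open MeasureTheory Filter Topology Set

noncomputable def g1 (s : ℝ) : ℝ := (Icc (-1 : ℝ) 1).indicator (fun s => |s| ^ (-(7/8) : ℝ)) s
noncomputable def dom (q : ℝ × ℝ × ℝ) : ℝ := g1 q.1 * (g1 q.2.1 * g1 q.2.2)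

theorem g1_nonneg (s : ℝ) : 0 ≤ g1 s := by
  unfold g1; apply indicator_nonneg; intro s _; positivity

theorem g1_of {s : ℝ} (h : |s| ≤ 1) : g1 s = |s| ^ (-(7/8) : ℝ) := by
  unfold g1; rw [indicator_of_mem]; exact abs_le.1 h

theorem g1_out {s : ℝ} (h : 1 < |s|) : g1 s = 0 := by
  unfold g1; rw [indicator_of_notMem]; intro hm; have := abs_le.2 hm; linarith

theorem g1_int : Integrable g1 := by
  unfold g1
  rw [integrable_indicator_iff measurableSet_Icc]
  have h1 : IntervalIntegrable (fun s : ℝ => s ^ (-(7/8) : ℝ)) volume 0 1 :=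
    intervalIntegral.intervalIntegrable_rpow' (by norm_num)
  have h2 : IntegrableOn (fun s : ℝ => |s| ^ (-(7/8) : ℝ)) (Ioc 0 1) := by
    have := (intervalIntegrable_iff_integrableOn_Ioc_of_le zero_le_one).1 h1
    refine this.congr_fun (fun s hs => ?_) measurableSet_Ioc
    rw [abs_of_pos hs.1]
  have h3 : IntegrableOn (fun s : ℝ => |s| ^ (-(7/8) : ℝ)) (Ico (-1) 0) := by
    have hmp : MeasurePreserving (fun s : ℝ => -s) := Measure.measurePreserving_neg volume
    have h := (hmp.integrableOn_comp_preimage (MeasurableEquiv.neg ℝ).measurableEmbedding).2 h2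
    have e : (fun s : ℝ => -s) ⁻¹' Ioc 0 1 = Ico (-1) 0 := by
      ext s; simp only [mem_preimage, mem_Ioc, mem_Ico]; constructor <;> rintro ⟨_, _⟩ <;> constructor <;> linarith
    rw [e] at h
    refine h.congr_fun (fun s _ => ?_) measurableSet_Ico
    simp [Function.comp]
  have h4 : IntegrableOn (fun s : ℝ => |s| ^ (-(7/8) : ℝ)) {0} := by
    exact integrableOn_singleton (by simp) (by simp)
  refine ((h3.union h4).union h2).mono_set ?_
  intro s hs
  rcases lt_trichotomy s 0 with h | h | h
  · exact Or.inl (Or.inl ⟨hs.1, h⟩)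
  · exact Or.inl (Or.inr h)
  · exact Or.inr ⟨h, hs.2⟩

theorem dom_int : Integrable dom :=
  Integrable.mul_prod (f := g1) (g := fun z : ℝ × ℝ => g1 z.1 * g1 z.2) g1_int (g1_int.mul_prod g1_int)

theorem dom_nonneg (q : ℝ × ℝ × ℝ) : 0 ≤ dom q :=
  mul_nonneg (g1_nonneg _) (mul_nonneg (g1_nonneg _) (g1_nonneg _))

theorem w0_ge_ab (q : ℝ × ℝ × ℝ) : |q.1| * |q.2.1| ≤ w0 q := by
  unfold w0
  apply Real.le_sqrt_of_sq_le
  unfold NN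
  have h1 : (|q.1| * |q.2.1|) ^ 2 = q.1 ^ 2 * q.2.1 ^ 2 := by rw [mul_pow, sq_abs, sq_abs]
  rw [h1]
  nlinarith [sq_nonneg (q.1 ^ 2), sq_nonneg (q.2.1 ^ 2), sq_nonneg q.2.2, mul_nonneg (sq_nonneg q.1) (sq_nonneg q.2.1)]

theorem w0_ge_t (q : ℝ × ℝ × ℝ) : |q.2.2| ≤ w0 q := by
  unfold w0
  apply Real.le_sqrt_of_sq_le
  unfold NN
  rw [sq_abs]
  nlinarith [sq_nonneg (q.1 ^ 2 + q.2.1 ^ 2 + 0 ^ 2), sq_nonneg q.2.2]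

theorem w0_le {q : ℝ × ℝ × ℝ} (ha : |q.1| ≤ 1) (hb : |q.2.1| ≤ 1) (ht : |q.2.2| ≤ 1) : w0 q ≤ 5 := by
  unfold w0
  rw [Real.sqrt_le_left (by norm_num)]
  have h1 : q.1 ^ 2 ≤ 1 := (sq_le_one_iff_abs_le_one _).2 ha
  have h2 : q.2.1 ^ 2 ≤ 1 := (sq_le_one_iff_abs_le_one _).2 hb
  have h3 : q.2.2 ^ 2 ≤ 1 := (sq_le_one_iff_abs_le_one _).2 ht
  unfold NN
  nlinarith [sq_nonneg q.1, sq_nonneg q.2.1, sq_nonneg q.2.2]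

theorem w0_pos_t {q : ℝ × ℝ × ℝ} (h : q.2.2 ≠ 0) : 0 < w0 q :=
  (abs_pos.2 h).trans_le (w0_ge_t q)

theorem w_rpow_split {q : ℝ × ℝ × ℝ} (ha : q.1 ≠ 0) (hb : q.2.1 ≠ 0) (ht : q.2.2 ≠ 0) {s : ℝ}
    (hs : 7/8 ≤ s) :
    w0 q ^ (-s) ≤ (|q.1| * |q.2.1|) ^ (-(s - 7/8)) * |q.2.2| ^ (-(7/8) : ℝ) := by
  have hw := w0_pos_t ht
  have e : w0 q ^ (-s) = w0 q ^ (-(s - 7/8)) * w0 q ^ (-(7/8) : ℝ) := by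
    rw [← Real.rpow_add hw]; congr 1; ring
  rw [e]
  apply mul_le_mul
  · exact Real.rpow_le_rpow_of_nonpos (mul_pos (abs_pos.2 ha) (abs_pos.2 hb)) (w0_ge_ab q) (by linarith)
  · exact Real.rpow_le_rpow_of_nonpos (abs_pos.2 ht) (w0_ge_t q) (by norm_num)
  · positivity
  · positivity

theorem dom_ge {q : ℝ × ℝ × ℝ} (ha : q.1 ≠ 0) (hb : q.2.1 ≠ 0) (ht : q.2.2 ≠ 0)
    (ha1 : |q.1| ≤ 1) (hb1 : |q.2.1| ≤ 1) (ht1 : |q.2.2| ≤ 1) {s : ℝ} (h0 : 0 ≤ s) (h1 : s ≤ 7/4) :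
    w0 q ^ (-s) ≤ 25 * dom q := by
  have hw := w0_pos_t ht
  have h2 := w_rpow_split ha hb ht (s := 7/4) (by norm_num)
  have e : w0 q ^ (-s) = w0 q ^ (7/4 - s) * w0 q ^ (-(7/4) : ℝ) := by
    rw [← Real.rpow_add hw]; congr 1; ring
  have h3 : w0 q ^ (7/4 - s) ≤ 25 := by
    calc w0 q ^ (7/4 - s) ≤ 5 ^ (7/4 - s) :=
          Real.rpow_le_rpow hw.le (w0_le ha1 hb1 ht1) (by linarith)
      _ ≤ 5 ^ (2 : ℝ) := Real.rpow_le_rpow_of_exponent_le (by norm_num) (by linarith)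
      _ = 25 := by norm_num
  have hd : dom q = (|q.1| * |q.2.1|) ^ (-(7/4 - 7/8) : ℝ) * |q.2.2| ^ (-(7/8) : ℝ) := by
    unfold dom
    rw [g1_of ha1, g1_of hb1, g1_of ht1, Real.mul_rpow (abs_nonneg _) (abs_nonneg _)]
    norm_num; ring
  rw [e, hd]
  exact mul_le_mul h3 h2 (by positivity) (by norm_num)

theorem ae_ne1 : ∀ᵐ q : ℝ × ℝ × ℝ, q.1 ≠ 0 ∧ q.2.1 ≠ 0 ∧ q.2.2 ≠ 0 := by
  have h : ∀ᵐ s : ℝ, s ≠ 0 := by simp [ae_iff]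
  have h1 : ∀ᵐ q : ℝ × ℝ × ℝ, q.1 ≠ 0 :=
    (Measure.quasiMeasurePreserving_fst (μ := (volume : Measure ℝ)) (ν := (volume : Measure (ℝ × ℝ)))).ae h
  have h2 : ∀ᵐ z : ℝ × ℝ, z.1 ≠ 0 :=
    (Measure.quasiMeasurePreserving_fst (μ := (volume : Measure ℝ)) (ν := (volume : Measure ℝ))).ae h
  have h3 : ∀ᵐ z : ℝ × ℝ, z.2 ≠ 0 :=
    (Measure.quasiMeasurePreserving_snd (μ := (volume : Measure ℝ)) (ν := (volume : Measure ℝ))).ae h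
  have h23 : ∀ᵐ q : ℝ × ℝ × ℝ, q.2.1 ≠ 0 ∧ q.2.2 ≠ 0 :=
    (Measure.quasiMeasurePreserving_snd (μ := (volume : Measure ℝ)) (ν := (volume : Measure (ℝ × ℝ)))).ae (h2.and h3)
  exact h1.and h23

namespace KF
variable {μ C : ℝ} {K Kt : ℝ → ℝ × ℝ × ℝ → ℝ}

theorem Cnn (h : KF μ C K Kt) : 0 ≤ C := by
  have h1 : w0 (0, 0, 1/4) = 1 := by unfold w0 NN; norm_num
  have := (abs_nonneg _).trans (h.bd 0 (0, 0, 1/4) (by rw [h1]; norm_num))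
  rwa [h1, Real.one_rpow, mul_one] at this

theorem dom_bd (h : KF μ C K Kt) (h0 : 0 ≤ μ) (h1 : μ ≤ 7/4) :
    ∀ᵐ q : ℝ × ℝ × ℝ, ∀ ε, |K ε q| ≤ 25 * C * dom q := by
  filter_upwards [ae_ne1] with q hq ε
  by_cases hb : 1 < |q.1| ∨ 1 < |q.2.1| ∨ 1 < |q.2.2|
  · rw [h.bs ε q hb, abs_zero]
    exact mul_nonneg (mul_nonneg (by norm_num) h.Cnn) (dom_nonneg q)
  · push Not at hb
    have := dom_ge hq.1 hq.2.1 hq.2.2 hb.1 hb.2.1 hb.2.2 h0 h1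
    have h2 := h.bd ε q (w0_pos_t hq.2.2)
    nlinarith [mul_le_mul_of_nonneg_left this h.Cnn]

theorem dom_bdt (h : KF μ C K Kt) {γ : ℝ} (hγ : 0 ≤ γ) (h0 : γ ≤ μ + 1) (h1 : μ + 1 - γ ≤ 7/4) :
    ∀ᵐ q : ℝ × ℝ × ℝ, ∀ ε, |(|q.2.2| ^ γ * Kt ε q)| ≤ 25 * C * dom q := by
  filter_upwards [ae_ne1] with q hq ε
  by_cases hb : 1 < |q.1| ∨ 1 < |q.2.1| ∨ 1 < |q.2.2|
  · rw [h.bst ε q hb, mul_zero, abs_zero]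
    exact mul_nonneg (mul_nonneg (by norm_num) h.Cnn) (dom_nonneg q)
  · push Not at hb
    have := dom_ge hq.1 hq.2.1 hq.2.2 hb.1 hb.2.1 hb.2.2 (s := μ + 1 - γ) (by linarith) h1
    have h2 := h.bdt ε q (w0_pos_t hq.2.2)
    have hw := w0_pos_t hq.2.2
    rw [abs_mul, abs_of_nonneg (by positivity : 0 ≤ |q.2.2| ^ γ)]
    have h3 : |q.2.2| ^ γ ≤ w0 q ^ γ := Real.rpow_le_rpow (abs_nonneg _) (w0_ge_t q) hγ
    have e : w0 q ^ γ * (C * w0 q ^ (-μ - 1)) = C * w0 q ^ (-(μ + 1 - γ)) := by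
      rw [mul_left_comm, ← Real.rpow_add hw]; congr 2; ring
    calc |q.2.2| ^ γ * |Kt ε q| ≤ w0 q ^ γ * (C * w0 q ^ (-μ - 1)) :=
          mul_le_mul h3 h2 (abs_nonneg _) (by positivity)
      _ = C * w0 q ^ (-(μ + 1 - γ)) := e
      _ ≤ _ := by nlinarith [mul_le_mul_of_nonneg_left this h.Cnn]
end KF

theorem seq_pos (n : ℕ) : (0 : ℝ) < 1 / ((n : ℝ) + 1) := by positivity
theorem seq_lim : Tendsto (fun n : ℕ => 1 / ((n : ℝ) + 1)) atTop (𝓝 (0 : ℝ)) :=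
  tendsto_one_div_add_atTop_nhds_zero_nat

/-- abstract: dominated families converge in L1 -/
theorem fam_conv {F : ℝ → ℝ × ℝ × ℝ → ℝ} {C : ℝ} (hc : ∀ ε, 0 < ε → Continuous (F ε))
    (hb : ∀ᵐ q : ℝ × ℝ × ℝ, ∀ ε, |F ε q| ≤ C * dom q)
    (hl : ∀ q, 0 < w0 q → Tendsto (fun ε => F ε q) (𝓝 0) (𝓝 (F 0 q))) :
    (∀ ε, 0 ≤ ε → Integrable (F ε)) ∧
      Tendsto (fun n : ℕ => ∫ q, |F (1 / ((n : ℝ) + 1)) q - F 0 q|) atTop (𝓝 0) := by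
  have hl' : ∀ᵐ q : ℝ × ℝ × ℝ, Tendsto (fun n : ℕ => F (1 / ((n : ℝ) + 1)) q) atTop (𝓝 (F 0 q)) := by
    filter_upwards [ae_ne1] with q hq
    exact (hl q (w0_pos_t hq.2.2)).comp seq_lim
  have hm : ∀ ε, 0 ≤ ε → AEStronglyMeasurable (F ε) volume := by
    intro ε hε
    rcases hε.eq_or_lt with h | h
    · rw [← h]
      exact aestronglyMeasurable_of_tendsto_ae atTop
        (fun n => (hc _ (seq_pos n)).aestronglyMeasurable) hl'
    · exact (hc ε h).aestronglyMeasurable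
  refine ⟨fun ε hε => (dom_int.const_mul C).mono' (hm ε hε) (hb.mono fun q hq => hq ε), ?_⟩
  have := tendsto_integral_of_dominated_convergence (μ := volume)
    (F := fun (n : ℕ) q => |F (1 / ((n : ℝ) + 1)) q - F 0 q|) (f := fun _ => (0 : ℝ))
    (fun q => 2 * (C * dom q)) (fun n => ((hm _ (seq_pos n).le).sub (hm 0 le_rfl)).norm)
    ((dom_int.const_mul C).const_mul 2) ?_ ?_
  · simpa using this
  · intro n
    filter_upwards [hb] with q hq
    rw [Real.norm_eq_abs, abs_abs]
    have h1 := hq (1 / ((n : ℝ) + 1))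
    have h2 := hq 0
    exact (abs_sub _ _).trans (by linarith)
  · filter_upwards [hl'] with q hq
    have := (hq.sub_const (F 0 q)).abs
    simpa using this
end

section
open MeasureTheory Filter Topology Set

namespace KF
variable {μ C : ℝ} {K Kt : ℝ → ℝ × ℝ × ℝ → ℝ}
theorem conv (h : KF μ C K Kt) (h0 : 0 ≤ μ) (h1 : μ ≤ 7/4) :
    (∀ ε, 0 ≤ ε → Integrable (K ε)) ∧
      Tendsto (fun n : ℕ => ∫ q, |K (1 / ((n : ℝ) + 1)) q - K 0 q|) atTop (𝓝 0) :=
  fam_conv (fun ε hε => (h.sm ε hε).continuous) (h.dom_bd h0 h1) h.lim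

theorem contt (h : KF μ C K Kt) {ε : ℝ} (hε : 0 < ε) : Continuous (Kt ε) := by
  rw [← funext (h.fd ε hε)]; exact fd_cont (h.sm ε hε) continuous_const

theorem convt (h : KF μ C K Kt) {γ : ℝ} (hγ : 0 ≤ γ) (h0 : γ ≤ μ + 1) (h1 : μ + 1 - γ ≤ 7/4) :
    (∀ ε, 0 ≤ ε → Integrable (fun q => |q.2.2| ^ γ * Kt ε q)) ∧
      Tendsto (fun n : ℕ => ∫ q : ℝ × ℝ × ℝ, |(|q.2.2| ^ γ * Kt (1 / ((n : ℝ) + 1)) q) - |q.2.2| ^ γ * Kt 0 q|)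
        atTop (𝓝 0) :=
  fam_conv (F := fun ε q => |q.2.2| ^ γ * Kt ε q) (fun ε hε => by
    have := h.contt hε
    have h2 : Continuous fun q : ℝ × ℝ × ℝ => |q.2.2| ^ γ :=
      (continuous_abs.comp (continuous_snd.comp continuous_snd)).rpow_const fun _ => Or.inr hγ
    exact h2.mul this) (h.dom_bdt hγ h0 h1) (fun q hq => tendsto_const_nhds.mul (h.limt q hq))

theorem hcs (h : KF μ C K Kt) (ε : ℝ) : HasCompactSupport (K ε) := (h.bs ε).hcs

theorem unif (h : KF μ C K Kt) (h0 : 0 ≤ μ) (h1 : μ ≤ 7/4) {g : ℝ × ℝ → ℝ} {D : ℝ} (hg : BM g D) :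
    TendstoUniformly (fun (n : ℕ) p => CK (K (1 / ((n : ℝ) + 1))) g p) (CK (K 0) g) atTop := by
  rw [Metric.tendstoUniformly_iff]
  intro ε hε
  have h2 := (h.conv h0 h1).2.const_mul D
  rw [mul_zero] at h2
  filter_upwards [h2.eventually_lt_const hε] with n hn p
  rw [dist_comm, Real.dist_eq, ← CK_sub_K ((h.conv h0 h1).1 _ (seq_pos n).le) ((h.conv h0 h1).1 _ le_rfl) hg]
  refine (CK_le (((h.conv h0 h1).1 _ (seq_pos n).le).sub ((h.conv h0 h1).1 _ le_rfl)) hg p).trans_lt hn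
end KF

section

theorem k0_int {δ : ℝ} (hδ : 0 < δ) (hδ1 : δ ≤ 1) : Integrable (k0 δ 0) := by
  obtain ⟨C, hC⟩ := k0_KF hδ hδ1; exact (hC.conv (by norm_num) (by norm_num)).1 0 le_rfl
theorem k1_int {δ : ℝ} (hδ : 0 < δ) (hδ1 : δ ≤ 1) : Integrable (k1 δ 0) := by
  obtain ⟨C, hC⟩ := k1_KF hδ hδ1; exact (hC.conv (by norm_num) (by norm_num)).1 0 le_rfl
theorem k2_int {δ : ℝ} (hδ : 0 < δ) (hδ1 : δ ≤ 1) : Integrable (k2 δ 0) := by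
  obtain ⟨C, hC⟩ := k2_KF hδ hδ1; exact (hC.conv (by norm_num) (by norm_num)).1 0 le_rfl
theorem k3_int {δ : ℝ} (hδ : 0 < δ) (hδ1 : δ ≤ 1) : Integrable (k3 δ 0) := by
  obtain ⟨C, hC⟩ := k3_KF hδ hδ1; exact (hC.conv (by norm_num) (by norm_num)).1 0 le_rfl

theorem unif_comp {F : ℕ → ℝ × ℝ → ℝ} {f : ℝ × ℝ → ℝ} (h : TendstoUniformly F f atTop) (c : ℝ → ℝ × ℝ) :
    TendstoUniformly (fun n s => F n (c s)) (fun s => f (c s)) atTop := h.comp c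

theorem unif_neg {F : ℕ → ℝ → ℝ} {f : ℝ → ℝ} (h : TendstoUniformly F f atTop) :
    TendstoUniformly (fun n s => -F n s) (fun s => -f s) atTop := by
  rw [Metric.tendstoUniformly_iff] at *
  intro ε hε
  filter_upwards [h ε hε] with n hn s
  rw [Real.dist_eq] at *
  have := hn s
  rw [← abs_neg] ; rw [Real.dist_eq] at this
  convert this using 2; ring

theorem CK0_dx {δ : ℝ} (hδ : 0 < δ) (hδ1 : δ ≤ 1) {g : ℝ × ℝ → ℝ} {D : ℝ} (hg : BM g D) (x y : ℝ) : HasDerivAt (fun x => CK (k0 δ 0) g (x, y)) (-CK (k1 δ 0) g (x, y)) x := by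
  obtain ⟨C, hC⟩ := k0_KF hδ hδ1
  obtain ⟨C', hC'⟩ := k1_KF hδ hδ1
  refine hasDerivAt_of_tendstoUniformly (l := atTop)
    (f := fun (n : ℕ) x => CK (k0 δ (1 / ((n : ℝ) + 1))) g (x, y))
    (f' := fun (n : ℕ) x => -CK (k1 δ (1 / ((n : ℝ) + 1))) g (x, y)) (g' := fun x => -CK (k1 δ 0) g (x, y)) ?_ ?_ ?_ x
  · exact unif_neg (unif_comp (hC'.unif (by norm_num) (by norm_num) hg) fun s => (s, y))
  · refine Eventually.of_forall fun n x => ?_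
    exact hd_CK_x (hC.sm _ (seq_pos n)) (hC.hcs _) (k0_fdx δ (seq_pos n)) hg x y
  · exact fun x => (hC.unif (by norm_num) (by norm_num) hg).tendsto_at (x, y)

theorem CK0_dxy {δ : ℝ} (hδ : 0 < δ) (hδ1 : δ ≤ 1) {g : ℝ × ℝ → ℝ} {D : ℝ} (hg : BM g D) (x y : ℝ) :
    HasDerivAt (fun y => x * CK (k0 δ 0) g (x, y)) (-CK (k2 δ 0) g (x, y)) y := by
  obtain ⟨C, hC⟩ := k0_KF hδ hδ1
  obtain ⟨C', hC'⟩ := k2_KF hδ hδ1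
  refine hasDerivAt_of_tendstoUniformly (l := atTop)
    (f := fun (n : ℕ) y => x * CK (k0 δ (1 / ((n : ℝ) + 1))) g (x, y))
    (f' := fun (n : ℕ) y => -CK (k2 δ (1 / ((n : ℝ) + 1))) g (x, y)) (g' := fun y => -CK (k2 δ 0) g (x, y)) ?_ ?_ ?_ y
  · exact unif_neg (unif_comp (hC'.unif (by norm_num) (by norm_num) hg) fun s => (x, s))
  · refine Eventually.of_forall fun n y => ?_
    have h1 := hd_CK_y (hC.sm _ (seq_pos n)) (hC.hcs _) (k0_fdt δ (seq_pos n)) hg x y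
    have h2 := CK_Y (hC.sm _ (seq_pos n)) (hC.hcs _) (k0_fdt δ (seq_pos n)) (k0_fdy δ (seq_pos n)) hg (x, y)
    refine (h1.const_mul x).congr_deriv ?_
    rw [← h2]; ring
  · exact fun y => ((hC.unif (by norm_num) (by norm_num) hg).tendsto_at (x, y)).const_mul x

theorem CK0_hx {δ : ℝ} (hδ : 0 < δ) (hδ1 : δ ≤ 1) {g : ℝ × ℝ → ℝ} {D : ℝ} (hg : BM g D) {gx : ℝ × ℝ → ℝ} {E : ℝ} (hgx : BM gx E)
    (hd : ∀ x y, HasDerivAt (fun x => g (x, y)) (gx (x, y)) x) (p : ℝ × ℝ) :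
    CK (k0 δ 0) gx p = -CK (k3 δ 0) g p := by
  obtain ⟨C, hC⟩ := k0_KF hδ hδ1
  obtain ⟨C', hC'⟩ := k3_KF hδ hδ1
  refine tendsto_nhds_unique ((hC.unif (by norm_num) (by norm_num) hgx).tendsto_at p) ?_
  have := ((hC'.unif (by norm_num) (by norm_num) hg).tendsto_at p).neg
  refine this.congr fun n => ?_
  exact (CK_hx (hC.sm _ (seq_pos n)) (hC.hcs _) (k0_fd3 δ (seq_pos n)) hg hgx hd p).symm
end

theorem int_zero_trd {f G : ℝ × ℝ × ℝ → ℝ} (hf : Integrable f) (hG : Integrable G)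
    (hd : ∀ a b t, HasDerivAt (fun t => f (a, b, t)) (G (a, b, t)) t) : ∫ z, G z = 0 := by
  have hf' : Integrable f (volume.prod (volume.prod volume)) := hf
  have hG' : Integrable G (volume.prod (volume.prod volume)) := hG
  have e : ∫ z, G z = ∫ z, G z ∂(volume.prod (volume.prod volume)) := rfl
  rw [e, integral_prod _ hG', ← integral_zero ℝ ℝ]
  apply integral_congr_ae
  filter_upwards [hf'.prod_right_ae, hG'.prod_right_ae] with a h1 h2
  rw [integral_prod _ h2, ← integral_zero ℝ ℝ]
  apply integral_congr_ae
  filter_upwards [h1.prod_right_ae, h2.prod_right_ae] with b h3 h4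
  exact integral_eq_zero_of_hasDerivAt_of_integrable (fun t => hd a b t) h4 h3

noncomputable def DK (L : ℝ × ℝ × ℝ → ℝ) (h : ℝ × ℝ → ℝ) (p : ℝ × ℝ) : ℝ :=
  ∫ q, (h (shf p q) - h (shf p (q.1, q.2.1, 0))) * L q

/-- Hölder in y -/
def HolY (h : ℝ × ℝ → ℝ) (γ L : ℝ) : Prop := ∀ x y τ, |h (x, y + τ) - h (x, y)| ≤ L * |τ| ^ γ

theorem HolY.shf {h : ℝ × ℝ → ℝ} {γ L : ℝ} (hh : HolY h γ L) (p : ℝ × ℝ) (q : ℝ × ℝ × ℝ) :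
    |h (shf p q) - h (shf p (q.1, q.2.1, 0))| ≤ L * |q.2.2| ^ γ := by
  have := hh (p.1 + q.1) (p.2 + (2 * p.1 + q.1) * q.2.1 / 2) q.2.2
  unfold _root_.shf
  convert this using 5 <;> ring

theorem cont0 (p : ℝ × ℝ) : Continuous fun q : ℝ × ℝ × ℝ => shf p (q.1, q.2.1, 0) := by
  unfold shf; fun_prop

namespace KF
variable {μ C : ℝ} {K Kt : ℝ → ℝ × ℝ × ℝ → ℝ}

theorem CK_eq_DK (h : KF μ C K Kt) {ε : ℝ} (hε : 0 < ε) {g : ℝ × ℝ → ℝ} {D : ℝ} (hg : BM g D) (p : ℝ × ℝ) :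
    CK (Kt ε) g p = DK (Kt ε) g p := by
  have it : Integrable (Kt ε) := (h.contt hε).integrable_of_hasCompactSupport (h.bst ε).hcs
  have i0 : Integrable (K ε) := (h.sm ε hε).continuous.integrable_of_hasCompactSupport (h.bs ε).hcs
  have hm : Measurable fun q : ℝ × ℝ × ℝ => g (shf p (q.1, q.2.1, 0)) := hg.1.comp (cont0 p).measurable
  have j0 : Integrable fun q : ℝ × ℝ × ℝ => g (shf p (q.1, q.2.1, 0)) * K ε q :=
    i0.bdd_mul (c := D) hm.aestronglyMeasurable (Eventually.of_forall fun q => hg.2 _)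
  have jt : Integrable fun q : ℝ × ℝ × ℝ => g (shf p (q.1, q.2.1, 0)) * Kt ε q :=
    it.bdd_mul (c := D) hm.aestronglyMeasurable (Eventually.of_forall fun q => hg.2 _)
  have key := int_zero_trd j0 jt (by
    intro a b t
    have h1 := hd_comp_curve (h.sm ε hε) (hasDerivAt_const t a) (hasDerivAt_const t b) (hasDerivAt_id t)
    rw [h.fd ε hε] at h1
    exact h1.const_mul (g (_root_.shf p (a, b, 0))))
  unfold CK DK
  have : ∫ q, (g (shf p q) - g (shf p (q.1, q.2.1, 0))) * Kt ε q
      = (∫ q, g (shf p q) * Kt ε q) - ∫ q, g (shf p (q.1, q.2.1, 0)) * Kt ε q := by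
    rw [← integral_sub (CK_int it hg p) jt]
    congr 1; funext q; ring
  rw [this, key, sub_zero]

theorem DK_int (h : KF μ C K Kt) {γ L : ℝ} (hγ : 0 ≤ γ) (h0 : γ ≤ μ + 1) (h1 : μ + 1 - γ ≤ 7/4)
    {g : ℝ × ℝ → ℝ} {D : ℝ} (hg : BM g D) (hh : HolY g γ L) {ε : ℝ} (hε : 0 ≤ ε) (p : ℝ × ℝ) :
    Integrable (fun q => (g (_root_.shf p q) - g (_root_.shf p (q.1, q.2.1, 0))) * Kt ε q) := by
  have hL : 0 ≤ L := by have := (abs_nonneg _).trans (hh 0 0 1); simpa using this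
  have hz : ∀ q : ℝ × ℝ × ℝ, (g (_root_.shf p q) - g (_root_.shf p (q.1, q.2.1, 0))) * Kt ε q
      = ((g (_root_.shf p q) - g (_root_.shf p (q.1, q.2.1, 0))) * (|q.2.2| ^ γ)⁻¹) * (|q.2.2| ^ γ * Kt ε q) := by
    intro q
    rcases eq_or_ne (|q.2.2| ^ γ) 0 with h3 | h3
    · have := hh.shf p q
      rw [h3, mul_zero] at this
      have : g (_root_.shf p q) - g (_root_.shf p (q.1, q.2.1, 0)) = 0 := abs_nonpos_iff.1 this
      rw [this]; simp
    · field_simp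
  rw [funext hz]
  refine ((h.convt hγ h0 h1).1 ε hε).bdd_mul (c := L) ?_ (Eventually.of_forall fun q => ?_)
  · refine Measurable.aestronglyMeasurable ?_
    have m1 := hg.1.comp (cont0 p).measurable
    have m2 := hg.1.comp (continuous_shf p).measurable
    have m3 : Measurable fun q : ℝ × ℝ × ℝ => (|q.2.2| ^ γ)⁻¹ := by fun_prop
    exact (m2.sub m1).mul m3
  · rw [norm_mul, Real.norm_eq_abs, Real.norm_eq_abs, abs_inv, abs_of_nonneg (by positivity : 0 ≤ |q.2.2| ^ γ)]
    rcases eq_or_ne (|q.2.2| ^ γ) 0 with h3 | h3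
    · rw [h3]; simpa using hL
    · have h4 : 0 < |q.2.2| ^ γ := lt_of_le_of_ne (by positivity) (Ne.symm h3)
      rw [← div_eq_mul_inv, div_le_iff₀ h4]; exact hh.shf p q

theorem DK_unif (h : KF μ C K Kt) {γ L : ℝ} (hγ : 0 ≤ γ) (h0 : γ ≤ μ + 1) (h1 : μ + 1 - γ ≤ 7/4)
    {g : ℝ × ℝ → ℝ} {D : ℝ} (hg : BM g D) (hh : HolY g γ L) :
    TendstoUniformly (fun (n : ℕ) p => DK (Kt (1 / ((n : ℝ) + 1))) g p) (DK (Kt 0) g) atTop := by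
  rw [Metric.tendstoUniformly_iff]
  intro ε hε
  have h2 := (h.convt hγ h0 h1).2.const_mul L
  rw [mul_zero] at h2
  filter_upwards [h2.eventually_lt_const hε] with n hn p
  rw [dist_comm, Real.dist_eq]
  refine lt_of_le_of_lt ?_ hn
  unfold DK
  rw [← integral_sub (h.DK_int hγ h0 h1 hg hh (seq_pos n).le p) (h.DK_int hγ h0 h1 hg hh le_rfl p),
    ← integral_const_mul]
  refine norm_integral_le_of_norm_le (G := ℝ) ((((h.convt hγ h0 h1).1 _ (seq_pos n).le).sub
    ((h.convt hγ h0 h1).1 _ le_rfl)).abs.const_mul L) (Eventually.of_forall fun q => ?_)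
  rw [← mul_sub, Real.norm_eq_abs, abs_mul]
  rw [← mul_sub, abs_mul, abs_of_nonneg (by positivity : 0 ≤ |q.2.2| ^ γ), ← mul_assoc]
  exact mul_le_mul_of_nonneg_right (hh.shf p q) (abs_nonneg _)

/-- L3 -/
theorem CK_dy (h : KF μ C K Kt) (hμ : 0 ≤ μ) (hμ1 : μ ≤ 7/4) {γ L : ℝ} (hγ : 0 ≤ γ) (h0 : γ ≤ μ + 1) (h1 : μ + 1 - γ ≤ 7/4)
    {g : ℝ × ℝ → ℝ} {D : ℝ} (hg : BM g D) (hh : HolY g γ L) (x y : ℝ) :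
    HasDerivAt (fun y => CK (K 0) g (x, y)) (-DK (Kt 0) g (x, y)) y := by
  refine hasDerivAt_of_tendstoUniformly (l := atTop)
    (f := fun (n : ℕ) y => CK (K (1 / ((n : ℝ) + 1))) g (x, y))
    (f' := fun (n : ℕ) y => -DK (Kt (1 / ((n : ℝ) + 1))) g (x, y)) (g' := fun y => -DK (Kt 0) g (x, y)) ?_ ?_ ?_ y
  · exact unif_neg (unif_comp (h.DK_unif hγ h0 h1 hg hh) fun s => (x, s))
  · refine Eventually.of_forall fun n y => ?_
    rw [← h.CK_eq_DK (seq_pos n) hg]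
    exact hd_CK_y (h.sm _ (seq_pos n)) (h.hcs _) (h.fd _ (seq_pos n)) hg x y
  · exact fun y => (h.unif hμ hμ1 hg).tendsto_at (x, y)

theorem DK_cont (h : KF μ C K Kt) {γ L : ℝ} (hγ : 0 ≤ γ) (h0 : γ ≤ μ + 1) (h1 : μ + 1 - γ ≤ 7/4)
    {g : ℝ × ℝ → ℝ} {D : ℝ} (hg : BM g D) (hh : HolY g γ L) : Continuous (DK (Kt 0) g) := by
  refine (h.DK_unif hγ h0 h1 hg hh).continuous (Frequently.of_forall fun n => ?_)
  have : (fun p => DK (Kt (1 / ((n : ℝ) + 1))) g p) = CK (Kt (1 / ((n : ℝ) + 1))) g :=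
    funext fun p => (h.CK_eq_DK (seq_pos n) hg p).symm
  rw [this]
  exact CK_cont_cc (h.contt (seq_pos n)) (h.bst _).hcs hg

theorem DK_bd (h : KF μ C K Kt) {γ L : ℝ} (hγ : 0 ≤ γ) (h0 : γ ≤ μ + 1) (h1 : μ + 1 - γ ≤ 7/4)
    {g : ℝ × ℝ → ℝ} (hh : HolY g γ L) (p : ℝ × ℝ) :
    |DK (Kt 0) g p| ≤ L * ∫ q : ℝ × ℝ × ℝ, |(|q.2.2| ^ γ * Kt 0 q)| := by
  unfold DK
  rw [← integral_const_mul]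
  refine norm_integral_le_of_norm_le (G := ℝ) (((h.convt hγ h0 h1).1 _ le_rfl).abs.const_mul L)
    (Eventually.of_forall fun q => ?_)
  rw [Real.norm_eq_abs, abs_mul, abs_mul (|q.2.2| ^ γ), abs_of_nonneg (by positivity : 0 ≤ |q.2.2| ^ γ), ← mul_assoc]
  exact mul_le_mul_of_nonneg_right (hh.shf p q) (abs_nonneg _)
end KF
end

section
open MeasureTheory Filter Topology Set

/-- averaged dominating function -/
noncomputable def gav (τ t : ℝ) : ℝ := ∫ s in Ioc (0:ℝ) 1, g1 (t - s * τ)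

theorem gav_prod (τ : ℝ) : Integrable (fun z : ℝ × ℝ => g1 (z.2 - z.1 * τ))
    ((volume.restrict (Ioc (0:ℝ) 1)).prod volume) := by
  have hmp : MeasurePreserving (fun z : ℝ × ℝ => (z.1, z.2 - z.1 * τ))
      ((volume.restrict (Ioc (0:ℝ) 1)).prod volume) ((volume.restrict (Ioc (0:ℝ) 1)).prod volume) := by
    refine (MeasurePreserving.id _).skew_product (g := fun s t => t - s * τ) (by fun_prop) ?_
    refine Eventually.of_forall fun s => ?_
    exact (measurePreserving_sub_right volume (s * τ)).map_eq
  have h1 : Integrable (fun z : ℝ × ℝ => g1 z.2) ((volume.restrict (Ioc (0:ℝ) 1)).prod volume) := by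
    have := Integrable.mul_prod (f := fun _ : ℝ => (1:ℝ)) (g := g1)
      (μ := volume.restrict (Ioc (0:ℝ) 1)) (ν := volume) (by simp) g1_int
    simpa using this
  exact hmp.integrable_comp_of_integrable h1

theorem gav_int (τ : ℝ) : Integrable (gav τ) := by
  have := (gav_prod τ).integral_prod_right
  exact this

theorem gav_eq (τ : ℝ) : ∫ t, gav τ t = ∫ t, g1 t := by
  unfold gav
  have h := integral_integral_swap (f := fun t s => g1 (t - s * τ)) (μ := volume)
    (ν := volume.restrict (Ioc (0:ℝ) 1)) (by
      have := (gav_prod τ).swap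
      exact this)
  rw [h]
  have : ∀ s : ℝ, ∫ t, g1 (t - s * τ) = ∫ t, g1 t := fun s => integral_sub_right_eq_self g1 _
  simp [this]

noncomputable def domav (τ : ℝ) (q : ℝ × ℝ × ℝ) : ℝ := g1 q.1 * (g1 q.2.1 * gav τ q.2.2)

theorem domav_int (τ : ℝ) : Integrable (domav τ) :=
  Integrable.mul_prod (f := g1) (g := fun z : ℝ × ℝ => g1 z.1 * gav τ z.2) g1_int (g1_int.mul_prod (gav_int τ))

theorem domav_eq (τ : ℝ) : ∫ q, domav τ q = ∫ q, dom q := by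
  have h1 : ∫ q, domav τ q = (∫ s, g1 s) * ∫ z : ℝ × ℝ, g1 z.1 * gav τ z.2 :=
    integral_prod_mul (μ := volume) (ν := volume) g1 (fun z : ℝ × ℝ => g1 z.1 * gav τ z.2)
  have h2 : ∫ q, dom q = (∫ s, g1 s) * ∫ z : ℝ × ℝ, g1 z.1 * g1 z.2 :=
    integral_prod_mul (μ := volume) (ν := volume) g1 (fun z : ℝ × ℝ => g1 z.1 * g1 z.2)
  have h3 : ∫ z : ℝ × ℝ, g1 z.1 * gav τ z.2 = (∫ s, g1 s) * ∫ t, gav τ t :=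
    integral_prod_mul (μ := volume) (ν := volume) g1 (gav τ)
  have h4 : ∫ z : ℝ × ℝ, g1 z.1 * g1 z.2 = (∫ s, g1 s) * ∫ t, g1 t :=
    integral_prod_mul (μ := volume) (ν := volume) g1 g1
  rw [h1, h2, h3, h4, gav_eq]

theorem gav_ii (τ t : ℝ) (hτ : τ ≠ 0) : IntervalIntegrable (fun s => g1 (t - s * τ)) volume 0 1 := by
  have h := (g1_int.comp_sub_left t).comp_mul_right' hτ
  exact h.intervalIntegrable

theorem mp_t (τ : ℝ) : MeasurePreserving (fun q : ℝ × ℝ × ℝ => (q.1, q.2.1, q.2.2 - τ)) := by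
  have h1 : MeasurePreserving (fun z : ℝ × ℝ => (z.1, z.2 - τ)) :=
    (MeasurePreserving.id volume).prod (measurePreserving_sub_right volume τ)
  exact (MeasurePreserving.id volume).prod h1

namespace KF
variable {μ C : ℝ} {K Kt : ℝ → ℝ × ℝ × ℝ → ℝ}

theorem bdA (h : KF μ C K Kt) (h0 : 7/8 ≤ μ) (h1 : μ ≤ 7/4) {τ ε : ℝ} {q : ℝ × ℝ × ℝ}
    (hq : q.1 ≠ 0 ∧ q.2.1 ≠ 0 ∧ q.2.2 ≠ 0) (hτ : |q.1| * |q.2.1| ≤ |τ|) :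
    |K ε q| ≤ C * |τ| ^ (7/4 - μ) * dom q := by
  have hC := h.Cnn
  by_cases hb : 1 < |q.1| ∨ 1 < |q.2.1| ∨ 1 < |q.2.2|
  · rw [h.bs ε q hb, abs_zero]
    exact mul_nonneg (by positivity) (dom_nonneg q)
  · push Not at hb
    have hab : 0 < |q.1| * |q.2.1| := mul_pos (abs_pos.2 hq.1) (abs_pos.2 hq.2.1)
    have hd : dom q = (|q.1| * |q.2.1|) ^ (-(7/8) : ℝ) * |q.2.2| ^ (-(7/8) : ℝ) := by
      unfold dom
      rw [g1_of hb.1, g1_of hb.2.1, g1_of hb.2.2, Real.mul_rpow (abs_nonneg _) (abs_nonneg _)]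
      ring
    have h2 := h.bd ε q (w0_pos_t hq.2.2)
    have h3 := w_rpow_split hq.1 hq.2.1 hq.2.2 h0
    have e : (|q.1| * |q.2.1|) ^ (-(μ - 7/8)) = (|q.1| * |q.2.1|) ^ (7/4 - μ) * (|q.1| * |q.2.1|) ^ (-(7/8) : ℝ) := by
      rw [← Real.rpow_add hab]; congr 1; ring
    have h4 : (|q.1| * |q.2.1|) ^ (7/4 - μ) ≤ |τ| ^ (7/4 - μ) := Real.rpow_le_rpow hab.le hτ (by linarith)
    rw [hd]
    refine h2.trans ?_
    rw [mul_assoc]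
    refine mul_le_mul_of_nonneg_left (h3.trans ?_) hC
    rw [e, mul_assoc]
    exact mul_le_mul_of_nonneg_right h4 (by positivity)

theorem bdB (h : KF μ C K Kt) (h0 : 3/4 ≤ μ) {τ ε : ℝ} (hτ0 : τ ≠ 0) {q : ℝ × ℝ × ℝ}
    (hq : q.1 ≠ 0 ∧ q.2.1 ≠ 0 ∧ q.2.2 ≠ 0) (hτ : |τ| ≤ |q.1| * |q.2.1|) :
    |Kt ε q| ≤ C * |τ| ^ (3/4 - μ) * dom q := by
  have hC := h.Cnn
  by_cases hb : 1 < |q.1| ∨ 1 < |q.2.1| ∨ 1 < |q.2.2|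
  · rw [h.bst ε q hb, abs_zero]
    exact mul_nonneg (by positivity) (dom_nonneg q)
  · push Not at hb
    have hab : 0 < |q.1| * |q.2.1| := mul_pos (abs_pos.2 hq.1) (abs_pos.2 hq.2.1)
    have hd : dom q = (|q.1| * |q.2.1|) ^ (-(7/8) : ℝ) * |q.2.2| ^ (-(7/8) : ℝ) := by
      unfold dom
      rw [g1_of hb.1, g1_of hb.2.1, g1_of hb.2.2, Real.mul_rpow (abs_nonneg _) (abs_nonneg _)]
      ring
    have h2 := h.bdt ε q (w0_pos_t hq.2.2)
    have h3 := w_rpow_split hq.1 hq.2.1 hq.2.2 (s := μ + 1) (by linarith)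
    rw [show -(μ + 1) = -μ - 1 by ring] at h3
    have e : (|q.1| * |q.2.1|) ^ (-(μ + 1 - 7/8)) = (|q.1| * |q.2.1|) ^ (3/4 - μ) * (|q.1| * |q.2.1|) ^ (-(7/8) : ℝ) := by
      rw [← Real.rpow_add hab]; congr 1; ring
    have h4 : (|q.1| * |q.2.1|) ^ (3/4 - μ) ≤ |τ| ^ (3/4 - μ) :=
      Real.rpow_le_rpow_of_nonpos (abs_pos.2 hτ0) hτ (by linarith)
    rw [hd]
    refine h2.trans ?_
    rw [mul_assoc]
    refine mul_le_mul_of_nonneg_left (h3.trans ?_) hC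
    rw [e, mul_assoc]
    exact mul_le_mul_of_nonneg_right h4 (by positivity)

theorem gav_nonneg (τ t : ℝ) : 0 ≤ gav τ t := integral_nonneg fun _ => g1_nonneg _

theorem diff_bd (h : KF μ C K Kt) (h0 : 7/8 ≤ μ) (h1 : μ ≤ 7/4) {τ ε : ℝ} (hτ0 : τ ≠ 0) (hε : 0 < ε)
    {q : ℝ × ℝ × ℝ} (hq : q.1 ≠ 0 ∧ q.2.1 ≠ 0 ∧ q.2.2 ≠ 0) (hq' : q.2.2 - τ ≠ 0) :
    |K ε (q.1, q.2.1, q.2.2 - τ) - K ε q| ≤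
      C * |τ| ^ (7/4 - μ) * (dom q + dom (q.1, q.2.1, q.2.2 - τ) + domav τ q) := by
  have hC := h.Cnn
  have hM : 0 ≤ C * |τ| ^ (7/4 - μ) := by positivity
  have n1 := dom_nonneg q
  have n2 := dom_nonneg (q.1, q.2.1, q.2.2 - τ)
  have n3 : 0 ≤ domav τ q := mul_nonneg (g1_nonneg _) (mul_nonneg (g1_nonneg _) (gav_nonneg _ _))
  by_cases hc : |q.1| * |q.2.1| ≤ |τ|
  · have a1 := h.bdA h0 h1 (ε := ε) hq hc
    have a2 := h.bdA h0 h1 (ε := ε) (q := (q.1, q.2.1, q.2.2 - τ)) ⟨hq.1, hq.2.1, hq'⟩ hc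
    refine (abs_sub _ _).trans ?_
    nlinarith
  · push Not at hc
    have hd : ∀ s ∈ uIcc (0:ℝ) 1, HasDerivAt (fun s => K ε (q.1, q.2.1, q.2.2 - s * τ))
        (Kt ε (q.1, q.2.1, q.2.2 - s * τ) * (-τ)) s := by
      intro s _
      have h3 := hd_comp_curve (h.sm ε hε) (hasDerivAt_const (q.2.2 - s * τ) q.1)
        (hasDerivAt_const (q.2.2 - s * τ) q.2.1) (hasDerivAt_id (q.2.2 - s * τ))
      rw [h.fd ε hε] at h3
      have h4 : HasDerivAt (fun s : ℝ => q.2.2 - s * τ) (-τ) s := by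
        have := ((hasDerivAt_id s).mul_const τ).const_sub q.2.2
        simpa using this
      exact HasDerivAt.comp s h3 h4
    have hcont : Continuous fun s : ℝ => Kt ε (q.1, q.2.1, q.2.2 - s * τ) * (-τ) := by
      have := h.contt hε
      fun_prop
    have ftc := intervalIntegral.integral_eq_sub_of_hasDerivAt hd (hcont.intervalIntegrable 0 1)
    simp only [one_mul, zero_mul, sub_zero] at ftc
    rw [← ftc]
    have hae : ∀ᵐ s : ℝ, q.2.2 - s * τ ≠ 0 := by
      have : ∀ᵐ s : ℝ, s ≠ q.2.2 / τ := by simp [ae_iff]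
      filter_upwards [this] with s hs h5
      apply hs; rw [eq_div_iff hτ0]; linarith
    have key : ‖∫ s in (0:ℝ)..1, Kt ε (q.1, q.2.1, q.2.2 - s * τ) * (-τ)‖ ≤
        ∫ s in (0:ℝ)..1, C * |τ| ^ (7/4 - μ) * (g1 q.1 * (g1 q.2.1 * g1 (q.2.2 - s * τ))) := by
      refine intervalIntegral.norm_integral_le_of_norm_le zero_le_one ?_ ?_
      · filter_upwards [hae] with s hs _
        have := h.bdB (by linarith) hτ0 (ε := ε) (q := (q.1, q.2.1, q.2.2 - s * τ)) ⟨hq.1, hq.2.1, hs⟩ hc.le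
        rw [norm_mul, norm_neg, Real.norm_eq_abs, Real.norm_eq_abs]
        have e : |τ| ^ (7/4 - μ) = |τ| ^ (3/4 - μ) * |τ| := by
          rw [← Real.rpow_add_one (abs_pos.2 hτ0).ne']; congr 1; ring
        rw [e]
        unfold dom at this
        simp only at this
        have h6 := mul_le_mul_of_nonneg_right this (abs_nonneg τ)
        refine h6.trans (le_of_eq ?_); ring
      · exact (((gav_ii τ q.2.2 hτ0).const_mul _).const_mul _).const_mul _
    have e2 : ∫ s in (0:ℝ)..1, C * |τ| ^ (7/4 - μ) * (g1 q.1 * (g1 q.2.1 * g1 (q.2.2 - s * τ)))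
        = C * |τ| ^ (7/4 - μ) * domav τ q := by
      rw [intervalIntegral.integral_const_mul, intervalIntegral.integral_const_mul,
        intervalIntegral.integral_const_mul, intervalIntegral.integral_of_le zero_le_one]
      rfl
    rw [e2] at key
    refine key.trans ?_
    nlinarith

/-- L2 -/
theorem holder (h : KF μ C K Kt) (h0 : 7/8 ≤ μ) (h1 : μ < 7/4) {g : ℝ × ℝ → ℝ} {D : ℝ} (hg : BM g D) :
    HolY (CK (K 0) g) (7/4 - μ) (D * (3 * C * ∫ q, dom q)) := by
  intro x y τ
  rcases eq_or_ne τ 0 with hτ0 | hτ0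
  · subst hτ0; simp [Real.zero_rpow (show (7/4 - μ) ≠ 0 by linarith)]
  have hu := h.unif (by linarith) h1.le hg
  have l1 := ((hu.tendsto_at (x, y + τ)).sub (hu.tendsto_at (x, y))).abs
  refine le_of_tendsto l1 (Eventually.of_forall fun n => ?_)
  set ε := 1 / ((n:ℝ) + 1) with hεd
  have hε : 0 < ε := seq_pos n
  have ik : Integrable (K ε) := (h.conv (by linarith) h1.le).1 ε hε.le
  have ik' : Integrable (fun q : ℝ × ℝ × ℝ => K ε (q.1, q.2.1, q.2.2 - τ)) :=
    (mp_t τ).integrable_comp_of_integrable ik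
  have e1 : CK (K ε) g (x, y + τ) = CK (fun q : ℝ × ℝ × ℝ => K ε (q.1, q.2.1, q.2.2 - τ)) g (x, y) := by
    unfold CK
    have hE : MeasurableEmbedding (fun q : ℝ × ℝ × ℝ => (q.1, q.2.1, q.2.2 - τ)) := by
      have : (fun q : ℝ × ℝ × ℝ => (q.1, q.2.1, q.2.2 - τ)) =
        (MeasurableEquiv.prodCongr (MeasurableEquiv.refl ℝ) (MeasurableEquiv.prodCongr (MeasurableEquiv.refl ℝ)
          (MeasurableEquiv.subRight τ))) := by
        funext q; rfl
      rw [this]; exact MeasurableEquiv.measurableEmbedding _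
    rw [← (mp_t τ).integral_comp hE]
    congr 1; funext q; congr 2
    unfold _root_.shf; ext <;> simp
  rw [e1, ← CK_sub_K ik' ik hg]
  refine (CK_le (ik'.sub ik) hg _).trans ?_
  have hD := hg.nonneg
  rw [mul_assoc]
  refine mul_le_mul_of_nonneg_left ?_ hD
  have j2 : Integrable (fun q : ℝ × ℝ × ℝ => dom (q.1, q.2.1, q.2.2 - τ)) :=
    (mp_t τ).integrable_comp_of_integrable dom_int
  have e2 : ∫ q : ℝ × ℝ × ℝ, dom (q.1, q.2.1, q.2.2 - τ) = ∫ q, dom q := by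
    have hE : MeasurableEmbedding (fun q : ℝ × ℝ × ℝ => (q.1, q.2.1, q.2.2 - τ)) := by
      have : (fun q : ℝ × ℝ × ℝ => (q.1, q.2.1, q.2.2 - τ)) =
        (MeasurableEquiv.prodCongr (MeasurableEquiv.refl ℝ) (MeasurableEquiv.prodCongr (MeasurableEquiv.refl ℝ)
          (MeasurableEquiv.subRight τ))) := by
        funext q; rfl
      rw [this]; exact MeasurableEquiv.measurableEmbedding _
    exact (mp_t τ).integral_comp hE dom
  have hae : ∀ᵐ q : ℝ × ℝ × ℝ, q.2.2 - τ ≠ 0 := by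
    filter_upwards [(mp_t τ).quasiMeasurePreserving.ae ae_ne1] with q hq
    exact hq.2.2
  have bound : ∫ q, |((fun q : ℝ × ℝ × ℝ => K ε (q.1, q.2.1, q.2.2 - τ)) - K ε) q| ≤
      ∫ q, C * |τ| ^ (7/4 - μ) * (dom q + dom (q.1, q.2.1, q.2.2 - τ) + domav τ q) := by
    apply integral_mono_ae (ik'.sub ik).abs (((dom_int.add j2).add (domav_int τ)).const_mul _)
    filter_upwards [ae_ne1, hae] with q h3 h4
    exact h.diff_bd h0 h1.le hτ0 hε h3 h4
  refine bound.trans (le_of_eq ?_)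
  have s1 : ∫ q : ℝ × ℝ × ℝ, (dom q + dom (q.1, q.2.1, q.2.2 - τ) + domav τ q) =
     ((∫ q, dom q) + ∫ q : ℝ × ℝ × ℝ, dom (q.1, q.2.1, q.2.2 - τ)) + ∫ q, domav τ q := by
    rw [← integral_add dom_int j2]
    exact integral_add (dom_int.add j2) (domav_int τ)
  rw [integral_const_mul, s1, e2, domav_eq]; ring
end KF

theorem CK_hol {K : ℝ × ℝ × ℝ → ℝ} (hK : Integrable K) {g : ℝ × ℝ → ℝ} {D γ L : ℝ} (hg : BM g D)
    (hh : HolY g γ L) : HolY (CK K g) γ (L * ∫ q, |K q|) := by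
  intro x y τ
  have hg' : BM (fun p : ℝ × ℝ => g (p.1, p.2 + τ)) D := ⟨hg.1.comp (by fun_prop), fun p => hg.2 _⟩
  have e : CK K g (x, y + τ) = CK K (fun p : ℝ × ℝ => g (p.1, p.2 + τ)) (x, y) := by
    unfold CK; congr 1; funext q; congr 2; unfold shf; ext <;> simp; ring
  have hd : BM (fun p : ℝ × ℝ => g (p.1, p.2 + τ) - g p) (L * |τ| ^ γ) :=
    ⟨hg'.1.sub hg.1, fun p => hh p.1 p.2 τ⟩
  have e2 := CK_sub_h hK hg' hg (x, y)
  rw [e, ← e2]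
  refine (CK_le hK hd _).trans (le_of_eq ?_); ring
end

section
open MeasureTheory Filter Topology Set

noncomputable def JJ (δ s : ℝ) : ℝ := 16 * s * H2 δ s + 24 * H1 δ s
noncomputable def ke (δ ε : ℝ) (q : ℝ × ℝ × ℝ) : ℝ := (q.1 ^ 2 + q.2.1 ^ 2) * JJ δ (NN ε q)
noncomputable def km (δ ε : ℝ) (q : ℝ × ℝ × ℝ) : ℝ := 8 * ε ^ 2 * H1 δ (NN ε q)

/-- kernel of the b-primitive -/
noncomputable def kG (δ ε x : ℝ) (q : ℝ × ℝ × ℝ) : ℝ := H1 δ (NN ε q) *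
  (4 * q.2.1 * (q.1 ^ 2 + q.2.1 ^ 2 + ε ^ 2) + 16 * q.1 * q.2.2 + 32 * (x + q.1) * q.2.2)
noncomputable def kGb (δ ε x : ℝ) (q : ℝ × ℝ × ℝ) : ℝ := H2 δ (NN ε q) *
  ((4 * q.2.1 * (q.1 ^ 2 + q.2.1 ^ 2 + ε ^ 2) + 16 * q.1 * q.2.2) ^ 2 - 1024 * (x + q.1) ^ 2 * q.2.2 ^ 2)
  + H1 δ (NN ε q) * (4 * (q.1 ^ 2 + q.2.1 ^ 2 + ε ^ 2) + 8 * (q.1 ^ 2 + q.2.1 ^ 2) - 32 * (x + q.1) ^ 2)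

theorem hN_curve (ε : ℝ) {c1 c2 c3 : ℝ → ℝ} {v1 v2 v3 s : ℝ}
    (h1 : HasDerivAt c1 v1 s) (h2 : HasDerivAt c2 v2 s) (h3 : HasDerivAt c3 v3 s) :
    HasDerivAt (fun s => NN ε (c1 s, c2 s, c3 s))
      (4 * (c1 s ^ 2 + c2 s ^ 2 + ε ^ 2) * (c1 s * v1 + c2 s * v2) + 32 * c3 s * v3) s := by
  unfold NN
  refine (((((h1.pow 2).add (h2.pow 2)).add_const (ε ^ 2)).pow 2).add ((h3.pow 2).const_mul 16)).congr_deriv ?_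
  simp; ring

theorem hH_curve {h h' : ℝ → ℝ} (hh : ∀ {s : ℝ}, 0 < s → HasDerivAt h (h' s) s) {ε : ℝ} (hε : 0 < ε) {c1 c2 c3 : ℝ → ℝ} {v1 v2 v3 s : ℝ}
    (h1 : HasDerivAt c1 v1 s) (h2 : HasDerivAt c2 v2 s) (h3 : HasDerivAt c3 v3 s) :
    HasDerivAt (fun s => h (NN ε (c1 s, c2 s, c3 s)))
      (h' (NN ε (c1 s, c2 s, c3 s)) * (4 * (c1 s ^ 2 + c2 s ^ 2 + ε ^ 2) * (c1 s * v1 + c2 s * v2) + 32 * c3 s * v3)) s :=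
  HasDerivAt.comp (h₂ := h) s (hh (NN_pos hε _)) (hN_curve ε h1 h2 h3)

theorem BS_of_H {h : ℝ → ℝ} {δ : ℝ} (hδ1 : δ ≤ 1) (hz : ∀ s, δ < s → h s = 0) (ε : ℝ) :
    BS 1 fun q => h (NN ε q) := fun q hq => hz _ (lt_of_le_of_lt hδ1 (NN_out hq))

theorem hcs_slice {K : ℝ × ℝ × ℝ → ℝ} (h : BS 1 K) (p : ℝ × ℝ) (b : ℝ) :
    HasCompactSupport fun p' : ℝ × ℝ => K (Psi p (b, p')) := by
  obtain ⟨R, hR⟩ := Psi_box h p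
  refine HasCompactSupport.intro (isCompact_closedBall 0 R) fun p' hp => hR p (by simp) _ ?_
  intro hc
  apply hp
  rw [mem_closedBall_zero_iff] at *
  exact (le_max_right _ _).trans hc

theorem lap_slice (δ : ℝ) {ε : ℝ} (hε : 0 < ε) (p : ℝ × ℝ) (b : ℝ) (p' : ℝ × ℝ) :
    grushinLap (fun p' : ℝ × ℝ => k0 δ ε (Psi p (b, p'))) p' =
      ke δ ε (Psi p (b, p')) + km δ ε (Psi p (b, p')) - kGb δ ε p.1 (Psi p (b, p')) := by
  obtain ⟨x0, y0⟩ := p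
  obtain ⟨x', y'⟩ := p'
  have ca : ∀ x : ℝ, HasDerivAt (fun x : ℝ => x - x0) 1 x := fun x => (hasDerivAt_id x).sub_const x0
  have cb : ∀ x : ℝ, HasDerivAt (fun _ : ℝ => b) 0 x := fun x => hasDerivAt_const x b
  have ct : ∀ x : ℝ, HasDerivAt (fun x : ℝ => y' - y0 - (x0 + x) * b / 2) (-b / 2) x := fun x => by
    refine (((((hasDerivAt_id x).const_add x0).mul_const b).div_const 2).const_sub (y' - y0)).congr_deriv ?_
    ring
  have d1 : deriv (fun x => k0 δ ε (Psi (x0, y0) (b, (x, y')))) = fun x =>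
      H1 δ (NN ε (x - x0, b, y' - y0 - (x0 + x) * b / 2)) *
      (4 * ((x - x0) ^ 2 + b ^ 2 + ε ^ 2) * (x - x0) - 16 * b * (y' - y0 - (x0 + x) * b / 2)) := by
    funext x
    have := hH_curve (fun {s} hs => hd_H0 δ hs) hε (ca x) (cb x) (ct x)
    refine (this.congr_deriv ?_).deriv
    ring
  have c1 : ∀ y : ℝ, HasDerivAt (fun _ : ℝ => x' - x0) 0 y := fun x => hasDerivAt_const x _
  have c3 : ∀ y : ℝ, HasDerivAt (fun y : ℝ => y - y0 - (x0 + x') * b / 2) 1 y := fun y =>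
    ((hasDerivAt_id y).sub_const y0).sub_const _
  have d2 : deriv (fun y => k0 δ ε (Psi (x0, y0) (b, (x', y)))) = fun y =>
      H1 δ (NN ε (x' - x0, b, y - y0 - (x0 + x') * b / 2)) * (32 * (y - y0 - (x0 + x') * b / 2)) := by
    funext y
    have := hH_curve (fun {s} hs => hd_H0 δ hs) hε (c1 y) (cb y) (c3 y)
    refine (this.congr_deriv ?_).deriv
    ring
  unfold grushinLap pXX pYY
  simp only
  rw [d1, d2]
  have e1 := ((hH_curve (fun {s} hs => hd_H1 δ hs) hε (ca x') (cb x') (ct x')).mul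
    ((((((ca x').pow 2).add_const (b ^ 2)).add_const (ε ^ 2)).const_mul 4).mul (ca x') |>.sub ((ct x').const_mul (16 * b)))).deriv
  have e2 := ((hH_curve (fun {s} hs => hd_H1 δ hs) hε (c1 y') (cb y') (c3 y')).mul ((c3 y').const_mul 32)).deriv
  have e1' : deriv (fun x => H1 δ (NN ε (x - x0, b, y' - y0 - (x0 + x) * b / 2)) *
      (4 * ((x - x0) ^ 2 + b ^ 2 + ε ^ 2) * (x - x0) - 16 * b * (y' - y0 - (x0 + x) * b / 2))) x' = _ := e1
  have e2' : deriv (fun y => H1 δ (NN ε (x' - x0, b, y - y0 - (x0 + x') * b / 2)) * (32 * (y - y0 - (x0 + x') * b / 2))) y' = _ := e2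
  rw [e1', e2']
  unfold ke km kGb JJ Psi
  simp only
  have hn : NN ε (x' - x0, b, y' - y0 - (x0 + x') * b / 2) =
    ((x' - x0) ^ 2 + b ^ 2 + ε ^ 2) ^ 2 + 16 * (y' - y0 - (x0 + x') * b / 2) ^ 2 := rfl
  generalize H1 δ (NN ε (x' - x0, b, y' - y0 - (x0 + x') * b / 2)) = h1
  generalize H2 δ (NN ε (x' - x0, b, y' - y0 - (x0 + x') * b / 2)) = h2
  rw [hn]
  simp
  ring

theorem kG_db (δ : ℝ) {ε : ℝ} (hε : 0 < ε) (p : ℝ × ℝ) (b : ℝ) (p' : ℝ × ℝ) :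
    HasDerivAt (fun b => kG δ ε p.1 (Psi p (b, p'))) (kGb δ ε p.1 (Psi p (b, p'))) b := by
  obtain ⟨x0, y0⟩ := p
  obtain ⟨x', y'⟩ := p'
  have ca : HasDerivAt (fun _ : ℝ => x' - x0) 0 b := hasDerivAt_const b _
  have cb : HasDerivAt (fun b : ℝ => b) 1 b := hasDerivAt_id b
  have ct : HasDerivAt (fun b : ℝ => y' - y0 - (x0 + x') * b / 2) (-(x0 + x') / 2) b := by
    refine ((((hasDerivAt_id b).const_mul (x0 + x')).div_const 2).const_sub (y' - y0)).congr_deriv ?_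
    ring
  unfold kG kGb Psi
  simp only
  refine ((hH_curve (fun {s} hs => hd_H1 δ hs) hε ca cb ct).mul
    ((((cb.const_mul 4).mul (((cb.pow 2).const_add ((x' - x0) ^ 2)).add_const (ε ^ 2))).add
      (ct.const_mul (16 * (x' - x0)))).add (ct.const_mul (32 * (x0 + (x' - x0)))))).congr_deriv ?_
  have hn : NN ε (x' - x0, b, y' - y0 - (x0 + x') * b / 2) =
    ((x' - x0) ^ 2 + b ^ 2 + ε ^ 2) ^ 2 + 16 * (y' - y0 - (x0 + x') * b / 2) ^ 2 := rfl
  generalize H1 δ (NN ε (x' - x0, b, y' - y0 - (x0 + x') * b / 2)) = h1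
  generalize H2 δ (NN ε (x' - x0, b, y' - y0 - (x0 + x') * b / 2)) = h2
  simp
  ring

section
variable {δ : ℝ}

theorem JJ_zero (hδ : 0 < δ) {s : ℝ} (hs : δ < s) : JJ δ s = 0 := by
  unfold JJ; rw [H1_zero hδ hs, H2_zero hδ hs]; ring

theorem cd_JJ (δ : ℝ) : ContDiffOn ℝ (⊤ : ℕ∞) (JJ δ) (Ioi 0) := by
  unfold JJ
  exact ((contDiff_const.mul contDiff_id).contDiffOn.mul (cd_H2 δ)).add (contDiffOn_const.mul (cd_H1 δ))

theorem JJ_bound (hδ : 0 < δ) : ∃ C, 0 < C ∧ ∀ s, 0 < s → |JJ δ s| ≤ C := by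
  obtain ⟨C, hC, h⟩ := H_bound_aux hδ (JJ δ) (cd_JJ δ).continuousOn 0 0 (fun _ h => JJ_zero hδ h)
    (fun s h0 h => by rw [zero_mul]; exact J_small hδ h0 h)
  exact ⟨C, hC, fun s hs => by simpa using h s hs⟩

theorem ke_cont {ε : ℝ} (hε : 0 < ε) : Continuous (ke δ ε) := by
  unfold ke
  exact (by fun_prop : Continuous fun q : ℝ × ℝ × ℝ => q.1 ^ 2 + q.2.1 ^ 2).mul (cd_comp (cd_JJ δ) hε).continuous
theorem km_cont {ε : ℝ} (hε : 0 < ε) : Continuous (km δ ε) := by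
  unfold km
  exact continuous_const.mul (cd_comp (cd_H1 δ) hε).continuous
theorem kG_cont {ε : ℝ} (hε : 0 < ε) (x : ℝ) : Continuous (kG δ ε x) := by
  unfold kG
  exact (cd_comp (cd_H1 δ) hε).continuous.mul (by fun_prop)
theorem kGb_cont {ε : ℝ} (hε : 0 < ε) (x : ℝ) : Continuous (kGb δ ε x) := by
  unfold kGb
  exact ((cd_comp (cd_H2 δ) hε).continuous.mul (by fun_prop)).add ((cd_comp (cd_H1 δ) hε).continuous.mul (by fun_prop))

theorem ke_BS (hδ : 0 < δ) (hδ1 : δ ≤ 1) (ε : ℝ) : BS 1 (ke δ ε) := fun q hq => by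
  unfold ke; rw [JJ_zero hδ (lt_of_le_of_lt hδ1 (NN_out hq)), mul_zero]
theorem km_BS (hδ : 0 < δ) (hδ1 : δ ≤ 1) (ε : ℝ) : BS 1 (km δ ε) := fun q hq => by
  unfold km; rw [H1_zero hδ (lt_of_le_of_lt hδ1 (NN_out hq)), mul_zero]
theorem kG_BS (hδ : 0 < δ) (hδ1 : δ ≤ 1) (ε x : ℝ) : BS 1 (kG δ ε x) := fun q hq => by
  unfold kG; rw [H1_zero hδ (lt_of_le_of_lt hδ1 (NN_out hq)), zero_mul]
theorem kGb_BS (hδ : 0 < δ) (hδ1 : δ ≤ 1) (ε x : ℝ) : BS 1 (kGb δ ε x) := fun q hq => by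
  unfold kGb
  rw [H1_zero hδ (lt_of_le_of_lt hδ1 (NN_out hq)), H2_zero hδ (lt_of_le_of_lt hδ1 (NN_out hq))]; ring
theorem k0_BS (hδ : 0 < δ) (hδ1 : δ ≤ 1) (ε : ℝ) : BS 1 (k0 δ ε) := fun q hq => by
  unfold k0; rw [H0_zero hδ (lt_of_le_of_lt hδ1 (NN_out hq))]

theorem int_of_BS {K : ℝ × ℝ × ℝ → ℝ} (hc : Continuous K) (hb : BS 1 K) : Integrable K :=
  hc.integrable_of_hasCompactSupport hb.hcs

theorem rep_eps (hδ : 0 < δ) (hδ1 : δ ≤ 1) {ε : ℝ} (hε : 0 < ε) {u F : ℝ × ℝ → ℝ} {D E : ℝ}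
    (hu : BM u D) (hF : BM F E) (hs : DSol u F) (p : ℝ × ℝ) :
    CK (ke δ ε) u p + CK (km δ ε) u p = CK (k0 δ ε) F p := by
  have ie := int_of_BS (ke_cont (δ := δ) hε) (ke_BS hδ hδ1 ε)
  have im := int_of_BS (km_cont (δ := δ) hε) (km_BS hδ hδ1 ε)
  have iG := int_of_BS (kG_cont (δ := δ) hε p.1) (kG_BS hδ hδ1 ε p.1)
  have iGb := int_of_BS (kGb_cont (δ := δ) hε p.1) (kGb_BS hδ hδ1 ε p.1)
  have i0 := int_of_BS (k0_sm δ hε).continuous (k0_BS hδ hδ1 ε)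
  have z : CK (kGb δ ε p.1) u p = 0 := by
    rw [CK_eq]
    refine int_zero_fst (f := fun z => u z.2 * kG δ ε p.1 (Psi p z)) (CK_int' iG hu p) (CK_int' iGb hu p) ?_
    intro b w
    exact (kG_db δ hε p b w).const_mul (u w)
  have e1 : CK (fun q => ke δ ε q + km δ ε q - kGb δ ε p.1 q) u p = CK (ke δ ε) u p + CK (km δ ε) u p := by
    have e0 := CK_sub_K (K := fun q => ke δ ε q + km δ ε q) (ie.add im) iGb hu p
    rw [e0, z, sub_zero]
    unfold CK
    rw [← integral_add (CK_int ie hu p) (CK_int im hu p)]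
    congr 1; funext q; ring
  rw [← e1, CK_eq, CK_eq]
  have j1 := CK_int' ((ie.add im).sub iGb) hu p
  have j2 := CK_int' i0 hF p
  have e2 : ∫ z : ℝ × ℝ × ℝ, u z.2 * (ke δ ε (Psi p z) + km δ ε (Psi p z) - kGb δ ε p.1 (Psi p z)) =
      ∫ b : ℝ, ∫ w : ℝ × ℝ, u w * (ke δ ε (Psi p (b, w)) + km δ ε (Psi p (b, w)) - kGb δ ε p.1 (Psi p (b, w))) :=
    integral_prod _ j1
  have e3 : ∫ z : ℝ × ℝ × ℝ, F z.2 * k0 δ ε (Psi p z) = ∫ b : ℝ, ∫ w : ℝ × ℝ, F w * k0 δ ε (Psi p (b, w)) :=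
    integral_prod _ j2
  rw [e2, e3]
  congr 1; funext b
  have cd : ContDiff ℝ 2 (fun w : ℝ × ℝ => k0 δ ε (Psi p (b, w))) := by
    have h1 : ContDiff ℝ 2 (fun w : ℝ × ℝ => Psi p (b, w)) := by unfold Psi; fun_prop
    exact (contDiff_infty.1 (k0_sm δ hε) 2).comp h1
  have := hs _ cd (hcs_slice (k0_BS hδ hδ1 ε) p b)
  rw [← this]
  congr 1; funext w
  rw [lap_slice δ hε]
end
end

section
open MeasureTheory Filter Topology Set

theorem dsol_one : DSol (fun _ => 1) (fun _ => 0) := by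
  have := dsol_of_contDiff (u := fun _ : ℝ × ℝ => (1:ℝ)) contDiff_const
  have e : grushinLap (fun _ : ℝ × ℝ => (1:ℝ)) = fun _ => 0 := by
    funext p; unfold grushinLap pXX pYY; simp
  rwa [e] at this

theorem BM_const (c : ℝ) : BM (fun _ => c) |c| := ⟨measurable_const, fun _ => le_rfl⟩

section
variable {δ : ℝ}

theorem m_mass (hδ : 0 < δ) (hδ1 : δ ≤ 1) {ε : ℝ} (hε : 0 < ε) : ∫ q, km δ ε q = -∫ q, ke δ ε q := by
  have := rep_eps hδ hδ1 hε (BM_const 1) (BM_const 0) dsol_one (0, 0)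
  unfold CK at this
  simp only [one_mul, zero_mul, integral_zero] at this
  linarith

noncomputable def bx : ℝ × ℝ × ℝ → ℝ := (Metric.closedBall (0 : ℝ × ℝ × ℝ) 1).indicator fun _ => 1

theorem bx_nn (q : ℝ × ℝ × ℝ) : 0 ≤ bx q := indicator_nonneg (fun _ _ => zero_le_one) q
theorem bx_int : Integrable bx := by
  unfold bx
  rw [integrable_indicator_iff measurableSet_closedBall]
  exact integrableOn_const (measure_closedBall_lt_top.ne)
theorem BS.of_bx {K : ℝ × ℝ × ℝ → ℝ} (h : BS 1 K) {q : ℝ × ℝ × ℝ} {c : ℝ} (hc : |K q| ≤ c) : |K q| ≤ c * bx q := by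
  unfold bx
  by_cases hq : q ∈ Metric.closedBall (0 : ℝ × ℝ × ℝ) 1
  · rwa [indicator_of_mem hq, mul_one]
  · rw [indicator_of_notMem hq, mul_zero, h q, abs_zero]
    by_contra hn
    push Not at hn
    apply hq
    rw [mem_closedBall_zero_iff, Prod.norm_def, Prod.norm_def]
    exact max_le hn.1 (max_le hn.2.1 hn.2.2)

theorem km_bd {C : ℝ} (hC : 0 < C) (hH : ∀ s, 0 < s → |H1 δ s| ≤ C * s ^ (-(3/2) : ℝ)) {ε ρ : ℝ} (hρ : 0 < ρ)
    {q : ℝ × ℝ × ℝ} (hq : ρ ≤ NN ε q) : |km δ ε q| ≤ 8 * C * ρ ^ (-(3/2) : ℝ) * ε ^ 2 := by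
  unfold km
  rw [abs_mul, abs_of_nonneg (by positivity : 0 ≤ 8 * ε ^ 2)]
  have h1 := hH _ (hρ.trans_le hq)
  have h2 : NN ε q ^ (-(3/2) : ℝ) ≤ ρ ^ (-(3/2) : ℝ) := Real.rpow_le_rpow_of_nonpos hρ hq (by norm_num)
  have h3 : |H1 δ (NN ε q)| ≤ C * ρ ^ (-(3/2) : ℝ) := h1.trans (mul_le_mul_of_nonneg_left h2 hC.le)
  nlinarith [mul_le_mul_of_nonneg_left h3 (by positivity : 0 ≤ 8 * ε ^ 2)]

theorem km_abs (hδ : 0 < δ) (hδ1 : δ ≤ 1) : ∃ M, 0 < M ∧ ∀ ε, 0 < ε → ∀ q,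
    |km δ ε q| ≤ -km δ ε q + M * ε ^ 2 * bx q := by
  obtain ⟨C, hC, hH⟩ := H1_bound hδ
  refine ⟨2 * (8 * C * (δ/2) ^ (-(3/2) : ℝ)), by positivity, fun ε hε q => ?_⟩
  rcases lt_or_ge (NN ε q) (δ/2) with h | h
  · have : km δ ε q ≤ 0 := by
      unfold km; rw [H1_small hδ (NN_pos hε q) h]
      have := Real.rpow_nonneg (NN_pos hε q).le (-(3/2) : ℝ)
      nlinarith [mul_nonneg (sq_nonneg ε) this]
    rw [abs_of_nonpos this]
    have := bx_nn q
    have h3 : 0 ≤ 2 * (8 * C * (δ / 2) ^ (-(3 / 2) : ℝ)) * ε ^ 2 * bx q := by positivity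
    linarith
  · have := (km_BS hδ hδ1 ε).of_bx (km_bd hC hH (by positivity) h)
    have h2 := le_abs_self (km δ ε q)
    nlinarith

theorem ke_fam (hδ : 0 < δ) (hδ1 : δ ≤ 1) : (∀ ε, 0 ≤ ε → Integrable (ke δ ε)) ∧
      Tendsto (fun n : ℕ => ∫ q, |ke δ (1 / ((n : ℝ) + 1)) q - ke δ 0 q|) atTop (𝓝 0) := by
  obtain ⟨C, hC, hJ⟩ := JJ_bound hδ
  refine fam_conv (C := 2 * C) (fun ε hε => ke_cont hε) ?_ ?_
  · filter_upwards [ae_ne1] with q hq ε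
    by_cases hb : 1 < |q.1| ∨ 1 < |q.2.1| ∨ 1 < |q.2.2|
    · rw [ke_BS hδ hδ1 ε q hb, abs_zero]
      exact mul_nonneg (by positivity) (dom_nonneg q)
    · push Not at hb
      have h1 : 1 ≤ dom q := by
        have aux : ∀ s : ℝ, s ≠ 0 → |s| ≤ 1 → 1 ≤ g1 s := fun s h0 h1 => by
          rw [g1_of h1]; exact Real.one_le_rpow_of_pos_of_le_one_of_nonpos (abs_pos.2 h0) h1 (by norm_num)
        unfold dom
        have a := aux _ hq.1 hb.1
        have b := aux _ hq.2.1 hb.2.1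
        have c := aux _ hq.2.2 hb.2.2
        nlinarith [mul_le_mul b c zero_le_one (by linarith)]
      unfold ke
      rw [abs_mul]
      have h2 := hJ (NN ε q) (NN_pos' (w0_pos_t hq.2.2))
      have h3 : |q.1 ^ 2 + q.2.1 ^ 2| ≤ 2 := by
        rw [abs_of_nonneg (by positivity)]
        have := (sq_le_one_iff_abs_le_one _).2 hb.1
        have := (sq_le_one_iff_abs_le_one _).2 hb.2.1
        linarith
      have h4 := mul_le_mul h3 h2 (abs_nonneg _) (by norm_num)
      nlinarith
  · intro q hq
    unfold ke
    exact (tend_H (cd_JJ δ).continuousOn hq).const_mul _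

noncomputable def C0 (δ : ℝ) : ℝ := ∫ q, ke δ 0 q

theorem ke_lim (hδ : 0 < δ) (hδ1 : δ ≤ 1) :
    Tendsto (fun n : ℕ => ∫ q, ke δ (1 / ((n : ℝ) + 1)) q) atTop (𝓝 (C0 δ)) := by
  have h := ke_fam hδ hδ1
  rw [tendsto_iff_norm_sub_tendsto_zero]
  refine squeeze_zero (fun _ => norm_nonneg _) (fun n => ?_) h.2
  unfold C0
  rw [← integral_sub (h.1 _ (seq_pos n).le) (h.1 _ le_rfl)]
  exact norm_integral_le_integral_norm _

theorem C0_pos (hδ : 0 < δ) (hδ1 : δ ≤ 1) : 0 < C0 δ := by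
  obtain ⟨M, hM, hm⟩ := km_abs hδ hδ1
  have low : ∀ ε, 0 < ε → 25 * ε ^ 4 < δ / 2 → 4 / 125 - M * ε ^ 2 * ∫ q, bx q ≤ ∫ q, ke δ ε q := by
    intro ε hε h25
    have im := int_of_BS (km_cont (δ := δ) hε) (km_BS hδ hδ1 ε)
    have e1 : ∫ q, ke δ ε q = ∫ q, - km δ ε q := by rw [integral_neg, m_mass hδ hδ1 hε, neg_neg]
    set B : Set (ℝ × ℝ × ℝ) := Icc 0 ε ×ˢ (Icc 0 ε ×ˢ Icc 0 (ε ^ 2)) with hB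
    have hBm : MeasurableSet B := measurableSet_Icc.prod (measurableSet_Icc.prod measurableSet_Icc)
    have hvol : volume.real B = ε ^ 4 := by
      have : volume B = volume (Icc 0 ε) * (volume (Icc 0 ε) * volume (Icc 0 (ε ^ 2))) := by
        rw [hB]
        have a1 : (volume : Measure (ℝ × ℝ × ℝ)) = volume.prod (volume.prod volume) := rfl
        rw [a1, Measure.prod_prod, Measure.prod_prod]
      unfold Measure.real
      rw [this, Real.volume_Icc, Real.volume_Icc, sub_zero, sub_zero, ENNReal.toReal_mul, ENNReal.toReal_mul,
        ENNReal.toReal_ofReal hε.le, ENNReal.toReal_ofReal (by positivity)]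
      ring
    have hfin : volume B ≠ ⊤ := by
      intro h; unfold Measure.real at hvol; rw [h] at hvol; simp at hvol; exact absurd hvol.symm (by positivity)
    have iB : Integrable (B.indicator fun _ => 4 / 125 / ε ^ 4) := by
      rw [integrable_indicator_iff hBm]; exact integrableOn_const hfin
    have hle : ∫ q, (B.indicator (fun _ => 4 / 125 / ε ^ 4) q - M * ε ^ 2 * bx q) ≤ ∫ q, - km δ ε q := by
      apply integral_mono (iB.sub (bx_int.const_mul _)) im.neg
      intro q
      show B.indicator (fun _ => 4 / 125 / ε ^ 4) q - M * ε ^ 2 * bx q ≤ - km δ ε q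
      by_cases hq : q ∈ B
      · rw [indicator_of_mem hq]
        obtain ⟨⟨a0, a1⟩, ⟨b0, b1⟩, t0, t1⟩ := hq
        have hN : NN ε q ≤ (5 * ε ^ 2) ^ 2 := by
          unfold NN
          have s1 : q.1 ^ 2 ≤ ε ^ 2 := by gcongr
          have s2 : q.2.1 ^ 2 ≤ ε ^ 2 := by gcongr
          have s3 : q.2.2 ^ 2 ≤ (ε ^ 2) ^ 2 := by gcongr
          have s4 : (q.1 ^ 2 + q.2.1 ^ 2 + ε ^ 2) ^ 2 ≤ (3 * ε ^ 2) ^ 2 := by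
            apply pow_le_pow_left₀ (by positivity); linarith
          nlinarith
        have hN2 : NN ε q < δ / 2 := lt_of_le_of_lt hN (by nlinarith)
        have hp := NN_pos hε q
        have r1 : ((5 * ε ^ 2) ^ 2) ^ (-(3/2) : ℝ) ≤ NN ε q ^ (-(3/2) : ℝ) :=
          Real.rpow_le_rpow_of_nonpos hp hN (by norm_num)
        have r2 : ((5 * ε ^ 2) ^ 2) ^ (-(3/2) : ℝ) = 1 / (125 * ε ^ 6) := by
          rw [← Real.rpow_natCast, ← Real.rpow_mul (by positivity)]
          rw [show ((2:ℕ):ℝ) * -(3/2) = -((3:ℕ):ℝ) by norm_num, Real.rpow_neg (by positivity), Real.rpow_natCast]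
          rw [one_div]; congr 1; ring
        have r3 : -km δ ε q = 4 * ε ^ 2 * NN ε q ^ (-(3/2) : ℝ) := by
          unfold km; rw [H1_small hδ hp hN2]; ring
        rw [r3]
        have r4 : 4 / 125 / ε ^ 4 = 4 * ε ^ 2 * (1 / (125 * ε ^ 6)) := by field_simp
        have := bx_nn q
        have h3 : 0 ≤ M * ε ^ 2 * bx q := by positivity
        rw [r4, ← r2]
        nlinarith [mul_le_mul_of_nonneg_left r1 (by positivity : 0 ≤ 4 * ε ^ 2)]
      · rw [indicator_of_notMem hq]
        have := hm ε hε q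
        have := abs_nonneg (km δ ε q)
        linarith
    rw [integral_sub iB (bx_int.const_mul _), integral_indicator hBm, setIntegral_const, integral_const_mul, hvol] at hle
    rw [e1]
    refine le_trans (le_of_eq ?_) hle
    rw [smul_eq_mul]; field_simp
  have hl := ke_lim hδ hδ1
  have l2 : Tendsto (fun n : ℕ => 4 / 125 - M * (1 / ((n : ℝ) + 1)) ^ 2 * ∫ q, bx q) atTop (𝓝 (4 / 125)) := by
    have := ((seq_lim.pow 2).const_mul M).mul_const (∫ q, bx q)
    have := this.const_sub (4 / 125)
    simpa using this
  have l3 : ∀ᶠ n : ℕ in atTop, 25 * (1 / ((n : ℝ) + 1)) ^ 4 < δ / 2 := by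
    have := (seq_lim.pow 4).const_mul 25
    simp only [ne_eq, OfNat.ofNat_ne_zero, not_false_eq_true, zero_pow, mul_zero] at this
    exact this.eventually_lt_const (by positivity)
  have := le_of_tendsto_of_tendsto l2 hl (l3.mono fun n hn => low _ (seq_pos n) hn)
  linarith

theorem NN_far {ρ : ℝ} (hρ : 0 < ρ) {q : ℝ × ℝ × ℝ} (hq : ρ ≤ ‖q‖) : min (ρ ^ 4) (ρ ^ 2) ≤ NN 0 q := by
  rw [Prod.norm_def, Prod.norm_def, le_max_iff, le_max_iff] at hq
  unfold NN
  have e2 := sq_nonneg q.1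
  have e3 := sq_nonneg q.2.1
  have e4 := sq_nonneg q.2.2
  have key : ∀ s : ℝ, ρ ≤ ‖s‖ → ρ ^ 2 ≤ s ^ 2 := fun s h => by
    rw [Real.norm_eq_abs] at h; rw [← sq_abs s]; gcongr
  rcases hq with h | h | h
  · have := key _ h
    refine (min_le_left _ _).trans ?_
    nlinarith [sq_nonneg ρ, sq_nonneg (ρ^2)]
  · have := key _ h
    refine (min_le_left _ _).trans ?_
    nlinarith [sq_nonneg ρ, sq_nonneg (ρ^2)]
  · have := key _ h
    refine (min_le_right _ _).trans ?_
    nlinarith [sq_nonneg (q.1 ^ 2 + q.2.1 ^ 2 + 0 ^ 2)]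

theorem m_conc (hδ : 0 < δ) (hδ1 : δ ≤ 1) {Λ : ℝ × ℝ × ℝ → ℝ} {L : ℝ} (hm : AEStronglyMeasurable Λ volume)
    (hb : ∀ q, |Λ q| ≤ L) (hc : ContinuousAt Λ 0) :
    Tendsto (fun n : ℕ => ∫ q, km δ (1 / ((n : ℝ) + 1)) q * Λ q) atTop (𝓝 (-(C0 δ * Λ 0))) := by
  obtain ⟨M, hM, hmm⟩ := km_abs hδ hδ1
  obtain ⟨C, hC, hH⟩ := H1_bound hδ
  have hL : 0 ≤ L := (abs_nonneg _).trans (hb 0)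
  have ik : ∀ n : ℕ, Integrable (km δ (1 / ((n : ℝ) + 1))) := fun n =>
    int_of_BS (km_cont (seq_pos n)) (km_BS hδ hδ1 _)
  have ikL : ∀ n : ℕ, Integrable (fun q => km δ (1 / ((n : ℝ) + 1)) q * Λ q) := fun n => by
    have := (ik n).bdd_mul (c := L) hm (Eventually.of_forall fun q => hb q)
    exact this.congr (Eventually.of_forall fun q => mul_comm _ _)
  have h0 : Tendsto (fun n : ℕ => ∫ q, km δ (1 / ((n : ℝ) + 1)) q * (Λ q - Λ 0)) atTop (𝓝 0) := by
    rw [Metric.tendsto_atTop']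
    intro η hη
    set I := ∫ q, bx q
    have hI : 0 ≤ I := integral_nonneg bx_nn
    -- constants
    set K := C0 δ + 1 with hK
    have hKp : 0 < K := by have := C0_pos hδ hδ1; linarith
    set η' := η / (2 * K) with hη'
    have hη'p : 0 < η' := by positivity
    obtain ⟨ρ, hρ, hρ1⟩ := Metric.continuousAt_iff.1 hc η' hη'p
    set r := min (ρ ^ 4) (ρ ^ 2) with hr
    have hrp : 0 < r := by positivity
    have t1 : Tendsto (fun n : ℕ => (∫ q, ke δ (1 / ((n : ℝ) + 1)) q) + M * (1 / ((n : ℝ) + 1)) ^ 2 * I) atTop (𝓝 (C0 δ)) := by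
      have := (ke_lim hδ hδ1).add (((seq_lim.pow 2).const_mul M).mul_const I)
      simpa using this
    have t2 : Tendsto (fun n : ℕ => 2 * L * (8 * C * r ^ (-(3/2) : ℝ) * (1 / ((n : ℝ) + 1)) ^ 2) * I) atTop (𝓝 0) := by
      have := (((seq_lim.pow 2).const_mul (8 * C * r ^ (-(3/2) : ℝ))).const_mul (2 * L)).mul_const I
      simpa using this
    have ev : ∀ᶠ n : ℕ in atTop, dist (∫ q, km δ (1 / ((n : ℝ) + 1)) q * (Λ q - Λ 0)) 0 < η := by
      filter_upwards [t1.eventually_lt_const (by linarith : C0 δ < K), t2.eventually_lt_const (half_pos hη)] with n n1 n2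
      set ε := 1 / ((n : ℝ) + 1) with hε
      have hεp : 0 < ε := seq_pos n
      rw [dist_zero_right]
      have hab : ∫ q, |km δ ε q| ≤ K := by
        have : ∫ q, |km δ ε q| ≤ ∫ q, (-km δ ε q + M * ε ^ 2 * bx q) :=
          integral_mono (ik n).abs ((ik n).neg.add (bx_int.const_mul _)) (hmm ε hεp)
        have e : ∫ q, (-km δ ε q + M * ε ^ 2 * bx q) = (∫ q, ke δ ε q) + M * ε ^ 2 * I := by
          have := integral_add (ik n).neg (bx_int.const_mul (M * ε ^ 2))
          rw [integral_const_mul] at this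
          refine Eq.trans this ?_
          have e5 : ∫ q, (-km δ ε) q = -∫ q, km δ ε q := integral_neg _
          rw [e5, m_mass hδ hδ1 hεp, neg_neg]
        linarith
      have hbd : ‖∫ q, km δ ε q * (Λ q - Λ 0)‖ ≤ ∫ q, (η' * |km δ ε q| + 2 * L * (8 * C * r ^ (-(3/2) : ℝ) * ε ^ 2) * bx q) := by
        refine norm_integral_le_of_norm_le (((ik n).abs.const_mul _).add (bx_int.const_mul _)) (Eventually.of_forall fun q => ?_)
        rw [norm_mul, Real.norm_eq_abs, Real.norm_eq_abs]
        have hbq := bx_nn q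
        rcases lt_or_ge ‖q‖ ρ with h | h
        · have := hρ1 (x := q) (by rwa [dist_zero_right])
          rw [Real.dist_eq] at this
          have h3 : 0 ≤ 2 * L * (8 * C * r ^ (-(3/2) : ℝ) * ε ^ 2) * bx q := by positivity
          nlinarith [mul_le_mul_of_nonneg_left this.le (abs_nonneg (km δ ε q))]
        · have h5 := (km_BS hδ hδ1 ε).of_bx (km_bd hC hH hrp ((NN_far hρ h).trans NN_le) : |km δ ε q| ≤ _)
          have h6 : |Λ q - Λ 0| ≤ 2 * L := (abs_sub _ _).trans (by linarith [hb q, hb 0])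
          have h7 := mul_le_mul h5 h6 (abs_nonneg _) (by positivity)
          have h8 : 0 ≤ η' * |km δ ε q| := by positivity
          linarith
      have e2 : ∫ q, (η' * |km δ ε q| + 2 * L * (8 * C * r ^ (-(3/2) : ℝ) * ε ^ 2) * bx q)
          = η' * (∫ q, |km δ ε q|) + 2 * L * (8 * C * r ^ (-(3/2) : ℝ) * ε ^ 2) * I := by
        have := integral_add ((ik n).abs.const_mul η') (bx_int.const_mul (2 * L * (8 * C * r ^ (-(3/2) : ℝ) * ε ^ 2)))
        rw [integral_const_mul, integral_const_mul] at this
        exact this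
      rw [e2] at hbd
      have : η' * (∫ q, |km δ ε q|) ≤ η / 2 := by
        calc _ ≤ η' * K := by gcongr
          _ = η / 2 := by rw [hη']; field_simp
      linarith
    obtain ⟨N, hN⟩ := eventually_atTop.1 ev
    exact ⟨N, fun n hn => hN n hn.le⟩
  have h1 := (ke_lim hδ hδ1).mul_const (Λ 0)
  have h2 := h0.sub h1
  rw [zero_sub] at h2
  refine h2.congr fun n => ?_
  have e : ∫ q, km δ (1 / ((n : ℝ) + 1)) q * (Λ q - Λ 0) =
    (∫ q, km δ (1 / ((n : ℝ) + 1)) q * Λ q) - (∫ q, km δ (1 / ((n : ℝ) + 1)) q) * Λ 0 := by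
    rw [← integral_mul_const, ← integral_sub (ikL n) ((ik n).mul_const _)]
    congr 1; funext q; ring
  rw [e, m_mass hδ hδ1 (seq_pos n)]; ring
end
end

section
open MeasureTheory Filter Topology Set

noncomputable def ishf (q : ℝ × ℝ × ℝ) (p : ℝ × ℝ) : ℝ × ℝ := (p.1 - q.1, p.2 - q.2.2 - (2 * p.1 - q.1) * q.2.1 / 2)

noncomputable def shfE (q : ℝ × ℝ × ℝ) : (ℝ × ℝ) ≃ᵐ (ℝ × ℝ) where
  toFun := fun p => shf p q
  invFun := ishf q
  left_inv := fun p => by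
    simp only [ishf, shf, Prod.ext_iff]
    exact ⟨by ring, by ring⟩
  right_inv := fun p => by
    simp only [ishf, shf, Prod.ext_iff]
    exact ⟨by ring, by ring⟩
  measurable_toFun := (continuous_shf' q).measurable
  measurable_invFun := by
    change Measurable (ishf q)
    unfold ishf; fun_prop

theorem mp_shf (q : ℝ × ℝ × ℝ) : MeasurePreserving (fun p => shf p q) := by
  unfold shf
  refine MeasurePreserving.skew_product (f := fun x : ℝ => x + q.1)
      (g := fun x y : ℝ => y + q.2.2 + (2 * x + q.1) * q.2.1 / 2) (measurePreserving_add_right _ _) ?_ ?_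
  · unfold Function.uncurry; fun_prop
  · refine Eventually.of_forall fun x => ?_
    have : (fun y : ℝ => y + q.2.2 + (2 * x + q.1) * q.2.1 / 2)
        = fun y => y + (q.2.2 + (2 * x + q.1) * q.2.1 / 2) := by funext t; ring
    rw [this]
    exact (measurePreserving_add_right _ _).map_eq

noncomputable def Lam (ψ u : ℝ × ℝ → ℝ) (q : ℝ × ℝ × ℝ) : ℝ := ∫ p, ψ p * u (shf p q)

theorem Lam_eq (ψ u : ℝ × ℝ → ℝ) (q : ℝ × ℝ × ℝ) : Lam ψ u q = ∫ p, ψ (ishf q p) * u p := by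
  have := (mp_shf q).integral_comp (shfE q).measurableEmbedding (fun p => ψ (ishf q p) * u p)
  unfold Lam
  rw [← this]
  congr 1; funext p
  have e : ishf q (shf p q) = p := (shfE q).left_inv p
  rw [e]

theorem shf_cont2 : Continuous (fun z : (ℝ × ℝ) × (ℝ × ℝ × ℝ) => shf z.1 z.2) := by unfold shf; fun_prop

section
variable {ψ u : ℝ × ℝ → ℝ} {D : ℝ}

theorem Lam_bd (hψ : Integrable ψ) (hu : BM u D) (q : ℝ × ℝ × ℝ) : |Lam ψ u q| ≤ D * ∫ p, |ψ p| := by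
  unfold Lam
  rw [← integral_const_mul]
  refine norm_integral_le_of_norm_le (G := ℝ) (hψ.abs.const_mul D) (Eventually.of_forall fun p => ?_)
  rw [Real.norm_eq_abs, abs_mul, mul_comm]
  exact mul_le_mul_of_nonneg_right (hu.2 _) (abs_nonneg _)

theorem Lam_meas (hψ : Measurable ψ) (hu : BM u D) : AEStronglyMeasurable (Lam ψ u) volume := by
  have : Measurable (fun z : (ℝ × ℝ × ℝ) × (ℝ × ℝ) => ψ z.2 * u (shf z.2 z.1)) :=
    (hψ.comp measurable_snd).mul (hu.1.comp (shf_cont2.measurable.comp measurable_swap))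
  exact (StronglyMeasurable.integral_prod_right' (ν := volume) this.stronglyMeasurable).aestronglyMeasurable

theorem Lam_cont (hψ : Continuous ψ) (hc : HasCompactSupport ψ) (hu : BM u D) : ContinuousAt (Lam ψ u) 0 := by
  have e : Lam ψ u = fun q => ∫ p, ψ (ishf q p) * u p := funext fun q => Lam_eq ψ u q
  rw [e]
  obtain ⟨M, hM⟩ := hψ.bounded_above_of_compact_support hc
  have hM0 : 0 ≤ M := (norm_nonneg _).trans (hM 0)
  obtain ⟨R, hR⟩ := hc.isCompact.isBounded.subset_closedBall 0
  have hR0 : 0 ≤ max R 0 := le_max_right _ _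
  set R1 := max R 0
  have hc2 : Continuous fun z : (ℝ × ℝ × ℝ) × (ℝ × ℝ) => ishf z.1 z.2 := by unfold ishf; fun_prop
  refine continuousAt_of_dominated (bound := fun p => M * D * (Metric.closedBall (0 : ℝ × ℝ) (3 * R1 + 3)).indicator (fun _ => 1) p) ?_ ?_ ?_ ?_
  · refine Eventually.of_forall fun q => ?_
    exact ((hψ.comp (hc2.comp (Continuous.prodMk_right q))).measurable.mul hu.1).aestronglyMeasurable
  · filter_upwards [Metric.ball_mem_nhds (0 : ℝ × ℝ × ℝ) one_pos] with q hq
    refine Eventually.of_forall fun p => ?_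
    rw [mem_ball_zero_iff, Prod.norm_def, Prod.norm_def, max_lt_iff, max_lt_iff, Real.norm_eq_abs, Real.norm_eq_abs, Real.norm_eq_abs] at hq
    obtain ⟨a1, b1, t1⟩ := hq
    by_cases hp : p ∈ Metric.closedBall (0 : ℝ × ℝ) (3 * R1 + 3)
    · rw [indicator_of_mem hp, mul_one, norm_mul]
      exact mul_le_mul (hM _) (hu.2 p) (norm_nonneg _) hM0
    · rw [indicator_of_notMem hp, mul_zero]
      have : ψ (ishf q p) = 0 := by
        by_contra hne
        have h1 := hR (subset_tsupport _ hne)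
        rw [mem_closedBall_zero_iff, Prod.norm_def, max_le_iff, Real.norm_eq_abs, Real.norm_eq_abs] at h1
        obtain ⟨h1, h2⟩ := h1
        replace h1 := h1.trans (le_max_left R 0)
        replace h2 := h2.trans (le_max_left R 0)
        apply hp
        rw [mem_closedBall_zero_iff, Prod.norm_def]
        simp only [ishf] at h1 h2
        have g1 : |p.1| ≤ R1 + 1 := by
          have := abs_add_le (p.1 - q.1) q.1
          rw [sub_add_cancel] at this; linarith
        refine max_le ?_ ?_
        · rw [Real.norm_eq_abs]; linarith
        · rw [Real.norm_eq_abs]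
          have e : p.2 = (p.2 - q.2.2 - (2 * p.1 - q.1) * q.2.1 / 2) + q.2.2 + (2 * p.1 - q.1) / 2 * q.2.1 := by ring
          rw [e]
          have k1 := abs_add_le ((p.2 - q.2.2 - (2 * p.1 - q.1) * q.2.1 / 2) + q.2.2) ((2 * p.1 - q.1) / 2 * q.2.1)
          have k2 := abs_add_le (p.2 - q.2.2 - (2 * p.1 - q.1) * q.2.1 / 2) q.2.2
          have k3 : |(2 * p.1 - q.1) / 2| ≤ R1 + 2 := by
            rw [abs_le] at *; constructor <;> linarith [a1.le, (abs_lt.1 a1).1, (abs_lt.1 a1).2, g1.1, g1.2]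
          rw [abs_mul] at k1
          have k4 := mul_le_mul k3 b1.le (abs_nonneg _) (by linarith)
          linarith
      rw [this, zero_mul, norm_zero]
  · refine Integrable.const_mul ?_ _
    rw [integrable_indicator_iff measurableSet_closedBall]
    exact integrableOn_const (measure_closedBall_lt_top.ne)
  · refine Eventually.of_forall fun p => ?_
    exact ((hψ.comp (hc2.comp (Continuous.prodMk_left p))).mul continuous_const).continuousAt

theorem Lam_fub {K : ℝ × ℝ × ℝ → ℝ} (hK : Integrable K) (hψ : Integrable ψ) (hu : BM u D) :
    ∫ p, ψ p * CK K u p = ∫ q, K q * Lam ψ u q := by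
  have hi : Integrable (fun z : (ℝ × ℝ) × (ℝ × ℝ × ℝ) => ψ z.1 * K z.2 * u (shf z.1 z.2)) (volume.prod volume) := by
    have h1 := hψ.mul_prod hK
    have h2 := h1.bdd_mul (c := D) (hu.1.comp shf_cont2.measurable).aestronglyMeasurable
      (Eventually.of_forall fun z => hu.2 (shf z.1 z.2))
    exact h2.congr (Eventually.of_forall fun z => mul_comm _ _)
  have := integral_integral_swap (f := fun p q => ψ p * K q * u (shf p q)) hi
  calc ∫ p, ψ p * CK K u p = ∫ p, ∫ q, ψ p * K q * u (shf p q) := by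
        congr 1; funext p; unfold CK; rw [← integral_const_mul]; congr 1; funext q; ring
    _ = ∫ q, ∫ p, ψ p * K q * u (shf p q) := this
    _ = _ := by
        congr 1; funext q; unfold Lam; rw [← integral_const_mul]; congr 1; funext p; ring

theorem ker_conv {Kn : ℕ → ℝ × ℝ × ℝ → ℝ} {K : ℝ × ℝ × ℝ → ℝ} (hn : ∀ n, Integrable (Kn n)) (hK : Integrable K)
    (hl : Tendsto (fun n => ∫ q, |Kn n q - K q|) atTop (𝓝 0)) (hu : BM u D) :
    (∀ p, Tendsto (fun n => CK (Kn n) u p) atTop (𝓝 (CK K u p))) ∧ ∃ M, ∀ n p, |CK (Kn n) u p| ≤ M := by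
  have hb : ∀ n p, |CK (Kn n) u p - CK K u p| ≤ D * ∫ q, |Kn n q - K q| := fun n p => by
    rw [← CK_sub_K (hn n) hK hu]
    exact CK_le ((hn n).sub hK) hu p
  constructor
  · intro p
    rw [tendsto_iff_norm_sub_tendsto_zero]
    refine squeeze_zero (fun _ => norm_nonneg _) (fun n => hb n p) ?_
    simpa using hl.const_mul D
  · obtain ⟨M, hM⟩ := hl.bddAbove_range
    refine ⟨D * M + D * ∫ q, |K q|, fun n p => ?_⟩
    have h1 := hb n p
    have h2 := CK_le hK hu p
    have h3 : ∫ q, |Kn n q - K q| ≤ M := hM ⟨n, rfl⟩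
    have h4 := mul_le_mul_of_nonneg_left h3 hu.nonneg
    have h5 := abs_add_le (CK (Kn n) u p - CK K u p) (CK K u p)
    rw [sub_add_cancel] at h5
    linarith

variable {F : ℝ × ℝ → ℝ} {E δ : ℝ}

theorem rep (hδ : 0 < δ) (hδ1 : δ ≤ 1) (hu : BM u D) (hF : BM F E) (hs : DSol u F) :
    u =ᵐ[volume] fun p => (CK (ke δ 0) u p - CK (k0 δ 0) F p) / C0 δ := by
  have hC := C0_pos hδ hδ1
  obtain ⟨Ck, hk⟩ := k0_KF hδ hδ1
  have hk' := hk.conv (by norm_num) (by norm_num)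
  have hf := ke_fam hδ hδ1
  obtain ⟨c1, M1, hM1⟩ := ker_conv (fun n => hf.1 _ (seq_pos n).le) (hf.1 0 le_rfl) hf.2 hu
  obtain ⟨c2, M2, hM2⟩ := ker_conv (fun n => hk'.1 _ (seq_pos n).le) (hk'.1 0 le_rfl) hk'.2 hF
  set G : ℝ × ℝ → ℝ := fun p => CK (k0 δ 0) F p - CK (ke δ 0) u p with hG
  have hGc : Continuous G := (CK_cont (hk'.1 0 le_rfl) hF).sub (CK_cont (hf.1 0 le_rfl) hu)
  have hGb : ∀ p, |G p| ≤ E * (∫ q, |k0 δ 0 q|) + D * ∫ q, |ke δ 0 q| := fun p =>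
    (abs_sub _ _).trans (add_le_add (CK_le (hk'.1 0 le_rfl) hF p) (CK_le (hf.1 0 le_rfl) hu p))
  have key : ∀ᵐ p, G p + C0 δ * u p = 0 := by
    refine ae_eq_zero_of_integral_contDiff_smul_eq_zero ?_ ?_
    · refine (locallyIntegrable_const (E * (∫ q, |k0 δ 0 q|) + D * (∫ q, |ke δ 0 q|) + C0 δ * D)).mono
        (hGc.measurable.add (hu.1.const_mul _)).aestronglyMeasurable (Eventually.of_forall fun p => ?_)
      refine le_trans ?_ (le_abs_self _)
      refine (abs_add_le _ _).trans (add_le_add (hGb p) ?_)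
      rw [abs_mul, abs_of_pos hC]
      exact mul_le_mul_of_nonneg_left (hu.2 p) hC.le
    · intro ψ hψ hψc
      have iψ : Integrable ψ := hψ.continuous.integrable_of_hasCompactSupport hψc
      have l1 : Tendsto (fun n : ℕ => ∫ p, ψ p * CK (km δ (1 / ((n : ℝ) + 1))) u p) atTop (𝓝 (∫ p, ψ p * G p)) := by
        have e : ∀ n : ℕ, ∀ p, CK (km δ (1 / ((n : ℝ) + 1))) u p =
            CK (k0 δ (1 / ((n : ℝ) + 1))) F p - CK (ke δ (1 / ((n : ℝ) + 1))) u p := fun n p => by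
          have := rep_eps hδ hδ1 (seq_pos n) hu hF hs p; linarith
        simp only [e]
        refine tendsto_integral_of_dominated_convergence (fun p => |ψ p| * (M2 + M1)) ?_ (iψ.abs.mul_const _) ?_ ?_
        · intro n
          exact (hψ.continuous.mul ((CK_cont (hk'.1 _ (seq_pos n).le) hF).sub (CK_cont (hf.1 _ (seq_pos n).le) hu))).aestronglyMeasurable
        · intro n
          refine Eventually.of_forall fun p => ?_
          rw [norm_mul]
          exact mul_le_mul_of_nonneg_left ((abs_sub _ _).trans (add_le_add (hM2 n p) (hM1 n p))) (norm_nonneg _)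
        · exact Eventually.of_forall fun p => ((c2 p).sub (c1 p)).const_mul _
      have l2 := m_conc hδ hδ1 (Lam_meas hψ.continuous.measurable hu) (Lam_bd iψ hu) (Lam_cont hψ.continuous hψc hu)
      have e2 : ∀ n : ℕ, ∫ p, ψ p * CK (km δ (1 / ((n : ℝ) + 1))) u p = ∫ q, km δ (1 / ((n : ℝ) + 1)) q * Lam ψ u q :=
        fun n => Lam_fub (int_of_BS (km_cont (seq_pos n)) (km_BS hδ hδ1 _)) iψ hu
      simp only [e2] at l1
      have e3 := tendsto_nhds_unique l1 l2
      have e4 : Lam ψ u 0 = ∫ p, ψ p * u p := by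
        unfold Lam; congr 1; funext p; simp [shf]
      have i1 : Integrable (fun p => ψ p * G p) := (hψ.continuous.mul hGc).integrable_of_hasCompactSupport hψc.mul_right
      have i2 : Integrable (fun p => ψ p * u p) := (iψ.bdd_mul (c := D) hu.1.aestronglyMeasurable
        (Eventually.of_forall hu.2)).congr (Eventually.of_forall fun p => mul_comm _ _)
      have e5 : ∫ p, ψ p • (G p + C0 δ * u p) = (∫ p, ψ p * G p) + C0 δ * ∫ p, ψ p * u p := by
        rw [← integral_const_mul]
        refine Eq.trans ?_ (integral_add i1 (i2.const_mul _))
        congr 1; funext p; simp only [smul_eq_mul]; ring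
      rw [e5, e3, e4]; ring
  filter_upwards [key] with p hp
  rw [eq_div_iff hC.ne']
  simp only [hG] at hp
  linarith
end
end

section
open MeasureTheory Filter Topology Set

theorem int_nn {f : ℝ × ℝ × ℝ → ℝ} (h : ∀ q, 0 ≤ f q) : 0 ≤ ∫ q, f q := integral_nonneg h

theorem NN0_pos {q : ℝ × ℝ × ℝ} (hq : q ≠ 0) : 0 < NN 0 q := by
  unfold NN
  by_contra h
  push Not at h
  apply hq
  have h1 : 0 ≤ q.1 ^ 2 := sq_nonneg _
  have h2 : 0 ≤ q.2.1 ^ 2 := sq_nonneg _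
  have h3 : 0 ≤ q.2.2 ^ 2 := sq_nonneg _
  have h4 : 0 ≤ (q.1 ^ 2 + q.2.1 ^ 2 + 0 ^ 2) ^ 2 := sq_nonneg _
  have h5 : q.2.2 ^ 2 = 0 := by linarith
  have h6 : (q.1 ^ 2 + q.2.1 ^ 2 + 0 ^ 2) ^ 2 = 0 := by linarith
  rw [pow_eq_zero_iff two_ne_zero] at h5 h6
  have h7 : q.1 ^ 2 = 0 := by linarith
  have h8 : q.2.1 ^ 2 = 0 := by linarith
  rw [pow_eq_zero_iff two_ne_zero] at h7 h8
  ext <;> assumption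

theorem ke0_sm {δ : ℝ} (hδ : 0 < δ) : ContDiff ℝ (⊤ : ℕ∞) (ke δ 0) := by
  rw [contDiff_iff_contDiffAt]
  intro q
  rcases lt_or_ge (NN 0 q) (δ / 2) with h | h
  · have : ke δ 0 =ᶠ[𝓝 q] fun _ => 0 := by
      filter_upwards [(NN_contDiff 0).continuous.continuousAt.eventually_lt continuousAt_const h] with r hr
      by_cases h0 : r = 0
      · subst h0; simp [ke]
      · unfold ke JJ; rw [J_small hδ (NN0_pos h0) hr, mul_zero]
    exact contDiffAt_const.congr_of_eventuallyEq this
  · have h0 : 0 < NN 0 q := lt_of_lt_of_le (half_pos hδ) h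
    have h1 : ContDiffAt ℝ (⊤ : ℕ∞) (fun q => JJ δ (NN 0 q)) q :=
      ((cd_JJ δ).contDiffAt (Ioi_mem_nhds h0)).comp q (NN_contDiff 0).contDiffAt
    unfold ke
    refine ContDiffAt.mul ?_ h1
    fun_prop

theorem pow_min {A B γ τ : ℝ} (hA : 0 ≤ A) (hB : 0 ≤ B) (hγ : 0 < γ) (hγ1 : γ ≤ 1) :
    min A (B * |τ|) ≤ (A + B) * |τ| ^ γ := by
  rcases le_or_gt |τ| 1 with h | h
  · have h1 : |τ| ≤ |τ| ^ γ := by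
      rcases eq_or_ne τ 0 with h0 | h0
      · subst h0; simp [Real.zero_rpow hγ.ne']
      · have := Real.rpow_le_rpow_of_exponent_ge (abs_pos.2 h0) h hγ1
        rwa [Real.rpow_one] at this
    refine (min_le_right _ _).trans ?_
    have := Real.rpow_nonneg (abs_nonneg τ) γ
    nlinarith [mul_le_mul_of_nonneg_left h1 hB, mul_nonneg hA this]
  · have h1 : 1 ≤ |τ| ^ γ := Real.one_le_rpow h.le hγ.le
    refine (min_le_left _ _).trans ?_
    nlinarith

/-- function with bounded y-derivative is Hölder -/
theorem holY_of_deriv {h h' : ℝ × ℝ → ℝ} {A B γ : ℝ} (hA : ∀ p, |h p| ≤ A) (hd : ∀ x y, HasDerivAt (fun y => h (x, y)) (h' (x, y)) y)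
    (hB : ∀ p, |h' p| ≤ B) (hγ : 0 < γ) (hγ1 : γ ≤ 1) : HolY h γ (2 * A + B) := by
  intro x y τ
  have hA0 : 0 ≤ A := (abs_nonneg _).trans (hA 0)
  have hB0 : 0 ≤ B := (abs_nonneg _).trans (hB 0)
  refine le_trans (le_min ?_ ?_) (pow_min (by positivity : 0 ≤ 2 * A) hB0 hγ hγ1)
  · refine (abs_sub _ _).trans ?_
    linarith [hA (x, y + τ), hA (x, y)]
  · have := Convex.norm_image_sub_le_of_norm_hasDerivWithin_le (f := fun y => h (x, y)) (f' := fun y => h' (x, y)) (s := univ) (C := B)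
      (x := y) (y := y + τ) (fun z _ => (hd x z).hasDerivWithinAt) (fun z _ => hB _) convex_univ (mem_univ _) (mem_univ _)
    simpa using this

theorem CK_sm_hol {K : ℝ × ℝ × ℝ → ℝ} (hK : ContDiff ℝ 1 K) (hc : HasCompactSupport K) : ∃ A, 0 ≤ A ∧ ∀ γ, 0 < γ → γ ≤ 1 →
    ∀ (h : ℝ × ℝ → ℝ) C, BM h C → HolY (CK K h) γ (A * C) := by
  have iK : Integrable K := hK.continuous.integrable_of_hasCompactSupport hc
  set Kt : ℝ × ℝ × ℝ → ℝ := fun q => fderiv ℝ K q (0, 0, 1) with hKt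
  have cKt : Continuous Kt := fd_cont hK continuous_const
  have hct : HasCompactSupport Kt := fd_hcs hc _
  have it : Integrable Kt := cKt.integrable_of_hasCompactSupport hct
  refine ⟨2 * (∫ q, |K q|) + ∫ q, |Kt q|, ?_, fun γ h0 h1 h C hh => ?_⟩
  · have := int_nn (fun q => abs_nonneg (K q))
    have := int_nn (fun q => abs_nonneg (Kt q))
    positivity
  · have := holY_of_deriv (h := CK K h) (h' := fun p => -CK Kt h p) (A := C * ∫ q, |K q|) (B := C * ∫ q, |Kt q|) (CK_le iK hh)
      (fun x y => hd_CK_y hK hc (fun q => rfl) hh x y) (fun p => by rw [abs_neg]; exact CK_le it hh p) h0 h1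
    have e : (2 * (∫ q, |K q|) + ∫ q, |Kt q|) * C = 2 * (C * ∫ q, |K q|) + C * ∫ q, |Kt q| := by ring
    rw [e]; exact this

/-- continuous bounded solution with bounded right-hand side -/
structure CS (u F : ℝ × ℝ → ℝ) (D E : ℝ) : Prop where
  cont : Continuous u
  bd : ∀ p, |u p| ≤ D
  hF : BM F E
  ds : DSol u F

namespace CS
variable {u F : ℝ × ℝ → ℝ} {D E δ : ℝ}

theorem bm (h : CS u F D E) : BM u D := ⟨h.cont.measurable, h.bd⟩

theorem rep (h : CS u F D E) (hδ : 0 < δ) (hδ1 : δ ≤ 1) (p : ℝ × ℝ) :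
    u p = (CK (ke δ 0) u p - CK (k0 δ 0) F p) / C0 δ := by
  have h1 := _root_.rep hδ hδ1 h.bm h.hF h.ds
  have h2 := (Continuous.ae_eq_iff_eq volume h.cont
    (((CK_cont ((ke_fam hδ hδ1).1 0 le_rfl) h.bm).sub (CK_cont (k0_int hδ hδ1) h.hF)).div_const _)).1 h1
  exact congrFun h2 p
end CS

theorem ae_bd {u : ℝ × ℝ → ℝ} (hc : Continuous u) {s : Set ℝ} (hs : IsClosed s) (h : ∀ᵐ p, u p ∈ s) (p : ℝ × ℝ) : u p ∈ s := by
  by_contra hn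
  have ho : IsOpen (u ⁻¹' sᶜ) := hs.isOpen_compl.preimage hc
  have : volume (u ⁻¹' sᶜ) = 0 := h
  rw [ho.measure_eq_zero_iff volume] at this
  have hp : p ∈ u ⁻¹' sᶜ := hn
  rw [this] at hp; exact hp

theorem dsol_congr {u v F : ℝ × ℝ → ℝ} (e : u =ᵐ[volume] v) (h : DSol u F) : DSol v F := by
  intro φ h1 h2
  rw [← h φ h1 h2]
  apply integral_congr_ae
  filter_upwards [e] with p hp
  rw [hp]

theorem dsol_congr' {u F G : ℝ × ℝ → ℝ} (e : F =ᵐ[volume] G) (h : DSol u F) : DSol u G := by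
  intro φ h1 h2
  rw [h φ h1 h2]
  apply integral_congr_ae
  filter_upwards [e] with p hp
  rw [hp]

theorem exists_cs {u F : ℝ × ℝ → ℝ} {D E : ℝ} (hu : BM u D) (hF : BM F E) (hs : DSol u F) :
    ∃ v, CS v F D E ∧ u =ᵐ[volume] v := by
  have h1 := rep one_pos le_rfl hu hF hs
  have hc : Continuous fun p => (CK (ke 1 0) u p - CK (k0 1 0) F p) / C0 1 := ((CK_cont ((ke_fam one_pos le_rfl).1 0 le_rfl) hu).sub (CK_cont (k0_int one_pos le_rfl) hF)).div_const (C0 1)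
  refine ⟨_, ⟨hc, fun p => ?_, hF, dsol_congr h1 hs⟩, h1⟩
  have := ae_bd hc (s := Icc (-D) D) isClosed_Icc (by
    filter_upwards [h1] with p hp
    rw [← hp]; exact abs_le.1 (hu.2 p)) p
  exact abs_le.2 this

namespace CS
variable {u F : ℝ × ℝ → ℝ} {D E δ : ℝ}

theorem D_nn (h : CS u F D E) : 0 ≤ D := (abs_nonneg _).trans (h.bd 0)
theorem E_nn (h : CS u F D E) : 0 ≤ E := h.hF.nonneg

theorem regY : ∃ A, 0 ≤ A ∧ ∀ (u F : ℝ × ℝ → ℝ) (D E : ℝ), CS u F D E → HolY u (3/4) (A * (D + E)) := by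
  obtain ⟨A1, hA1, h1⟩ := CK_sm_hol (contDiff_infty.1 (ke0_sm one_pos) 1) (ke_BS one_pos le_rfl 0).hcs
  obtain ⟨C, hC⟩ := k0_KF one_pos le_rfl
  have hC0 := C0_pos one_pos le_rfl
  have hd := int_nn dom_nonneg
  have hCn := hC.Cnn
  refine ⟨(A1 + 3 * C * ∫ q, dom q) / C0 1, by positivity, fun u F D E h x y τ => ?_⟩
  have r1 := h1 (3/4) (by norm_num) (by norm_num) u D h.bm x y τ
  have r2 := hC.holder (by norm_num) (by norm_num) h.hF x y τ
  rw [show (7/4 - 1 : ℝ) = 3/4 by norm_num] at r2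
  rw [h.rep one_pos le_rfl, h.rep one_pos le_rfl (x, y), ← sub_div, abs_div, abs_of_pos hC0, div_le_iff₀ hC0]
  have e : (A1 + 3 * C * ∫ q, dom q) / C0 1 * (D + E) * |τ| ^ (3/4 : ℝ) * C0 1 = (A1 + 3 * C * ∫ q, dom q) * (D + E) * |τ| ^ (3/4 : ℝ) := by
    field_simp
  rw [e]
  have t0 := Real.rpow_nonneg (abs_nonneg τ) (3/4)
  have tri : ∀ a b c d : ℝ, |a - b - (c - d)| ≤ |a - c| + |b - d| := fun a b c d => by
    rw [show a - b - (c - d) = (a - c) - (b - d) by ring]; exact abs_sub _ _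
  refine (tri _ _ _ _).trans ((add_le_add r1 r2).trans ?_)
  have hD := h.D_nn
  have hE := h.E_nn
  have p1 : 0 ≤ A1 * E * |τ| ^ (3/4 : ℝ) := by positivity
  have p2 : 0 ≤ D * (3 * C * ∫ q, dom q) * |τ| ^ (3/4 : ℝ) := by positivity
  nlinarith

theorem regX : ∃ A, 0 ≤ A ∧ ∀ (u F : ℝ × ℝ → ℝ) (D E : ℝ), CS u F D E → ∃ ux : ℝ × ℝ → ℝ, Continuous ux ∧
    (∀ x y, HasDerivAt (fun x => u (x, y)) (ux (x, y)) x) ∧ (∀ p, |ux p| ≤ A * (D + E)) ∧ HolY ux (1/4) (A * (D + E)) := by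
  have hsm := contDiff_infty.1 (ke0_sm one_pos) 2
  have hcs := (ke_BS one_pos le_rfl 0).hcs
  set K : ℝ × ℝ × ℝ → ℝ := fun q => fderiv ℝ (ke 1 0) q (1, 0, q.2.1 / 2) with hK
  have K1 : ContDiff ℝ 1 K := (hsm.fderiv_right (m := 1) (by norm_num)).clm_apply (by fun_prop)
  have Kc : HasCompactSupport K := fd_hcs hcs _
  have Ki : Integrable K := K1.continuous.integrable_of_hasCompactSupport Kc
  obtain ⟨A1, hA1, h1⟩ := CK_sm_hol K1 Kc
  obtain ⟨C, hC⟩ := k1_KF one_pos le_rfl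
  have hC0 := C0_pos one_pos le_rfl
  have hd := int_nn dom_nonneg
  have hCn := hC.Cnn
  have ik := k1_int one_pos le_rfl
  have m1 := int_nn (fun q => abs_nonneg (K q))
  have m2 := int_nn (fun q => abs_nonneg (k1 1 0 q))
  set I1 := ∫ q, |K q|
  set I2 := ∫ q, |k1 1 0 q|
  set I3 := ∫ q, dom q
  refine ⟨(A1 + 3 * C * I3 + I1 + I2) / C0 1, by positivity, fun u F D E h => ?_⟩
  have hD := h.D_nn
  have hE := h.E_nn
  refine ⟨fun p => (-CK K u p - -CK (k1 1 0) F p) / C0 1, ?_, ?_, ?_, ?_⟩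
  · exact (((CK_cont Ki h.bm).neg.sub (CK_cont ik h.hF).neg).div_const _)
  · intro x y
    have a := hd_CK_x (hsm.of_le (by norm_num)) hcs (fun q => rfl) h.bm x y
    have b := CK0_dx one_pos le_rfl h.hF x y
    have := (a.sub b).div_const (C0 1)
    refine this.congr_of_eventuallyEq (Eventually.of_forall fun z => ?_)
    exact h.rep one_pos le_rfl (z, y)
  · intro p
    rw [abs_div, abs_of_pos hC0, div_mul_eq_mul_div, div_le_div_iff_of_pos_right hC0]
    refine (abs_sub _ _).trans ?_
    rw [abs_neg, abs_neg]
    have a := CK_le Ki h.bm p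
    have b := CK_le ik h.hF p
    have p1 : 0 ≤ A1 * (D + E) := by positivity
    have p2 : 0 ≤ (3 * C * I3) * (D + E) := by positivity
    have p3 : 0 ≤ I1 * E := by positivity
    have p4 : 0 ≤ I2 * D := by positivity
    nlinarith
  · intro x y τ
    have r1 := h1 (1/4) (by norm_num) (by norm_num) u D h.bm x y τ
    have r2 := hC.holder (by norm_num) (by norm_num) h.hF x y τ
    rw [show (7/4 - 3/2 : ℝ) = 1/4 by norm_num] at r2
    beta_reduce
    rw [← sub_div, abs_div, abs_of_pos hC0, div_mul_eq_mul_div, div_mul_eq_mul_div, div_le_div_iff_of_pos_right hC0]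
    have t0 := Real.rpow_nonneg (abs_nonneg τ) (1/4)
    have tri : ∀ a b c d : ℝ, |-a - -b - (-c - -d)| ≤ |a - c| + |b - d| := fun a b c d => by
      rw [show -a - -b - (-c - -d) = (b - d) - (a - c) by ring, add_comm]; exact abs_sub _ _
    refine (tri _ _ _ _).trans ((add_le_add r1 r2).trans ?_)
    set t := |τ| ^ (1/4 : ℝ)
    have p1 : 0 ≤ A1 * E * t := by positivity
    have p2 : 0 ≤ D * (3 * C * I3) * t := by positivity
    have p3 : 0 ≤ I1 * (D + E) * t := by positivity
    have p4 : 0 ≤ I2 * (D + E) * t := by positivity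
    nlinarith

theorem regYd (h : CS u F D E) {γ L : ℝ} (hγ : 1/4 ≤ γ) (hγ2 : γ ≤ 2) (hh : HolY F γ L) : ∃ uy : ℝ × ℝ → ℝ, Continuous uy ∧
    (∀ x y, HasDerivAt (fun y => u (x, y)) (uy (x, y)) y) ∧ ∃ M, ∀ p, |uy p| ≤ M := by
  have hsm := contDiff_infty.1 (ke0_sm one_pos) 2
  have hcs := (ke_BS one_pos le_rfl 0).hcs
  set K : ℝ × ℝ × ℝ → ℝ := fun q => fderiv ℝ (ke 1 0) q (0, 0, 1) with hK
  have K1 : Continuous K := fd_cont (hsm.of_le (by norm_num)) continuous_const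
  have Kc : HasCompactSupport K := fd_hcs hcs _
  have Ki : Integrable K := K1.integrable_of_hasCompactSupport Kc
  obtain ⟨C, hC⟩ := k0_KF one_pos le_rfl
  have hC0 := C0_pos one_pos le_rfl
  refine ⟨fun p => (-CK K u p - -DK (kt 1 0) F p) / C0 1, ?_, ?_, ?_⟩
  · exact ((CK_cont Ki h.bm).neg.sub (hC.DK_cont (by linarith) (by linarith) (by linarith) h.hF hh).neg).div_const _
  · intro x y
    have a := hd_CK_y (hsm.of_le (by norm_num)) hcs (fun q => rfl) h.bm x y
    have b := hC.CK_dy (by norm_num) (by norm_num) (by linarith) (by linarith) (by linarith) h.hF hh x y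
    have := (a.sub b).div_const (C0 1)
    refine this.congr_of_eventuallyEq (Eventually.of_forall fun z => ?_)
    exact h.rep one_pos le_rfl (x, z)
  · refine ⟨(D * (∫ q, |K q|) + L * ∫ q : ℝ × ℝ × ℝ, |(|q.2.2| ^ γ * kt 1 0 q)|) / C0 1, fun p => ?_⟩
    rw [abs_div, abs_of_pos hC0, div_le_div_iff_of_pos_right hC0]
    refine (abs_sub _ _).trans ?_
    rw [abs_neg, abs_neg]
    exact add_le_add (CK_le Ki h.bm p) (hC.DK_bd (by linarith) (by linarith) (by linarith) hh p)

/-- derivative of `x u` in y -/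
theorem regS (h : CS u F D E) : ∃ S : ℝ × ℝ → ℝ, Continuous S ∧
    (∀ x y, HasDerivAt (fun y => x * u (x, y)) (S (x, y)) y) ∧
    ∃ A, ∀ x y τ, |S (x, y + τ) - S (x, y)| ≤ A * (1 + |x|) * |τ| ^ (1/4 : ℝ) := by
  have hsm := contDiff_infty.1 (ke0_sm one_pos) 2
  have hcs := (ke_BS one_pos le_rfl 0).hcs
  set K : ℝ × ℝ × ℝ → ℝ := fun q => fderiv ℝ (ke 1 0) q (0, 0, 1) with hK
  have K1 : ContDiff ℝ 1 K := (hsm.fderiv_right (m := 1) (by norm_num)).clm_apply contDiff_const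
  have Kc : HasCompactSupport K := fd_hcs hcs _
  have Ki : Integrable K := K1.continuous.integrable_of_hasCompactSupport Kc
  obtain ⟨A1, hA1, h1⟩ := CK_sm_hol K1 Kc
  obtain ⟨C, hC⟩ := k2_KF one_pos le_rfl
  have hC0 := C0_pos one_pos le_rfl
  have hd := int_nn dom_nonneg
  have hCn := hC.Cnn
  have ik := k2_int one_pos le_rfl
  have hD := h.D_nn
  have hE := h.E_nn
  refine ⟨fun p => (p.1 * -CK K u p - -CK (k2 1 0) F p) / C0 1, ?_, ?_, ?_⟩
  · exact ((continuous_fst.mul (CK_cont Ki h.bm).neg).sub (CK_cont ik h.hF).neg).div_const _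
  · intro x y
    have a := hd_CK_y (hsm.of_le (by norm_num)) hcs (fun q => rfl) h.bm x y
    have b := CK0_dxy one_pos le_rfl h.hF x y
    have := ((a.const_mul x).sub b).div_const (C0 1)
    refine this.congr_of_eventuallyEq (Eventually.of_forall fun z => ?_)
    beta_reduce
    rw [h.rep one_pos le_rfl (x, z)]
    simp only [Pi.sub_apply]
    ring
  · set I3 := ∫ q, dom q
    refine ⟨(A1 * D + E * (3 * C * I3)) / C0 1, fun x y τ => ?_⟩
    have r1 := h1 (1/4) (by norm_num) (by norm_num) u D h.bm x y τ
    have r2 := hC.holder (by norm_num) (by norm_num) h.hF x y τ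
    rw [show (7/4 - 3/2 : ℝ) = 1/4 by norm_num] at r2
    beta_reduce
    rw [← sub_div, abs_div, abs_of_pos hC0, div_mul_eq_mul_div, div_mul_eq_mul_div, div_le_div_iff_of_pos_right hC0]
    have t0 := Real.rpow_nonneg (abs_nonneg τ) (1/4)
    have tri : ∀ a b c d : ℝ, |x * -a - -b - (x * -c - -d)| ≤ |x| * |a - c| + |b - d| := fun a b c d => by
      rw [show x * -a - -b - (x * -c - -d) = (b - d) - x * (a - c) by ring, add_comm, ← abs_mul]; exact abs_sub _ _
    refine (tri _ _ _ _).trans ((add_le_add (mul_le_mul_of_nonneg_left r1 (abs_nonneg x)) r2).trans ?_)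
    set t := |τ| ^ (1/4 : ℝ)
    have hx := abs_nonneg x
    have p1 : 0 ≤ A1 * D * t := by positivity
    have p2 : 0 ≤ |x| * (E * (3 * C * I3) * t) := by positivity
    nlinarith
end CS
end

section
open MeasureTheory Filter Topology Set

/-- primitives of compactly supported smooth functions of zero mean -/
theorem prim_cc {η : ℝ → ℝ} (hη : ContDiff ℝ (⊤ : ℕ∞) η) (hc : HasCompactSupport η) (h0 : ∫ x, η x = 0) :
    ∃ α : ℝ → ℝ, ContDiff ℝ (⊤ : ℕ∞) α ∧ HasCompactSupport α ∧ ∀ x, HasDerivAt α (η x) x := by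
  obtain ⟨R, hR⟩ := hc.isCompact.isBounded.subset_closedBall 0
  have hz : ∀ x, R < |x| → η x = 0 := fun x hx => by
    by_contra hn
    have := hR (subset_tsupport _ hn)
    rw [mem_closedBall_zero_iff, Real.norm_eq_abs] at this
    linarith
  have hi : Integrable η := hη.continuous.integrable_of_hasCompactSupport hc
  set α : ℝ → ℝ := fun x => ∫ t in Iic x, η t with hα
  have hd : ∀ x, HasDerivAt α (η x) x := fun x => by
    have e : α = fun x => (∫ t in Iic (0:ℝ), η t) + ∫ t in (0:ℝ)..x, η t := by
      funext x
      have := intervalIntegral.integral_Iic_sub_Iic (a := 0) (b := x) (f := η) (μ := volume) hi.integrableOn hi.integrableOn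
      simp only [hα]; linarith
    rw [e]
    exact (intervalIntegral.integral_hasDerivAt_right (hη.continuous.intervalIntegrable _ _)
      (hη.continuous.stronglyMeasurableAtFilter _ _) hη.continuous.continuousAt).const_add _
  refine ⟨α, ?_, ?_, hd⟩
  · rw [contDiff_infty_iff_deriv]
    have : deriv α = η := funext fun x => (hd x).deriv
    exact ⟨fun x => (hd x).differentiableAt, this ▸ hη⟩
  · refine HasCompactSupport.intro (isCompact_closedBall (0:ℝ) R) fun x hx => ?_
    rw [mem_closedBall_zero_iff, Real.norm_eq_abs, not_le] at hx
    rcases lt_abs.1 hx with h | h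
    · have h1 : ∫ t in Ioi x, η t = 0 := by
        refine setIntegral_eq_zero_of_forall_eq_zero fun t ht => hz t ?_
        exact lt_of_lt_of_le (h.trans ht) (le_abs_self _)
      have := integral_add_compl (μ := volume) (f := η) (s := Iic x) measurableSet_Iic hi
      rw [compl_Iic, h1, h0, add_zero] at this
      exact this
    · refine setIntegral_eq_zero_of_forall_eq_zero fun t ht => hz t ?_
      have : t ≤ x := ht
      exact lt_of_lt_of_le (by linarith) (neg_le_abs _)

theorem dbr0 {m : ℝ → ℝ} (hm : Continuous m)
    (h : ∀ α α' : ℝ → ℝ, ContDiff ℝ (⊤ : ℕ∞) α → HasCompactSupport α → (∀ x, HasDerivAt α (α' x) x) → ∫ x, m x * α' x = 0) :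
    ∃ c, ∀ x, m x = c := by
  obtain ⟨b⟩ : Nonempty (ContDiffBump (0:ℝ)) := inferInstance
  have ib := b.integrable (μ := volume)
  have hbp := b.integral_pos (μ := volume)
  set J := ∫ x, b x
  have bcd : ContDiff ℝ (⊤ : ℕ∞) b := b.contDiff
  have imul : ∀ η : ℝ → ℝ, Continuous η → HasCompactSupport η → Integrable (fun x => m x * η x) := fun η h1 h2 => by
    have : HasCompactSupport (m * η) := h2.mul_left
    exact (hm.mul h1).integrable_of_hasCompactSupport this
  set c := (∫ x, m x * b x) / J with hc
  refine ⟨c, fun x => ?_⟩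
  have key : ∀ᵐ x, m x - c = 0 := by
    refine ae_eq_zero_of_integral_contDiff_smul_eq_zero (hm.sub continuous_const).locallyIntegrable ?_
    intro η hη hηc
    have iη : Integrable η := hη.continuous.integrable_of_hasCompactSupport hηc
    set I := ∫ x, η x
    obtain ⟨α, a1, a2, a3⟩ := prim_cc (η := fun x => η x - (I / J) * b x) (hη.sub (contDiff_const.mul bcd))
      (hηc.sub (b.hasCompactSupport.mul_left (f := fun _ => I / J))) (by
        rw [integral_sub iη (ib.const_mul _), integral_const_mul]
        show I - I / J * J = 0
        field_simp; ring)
    have := h α _ a1 a2 a3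
    have e : ∫ x, m x * (η x - I / J * b x) = (∫ x, m x * η x) - I / J * ∫ x, m x * b x := by
      rw [← integral_const_mul]
      refine Eq.trans ?_ (integral_sub (imul η hη.continuous hηc) ((imul b b.continuous b.hasCompactSupport).const_mul _))
      congr 1; funext x; ring
    rw [e] at this
    have e2 : ∫ x, η x • (m x - c) = (∫ x, m x * η x) - c * I := by
      rw [← integral_const_mul]
      refine Eq.trans ?_ (integral_sub (imul η hη.continuous hηc) (iη.const_mul _))
      congr 1; funext x; simp only [smul_eq_mul]; ring
    rw [e2, hc]
    refine Eq.trans ?_ this; ring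
  have := (Continuous.ae_eq_iff_eq volume (f := fun x => m x - c) (g := fun _ => 0) (hm.sub continuous_const) continuous_const).1 key
  have := congrFun this x
  linarith

theorem dbr {f g : ℝ → ℝ} (hf : Continuous f) (hg : Continuous g)
    (h : ∀ α α' : ℝ → ℝ, ContDiff ℝ (⊤ : ℕ∞) α → HasCompactSupport α → (∀ x, HasDerivAt α (α' x) x) →
      ∫ x, (f x * α' x + g x * α x) = 0) (x : ℝ) : HasDerivAt f (g x) x := by
  set G : ℝ → ℝ := fun x => ∫ t in (0:ℝ)..x, g t with hG
  have hd : ∀ x, HasDerivAt G (g x) x := fun x =>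
    intervalIntegral.integral_hasDerivAt_right (hg.intervalIntegrable _ _)
      (hg.stronglyMeasurableAtFilter _ _) hg.continuousAt
  have cG : Continuous G := continuous_iff_continuousAt.2 fun x => (hd x).continuousAt
  have imul : ∀ m η : ℝ → ℝ, Continuous m → Continuous η → HasCompactSupport η → Integrable (fun x => m x * η x) := fun m η h0 h1 h2 => by
    have : HasCompactSupport (m * η) := h2.mul_left
    exact (h0.mul h1).integrable_of_hasCompactSupport this
  obtain ⟨c, hc⟩ := dbr0 (m := fun x => f x - G x) (hf.sub cG) (by
    intro α α' h1 h2 h3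
    have := h α α' h1 h2 h3
    have ea : α' = deriv α := funext fun x => (h3 x).deriv.symm
    have ca : Continuous α' := ea ▸ (h1.continuous_deriv (by norm_num))
    have sa : HasCompactSupport α' := ea ▸ h2.deriv
    have i := integral_mul_deriv_eq_deriv_mul_of_integrable (u := G) (v := α) (u' := g) (v' := α') (fun x _ => hd x) (fun x _ => h3 x)
      (imul G α' cG ca sa) (imul g α hg h1.continuous h2) (imul G α cG h1.continuous h2)
    have e1 : ∫ x, (f x * α' x + g x * α x) = (∫ x, f x * α' x) + ∫ x, g x * α x :=
      integral_add (imul f α' hf ca sa) (imul g α hg h1.continuous h2)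
    have e2 : ∫ x, (f x - G x) * α' x = (∫ x, f x * α' x) - ∫ x, G x * α' x := by
      refine Eq.trans ?_ (integral_sub (imul f α' hf ca sa) (imul G α' cG ca sa))
      congr 1; funext x; ring
    rw [e2, i]; linarith)
  have : f = fun x => G x + c := funext fun x => by have := hc x; linarith
  rw [this]
  exact (hd x).add_const c

theorem prod_cc {α β : ℝ → ℝ} (h1 : HasCompactSupport α) (h2 : HasCompactSupport β) :
    HasCompactSupport fun p : ℝ × ℝ => α p.1 * β p.2 := by
  refine HasCompactSupport.intro (h1.isCompact.prod h2.isCompact) fun p hp => ?_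
  by_contra hn
  exact hp ⟨subset_tsupport _ (left_ne_zero_of_mul hn), subset_tsupport _ (right_ne_zero_of_mul hn)⟩

theorem xx_lemma {u ux uy F S : ℝ × ℝ → ℝ} (cu : Continuous u) (cux : Continuous ux) (cuy : Continuous uy) (cF : Continuous F) (cS : Continuous S)
    (hx : ∀ x y, HasDerivAt (fun x => u (x, y)) (ux (x, y)) x) (hy : ∀ x y, HasDerivAt (fun y => u (x, y)) (uy (x, y)) y)
    (hS : ∀ x y, HasDerivAt (fun y => x * uy (x, y)) (S (x, y)) y) (hs : DSol u F) (x y : ℝ) :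
    HasDerivAt (fun x => ux (x, y)) (F (x, y) - x * S (x, y)) x := by
  set G : ℝ × ℝ → ℝ := fun p => F p - p.1 * S p with hG
  have cG : Continuous G := cF.sub (continuous_fst.mul cS)
  have weak : ∀ φ : ℝ × ℝ → ℝ, ContDiff ℝ 2 φ → HasCompactSupport φ → ∫ p, (ux p * pX φ p + G p * φ p) = 0 := by
    intro φ hφ hc
    have hφ1 : ContDiff ℝ 1 φ := hφ.of_le (by norm_num)
    have cφ := hφ.continuous
    have cφx := continuous_pX hφ1
    have cφy := continuous_pY hφ1
    have cφxx := continuous_pXX hφ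
    have cφyy := continuous_pYY hφ
    have sx := hcs_pX hφ1 hc
    have sy := hcs_pY hφ1 hc
    have sxx := hcs_pXX hφ hc
    have syy := hcs_pYY hφ hc
    have c2 : Continuous (fun p : ℝ × ℝ => p.1 ^ 2) := by fun_prop
    have a1 : ∫ p, u p * pXX φ p = - ∫ p, ux p * pX φ p :=
      ibpX (intc cux cφx sx) (intc cu cφxx sxx) (intc cu cφx sx) hx (hasDerivAt_pXX hφ)
    have b1 : ∫ p : ℝ × ℝ, (p.1 ^ 2 * u p) * pYY φ p = - ∫ p, (p.1 ^ 2 * uy p) * pY φ p :=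
      ibpY (intc (c2.mul cuy) cφy sy) (intc (c2.mul cu) cφyy syy) (intc (c2.mul cu) cφy sy)
        (fun x y => (hy x y).const_mul (x ^ 2)) (hasDerivAt_pYY hφ)
    have b2 : ∫ p : ℝ × ℝ, (p.1 ^ 2 * uy p) * pY φ p = - ∫ p, (p.1 * S p) * φ p :=
      ibpY (intc (continuous_fst.mul cS) cφ hc) (intc (c2.mul cuy) cφy sy) (intc (c2.mul cuy) cφ hc)
        (fun x y => ((hS x y).const_mul x).congr_of_eventuallyEq (Eventually.of_forall fun z => by beta_reduce; ring)) (hasDerivAt_pY hφ1)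
    have e1 : ∫ p, u p * grushinLap φ p
        = (∫ p, u p * pXX φ p) + ∫ p : ℝ × ℝ, (p.1 ^ 2 * u p) * pYY φ p := by
      refine Eq.trans ?_ (integral_add (intc cu cφxx sxx) (intc (c2.mul cu) cφyy syy))
      congr 1; funext p; simp only [grushinLap, Pi.mul_apply]; ring
    have e2 : ∫ p, (ux p * pX φ p + G p * φ p) = (∫ p, ux p * pX φ p) + ∫ p, G p * φ p :=
      integral_add (intc cux cφx sx) (intc cG cφ hc)
    have e3 : ∫ p, G p * φ p = (∫ p, F p * φ p) - ∫ p : ℝ × ℝ, (p.1 * S p) * φ p := by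
      refine Eq.trans ?_ (integral_sub (intc cF cφ hc) (intc (continuous_fst.mul cS) cφ hc))
      congr 1; funext p; simp only [hG, Pi.mul_apply]; ring
    have := hs φ hφ hc
    rw [e2, e3]; rw [e1, a1, b1, b2] at this; linarith
  refine dbr (f := fun x => ux (x, y)) (g := fun x => F (x, y) - x * S (x, y)) (by fun_prop) (by fun_prop) ?_ x
  intro α α' h1 h2 h3
  have ea : α' = deriv α := funext fun x => (h3 x).deriv.symm
  have ca : Continuous α' := ea ▸ (h1.continuous_deriv (by norm_num))
  have sa : HasCompactSupport α' := ea ▸ h2.deriv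
  have cint : Continuous fun y => ∫ x, (ux (x, y) * α' x + G (x, y) * α x) := by
    rw [← continuousOn_univ]
    refine continuousOn_integral_of_compact_support (k := tsupport α ∪ tsupport α') (h2.isCompact.union sa.isCompact) ?_ ?_
    · apply Continuous.continuousOn
      unfold Function.uncurry
      fun_prop
    · intro p x _ hx
      rw [mem_union, not_or] at hx
      rw [image_eq_zero_of_notMem_tsupport hx.1, image_eq_zero_of_notMem_tsupport hx.2]; ring
  have z := (Continuous.ae_eq_iff_eq volume cint continuous_const (g := fun _ => (0:ℝ))).1 (by
    refine ae_eq_zero_of_integral_contDiff_smul_eq_zero cint.locallyIntegrable ?_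
    intro β b1 b2
    have hφ : ContDiff ℝ 2 fun p : ℝ × ℝ => α p.1 * β p.2 :=
      ((contDiff_infty.1 h1 2).comp contDiff_fst).mul ((contDiff_infty.1 b1 2).comp contDiff_snd)
    have hw := weak _ hφ (prod_cc h2 b2)
    have epx : ∀ p : ℝ × ℝ, pX (fun p : ℝ × ℝ => α p.1 * β p.2) p = α' p.1 * β p.2 := fun p =>
      ((h3 p.1).mul_const (β p.2)).deriv
    simp only [epx] at hw
    have hi : Integrable (fun p : ℝ × ℝ => ux p * (α' p.1 * β p.2) + G p * (α p.1 * β p.2)) (volume.prod volume) :=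
      (intc cux (by fun_prop) (prod_cc sa b2)).add (intc cG hφ.continuous (prod_cc h2 b2))
    have hw2 := integral_prod_symm _ hi
    rw [← hw]
    refine Eq.trans ?_ hw2.symm
    congr 1; funext y
    rw [smul_eq_mul, ← integral_const_mul]
    congr 1; funext x; ring)
  exact congrFun z y
end

section
open MeasureTheory Filter Topology Set

theorem BM.intm {h g : ℝ × ℝ → ℝ} {C : ℝ} (hh : BM h C) (hg : Integrable g) : Integrable fun p => h p * g p :=
  hg.bdd_mul (c := C) hh.1.aestronglyMeasurable (Eventually.of_forall hh.2)

theorem int_lap {φ : ℝ × ℝ → ℝ} (h1 : ContDiff ℝ 2 φ) (h2 : HasCompactSupport φ) : Integrable (grushinLap φ) :=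
  int_of_cc (continuous_lap h1) (hcs_lap h1 h2)

theorem BM.add {f g : ℝ × ℝ → ℝ} {C D : ℝ} (hf : BM f C) (hg : BM g D) : BM (fun p => f p + g p) (C + D) :=
  ⟨hf.1.add hg.1, fun p => (abs_add_le _ _).trans (add_le_add (hf.2 p) (hg.2 p))⟩
theorem BM.sub {f g : ℝ × ℝ → ℝ} {C D : ℝ} (hf : BM f C) (hg : BM g D) : BM (fun p => f p - g p) (C + D) :=
  ⟨hf.1.sub hg.1, fun p => (abs_sub _ _).trans (add_le_add (hf.2 p) (hg.2 p))⟩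
theorem BM.smul {f : ℝ × ℝ → ℝ} {C : ℝ} (c : ℝ) (hf : BM f C) : BM (fun p => c * f p) (|c| * C) :=
  ⟨hf.1.const_mul c, fun p => by rw [abs_mul]; exact mul_le_mul_of_nonneg_left (hf.2 p) (abs_nonneg _)⟩

theorem DSol.add {u v F G : ℝ × ℝ → ℝ} {A B C D : ℝ} (h1 : BM u A) (h2 : BM v B) (h3 : BM F C) (h4 : BM G D)
    (hu : DSol u F) (hv : DSol v G) : DSol (fun p => u p + v p) (fun p => F p + G p) := by
  intro φ a b
  have i := int_lap a b
  have j := int_of_cc a.continuous b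
  simp only [add_mul]
  rw [integral_add (h1.intm i) (h2.intm i), integral_add (h3.intm j) (h4.intm j), hu φ a b, hv φ a b]

theorem DSol.smul {u F : ℝ × ℝ → ℝ} (c : ℝ) (hu : DSol u F) : DSol (fun p => c * u p) (fun p => c * F p) := by
  intro φ a b
  simp only [mul_assoc]
  rw [integral_const_mul, integral_const_mul, hu φ a b]

theorem DSol.sub {u v F G : ℝ × ℝ → ℝ} {A B C D : ℝ} (h1 : BM u A) (h2 : BM v B) (h3 : BM F C) (h4 : BM G D)
    (hu : DSol u F) (hv : DSol v G) : DSol (fun p => u p - v p) (fun p => F p - G p) := by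
  intro φ a b
  have i := int_lap a b
  have j := int_of_cc a.continuous b
  simp only [sub_mul]
  rw [integral_sub (h1.intm i) (h2.intm i), integral_sub (h3.intm j) (h4.intm j), hu φ a b, hv φ a b]

theorem dsol_lim {un Fn : ℕ → ℝ × ℝ → ℝ} {u F : ℝ × ℝ → ℝ} {D E : ℝ} (hu : ∀ n, BM (un n) D) (hF : ∀ n, BM (Fn n) E)
    (hs : ∀ n, DSol (un n) (Fn n)) (lu : ∀ p, Tendsto (fun n => un n p) atTop (𝓝 (u p)))
    (lF : ∀ p, Tendsto (fun n => Fn n p) atTop (𝓝 (F p))) : DSol u F := by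
  intro φ a b
  have i := int_lap a b
  have j := int_of_cc a.continuous b
  have l : ∀ (un : ℕ → ℝ × ℝ → ℝ) (u g : ℝ × ℝ → ℝ) (D : ℝ), (∀ n, BM (un n) D) → (∀ p, Tendsto (fun n => un n p) atTop (𝓝 (u p))) →
      Integrable g → Tendsto (fun n => ∫ p, un n p * g p) atTop (𝓝 (∫ p, u p * g p)) := by
    intro un u g D h1 h2 h3
    refine tendsto_integral_of_dominated_convergence (fun p => D * |g p|) (fun n => ((h1 n).intm h3).aestronglyMeasurable)
      (h3.abs.const_mul D) (fun n => Eventually.of_forall fun p => ?_) (Eventually.of_forall fun p => (h2 p).mul_const _)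
    rw [norm_mul]; exact mul_le_mul_of_nonneg_right ((h1 n).2 p) (norm_nonneg _)
  have l1 := l un u _ D hu lu i
  have l2 := l Fn F φ E hF lF j
  refine tendsto_nhds_unique l1 (l2.congr fun n => ?_)
  exact (hs n φ a b).symm

/-- change of variables for an affine diagonal isometry -/
noncomputable def affE (s t c d : ℝ) (hs : s * s = 1) (ht : t * t = 1) : (ℝ × ℝ) ≃ᵐ (ℝ × ℝ) where
  toFun := fun p => (s * p.1 + c, t * p.2 + d)
  invFun := fun p => (s * (p.1 - c), t * (p.2 - d))
  left_inv := fun p => by ext <;> simp [← mul_assoc, hs, ht]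
  right_inv := fun p => by ext <;> simp [← mul_assoc, hs, ht]
  measurable_toFun := by change Measurable (fun p : ℝ × ℝ => (s * p.1 + c, t * p.2 + d)); fun_prop
  measurable_invFun := by change Measurable (fun p : ℝ × ℝ => (s * (p.1 - c), t * (p.2 - d))); fun_prop

theorem mp_lin (s c : ℝ) (hs : s * s = 1) : MeasurePreserving (fun x : ℝ => s * x + c) := by
  rcases mul_self_eq_one_iff.1 hs with h | h
  · subst h; simpa using measurePreserving_add_right (volume : Measure ℝ) c
  · subst h
    have := (measurePreserving_add_right (volume : Measure ℝ) c).comp (Measure.measurePreserving_neg (volume : Measure ℝ))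
    have e : (fun x : ℝ => -1 * x + c) = (fun x => x + c) ∘ Neg.neg := by funext x; simp
    rw [e]; exact this

theorem int_aff (s t c d : ℝ) (hs : s * s = 1) (ht : t * t = 1) (f : ℝ × ℝ → ℝ) :
    ∫ p : ℝ × ℝ, f (s * p.1 + c, t * p.2 + d) = ∫ p, f p :=
  ((mp_lin s c hs).prod (mp_lin t d ht)).integral_comp (affE s t c d hs ht).measurableEmbedding f

theorem dd_aff (t d : ℝ) (ht : t * t = 1) (f : ℝ → ℝ) (y : ℝ) : deriv (deriv fun y => f (t * y + d)) y = deriv (deriv f) (t * y + d) := by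
  have e : ∀ (f : ℝ → ℝ) y, deriv (fun y => f (t * y + d)) y = t * deriv f (t * y + d) := fun f y => by
    have h1 := deriv_comp_mul_left t (fun z => f (z + d)) y
    rw [h1, deriv_comp_add_const, smul_eq_mul]
  have e1 : deriv (fun y => f (t * y + d)) = fun y => t * deriv f (t * y + d) := funext (e f)
  rw [e1, deriv_const_mul_field, e, ← mul_assoc, ht, one_mul]

theorem lap_aff (s t d : ℝ) (hs : s * s = 1) (ht : t * t = 1) (φ : ℝ × ℝ → ℝ) (p : ℝ × ℝ) :
    grushinLap (fun p : ℝ × ℝ => φ (s * p.1 + 0, t * p.2 + d)) p = grushinLap φ (s * p.1 + 0, t * p.2 + d) := by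
  unfold grushinLap pXX pYY
  rw [dd_aff s 0 hs (fun x => φ (x, t * p.2 + d)), dd_aff t d ht (fun y => φ (s * p.1 + 0, y))]
  have : (s * p.1 + 0) ^ 2 = p.1 ^ 2 := by rw [add_zero, mul_pow, sq s, hs, one_mul]
  simp only [this]

theorem DSol.aff {u F : ℝ × ℝ → ℝ} (hu : DSol u F) (s t d : ℝ) (hs : s * s = 1) (ht : t * t = 1) :
    DSol (fun p : ℝ × ℝ => u (s * p.1 + 0, t * p.2 + d)) (fun p => F (s * p.1 + 0, t * p.2 + d)) := by
  intro φ a b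
  set ψ : ℝ × ℝ → ℝ := fun p => φ (s * p.1 + 0, t * p.2 + (-(t * d))) with hψ
  have inv : ∀ p : ℝ × ℝ, ψ (s * p.1 + 0, t * p.2 + d) = φ p := fun p => by
    simp only [hψ]
    congr 1
    ext
    · simp only [add_zero]; rw [← mul_assoc, hs, one_mul]
    · show t * (t * p.2 + d) + -(t * d) = p.2
      have : t * (t * p.2 + d) + -(t * d) = t * t * p.2 := by ring
      rw [this, ht, one_mul]
  have eφ : φ = fun p : ℝ × ℝ => ψ (s * p.1 + 0, t * p.2 + d) := funext fun p => (inv p).symm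
  have cψ : ContDiff ℝ 2 ψ := a.comp (by fun_prop)
  have sψ : HasCompactSupport ψ := by
    have hco := b.comp_homeomorph (((Homeomorph.mulLeft₀ s (by rintro rfl; simp at hs)).trans (Homeomorph.addRight 0)).prodCongr
      ((Homeomorph.mulLeft₀ t (by rintro rfl; simp at ht)).trans (Homeomorph.addRight (-(t * d)))))
    exact hco
  have := hu ψ cψ sψ
  rw [← int_aff s t 0 d hs ht, ← int_aff s t 0 d hs ht (fun p => F p * ψ p)] at this
  rw [eφ]
  simp only [lap_aff s t d hs ht ψ]
  exact this

theorem BM.aff {u : ℝ × ℝ → ℝ} {C : ℝ} (h : BM u C) (s t c d : ℝ) : BM (fun p : ℝ × ℝ => u (s * p.1 + c, t * p.2 + d)) C :=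
  ⟨h.1.comp (by fun_prop), fun p => h.2 _⟩

theorem CS.aff {u F : ℝ × ℝ → ℝ} {D E : ℝ} (h : CS u F D E) (s t d : ℝ) (hs : s * s = 1) (ht : t * t = 1) :
    CS (fun p : ℝ × ℝ => u (s * p.1 + 0, t * p.2 + d)) (fun p => F (s * p.1 + 0, t * p.2 + d)) D E :=
  ⟨h.cont.comp (by fun_prop), fun p => h.bd _, h.hF.aff _ _ _ _, h.ds.aff s t d hs ht⟩

theorem CS.transY {u F : ℝ × ℝ → ℝ} {D E : ℝ} (h : CS u F D E) (d : ℝ) :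
    CS (fun p : ℝ × ℝ => u (p.1, p.2 + d)) (fun p => F (p.1, p.2 + d)) D E := by
  simpa using h.aff 1 1 d (by norm_num) (by norm_num)

theorem CS.sub {u v F G : ℝ × ℝ → ℝ} {A B C D : ℝ} (h1 : CS u F A B) (h2 : CS v G C D) :
    CS (fun p => u p - v p) (fun p => F p - G p) (A + C) (B + D) :=
  ⟨h1.cont.sub h2.cont, (h1.bm.sub h2.bm).2, h1.hF.sub h2.hF, h1.ds.sub h1.bm h2.bm h1.hF h2.hF h2.ds⟩

theorem mvt_y {u uy : ℝ × ℝ → ℝ} {M : ℝ} (hd : ∀ x y, HasDerivAt (fun y => u (x, y)) (uy (x, y)) y) (hB : ∀ p, |uy p| ≤ M) (x y τ : ℝ) :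
    |u (x, y + τ) - u (x, y)| ≤ M * |τ| := by
  have := Convex.norm_image_sub_le_of_norm_hasDerivWithin_le (f := fun y => u (x, y)) (f' := fun y => uy (x, y)) (s := univ) (C := M)
      (x := y) (y := y + τ) (fun z _ => (hd x z).hasDerivWithinAt) (fun z _ => hB _) convex_univ (mem_univ _) (mem_univ _)
  simpa using this

theorem CS.dy {u F uy Fy : ℝ × ℝ → ℝ} {D E M N : ℝ} (h : CS u F D E) (cuy : Continuous uy) (hM : ∀ p, |uy p| ≤ M) (hFy : BM Fy N)
    (du : ∀ x y, HasDerivAt (fun y => u (x, y)) (uy (x, y)) y) (dF : ∀ x y, HasDerivAt (fun y => F (x, y)) (Fy (x, y)) y) :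
    CS uy Fy M N := by
  refine ⟨cuy, hM, hFy, ?_⟩
  have gen : ∀ {u uy : ℝ × ℝ → ℝ} {D M : ℝ}, BM u D → (∀ p, |uy p| ≤ M) → (∀ x y, HasDerivAt (fun y => u (x, y)) (uy (x, y)) y) →
      (∀ n : ℕ, BM (fun p : ℝ × ℝ => ((n : ℝ) + 1) * (u (p.1, p.2 + 1 / ((n : ℝ) + 1)) - u p)) M) ∧
      ∀ p : ℝ × ℝ, Tendsto (fun n : ℕ => ((n : ℝ) + 1) * (u (p.1, p.2 + 1 / ((n : ℝ) + 1)) - u p)) atTop (𝓝 (uy p)) := by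
    intro u uy D M hu hM hd
    constructor
    · intro n
      refine ⟨Measurable.const_mul ((hu.1.comp (by fun_prop)).sub hu.1) _, fun p => ?_⟩
      have := mvt_y hd hM p.1 p.2 (1 / ((n : ℝ) + 1))
      have hp : (0:ℝ) < n + 1 := by positivity
      rw [abs_of_pos (seq_pos n)] at this
      rw [abs_mul, abs_of_pos hp]
      calc _ ≤ ((n : ℝ) + 1) * (M * (1 / ((n : ℝ) + 1))) := mul_le_mul_of_nonneg_left this hp.le
        _ = M := by field_simp
    · intro p
      have h1 := (hd p.1 p.2).tendsto_slope_zero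
      have h2 : Tendsto (fun n : ℕ => 1 / ((n : ℝ) + 1)) atTop (𝓝[≠] 0) :=
        tendsto_nhdsWithin_iff.2 ⟨seq_lim, Eventually.of_forall fun n => (seq_pos n).ne'⟩
      refine (h1.comp h2).congr fun n => ?_
      simp
  obtain ⟨a1, a2⟩ := gen h.bm hM du
  obtain ⟨b1, b2⟩ := gen h.hF hFy.2 dF
  refine dsol_lim a1 b1 (fun n => ?_) a2 b2
  exact ((h.transY _).ds.sub (h.transY _).bm h.bm (h.transY _).hF h.hF h.ds).smul _

theorem second_deriv_max {f f' : ℝ → ℝ} {c x0 : ℝ} (h1 : ∀ x, HasDerivAt f (f' x) x) (h2 : HasDerivAt f' c x0) (hm : IsLocalMax f x0) : c ≤ 0 := by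
  by_contra hc
  push Not at hc
  have e : deriv f = f' := funext fun x => (h1 x).deriv
  have hmin : IsLocalMin f x0 := by
    apply isLocalMin_of_deriv_deriv_pos
    · rw [e, h2.deriv]; exact hc
    · rw [hm.deriv_eq_zero]
    · exact (h1 x0).continuousAt
  have ec : f =ᶠ[𝓝 x0] fun _ => f x0 := by
    filter_upwards [hm, hmin] with x a b using le_antisymm a b
  have e0 : f' =ᶠ[𝓝 x0] fun _ => 0 := by
    filter_upwards [ec.eventuallyEq_nhds] with x hx
    rw [← e, hx.deriv_eq, deriv_const]
  have := h2.congr_of_eventuallyEq e0.symm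
  have := this.unique (hasDerivAt_const x0 (0:ℝ))
  linarith

theorem uniq_le {k : ℝ} (hk : 0 < k) {z : ℝ × ℝ → ℝ} {D E : ℝ} (h : CS z (fun p => k * z p) D E) (p0 : ℝ × ℝ) : z p0 ≤ 0 := by
  obtain ⟨A1, hA1, r1⟩ := CS.regY
  have hy1 := r1 _ _ _ _ h
  have hyF : HolY (fun p => k * z p) (3/4) (k * (A1 * (D + E))) := fun x y τ => by
    rw [← mul_sub, abs_mul, abs_of_pos hk, mul_assoc]
    exact mul_le_mul_of_nonneg_left (hy1 x y τ) hk.le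
  obtain ⟨zy, czy, dzy, M, bzy⟩ := h.regYd (by norm_num) (by norm_num) hyF
  have h2 : CS zy (fun p => k * zy p) M (|k| * M) :=
    h.dy czy bzy (BM.smul k ⟨czy.measurable, bzy⟩) dzy (fun x y => (dzy x y).const_mul k)
  have hy2 := r1 _ _ _ _ h2
  have hyF2 : HolY (fun p => k * zy p) (3/4) (k * (A1 * (M + |k| * M))) := fun x y τ => by
    have e : |k * zy (x, y + τ) - k * zy (x, y)| = k * |zy (x, y + τ) - zy (x, y)| := by
      rw [← mul_sub, abs_mul, abs_of_pos hk]
    rw [e, mul_assoc]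
    exact mul_le_mul_of_nonneg_left (hy2 x y τ) hk.le
  obtain ⟨zyy, czyy, dzyy, _⟩ := h2.regYd (by norm_num) (by norm_num) hyF2
  obtain ⟨_, _, rX⟩ := CS.regX
  obtain ⟨zx, czx, dzx, _, _⟩ := rX _ _ _ _ h
  have dxx := fun x y => xx_lemma h.cont czx czy (continuous_const.mul h.cont) (continuous_fst.mul czyy) dzx dzy
    (S := fun p => p.1 * zyy p) (fun x y => (dzyy x y).const_mul x) h.ds x y
  by_contra hp
  push Not at hp
  set A := 100 / k ^ 2 with hA
  have hAp : 0 < A := by positivity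
  set b : ℝ × ℝ → ℝ := fun p => A + p.1 ^ 4 + 4 * p.2 ^ 2 with hb
  have cb : Continuous b := by fun_prop
  have bpos : ∀ p, 0 < b p := fun p => by simp only [hb]; positivity
  set ε := z p0 / (2 * b p0) with hε
  have hεp : 0 < ε := div_pos hp (by have := bpos p0; positivity)
  set m : ℝ × ℝ → ℝ := fun p => z p - ε * b p with hm
  have cm : Continuous m := h.cont.sub (continuous_const.mul cb)
  have m0 : 0 < m p0 := by
    have : m p0 = z p0 / 2 := by simp only [hm, hε]; have := bpos p0; field_simp; ring
    rw [this]; positivity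
  set K : Set (ℝ × ℝ) := {p | 0 ≤ m p}
  have hKc : IsClosed K := isClosed_le continuous_const cm
  have hKb : K ⊆ Metric.closedBall 0 (1 + D / ε) := by
    intro p hp
    have hp' : 0 ≤ m p := hp
    simp only [hm, hb] at hp'
    have hz := (le_abs_self _).trans (h.bd p)
    have hr : p.1 ^ 4 + 4 * p.2 ^ 2 ≤ D / ε := by
      rw [le_div_iff₀ hεp]; nlinarith
    have r0 : 0 ≤ D / ε := div_nonneg h.D_nn hεp.le
    rw [mem_closedBall_zero_iff, Prod.norm_def, Real.norm_eq_abs, Real.norm_eq_abs]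
    refine max_le ?_ ?_
    · by_contra hn
      push Not at hn
      have e : p.1 ^ 4 = |p.1| ^ 4 := by rw [← abs_pow, abs_of_nonneg (by positivity)]
      have : |p.1| ≤ |p.1| ^ 4 := le_self_pow₀ (by linarith) (by norm_num)
      nlinarith [sq_nonneg p.2]
    · by_contra hn
      push Not at hn
      have : |p.2| ≤ |p.2| ^ 2 := le_self_pow₀ (by linarith) (by norm_num)
      rw [sq_abs] at this
      have : 0 ≤ p.1 ^ 4 := by positivity
      linarith
  have hK : IsCompact K := (isCompact_closedBall _ _).of_isClosed_subset hKc hKb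
  obtain ⟨p1, hp1, hmax⟩ := hK.exists_isMaxOn ⟨p0, m0.le⟩ cm.continuousOn
  have gmax : ∀ p, m p ≤ m p1 := fun p => by
    by_cases hpK : p ∈ K
    · exact hmax hpK
    · have : ¬ 0 ≤ m p := hpK
      have : 0 ≤ m p1 := hp1
      linarith
  have m1 : 0 < m p1 := m0.trans_le (gmax p0)
  obtain ⟨x, y⟩ := p1
  have c1 : (k * z (x, y) - x * (x * zyy (x, y))) - ε * (12 * x ^ 2) ≤ 0 := by
    refine second_deriv_max (f := fun x => m (x, y)) (f' := fun x => zx (x, y) - ε * (4 * x ^ 3)) (x0 := x) ?_ ?_ (Eventually.of_forall fun x' => gmax _)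
    · intro x
      refine (dzx x y).sub (HasDerivAt.const_mul ε ?_)
      simp only [hb]
      have := (((hasDerivAt_pow 4 x).const_add A).add_const (4 * y ^ 2))
      refine this.congr_deriv ?_
      norm_num
    · refine (dxx x y).sub (HasDerivAt.const_mul ε ?_)
      refine ((hasDerivAt_pow 3 x).const_mul 4).congr_deriv ?_
      norm_num; ring
  have c2 : zyy (x, y) - ε * 8 ≤ 0 := by
    refine second_deriv_max (f := fun y => m (x, y)) (f' := fun y => zy (x, y) - ε * (8 * y)) (x0 := y) ?_ ?_ (Eventually.of_forall fun x' => gmax _)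
    · intro y
      refine (dzy x y).sub (HasDerivAt.const_mul ε ?_)
      simp only [hb]
      have := (((hasDerivAt_pow 2 y).const_mul 4).const_add (A + x ^ 4))
      refine this.congr_deriv ?_
      norm_num; ring
    · refine (dzyy x y).sub (HasDerivAt.const_mul ε ?_)
      simpa using (hasDerivAt_id y).const_mul 8
  have hk2 : k * A = 100 / k := by rw [hA]; field_simp
  have key : 20 * x ^ 2 ≤ k * (A + x ^ 4) := by
    have : k * (k * (A + x ^ 4) - 20 * x ^ 2) = (k * x ^ 2 - 10) ^ 2 := by
      rw [hA]; field_simp; ring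
    have h3 : 0 ≤ k * (k * (A + x ^ 4) - 20 * x ^ 2) := this ▸ sq_nonneg _
    have := nonneg_of_mul_nonneg_right h3 hk
    linarith
  have f1 : k * z (x, y) ≤ ε * (20 * x ^ 2) := by nlinarith [sq_nonneg x, mul_le_mul_of_nonneg_left c2 (sq_nonneg x)]
  have f2 : ε * (20 * x ^ 2) ≤ ε * (k * b (x, y)) := by
    apply mul_le_mul_of_nonneg_left _ hεp.le
    simp only [hb]
    nlinarith [sq_nonneg y, mul_nonneg hk.le (sq_nonneg y)]
  have f3 : k * m (x, y) ≤ 0 := by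
    have : k * m (x, y) = k * z (x, y) - ε * (k * b (x, y)) := by simp only [hm]; ring
    linarith
  nlinarith
end

section
open MeasureTheory Filter Topology Set

theorem dsol_const (c : ℝ) : DSol (fun _ => c) (fun _ => 0) := by
  have := dsol_of_contDiff (u := fun _ : ℝ × ℝ => c) contDiff_const
  have e : grushinLap (fun _ : ℝ × ℝ => c) = fun _ => 0 := by
    funext p; simp [grushinLap, pXX, pYY]
  rwa [e] at this

theorem cs_of_eq {u v F G : ℝ × ℝ → ℝ} {D E : ℝ} (h : CS u F D E) (h1 : u = v) (h2 : F = G) : CS v G D E := by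
  subst h1; subst h2; exact h

theorem BM.mono {u : ℝ × ℝ → ℝ} {C D : ℝ} (h : BM u C) (hc : C ≤ D) : BM u D := ⟨h.1, fun p => (h.2 p).trans hc⟩

theorem sol_exists {k : ℝ} (hk : 0 < k) {h : ℝ × ℝ → ℝ} {C : ℝ} (hh : BM h C) :
    ∃ v, CS v (fun p => k * v p - h p) (C / k) (C + C) := by
  have hC := hh.nonneg
  obtain ⟨v, m, b, ds⟩ := exist_nonneg hk (h := fun p => h p + C) (hh.1.add_const C) (H := 2 * C)
    (fun p => by have := abs_le.1 (hh.2 p); constructor <;> linarith)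
  have b1 : BM v (2 * C / k) := ⟨m, fun p => by rw [abs_of_nonneg (b p).1]; exact (b p).2⟩
  have b2 : BM (fun p => k * v p - (h p + C)) (|k| * (2 * C / k) + (C + |C|)) :=
    (b1.smul k).sub (hh.add (BM_const C))
  have ds1 := ds.sub (v := fun _ => C / k) b1 (BM_const _) b2 (BM_const 0) (dsol_const _)
  have ds2 : DSol (fun p => v p - C / k) (fun p => k * (v p - C / k) - h p) := by
    convert ds1 using 2 with p
    field_simp; ring
  have b3 : BM (fun p => v p - C / k) (C / k) := ⟨m.sub_const _, fun p => by
    have := b p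
    have e : 2 * C / k = C / k + C / k := by ring
    rw [abs_le]; constructor <;> linarith⟩
  have b4 : BM (fun p => k * (v p - C / k) - h p) (C + C) :=
    ((b3.smul k).sub hh).mono (by rw [abs_of_pos hk]; field_simp; rfl)
  obtain ⟨w, hw, ew⟩ := exists_cs b3 b4 ds2
  refine ⟨w, hw.cont, hw.bd, ?_, ?_⟩
  · have bw : BM w (C / k) := hw.bm
    exact ((bw.smul k).sub hh).mono (by rw [abs_of_pos hk]; field_simp; rfl)
  · refine dsol_congr' ?_ hw.ds
    filter_upwards [ew] with p hp
    rw [← hp]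

theorem sol_uniq0 {k : ℝ} (hk : 0 < k) {z : ℝ × ℝ → ℝ} {D E : ℝ} (h : CS z (fun p => k * z p) D E) (p : ℝ × ℝ) : z p = 0 := by
  refine le_antisymm (uniq_le hk h p) ?_
  have h0 : CS (fun _ => (0:ℝ)) (fun _ => 0) 0 0 := ⟨continuous_const, by simp, ⟨measurable_const, by simp⟩, dsol_const 0⟩
  have := uniq_le hk (z := fun p => 0 - z p) (cs_of_eq (h0.sub h) rfl (by funext p; ring)) p
  linarith

theorem sol_mono {k : ℝ} (hk : 0 < k) {h h' v v' : ℝ × ℝ → ℝ} {D E D' E' C : ℝ} (s : CS v (fun p => k * v p - h p) D E)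
    (s' : CS v' (fun p => k * v' p - h' p) D' E') (hh : BM h C) (hh' : BM h' C) (hle : ∀ p, h p ≤ h' p) (p : ℝ × ℝ) : v p ≤ v' p := by
  have bd : BM (fun p => h' p - h p) (C + C) := hh'.sub hh
  obtain ⟨z, m, b, ds⟩ := exist_nonneg hk (h := fun p => h' p - h p) bd.1 (H := C + C)
    (fun p => ⟨by have := hle p; linarith, (le_abs_self _).trans (bd.2 p)⟩)
  have bz : BM z ((C + C) / k) := ⟨m, fun p => by rw [abs_of_nonneg (b p).1]; exact (b p).2⟩
  obtain ⟨w, hw, ew⟩ := exists_cs bz ((bz.smul k).sub bd) ds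
  have w0 : 0 ≤ w p := ae_bd hw.cont (s := Ici 0) isClosed_Ici (by filter_upwards [ew] with q hq; rw [← hq]; exact (b q).1) p
  have hw' : CS w (fun p => k * w p - (h' p - h p)) ((C + C) / k) (|k| * ((C + C) / k) + (C + C)) := by
    refine ⟨hw.cont, hw.bd, (hw.bm.smul k).sub bd, dsol_congr' ?_ hw.ds⟩
    filter_upwards [ew] with p hp
    rw [← hp]
  have := sol_uniq0 hk (z := fun p => v' p - v p - w p) (cs_of_eq ((s'.sub s).sub hw') rfl (by funext p; ring)) p
  linarith

theorem sol_uniq {k : ℝ} (hk : 0 < k) {h v v' : ℝ × ℝ → ℝ} {D E D' E' : ℝ} (s : CS v (fun p => k * v p - h p) D E)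
    (s' : CS v' (fun p => k * v' p - h p) D' E') : v = v' := by
  funext p
  have := sol_uniq0 hk (z := fun p => v' p - v p) (cs_of_eq (s'.sub s) rfl (by funext p; ring)) p
  linarith

open Classical in
/-- resolvent of the Grushin Laplacian -/
noncomputable def TT (k : ℝ) (h : ℝ × ℝ → ℝ) : ℝ × ℝ → ℝ :=
  if H : ∃ v D E, CS v (fun p => k * v p - h p) D E then H.choose else fun _ => 0

theorem TT_spec {k : ℝ} (hk : 0 < k) {h : ℝ × ℝ → ℝ} {C : ℝ} (hh : BM h C) : CS (TT k h) (fun p => k * TT k h p - h p) (C / k) (C + C) := by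
  obtain ⟨v, hv⟩ := sol_exists hk hh
  have H : ∃ v D E, CS v (fun p => k * v p - h p) D E := ⟨v, _, _, hv⟩
  have : TT k h = H.choose := dif_pos H
  obtain ⟨D, E, hs⟩ := H.choose_spec
  rw [← this] at hs
  rw [sol_uniq hk hs hv]; exact hv

theorem TT_eq {k : ℝ} (hk : 0 < k) {h v : ℝ × ℝ → ℝ} {C D E : ℝ} (hh : BM h C) (s : CS v (fun p => k * v p - h p) D E) : TT k h = v :=
  sol_uniq hk (TT_spec hk hh) s

theorem TT_cont {k : ℝ} (hk : 0 < k) {h : ℝ × ℝ → ℝ} {C : ℝ} (hh : BM h C) : Continuous (TT k h) := (TT_spec hk hh).cont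

theorem TT_mono {k : ℝ} (hk : 0 < k) {h h' : ℝ × ℝ → ℝ} {C : ℝ} (hh : BM h C) (hh' : BM h' C) (hle : ∀ p, h p ≤ h' p) (p : ℝ × ℝ) :
    TT k h p ≤ TT k h' p := sol_mono hk (TT_spec hk hh) (TT_spec hk hh') hh hh' hle p

theorem TT_const {k : ℝ} (hk : 0 < k) (c : ℝ) (p : ℝ × ℝ) : TT k (fun _ => c) p = c / k := by
  have : CS (fun _ => c / k) (fun p => k * (c / k) - c) (|c / k|) 0 :=
    ⟨continuous_const, fun _ => le_rfl, ⟨measurable_const, fun _ => by field_simp; simp⟩, by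
      have := dsol_const (c / k)
      convert this using 2; field_simp; ring⟩
  rw [TT_eq hk (BM_const c) this]

theorem TT_aff {k : ℝ} (hk : 0 < k) {h : ℝ × ℝ → ℝ} {C : ℝ} (hh : BM h C) (s t d : ℝ) (hs : s * s = 1) (ht : t * t = 1) (p : ℝ × ℝ) :
    TT k (fun p : ℝ × ℝ => h (s * p.1 + 0, t * p.2 + d)) p = TT k h (s * p.1 + 0, t * p.2 + d) := by
  rw [TT_eq hk (hh.aff s t 0 d) ((TT_spec hk hh).aff s t d hs ht)]

theorem TT_sub {k : ℝ} (hk : 0 < k) {h h' : ℝ × ℝ → ℝ} {C C' : ℝ} (hh : BM h C) (hh' : BM h' C') (p : ℝ × ℝ) :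
    TT k (fun p => h p - h' p) p = TT k h p - TT k h' p := by
  rw [TT_eq hk (hh.sub hh') (cs_of_eq ((TT_spec hk hh).sub (TT_spec hk hh')) rfl (by funext p; ring))]

theorem TT_smul {k : ℝ} (hk : 0 < k) {h : ℝ × ℝ → ℝ} {C : ℝ} (hh : BM h C) (c : ℝ) (p : ℝ × ℝ) :
    TT k (fun p => c * h p) p = c * TT k h p := by
  have s := TT_spec hk hh
  have : CS (fun p => c * TT k h p) (fun p => k * (c * TT k h p) - c * h p) _ _ :=
    ⟨continuous_const.mul s.cont, (s.bm.smul c).2, ((s.bm.smul c).smul k).sub (hh.smul c), by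
      have := s.ds.smul c
      convert this using 2; ring⟩
  rw [TT_eq hk (hh.smul c) this]

/-- classical compactly supported functions are reproduced -/
theorem bm_of_cc {φ : ℝ × ℝ → ℝ} (hc : Continuous φ) (h : HasCompactSupport φ) : ∃ C, BM φ C := by
  obtain ⟨C, hC⟩ := h.exists_bound_of_continuous hc
  exact ⟨C, hc.measurable, hC⟩

theorem TT_cc {k : ℝ} (hk : 0 < k) {φ : ℝ × ℝ → ℝ} (h1 : ContDiff ℝ 2 φ) (h2 : HasCompactSupport φ) :
    (∃ C, BM (fun p => k * φ p - grushinLap φ p) C) ∧ TT k (fun p => k * φ p - grushinLap φ p) = φ := by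
  obtain ⟨C, hC⟩ := bm_of_cc h1.continuous h2
  obtain ⟨D, hD⟩ := bm_of_cc (continuous_lap h1) (hcs_lap h1 h2)
  have b := (hC.smul k).sub hD
  refine ⟨⟨_, b⟩, TT_eq hk b (D := C) (E := D) ⟨h1.continuous, hC.2, ?_, ?_⟩⟩
  · convert hD using 2; ring
  · convert dsol_of_contDiff h1 using 2; ring
end

section
open MeasureTheory Filter Topology Set

/-- right half plane -/
def HP : Set (ℝ × ℝ) := {p | 0 < p.1}

theorem HP_meas : MeasurableSet HP := measurableSet_lt measurable_const measurable_fst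

theorem null_axis : ∀ᵐ p : ℝ × ℝ, p.1 ≠ 0 := by
  have h := (Measure.quasiMeasurePreserving_fst (μ := (volume : Measure ℝ)) (ν := (volume : Measure ℝ)))
  have h0 : ∀ᵐ x : ℝ, x ≠ 0 := by
    rw [ae_iff]; simp
  exact h.ae h0

theorem int_odd {g χ : ℝ × ℝ → ℝ} {C : ℝ} (hg : BM g C) (ho : ∀ x y, g (-x, y) = -g (x, y)) (hχ : Integrable χ) :
    ∫ p, g p * χ p = ∫ p in HP, g p * (χ p - χ (-p.1, p.2)) := by
  have i := hg.intm hχ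
  have hχ' : Integrable (fun p : ℝ × ℝ => χ (-p.1, p.2)) := by
    have := ((mp_lin (-1) 0 (by norm_num)).prod (mp_lin 1 0 (by norm_num))).integrable_comp_of_integrable hχ
    have e : (χ ∘ Prod.map (fun x : ℝ => -1 * x + 0) fun x : ℝ => 1 * x + 0) = fun p : ℝ × ℝ => χ (-p.1, p.2) := by
      funext p; simp; rfl
    rw [e] at this; exact this
  have i' := hg.intm hχ'
  rw [← integral_add_compl HP_meas i]
  have e1 : ∫ p in HP, g p * (χ p - χ (-p.1, p.2)) = (∫ p in HP, g p * χ p) - ∫ p in HP, g p * χ (-p.1, p.2) := by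
    rw [← integral_sub i.integrableOn i'.integrableOn]
    simp only [mul_sub]
  rw [e1, sub_eq_add_neg]
  congr 1
  rw [← integral_indicator HP_meas, ← integral_indicator HP_meas.compl, ← int_aff (-1) 1 0 0 (by norm_num) (by norm_num), ← integral_neg]
  apply integral_congr_ae
  filter_upwards [null_axis] with p hp
  by_cases h : p ∈ HP
  · have h2 : (-1 * p.1 + 0, 1 * p.2 + 0) ∈ HPᶜ := by
      have : 0 < p.1 := h
      simp only [mem_compl_iff, HP, mem_ofPred_eq, not_lt]; linarith
    rw [indicator_of_mem h2, indicator_of_mem h]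
    simp [ho]
  · have h2 : (-1 * p.1 + 0, 1 * p.2 + 0) ∉ HPᶜ := by
      have : ¬ 0 < p.1 := h
      have : p.1 < 0 := lt_of_le_of_ne (not_lt.1 this) hp
      simp only [mem_compl_iff, HP, mem_ofPred_eq, not_not]; linarith
    rw [indicator_of_notMem h2, indicator_of_notMem h]; simp

theorem frontier_HP (p : ℝ × ℝ) (hp : p ∈ frontier HP) : p.1 = 0 := by
  have := frontier_lt_subset_eq (f := fun _ : ℝ × ℝ => (0:ℝ)) (g := fun p : ℝ × ℝ => p.1) continuous_const continuous_fst hp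
  exact this.symm

/-- reflection positivity -/
theorem TT_RP {k : ℝ} (hk : 0 < k) {h : ℝ × ℝ → ℝ} {C : ℝ} (hh : BM h C) (ho : ∀ x y, h (-x, y) = -h (x, y))
    (hp : ∀ x y, 0 < x → 0 ≤ h (x, y)) (x y : ℝ) (hx : 0 < x) : 0 ≤ TT k h (x, y) := by
  obtain ⟨v, vm, vb, hv⟩ := hb_exist hk (Ω := HP) HP_meas oddSub (fun φ hφ => ⟨hφ.1.1, hφ.1.2, fun p hp => by
    have e := frontier_HP p hp
    have := hφ.2 p.1 p.2
    rw [e, neg_zero] at this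
    have e' : p = (0, p.2) := Prod.ext e rfl
    rw [e']; linarith⟩) (h := HP.indicator h) (hh.1.indicator HP_meas) (H := C) (fun p => by
      by_cases hpp : p ∈ HP
      · rw [indicator_of_mem hpp]; exact ⟨hp p.1 p.2 hpp, (le_abs_self _).trans (hh.2 p)⟩
      · rw [indicator_of_notMem hpp]; exact ⟨le_rfl, hh.nonneg⟩)
  set vo : ℝ × ℝ → ℝ := fun p => if 0 < p.1 then v p else if p.1 < 0 then - v (-p.1, p.2) else 0 with hvo
  have vom : Measurable vo := by
    refine Measurable.ite HP_meas vm (Measurable.ite (measurableSet_lt measurable_fst measurable_const) ?_ measurable_const)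
    exact (vm.comp (by fun_prop : Measurable fun p : ℝ × ℝ => (-p.1, p.2))).neg
  have hCk : 0 ≤ C / k := div_nonneg hh.nonneg hk.le
  have vob : BM vo (C / k) := ⟨vom, fun p => by
    simp only [hvo]
    split_ifs
    · rw [abs_of_nonneg (vb _).1]; exact (vb _).2
    · rw [abs_neg, abs_of_nonneg (vb _).1]; exact (vb _).2
    · simpa using hCk⟩
  have voo : ∀ x y, vo (-x, y) = - vo (x, y) := fun x y => by
    simp only [hvo]
    rcases lt_trichotomy x 0 with h | h | h
    · simp [h, h.le, not_lt.2 h.le]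
    · simp [h]
    · simp [h, not_lt.2 h.le]
  have ds : DSol vo (fun p => k * vo p - h p) := by
    intro φ hφ hc
    have i1 := int_lap hφ hc
    have i2 := int_of_cc hφ.continuous hc
    have bF : BM (fun p => k * vo p - h p) _ := (vob.smul k).sub hh
    rw [int_odd vob voo i1, int_odd bF (fun x y => by simp only [voo, ho]; ring) i2]
    set φr : ℝ × ℝ → ℝ := fun p => φ (-1 * p.1 + 0, 1 * p.2 + 0) with hφr
    have cr : ContDiff ℝ 2 φr := hφ.comp (by fun_prop)
    have hcr : HasCompactSupport φr := by
      refine hc.comp_homeomorph (φ := ⟨⟨fun p => (-1 * p.1 + 0, 1 * p.2 + 0), fun p => (-1 * p.1 + 0, 1 * p.2 + 0), fun p => by simp, fun p => by simp⟩, by fun_prop, by fun_prop⟩)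
    have hψ : φ + (-1 : ℝ) • φr ∈ oddSub := by
      refine ⟨testSub.add_mem ⟨hφ, hc⟩ (testSub.smul_mem (-1) ⟨cr, hcr⟩), fun x y => ?_⟩
      simp only [hφr, Pi.add_apply, Pi.smul_apply, smul_eq_mul]
      simp
    have key := hv _ hψ
    have eψ : ∀ p : ℝ × ℝ, (φ + (-1 : ℝ) • φr) p = φ p - φ (-p.1, p.2) := fun p => by
      simp only [hφr, Pi.add_apply, Pi.smul_apply, smul_eq_mul]; simp; ring
    have eL : ∀ p : ℝ × ℝ, grushinLap (φ + (-1 : ℝ) • φr) p = grushinLap φ p - grushinLap φ (-p.1, p.2) := fun p => by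
      have c2 : ContDiff ℝ 2 ((-1 : ℝ) • φr) := cr.const_smul (-1 : ℝ)
      rw [lap_add hφ c2, lap_smul, lap_aff (-1) 1 0 (by norm_num) (by norm_num)]
      simp; ring
    simp only [eψ, eL] at key
    have j1 : Integrable (fun p : ℝ × ℝ => φ p - φ (-p.1, p.2)) := by
      refine (int_of_cc (hψ.1.1.continuous) hψ.1.2).congr (Eventually.of_forall fun p => eψ p)
    have j2 : Integrable (fun p : ℝ × ℝ => grushinLap φ p - grushinLap φ (-p.1, p.2)) := by
      refine (int_lap hψ.1.1 hψ.1.2).congr (Eventually.of_forall fun p => eL p)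
    have bvv : BM v (C / k) := ⟨vm, fun p => by rw [abs_of_nonneg (vb _).1]; exact (vb _).2⟩
    have k1 : ∫ p in HP, v p * (k * (φ p - φ (-p.1, p.2)) - (grushinLap φ p - grushinLap φ (-p.1, p.2)))
        = (∫ p in HP, k * (v p * (φ p - φ (-p.1, p.2)))) - ∫ p in HP, v p * (grushinLap φ p - grushinLap φ (-p.1, p.2)) := by
      rw [← integral_sub ((bvv.intm j1).const_mul k).integrableOn (bvv.intm j2).integrableOn]
      congr 1; funext p; ring
    rw [k1] at key
    have k2 : ∫ p in HP, (k * vo p - h p) * (φ p - φ (-p.1, p.2)) = (∫ p in HP, k * (v p * (φ p - φ (-p.1, p.2)))) - ∫ p in HP, HP.indicator h p * (φ p - φ (-p.1, p.2)) := by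
      rw [← integral_sub ((bvv.intm j1).const_mul k).integrableOn (BM.intm ⟨hh.1.indicator HP_meas, fun p => ?_⟩ j1).integrableOn]
      · refine setIntegral_congr_fun HP_meas fun p hp => ?_
        have hp' : 0 < p.1 := hp
        simp only [hvo, if_pos hp', indicator_of_mem hp]; ring
      · exact C
      · by_cases hp : p ∈ HP
        · rw [indicator_of_mem hp]; exact hh.2 p
        · rw [indicator_of_notMem hp, abs_zero]; exact hh.nonneg
    have k3 : ∫ p in HP, vo p * (grushinLap φ p - grushinLap φ (-p.1, p.2)) = ∫ p in HP, v p * (grushinLap φ p - grushinLap φ (-p.1, p.2)) := by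
      refine setIntegral_congr_fun HP_meas fun p hp => ?_
      have hp' : 0 < p.1 := hp
      simp only [hvo, if_pos hp']
    rw [k2, k3]; linarith
  obtain ⟨w, hw, ew⟩ := exists_cs vob ((vob.smul k).sub hh) ds
  have hw' : CS w (fun p => k * w p - h p) (C / k) (|k| * (C / k) + C) := by
    refine ⟨hw.cont, hw.bd, (hw.bm.smul k).sub hh, dsol_congr' ?_ hw.ds⟩
    filter_upwards [ew] with p hp
    rw [← hp]
  rw [TT_eq hk hh hw']
  have cm : Continuous fun p : ℝ × ℝ => w p * max p.1 0 := hw.cont.mul (by fun_prop)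
  have := ae_bd cm (s := Ici 0) isClosed_Ici (by
    filter_upwards [ew] with p hp
    rw [← hp]
    by_cases h0 : 0 < p.1
    · simp only [hvo, if_pos h0]; exact mul_nonneg (vb _).1 (le_max_right _ _)
    · rw [max_eq_right (not_lt.1 h0), mul_zero]; exact mem_Ici.2 le_rfl) (x, y)
  have h3 : 0 ≤ w (x, y) * max x 0 := this
  rw [max_eq_left hx.le] at h3
  exact nonneg_of_mul_nonneg_left h3 hx
end

section
open MeasureTheory Filter Topology Set

/-- modulus of continuity -/
noncomputable def md (p q : ℝ × ℝ) : ℝ := |p.1 - q.1| + |p.2 - q.2| ^ (3/4 : ℝ)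

theorem md_lim (p : ℝ × ℝ) : Tendsto (fun q => md q p) (𝓝 p) (𝓝 0) := by
  have : Continuous fun q => md q p := by
    unfold md
    refine (by fun_prop : Continuous fun q : ℝ × ℝ => |q.1 - p.1|).add ?_
    exact (by fun_prop : Continuous fun q : ℝ × ℝ => |q.2 - p.2|).rpow_const (fun _ => Or.inr (by norm_num))
  have h := this.tendsto p
  simpa [md, Real.zero_rpow] using h

theorem cs_modulus : ∃ A, 0 ≤ A ∧ ∀ (u F : ℝ × ℝ → ℝ) (D E : ℝ), CS u F D E → ∀ p q, |u p - u q| ≤ A * (D + E) * md p q := by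
  obtain ⟨A, hA, h1⟩ := CS.regY
  obtain ⟨B, hB, h2⟩ := CS.regX
  refine ⟨A + B, by positivity, fun u F D E h p q => ?_⟩
  have a := h1 _ _ _ _ h q.1 q.2 (p.2 - q.2)
  obtain ⟨ux, _, dx, bx, _⟩ := h2 _ _ _ _ h
  have b : |u (p.1, p.2) - u (q.1, p.2)| ≤ B * (D + E) * |p.1 - q.1| := by
    have := Convex.norm_image_sub_le_of_norm_hasDerivWithin_le (f := fun x => u (x, p.2)) (f' := fun x => ux (x, p.2)) (s := univ) (C := B * (D + E))
      (x := q.1) (y := p.1) (fun x _ => (dx x p.2).hasDerivWithinAt) (fun x _ => bx _) convex_univ (mem_univ _) (mem_univ _)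
    simpa using this
  have hDE : 0 ≤ D + E := add_nonneg h.D_nn h.E_nn
  have e : q.2 + (p.2 - q.2) = p.2 := by ring
  rw [e] at a
  have t : |u p - u q| ≤ |u (p.1, p.2) - u (q.1, p.2)| + |u (q.1, p.2) - u (q.1, q.2)| := abs_sub_le _ _ _
  have r1 : 0 ≤ |p.1 - q.1| := abs_nonneg _
  have r2 : 0 ≤ |p.2 - q.2| ^ (3/4 : ℝ) := by positivity
  have m1 : 0 ≤ A * (D + E) * |p.1 - q.1| := by positivity
  have m2 : 0 ≤ B * (D + E) * |p.2 - q.2| ^ (3/4 : ℝ) := by positivity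
  unfold md
  nlinarith

theorem md_nonneg (p q : ℝ × ℝ) : 0 ≤ md p q := by unfold md; positivity

theorem compactness {un : ℕ → ℝ × ℝ → ℝ} {D L : ℝ} (hb : ∀ n p, |un n p| ≤ D) (hL : ∀ n p q, |un n p - un n q| ≤ L * md p q) :
    ∃ φ : ℕ → ℕ, StrictMono φ ∧ ∃ u : ℝ × ℝ → ℝ, Continuous u ∧ ∀ p, Tendsto (fun n => un (φ n) p) atTop (𝓝 (u p)) := by
  have hL0 : 0 ≤ L := by
    have h := (abs_nonneg _).trans (hL 0 (1, 0) (0, 0))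
    have : md (1, 0) (0, 0) = 1 := by simp [md, Real.zero_rpow]
    rw [this] at h; linarith
  set d := TopologicalSpace.denseSeq (ℝ × ℝ)
  have hd : DenseRange d := TopologicalSpace.denseRange_denseSeq _
  have hc : IsCompact (univ.pi fun _ : ℕ => Icc (-D) D) := isCompact_univ_pi fun _ => isCompact_Icc
  obtain ⟨a, _, φ, hφ, ha⟩ := hc.tendsto_subseq (x := fun n m => un n (d m)) (fun n => fun m _ => abs_le.1 (hb n (d m)))
  rw [tendsto_pi_nhds] at ha
  have near : ∀ p, ∀ ε > 0, ∃ m, L * md p (d m) < ε := by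
    intro p ε hε
    have ho : ∀ᶠ q in 𝓝 p, L * md p q < ε := by
      have h1 : Tendsto (fun q => L * md p q) (𝓝 p) (𝓝 (L * 0)) := by
        refine ((md_lim p).const_mul L).congr fun q => ?_
        unfold md; rw [abs_sub_comm p.1, abs_sub_comm p.2]
      rw [mul_zero] at h1
      exact h1.eventually (gt_mem_nhds hε)
    obtain ⟨q, hq⟩ := hd.inter_nhds_nonempty ho
    obtain ⟨⟨m, rfl⟩, hq⟩ := hq
    exact ⟨m, hq⟩
  have cau : ∀ p, CauchySeq fun n => un (φ n) p := by
    intro p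
    rw [Metric.cauchySeq_iff']
    intro ε hε
    obtain ⟨m, hm⟩ := near p (ε / 3) (by positivity)
    obtain ⟨N, hN⟩ := Metric.cauchySeq_iff'.1 (ha m).cauchySeq (ε / 3) (by positivity)
    refine ⟨N, fun n hn => ?_⟩
    have h1 := hN n hn
    simp only [Function.comp, Real.dist_eq] at h1 ⊢
    have h2 := hL (φ n) p (d m)
    have h3 := hL (φ N) p (d m)
    rw [abs_lt] at h1 ⊢
    rw [abs_le] at h2 h3
    constructor <;> linarith
  choose u hu using fun p => cauchySeq_tendsto_of_complete (cau p)
  refine ⟨φ, hφ, u, ?_, hu⟩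
  have mu : ∀ p q, |u p - u q| ≤ L * md p q := fun p q =>
    le_of_tendsto ((hu p).sub (hu q)).abs (Eventually.of_forall fun n => hL _ p q)
  rw [continuous_iff_continuousAt]
  intro p
  rw [ContinuousAt, tendsto_iff_norm_sub_tendsto_zero]
  have h1 := (md_lim p).const_mul L
  rw [mul_zero] at h1
  exact squeeze_zero (fun q => norm_nonneg _) (fun q => mu q p) h1

theorem TT_modulus {k : ℝ} (hk : 0 < k) (C : ℝ) : ∃ L, ∀ h : ℝ × ℝ → ℝ, BM h C → ∀ p q, |TT k h p - TT k h q| ≤ L * md p q := by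
  obtain ⟨A, _, hA⟩ := cs_modulus
  exact ⟨_, fun h hh p q => hA _ _ _ _ (TT_spec hk hh) p q⟩

theorem TT_lim {k : ℝ} (hk : 0 < k) {hn : ℕ → ℝ × ℝ → ℝ} {h : ℝ × ℝ → ℝ} {C : ℝ} (hb : ∀ n, BM (hn n) C)
    (hl : ∀ p, Tendsto (fun n => hn n p) atTop (𝓝 (h p))) (p : ℝ × ℝ) : Tendsto (fun n => TT k (hn n) p) atTop (𝓝 (TT k h p)) := by
  have hh : BM h C := ⟨measurable_of_tendsto_metrizable (fun n => (hb n).1) (tendsto_pi_nhds.2 hl), fun p =>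
    le_of_tendsto (hl p).abs (Eventually.of_forall fun n => (hb n).2 p)⟩
  obtain ⟨L, hL⟩ := TT_modulus hk C
  refine tendsto_of_subseq_tendsto fun ns hns => ?_
  obtain ⟨φ, hφ, u, cu, hu⟩ := compactness (un := fun n => TT k (hn (ns n))) (D := C / k) (L := L)
    (fun n p => (TT_spec hk (hb _)).bd p) (fun n p q => hL _ (hb _) p q)
  refine ⟨φ, ?_⟩
  have ub : ∀ p, |u p| ≤ C / k := fun p => le_of_tendsto (hu p).abs (Eventually.of_forall fun n => (TT_spec hk (hb _)).bd p)
  have l2 : ∀ p, Tendsto (fun n => hn (ns (φ n)) p) atTop (𝓝 (h p)) := fun p => (hl p).comp (hns.comp hφ.tendsto_atTop)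
  have ds : DSol u (fun p => k * u p - h p) := by
    refine dsol_lim (un := fun n => TT k (hn (ns (φ n)))) (Fn := fun n p => k * TT k (hn (ns (φ n))) p - hn (ns (φ n)) p)
      (fun n => (TT_spec hk (hb _)).bm) (fun n => (TT_spec hk (hb _)).hF) (fun n => (TT_spec hk (hb _)).ds) hu ?_
    intro p
    exact ((hu p).const_mul k).sub (l2 p)
  have : TT k h = u := TT_eq hk hh (D := C / k) (E := |k| * (C / k) + C) ⟨cu, ub, (BM.smul k ⟨cu.measurable, ub⟩).sub hh, ds⟩
  rw [this]
  exact hu p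

theorem TT_indep {k : ℝ} (hk : 0 < k) {h : ℝ × ℝ → ℝ} {C : ℝ} (hh : BM h C) (hi : ∀ x y, h (x, y) = h (x, 0)) (x y : ℝ) :
    TT k h (x, y) = TT k h (x, 0) := by
  have := TT_aff hk hh 1 1 y (by norm_num) (by norm_num) (x, 0)
  simp only [one_mul, add_zero, zero_add] at this
  rw [← this]
  congr 1
  funext p
  rw [hi, hi p.1 p.2]

theorem TT_transX {k : ℝ} (hk : 0 < k) {h : ℝ × ℝ → ℝ} {C : ℝ} (hh : BM h C) (hc : Continuous h) (hi : ∀ x y, h (x, y) = h (x, 0)) (s : ℝ) (p : ℝ × ℝ) :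
    TT k (fun p => h (p.1 + s, p.2)) p = TT k h (p.1 + s, p.2) := by
  have S := TT_spec hk hh
  obtain ⟨_, _, hX⟩ := CS.regX
  obtain ⟨vx, cvx, dvx, _⟩ := hX _ _ _ _ S
  have cF : Continuous fun p => k * TT k h p - h p := (continuous_const.mul S.cont).sub hc
  have dxx := fun x y => xx_lemma S.cont cvx (uy := fun _ => 0) (S := fun _ => 0) continuous_const cF continuous_const dvx
    (fun x y => by
      have : (fun y => TT k h (x, y)) = fun _ => TT k h (x, 0) := funext fun y => TT_indep hk hh hi x y
      rw [this]; exact hasDerivAt_const _ _) (fun x y => by simpa using hasDerivAt_const y (0:ℝ)) S.ds x y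
  simp only [mul_zero, sub_zero] at dxx
  set g : ℝ → ℝ := fun x => TT k h (x, 0) with hg
  have g1 : deriv g = fun x => vx (x, 0) := funext fun x => (dvx x 0).deriv
  have g2 : deriv (deriv g) = fun x => k * TT k h (x, 0) - h (x, 0) := by rw [g1]; exact funext fun x => (dxx x 0).deriv
  have cg : ContDiff ℝ 2 g := by
    have : ContDiff ℝ (1 + 1) g := by
      rw [contDiff_succ_iff_deriv]
      refine ⟨fun x => (dvx x 0).differentiableAt, by simp, ?_⟩
      rw [contDiff_one_iff_deriv, g2]
      refine ⟨?_, cF.comp (by fun_prop)⟩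
      rw [g1]
      exact fun x => (dxx x 0).differentiableAt
    simpa [one_add_one_eq_two] using this
  set V : ℝ × ℝ → ℝ := fun p => g (p.1 + s) with hV
  have cV : ContDiff ℝ 2 V := cg.comp (by fun_prop)
  have eV : V = fun p => TT k h (p.1 + s, p.2) := funext fun p => (TT_indep hk hh hi _ _).symm
  have lV : grushinLap V = fun p => k * V p - h (p.1 + s, p.2) := by
    funext p
    have e1 : pYY V p = 0 := by simp [pYY, hV]
    have e2 : pXX V p = deriv (deriv g) (p.1 + s) := by
      unfold pXX
      have : deriv (fun x => V (x, p.2)) = fun x => deriv g (x + s) := by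
        funext x; exact deriv_comp_add_const g s x
      rw [this]; exact deriv_comp_add_const (deriv g) s p.1
    unfold grushinLap
    rw [e1, e2, g2, hi (p.1 + s) p.2]; simp [hV, hg]
  have ds := dsol_of_contDiff cV
  rw [lV] at ds
  have bh : BM (fun p : ℝ × ℝ => h (p.1 + s, p.2)) C := ⟨hh.1.comp (by fun_prop), fun p => hh.2 _⟩
  have bV : BM V (C / k) := ⟨cV.continuous.measurable, fun p => S.bd _⟩
  rw [TT_eq hk bh (D := C / k) (E := |k| * (C / k) + C) ⟨cV.continuous, bV.2, (bV.smul k).sub bh, ds⟩, eV]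
end

section
open MeasureTheory Filter Topology Set

theorem hd_pp (m : ℕ) (t : ℝ) : HasDerivAt (fun t : ℝ => (max t 0) ^ (m + 2)) ((m + 2 : ℝ) * (max t 0) ^ (m + 1)) t := by
  rcases lt_trichotomy t 0 with h | h | h
  · rw [max_eq_right h.le]
    have e : (fun t : ℝ => (max t 0) ^ (m + 2)) =ᶠ[𝓝 t] fun _ => 0 := by
      filter_upwards [Iio_mem_nhds h] with r hr
      rw [max_eq_right (le_of_lt hr)]; simp
    refine ((hasDerivAt_const t (0:ℝ)).congr_of_eventuallyEq e).congr_deriv (by simp)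
  · subst h
    simp only [max_self, ne_eq, Nat.add_eq_zero_iff, one_ne_zero, and_false, not_false_eq_true, zero_pow, mul_zero]
    rw [hasDerivAt_iff_isLittleO_nhds_zero]
    simp only [zero_add, max_self, smul_zero, sub_zero]
    have h1 : (fun h : ℝ => h ^ (m + 2)) =o[𝓝 0] fun h => h := by
      have := Asymptotics.isLittleO_pow_pow (𝕜 := ℝ) (m := 1) (n := m + 2) (by omega)
      simpa using this
    refine Asymptotics.IsBigO.trans_isLittleO ?_ h1
    refine Asymptotics.IsBigO.of_bound 1 (Eventually.of_forall fun x => ?_)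
    simp only [ne_eq, Nat.add_eq_zero_iff, OfNat.ofNat_ne_zero, and_false, not_false_eq_true, zero_pow, sub_zero, norm_pow, one_mul]
    gcongr
    rw [Real.norm_eq_abs, Real.norm_eq_abs, abs_of_nonneg (le_max_right _ _)]
    exact max_le (le_abs_self _) (abs_nonneg _)
  · rw [max_eq_left h.le]
    have e : (fun t : ℝ => (max t 0) ^ (m + 2)) =ᶠ[𝓝 t] fun t => t ^ (m + 2) := by
      filter_upwards [Ioi_mem_nhds h] with r hr
      rw [max_eq_left (le_of_lt hr)]
    refine ((hasDerivAt_pow (m + 2) t).congr_of_eventuallyEq e).congr_deriv (by push_cast; norm_num)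

theorem cd_pp (n : ℕ) : ContDiff ℝ 2 (fun t : ℝ => (max t 0) ^ (n + 3)) := by
  have d1 : deriv (fun t : ℝ => (max t 0) ^ (n + 3)) = fun t => ((n + 1 : ℕ) + 2 : ℝ) * (max t 0) ^ (n + 1 + 1) :=
    funext fun t => (hd_pp (n + 1) t).deriv
  have : ContDiff ℝ (1 + 1) (fun t : ℝ => (max t 0) ^ (n + 3)) := by
    rw [contDiff_succ_iff_deriv]
    refine ⟨fun t => (hd_pp (n + 1) t).differentiableAt, by simp, ?_⟩
    rw [d1]
    refine contDiff_const.mul ?_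
    rw [contDiff_one_iff_deriv]
    refine ⟨fun t => (hd_pp n t).differentiableAt, ?_⟩
    have : deriv (fun t : ℝ => (max t 0) ^ (n + 1 + 1)) = fun t => ((n : ℝ) + 2) * (max t 0) ^ (n + 1) :=
      funext fun t => (hd_pp n t).deriv
    rw [this]; fun_prop
  simpa [one_add_one_eq_two] using this

theorem dd_pp (n : ℕ) {f f1 : ℝ → ℝ} {f2 x : ℝ} (h1 : ∀ x, HasDerivAt f (f1 x) x) (h2 : HasDerivAt f1 f2 x) :
    deriv (deriv fun x => (max (f x) 0) ^ (n + 3)) x = (n + 3) * (n + 2) * (max (f x) 0) ^ (n + 1) * f1 x ^ 2 + (n + 3) * (max (f x) 0) ^ (n + 2) * f2 := by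
  have e : deriv (fun x => (max (f x) 0) ^ (n + 3)) = fun x => ((n + 1 : ℕ) + 2 : ℝ) * (max (f x) 0) ^ (n + 1 + 1) * f1 x :=
    funext fun x => ((hd_pp (n + 1) (f x)).comp x (h1 x)).deriv
  rw [e]
  have := ((((hd_pp n (f x)).comp x (h1 x)).const_mul ((n + 1 : ℕ) + 2 : ℝ)).mul h2).deriv
  refine Eq.trans this ?_
  simp only [Function.comp]
  push_cast; ring

theorem bump {k a b B M : ℝ} (hk : 0 < k) (ha : a ≠ 0) (hB : 0 < B) {l l1 l2 : ℝ → ℝ} (cl : ContDiff ℝ 2 l) (c2 : Continuous l2)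
    (h1 : ∀ x, HasDerivAt l (l1 x) x) (h2 : ∀ x, HasDerivAt l1 (l2 x) x) (hl1 : ∀ x, l1 x ≠ 0) (hl0 : ∀ x, l x = 0 → x = a)
    (hM : ∀ x, |l x| ≤ 1 → |x| ≤ M) {N : Set (ℝ × ℝ)} (hN : N ∈ 𝓝 (a, b)) :
    ∃ (n : ℕ) (C : ℝ) (φ : ℝ × ℝ → ℝ), φ = (fun p => (max (1 - l p.1 ^ 2 - ((p.2 - b) / B) ^ 2) 0) ^ (n + 3)) ∧ 0 < C ∧ ContDiff ℝ 2 φ ∧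
      HasCompactSupport φ ∧ (∀ p, p ∉ N → k * φ p - grushinLap φ p ≤ 0) ∧ (∀ p, k * φ p - grushinLap φ p ≤ C) := by
  set s : ℝ × ℝ → ℝ := fun p => 1 - l p.1 ^ 2 - ((p.2 - b) / B) ^ 2 with hs
  have c1 : Continuous l1 := continuous_iff_continuousAt.2 fun x => (h2 x).continuousAt
  have c0 : Continuous l := cl.continuous
  have cs : Continuous s := by simp only [hs]; fun_prop
  set q : ℝ × ℝ → ℝ := fun p => (2 * l p.1 * l1 p.1) ^ 2 + p.1 ^ 2 * (2 * (p.2 - b) / B ^ 2) ^ 2 with hq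
  set r : ℝ × ℝ → ℝ := fun p => 2 * l1 p.1 ^ 2 + 2 * l p.1 * l2 p.1 + 2 * p.1 ^ 2 / B ^ 2 with hr
  have cq : Continuous q := by simp only [hq]; fun_prop
  have cr : Continuous r := by simp only [hr]; fun_prop
  set K : Set (ℝ × ℝ) := {p | 0 ≤ s p}
  have Kc : IsClosed K := isClosed_le continuous_const cs
  have Kb : K ⊆ Icc (-M) M ×ˢ Icc (b - B) (b + B) := by
    intro p hp
    have hp' : 0 ≤ 1 - l p.1 ^ 2 - ((p.2 - b) / B) ^ 2 := hp
    have x1 : |l p.1| ≤ 1 := by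
      rw [← sq_le_one_iff_abs_le_one]; nlinarith [sq_nonneg ((p.2 - b) / B)]
    have x2 : |(p.2 - b) / B| ≤ 1 := by
      rw [← sq_le_one_iff_abs_le_one]; nlinarith [sq_nonneg (l p.1)]
    rw [abs_div, abs_of_pos hB, div_le_one hB, abs_le] at x2
    exact ⟨abs_le.1 (hM _ x1), by constructor <;> linarith⟩
  have Kk : IsCompact K := (isCompact_Icc.prod isCompact_Icc).of_isClosed_subset Kc Kb
  obtain ⟨ρ, hρ⟩ := Kk.exists_bound_of_continuousOn cr.continuousOn
  have Zk : IsCompact (K \ interior N) := Kk.diff isOpen_interior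
  obtain ⟨m, hm, hmq⟩ : ∃ m, 0 < m ∧ ∀ p ∈ K \ interior N, m ≤ q p := by
    rcases (K \ interior N).eq_empty_or_nonempty with h | h
    · exact ⟨1, one_pos, by rw [h]; simp⟩
    obtain ⟨p0, hp0, hmin⟩ := Zk.exists_isMinOn h cq.continuousOn
    refine ⟨q p0, ?_, fun p hp => hmin hp⟩
    by_contra hn
    push Not at hn
    have t1 : 0 ≤ (2 * l p0.1 * l1 p0.1) ^ 2 := sq_nonneg _
    have t2 : 0 ≤ p0.1 ^ 2 * (2 * (p0.2 - b) / B ^ 2) ^ 2 := by positivity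
    have hn' : (2 * l p0.1 * l1 p0.1) ^ 2 + p0.1 ^ 2 * (2 * (p0.2 - b) / B ^ 2) ^ 2 ≤ 0 := hn
    have z1 : (2 * l p0.1 * l1 p0.1) ^ 2 = 0 := by linarith
    have z2 : p0.1 ^ 2 * (2 * (p0.2 - b) / B ^ 2) ^ 2 = 0 := by linarith
    have x0 : p0.1 = a := by
      apply hl0
      have := pow_eq_zero_iff (two_ne_zero) |>.1 z1
      simpa [hl1] using this
    have y0 : p0.2 = b := by
      rw [x0] at z2
      have : (2 * (p0.2 - b) / B ^ 2) = 0 := by simpa [ha] using z2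
      have : p0.2 - b = 0 := by simpa [hB.ne'] using this
      linarith
    have : p0 = (a, b) := Prod.ext x0 y0
    exact hp0.2 (this ▸ mem_interior_iff_mem_nhds.2 hN)
  obtain ⟨n, hn⟩ := exists_nat_ge ((|ρ| + k) / m)
  rw [div_le_iff₀ hm] at hn
  set φ : ℝ × ℝ → ℝ := fun p => (max (s p) 0) ^ (n + 3) with hφ
  have csd : ContDiff ℝ 2 s := by
    simp only [hs]
    have : ContDiff ℝ 2 fun p : ℝ × ℝ => l p.1 := cl.comp contDiff_fst
    fun_prop
  have cφ : ContDiff ℝ 2 φ := (cd_pp n).comp csd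
  have hcφ : HasCompactSupport φ := by
    refine HasCompactSupport.intro Kk fun p hp => ?_
    have : ¬ 0 ≤ s p := hp
    simp only [hφ]; rw [max_eq_right (by linarith)]; simp
  have lap : ∀ p, grushinLap φ p = (n + 3) * (n + 2) * (max (s p) 0) ^ (n + 1) * q p - (n + 3) * (max (s p) 0) ^ (n + 2) * r p := by
    rintro ⟨x, y⟩
    have e1 : pXX φ (x, y) = _ := dd_pp n (f := fun x => s (x, y)) (f1 := fun x => -(2 * l x * l1 x)) (f2 := -(2 * (l1 x * l1 x + l x * l2 x))) (x := x)
      (fun x => by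
        simp only [hs]
        have := (((h1 x).pow 2).const_sub 1).sub_const (((y - b) / B) ^ 2)
        refine this.congr_deriv ?_
        norm_num)
      (by
        have := (((h1 x).mul (h2 x)).const_mul 2).neg
        refine (this.congr_of_eventuallyEq (Eventually.of_forall fun x => ?_))
        simp; ring)
    have e2 : pYY φ (x, y) = _ := dd_pp n (f := fun y => s (x, y)) (f1 := fun y => -(2 * (y - b) / B ^ 2)) (f2 := -(2 / B ^ 2)) (x := y)
      (fun y => by
        simp only [hs]
        have := ((((hasDerivAt_id y).sub_const b).div_const B).pow 2).const_sub (1 - l x ^ 2)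
        refine this.congr_deriv ?_
        simp; field_simp)
      (by
        have := ((((hasDerivAt_id y).sub_const b).const_mul 2).div_const (B ^ 2)).neg
        refine this.congr_deriv ?_
        simp)
    unfold grushinLap
    rw [e1, e2]
    simp only [hq, hr]
    ring
  obtain ⟨C, hC⟩ := (TT_cc hk cφ hcφ).1
  refine ⟨n, |C| + 1, φ, rfl, by positivity, cφ, hcφ, fun p hp => ?_, fun p => ?_⟩
  · rw [lap p]
    simp only [hφ]
    by_cases hs0 : 0 ≤ s p
    · rw [max_eq_left hs0]
      have hq' := hmq p ⟨hs0, fun h => hp (interior_subset h)⟩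
      have hr' := hρ p hs0
      rw [Real.norm_eq_abs] at hr'
      have hr2 : r p ≤ |ρ| := (le_abs_self _).trans (hr'.trans (le_abs_self _))
      have s1 : s p ≤ 1 := by simp only [hs]; nlinarith [sq_nonneg (l p.1), sq_nonneg ((p.2 - b) / B)]
      have key : k * s p ^ 2 + (n + 3) * s p * r p - (n + 3) * (n + 2) * q p ≤ 0 := by
        have i1 : k * s p ^ 2 ≤ k := by
          have : s p ^ 2 ≤ 1 := by nlinarith
          nlinarith
        have i2 : s p * r p ≤ |ρ| := by
          have : s p * r p ≤ s p * |ρ| := mul_le_mul_of_nonneg_left hr2 hs0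
          have : s p * |ρ| ≤ 1 * |ρ| := mul_le_mul_of_nonneg_right s1 (abs_nonneg _)
          linarith
        have n0 : (0:ℝ) ≤ n := Nat.cast_nonneg n
        have i3 : |ρ| + k ≤ (n + 2) * q p := by nlinarith
        have i4 : (n + 3 : ℝ) * (s p * r p) ≤ (n + 3) * ((n + 2) * q p - k) := mul_le_mul_of_nonneg_left (by linarith) (by linarith)
        nlinarith
      have : k * s p ^ (n + 3) - ((n + 3) * (n + 2) * s p ^ (n + 1) * q p - (n + 3) * s p ^ (n + 2) * r p)
          = s p ^ (n + 1) * (k * s p ^ 2 + (n + 3) * s p * r p - (n + 3) * (n + 2) * q p) := by ring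
      rw [this]
      exact mul_nonpos_of_nonneg_of_nonpos (by positivity) key
    · rw [max_eq_right (by linarith)]; simp
  · exact ((le_abs_self _).trans (hC.2 p)).trans ((le_abs_self C).trans (by linarith))
end

section
open MeasureTheory Filter Topology Set

theorem TT_comp {k : ℝ} (hk : 0 < k) {g φ : ℝ × ℝ → ℝ} {C ε : ℝ} (hg : BM g C) (h1 : ContDiff ℝ 2 φ) (h2 : HasCompactSupport φ)
    (hle : ∀ p, ε * (k * φ p - grushinLap φ p) ≤ g p) (p : ℝ × ℝ) : ε * φ p ≤ TT k g p := by
  obtain ⟨⟨D, hD⟩, e⟩ := TT_cc hk h1 h2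
  have h := TT_smul hk hD ε p
  have e2 : TT k (fun p => k * φ p - grushinLap φ p) p = φ p := congrFun e p
  rw [e2] at h
  rw [← h]
  exact TT_mono hk ((hD.smul ε).mono (le_max_left _ C)) (hg.mono (le_max_right _ _)) hle p

theorem TT_RPcomp {k : ℝ} (hk : 0 < k) {g φ : ℝ × ℝ → ℝ} {C ε : ℝ} (hg : BM g C) (ho : ∀ x y, g (-x, y) = -g (x, y))
    (h1 : ContDiff ℝ 2 φ) (h2 : HasCompactSupport φ) (hφ : ∀ x y, φ (-x, y) = -φ (x, y))
    (hle : ∀ x y, 0 < x → ε * (k * φ (x, y) - grushinLap φ (x, y)) ≤ g (x, y)) (x y : ℝ) (hx : 0 < x) : ε * φ (x, y) ≤ TT k g (x, y) := by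
  obtain ⟨⟨D, hD⟩, e⟩ := TT_cc hk h1 h2
  have h := TT_smul hk hD ε (x, y)
  have e2 : TT k (fun p => k * φ p - grushinLap φ p) (x, y) = φ (x, y) := congrFun e _
  rw [e2] at h
  have h3 := TT_sub hk hg (hD.smul ε) (x, y)
  rw [h] at h3
  have lo : ∀ x y, grushinLap φ (-x, y) = - grushinLap φ (x, y) := fun x y => by
    have a := lap_aff (-1) 1 0 (by norm_num) (by norm_num) φ (x, y)
    have b : (fun p : ℝ × ℝ => φ (-1 * p.1 + 0, 1 * p.2 + 0)) = (-1 : ℝ) • φ := by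
      funext p
      have := hφ p.1 p.2
      simp [this]
    rw [b, lap_smul] at a
    simp at a
    linarith
  have := TT_RP hk (hg.sub (hD.smul ε)) (fun x y => by simp only [ho, lo, hφ]; ring) (fun x y hx => sub_nonneg.2 (hle x y hx)) x y hx
  linarith

theorem exists_pos_off {g : ℝ × ℝ → ℝ} (hc : Continuous g) {p0 : ℝ × ℝ} (h0 : 0 < g p0) : ∃ p, p.1 ≠ 0 ∧ 0 < g p := by
  have hd : Dense {p : ℝ × ℝ | p.1 ≠ 0} := Measure.dense_of_ae null_axis
  obtain ⟨p, h1, h2⟩ := hd.inter_open_nonempty {p | 0 < g p} (isOpen_lt continuous_const hc) ⟨p0, h0⟩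
  exact ⟨p, h2, h1⟩

theorem TT_pos {k : ℝ} (hk : 0 < k) {g : ℝ × ℝ → ℝ} {C : ℝ} (hg : BM g C) (hc : Continuous g) (h0 : ∀ p, 0 ≤ g p)
    (h1 : ∃ p, g p ≠ 0) (q : ℝ × ℝ) : 0 < TT k g q := by
  obtain ⟨p0, hp0⟩ := h1
  obtain ⟨⟨a, b⟩, ha, hp⟩ := exists_pos_off hc (lt_of_le_of_ne (h0 p0) hp0.symm)
  simp only at ha
  set c := g (a, b) / 2 with hcd
  have hcp : 0 < c := by positivity
  set N : Set (ℝ × ℝ) := {p | c < g p}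
  have hN : N ∈ 𝓝 (a, b) := (isOpen_lt continuous_const hc).mem_nhds (by show c < g (a, b); rw [hcd]; linarith)
  set A := 2 * (|q.1 - a| + 1) with hA
  set B := 2 * (|q.2 - b| + 1) with hB
  have A0 : 0 < A := by positivity
  have B0 : 0 < B := by positivity
  obtain ⟨n, D, φ, eφ, hD, cφ, kφ, l1, l2⟩ := bump (l := fun x => (x - a) / A) (l1 := fun _ => 1 / A) (l2 := fun _ => 0) (M := |a| + A)
    hk ha B0 (by fun_prop) (by fun_prop) (fun x => ((hasDerivAt_id x).sub_const a).div_const A) (fun x => hasDerivAt_const _ _)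
    (fun x => by positivity) (fun x hx => by have : x - a = 0 := by simpa [A0.ne'] using hx
                                             linarith)
    (fun x hx => by
      rw [abs_div, abs_of_pos A0, div_le_one A0] at hx
      have : |x| ≤ |x - a| + |a| := by simpa using abs_add_le (x - a) a
      linarith) hN
  have key := TT_comp hk (ε := c / D) hg cφ kφ (fun p => by
    by_cases hpN : p ∈ N
    · have : c / D * (k * φ p - grushinLap φ p) ≤ c / D * D := mul_le_mul_of_nonneg_left (l2 p) (by positivity)
      rw [div_mul_cancel₀ _ hD.ne'] at this
      exact this.trans (le_of_lt hpN)
    · exact (mul_nonpos_of_nonneg_of_nonpos (by positivity) (l1 p hpN)).trans (h0 p)) q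
  refine lt_of_lt_of_le ?_ key
  refine mul_pos (by positivity) ?_
  rw [eφ]
  apply pow_pos
  apply lt_max_of_lt_left
  have x1 : ((q.1 - a) / A) ^ 2 ≤ 1 / 4 := by
    have : |(q.1 - a) / A| ≤ 1 / 2 := by
      rw [abs_div, abs_of_pos A0, div_le_iff₀ A0]; rw [hA]; linarith
    have := sq_le_sq' (abs_le.1 this).1 (abs_le.1 this).2
    linarith
  have x2 : ((q.2 - b) / B) ^ 2 ≤ 1 / 4 := by
    have : |(q.2 - b) / B| ≤ 1 / 2 := by
      rw [abs_div, abs_of_pos B0, div_le_iff₀ B0]; rw [hB]; linarith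
    have := sq_le_sq' (abs_le.1 this).1 (abs_le.1 this).2
    linarith
  linarith

theorem TT_pos_half {k : ℝ} (hk : 0 < k) {g : ℝ × ℝ → ℝ} {C : ℝ} (hg : BM g C) (hc : Continuous g) (ho : ∀ x y, g (-x, y) = -g (x, y))
    (h0 : ∀ x y, 0 < x → 0 ≤ g (x, y)) (h1 : ∃ x y, 0 < x ∧ g (x, y) ≠ 0) (x1 y1 : ℝ) (hx1 : 0 < x1) : 0 < TT k g (x1, y1) := by
  obtain ⟨a, b, ha, hab⟩ := h1
  have hp := lt_of_le_of_ne (h0 a b ha) hab.symm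
  set c := g (a, b) / 2 with hcd
  have hcp : 0 < c := by positivity
  set N : Set (ℝ × ℝ) := {p | c < g p}
  have hN : N ∈ 𝓝 (a, b) := (isOpen_lt continuous_const hc).mem_nhds (by show c < g (a, b); rw [hcd]; linarith)
  set μ := Real.log 2 / a with hμ
  have μ0 : 0 < μ := div_pos (Real.log_pos (by norm_num)) ha
  have ex1 : Real.exp (-(μ * x1)) < 1 := by rw [← Real.exp_zero]; exact Real.exp_lt_exp.2 (by nlinarith)
  set ω := min (Real.exp (-(μ * |x1 - a|))) (2 - 2 * Real.exp (-(μ * x1))) with hω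
  have ω0 : 0 < ω := lt_min (Real.exp_pos _) (by linarith)
  set η := ω / (2 * (|x1 - a| + 1)) with hη
  have η0 : 0 < η := by positivity
  have η1 : η * |x1 - a| < ω := by
    have h2 : η * (2 * (|x1 - a| + 1)) = ω := by rw [hη]; field_simp
    nlinarith [abs_nonneg (x1 - a)]
  set l : ℝ → ℝ := fun x => 1 - Real.exp (-(μ * (x - a))) + η * (x - a) with hl
  have l_mono : StrictMono l := by
    intro x x' h
    simp only [hl]
    have e1 : Real.exp (-(μ * (x' - a))) < Real.exp (-(μ * (x - a))) := Real.exp_lt_exp.2 (by nlinarith)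
    nlinarith
  have l_a : l a = 0 := by simp [hl]
  have l_0 : l 0 ≤ -1 := by
    simp only [hl]
    have : Real.exp (-(μ * (0 - a))) = 2 := by
      have : -(μ * (0 - a)) = Real.log 2 := by rw [hμ]; field_simp; ring
      rw [this, Real.exp_log (by norm_num)]
    rw [this]; nlinarith
  have l_x1 : l x1 < 1 := by
    simp only [hl]
    have e1 : Real.exp (-(μ * |x1 - a|)) ≤ Real.exp (-(μ * (x1 - a))) := Real.exp_le_exp.2 (by have := le_abs_self (x1 - a); nlinarith)
    have e2 : η * (x1 - a) < Real.exp (-(μ * |x1 - a|)) := by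
      have : η * (x1 - a) ≤ η * |x1 - a| := mul_le_mul_of_nonneg_left (le_abs_self _) η0.le
      exact (this.trans_lt η1).trans_le (min_le_left _ _)
    linarith
  have l_x1' : -1 < l x1 := by
    simp only [hl]
    have e1 : Real.exp (-(μ * (x1 - a))) = 2 * Real.exp (-(μ * x1)) := by
      have : -(μ * (x1 - a)) = Real.log 2 + -(μ * x1) := by rw [hμ]; field_simp; ring
      rw [this, Real.exp_add, Real.exp_log (by norm_num)]
    have e2 : -(η * |x1 - a|) ≤ η * (x1 - a) := by
      have := mul_le_mul_of_nonneg_left (neg_abs_le (x1 - a)) η0.le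
      linarith
    have e3 : ω ≤ 2 - 2 * Real.exp (-(μ * x1)) := min_le_right _ _
    rw [e1]; linarith
  have sq1 : l x1 ^ 2 < 1 := by nlinarith
  obtain ⟨B, B0, hB⟩ : ∃ B, 0 < B ∧ ((y1 - b) / B) ^ 2 < 1 - l x1 ^ 2 := by
    have t : Tendsto (fun B : ℝ => ((y1 - b) / B) ^ 2) atTop (𝓝 (0 ^ 2)) := (tendsto_const_nhds.div_atTop tendsto_id).pow 2
    have := (t.eventually (gt_mem_nhds (by linarith : (0:ℝ) ^ 2 < 1 - l x1 ^ 2))).and (eventually_gt_atTop 0)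
    obtain ⟨B, h1, h2⟩ := this.exists
    exact ⟨B, h2, h1⟩
  obtain ⟨n, D, φ, eφ, hD, cφ, kφ, q1, q2⟩ := bump (l := l) (l1 := fun x => μ * Real.exp (-(μ * (x - a))) + η) (l2 := fun x => -(μ ^ 2 * Real.exp (-(μ * (x - a))))) (M := |a| + 2 / η)
    (N := N) hk ha.ne' B0 (by simp only [hl]; fun_prop) (by fun_prop)
    (fun x => by
      have h1 : HasDerivAt (fun x => -(μ * (x - a))) (-(μ * 1)) x := (((hasDerivAt_id x).sub_const a).const_mul μ).neg
      have := (h1.exp.const_sub 1).add (((hasDerivAt_id x).sub_const a).const_mul η)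
      refine this.congr_deriv ?_
      ring)
    (fun x => by
      have h1 : HasDerivAt (fun x => -(μ * (x - a))) (-(μ * 1)) x := (((hasDerivAt_id x).sub_const a).const_mul μ).neg
      have := (h1.exp.const_mul μ).add_const η
      refine this.congr_deriv ?_
      ring)
    (fun x => by positivity) (fun x hx => l_mono.injective (hx.trans l_a.symm))
    (fun x hx => by
      have x0 : 0 ≤ x := by
        by_contra hn
        push Not at hn
        have := l_mono hn
        have := (abs_le.1 hx).1
        linarith
      rw [abs_of_nonneg x0]
      have h2 := (abs_le.1 hx).2
      have ha' : |a| = a := abs_of_pos ha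
      rw [ha']
      by_cases hxa : x ≤ a
      · have : 0 ≤ 2 / η := by positivity
        linarith
      · push Not at hxa
        have e1 : Real.exp (-(μ * (x - a))) ≤ 1 := Real.exp_le_one_iff.2 (by nlinarith)
        simp only [hl] at h2
        have : x - a ≤ 2 / η := by rw [le_div_iff₀ η0]; nlinarith
        linarith) hN
  have φ0 : ∀ x y, x ≤ 0 → φ (x, y) = 0 := fun x y hx => by
    have : l x ≤ -1 := (l_mono.monotone hx).trans l_0
    rw [eφ]
    simp only
    rw [max_eq_right (by nlinarith [sq_nonneg ((y - b) / B)])]; simp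
  set φr : ℝ × ℝ → ℝ := fun p => φ (-1 * p.1 + 0, 1 * p.2 + 0) with hφr
  have cr : ContDiff ℝ 2 φr := cφ.comp (by fun_prop)
  have hcr : HasCompactSupport φr := by
    refine kφ.comp_homeomorph (φ := ⟨⟨fun p => (-1 * p.1 + 0, 1 * p.2 + 0), fun p => (-1 * p.1 + 0, 1 * p.2 + 0), fun p => by simp, fun p => by simp⟩, by fun_prop, by fun_prop⟩)
  have cr2 : ContDiff ℝ 2 ((-1 : ℝ) • φr) := cr.const_smul (-1 : ℝ)
  have hψ := testSub.add_mem ⟨cφ, kφ⟩ (testSub.smul_mem (-1) ⟨cr, hcr⟩)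
  have lap0 : ∀ x y, x < 0 → grushinLap φ (x, y) = 0 := fun x y hx => by
    unfold grushinLap pXX pYY
    have e1 : (fun x => φ (x, y)) =ᶠ[𝓝 x] fun _ => 0 := by
      filter_upwards [Iio_mem_nhds hx] with z hz using φ0 z y (le_of_lt hz)
    have e2 : (fun y => φ (x, y)) = fun _ => 0 := funext fun y => φ0 x y hx.le
    simp only
    rw [e2, e1.deriv.deriv_eq]; simp
  have key := TT_RPcomp hk (ε := c / D) hg ho hψ.1 hψ.2 (fun x y => by simp [hφr]) (fun x y hx => by
    rw [lap_add cφ cr2, lap_smul, lap_aff (-1) 1 0 (by norm_num) (by norm_num)]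
    have z1 : φr (x, y) = 0 := φ0 _ _ (by simp; linarith)
    have z2 : grushinLap φ (-1 * x + 0, 1 * y + 0) = 0 := lap0 _ _ (by linarith)
    rw [z2, mul_zero, add_zero]
    simp only [Pi.add_apply, Pi.smul_apply, z1, smul_zero, add_zero]
    by_cases hpN : (x, y) ∈ N
    · have : c / D * (k * φ (x, y) - grushinLap φ (x, y)) ≤ c / D * D := mul_le_mul_of_nonneg_left (q2 _) (by positivity)
      rw [div_mul_cancel₀ _ hD.ne'] at this
      exact this.trans (le_of_lt hpN)
    · exact (mul_nonpos_of_nonneg_of_nonpos (by positivity) (q1 _ hpN)).trans (h0 x y hx)) x1 y1 hx1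
  refine lt_of_lt_of_le ?_ key
  refine mul_pos (by positivity) ?_
  have z1 : φr (x1, y1) = 0 := φ0 _ _ (by simp; linarith)
  simp only [Pi.add_apply, Pi.smul_apply, z1, smul_zero, add_zero]
  rw [eφ]
  apply pow_pos
  apply lt_max_of_lt_left
  simp only
  linarith
end

section
open MeasureTheory Filter Topology Set

/-- one dimensional bump -/
noncomputable def bq (b B y : ℝ) : ℝ := (max (1 - ((y - b) / B) ^ 2) 0) ^ (0 + 3)

theorem bq_nonneg (b B y : ℝ) : 0 ≤ bq b B y := pow_nonneg (le_max_right _ _) _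

theorem bq_cd (b B : ℝ) : ContDiff ℝ 2 (bq b B) := (cd_pp 0).comp (by fun_prop)

theorem bq_pos {b B y : ℝ} (hB : 0 < B) (h : |y - b| < B) : 0 < bq b B y := by
  apply pow_pos
  apply lt_max_of_lt_left
  have : |(y - b) / B| < 1 := by rw [abs_div, abs_of_pos hB, div_lt_one hB]; exact h
  have := (sq_lt_one_iff_abs_lt_one _).2 this
  linarith

theorem bq_zero {b B y : ℝ} (hB : 0 < B) (h : B ≤ |y - b|) : bq b B y = 0 := by
  unfold bq
  have : 1 ≤ |(y - b) / B| := by rw [abs_div, abs_of_pos hB, one_le_div hB]; exact h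
  have := (one_le_sq_iff_one_le_abs _).2 this
  rw [max_eq_right (by linarith)]; simp

theorem bq_dd {b B : ℝ} (hB : 0 < B) (y : ℝ) : -(10 / B ^ 2) * bq b B y ≤ deriv (deriv (bq b B)) y := by
  have e2 : deriv (deriv (bq b B)) y = _ := dd_pp 0 (f := fun y => 1 - ((y - b) / B) ^ 2) (f1 := fun y => -(2 * (y - b) / B ^ 2)) (f2 := -(2 / B ^ 2)) (x := y)
      (fun y => by
        have := ((((hasDerivAt_id y).sub_const b).div_const B).pow 2).const_sub 1
        refine this.congr_deriv ?_
        simp; field_simp)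
      (by
        have := ((((hasDerivAt_id y).sub_const b).const_mul 2).div_const (B ^ 2)).neg
        refine this.congr_deriv ?_
        simp)
  rw [e2]
  unfold bq
  set m := max (1 - ((y - b) / B) ^ 2) 0 with hm
  have m0 : 0 ≤ m := le_max_right _ _
  have hY : m * ((y - b) / B) ^ 2 = m * (1 - m) := by
    rcases le_total 0 (1 - ((y - b) / B) ^ 2) with h | h
    · rw [max_eq_left h] at hm; rw [hm]; ring
    · rw [max_eq_right h] at hm; rw [hm]; ring
  have e3 : (0 + 3 : ℝ) * (0 + 2) * m ^ (0 + 1) * (-(2 * (y - b) / B ^ 2)) ^ 2 + (0 + 3) * m ^ (0 + 2) * -(2 / B ^ 2)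
      = 1 / B ^ 2 * (24 * (m * ((y - b) / B) ^ 2) - 6 * m ^ 2) := by
    field_simp; ring
  have e4 : -(10 / B ^ 2) * m ^ (0 + 3) = 1 / B ^ 2 * (-10 * m ^ 3) := by ring
  push_cast
  rw [e3, e4, hY]
  apply mul_le_mul_of_nonneg_left _ (by positivity)
  nlinarith [mul_nonneg m0 (sq_nonneg (m - 3/2)), mul_nonneg m0 (sq_nonneg m)]

theorem lap_prod {α β : ℝ → ℝ} (x y : ℝ) : grushinLap (fun p : ℝ × ℝ => α p.1 * β p.2) (x, y) = deriv (deriv α) x * β y + x ^ 2 * (α x * deriv (deriv β) y) := by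
  unfold grushinLap pXX pYY
  have e1 : deriv (fun x => α x * β y) = fun x => deriv α x * β y := funext fun x => deriv_mul_const_field _
  have e2 : deriv (fun y => α x * β y) = fun y => α x * deriv β y := funext fun y => deriv_const_mul_field _
  simp only
  rw [e1, e2, deriv_mul_const_field, deriv_const_mul_field]

theorem TT_hopf {k : ℝ} (hk : 0 < k) {g : ℝ × ℝ → ℝ} {C : ℝ} (hg : BM g C) (hc : Continuous g) (ho : ∀ x y, g (-x, y) = -g (x, y))
    (h0 : ∀ x y, 0 < x → 0 < g (x, y)) (y0 : ℝ) : ∃ c > 0, ∃ d > 0, ∀ x, 0 < x → x < d → c * x ≤ TT k g (x, y0) := by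
  set M := k + 10 with hM
  set d := 1 / M with hd
  have M0 : 0 < M := by positivity
  have d0 : 0 < d := by positivity
  have dM : d * M = 1 := by rw [hd]; field_simp
  have d1 : d ≤ 1 / 10 := by rw [hd]; apply one_div_le_one_div_of_le <;> linarith
  set χ : ℝ → ℝ := fun x => Real.smoothTransition (2 - x ^ 2 / d ^ 2) with hχ
  have cχ : ContDiff ℝ 2 χ := Real.smoothTransition.contDiff.comp (by fun_prop)
  set α : ℝ → ℝ := fun x => (x + M * x ^ 3) * χ x with hα
  have cα : ContDiff ℝ 2 α := (by fun_prop : ContDiff ℝ 2 fun x : ℝ => x + M * x ^ 3).mul cχ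
  have χ1 : ∀ x, |x| < d → χ x = 1 := fun x hx => by
    apply Real.smoothTransition.one_of_one_le
    have : x ^ 2 / d ^ 2 ≤ 1 := by
      rw [div_le_one (by positivity), ← sq_abs]
      gcongr
    linarith
  have χ2 : ∀ x, 2 * d < |x| → χ x = 0 := fun x hx => by
    apply Real.smoothTransition.zero_of_nonpos
    have : 2 ≤ x ^ 2 / d ^ 2 := by
      rw [le_div_iff₀ (by positivity), ← sq_abs x]
      nlinarith
    linarith
  set φ : ℝ × ℝ → ℝ := fun p => α p.1 * bq y0 1 p.2 with hφ
  have cφ : ContDiff ℝ 2 φ := (cα.comp contDiff_fst).mul ((bq_cd y0 1).comp contDiff_snd)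
  have kφ : HasCompactSupport φ := by
    refine HasCompactSupport.intro (K := Icc (-(2 * d)) (2 * d) ×ˢ Icc (y0 - 1) (y0 + 1)) (isCompact_Icc.prod isCompact_Icc) fun p hp => ?_
    simp only [hφ]
    by_cases h1 : 2 * d < |p.1|
    · simp [hα, χ2 _ h1]
    · have h2 : 1 ≤ |p.2 - y0| := by
        by_contra hn
        push Not at hn h1
        rw [abs_lt] at hn
        exact hp ⟨abs_le.1 h1, by constructor <;> linarith⟩
      rw [bq_zero one_pos h2, mul_zero]
  have φo : ∀ x y, φ (-x, y) = -φ (x, y) := fun x y => by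
    simp only [hφ, hα, hχ]
    rw [neg_sq]; ring
  obtain ⟨⟨D, hD⟩, _⟩ := TT_cc hk cφ kφ
  set K : Set (ℝ × ℝ) := Icc d (2 * d) ×ˢ Icc (y0 - 1) (y0 + 1) with hK
  have Kk : IsCompact K := isCompact_Icc.prod isCompact_Icc
  obtain ⟨p0, hp0, hmin⟩ := Kk.exists_isMinOn ⟨(d, y0), ⟨⟨le_rfl, by linarith⟩, by constructor <;> linarith⟩⟩ hc.continuousOn
  set c := g p0 with hcd
  have c0 : 0 < c := h0 p0.1 p0.2 (d0.trans_le hp0.1.1)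
  have D1 : 0 < |D| + 1 := by positivity
  set ε := c / (|D| + 1) with hε
  have ε0 : 0 < ε := by positivity
  have key := TT_RPcomp hk (ε := ε) hg ho cφ kφ φo (fun x y hx => by
    by_cases hin : (x, y) ∈ K
    · have h1 : k * φ (x, y) - grushinLap φ (x, y) ≤ |D| + 1 := ((le_abs_self _).trans (hD.2 (x, y))).trans ((le_abs_self D).trans (by linarith))
      have h2 := mul_le_mul_of_nonneg_left h1 ε0.le
      rw [hε, div_mul_cancel₀ _ D1.ne'] at h2
      exact h2.trans (hmin hin)
    · refine le_trans (mul_nonpos_of_nonneg_of_nonpos ε0.le ?_) (h0 x y hx).le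
      have hl : grushinLap φ (x, y) = _ := lap_prod x y
      rw [hl]
      simp only [hφ]
      have hb := bq_dd (b := y0) one_pos y
      have hb0 := bq_nonneg y0 1 y
      rcases lt_or_ge x d with hxd | hxd
      · have ev : α =ᶠ[𝓝 x] fun x => x + M * x ^ 3 := by
          filter_upwards [Ioo_mem_nhds hx hxd] with z hz
          simp only [hα]
          rw [χ1 z (by rw [abs_of_pos hz.1]; exact hz.2), mul_one]
        have dd : deriv (deriv α) x = 6 * M * x := by
          have e1 : deriv (fun x => x + M * x ^ 3) = fun x : ℝ => 1 + M * (3 * x ^ 2) := by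
            funext z
            refine HasDerivAt.deriv (((hasDerivAt_id z).add ((hasDerivAt_pow 3 z).const_mul M)).congr_deriv ?_)
            norm_num
          rw [ev.deriv.deriv_eq, e1]
          refine HasDerivAt.deriv (((((hasDerivAt_pow 2 x).const_mul 3).const_mul M).const_add 1).congr_deriv ?_)
          norm_num; ring
        rw [dd, ev.eq_of_nhds]
        norm_num at hb
        have a0 : 0 ≤ x + M * x ^ 3 := by positivity
        have Mx : M * x ^ 2 ≤ 1 := by
          have : x ^ 2 ≤ d * 1 := by nlinarith
          nlinarith
        have ax : x + M * x ^ 3 ≤ 2 * x := by nlinarith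
        have x21 : x ^ 2 ≤ 1 := by nlinarith
        have s1 : -(x ^ 2 * ((x + M * x ^ 3) * deriv (deriv (bq y0 1)) y)) ≤ 10 * (x + M * x ^ 3) * bq y0 1 y := by
          have t1 : (x ^ 2 * (x + M * x ^ 3)) * (-(10 * bq y0 1 y)) ≤ (x ^ 2 * (x + M * x ^ 3)) * deriv (deriv (bq y0 1)) y :=
            mul_le_mul_of_nonneg_left hb (by positivity)
          have t2 : x ^ 2 * ((x + M * x ^ 3) * bq y0 1 y) ≤ 1 * ((x + M * x ^ 3) * bq y0 1 y) := mul_le_mul_of_nonneg_right x21 (by positivity)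
          nlinarith
        have s2 : ((k + 10) * (x + M * x ^ 3)) * bq y0 1 y ≤ (6 * M * x) * bq y0 1 y := by
          apply mul_le_mul_of_nonneg_right _ hb0
          rw [← hM]; nlinarith
        nlinarith
      · by_cases hx2 : 2 * d < x
        · have ev : α =ᶠ[𝓝 x] fun _ => 0 := by
            filter_upwards [Ioi_mem_nhds hx2] with z hz
            simp only [hα]
            rw [χ2 z (lt_of_lt_of_le hz (le_abs_self _)), mul_zero]
          rw [ev.deriv.deriv_eq, ev.eq_of_nhds]; simp
        · push Not at hx2
          have hy : 1 < |y - y0| := by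
            by_contra hn
            push Not at hn
            rw [abs_le] at hn
            exact hin ⟨⟨hxd, hx2⟩, by constructor <;> linarith⟩
          have ev : bq y0 1 =ᶠ[𝓝 y] fun _ => 0 := by
            have : ∀ᶠ z in 𝓝 y, 1 < |z - y0| := (by fun_prop : Continuous fun z : ℝ => |z - y0|).continuousAt.eventually (lt_mem_nhds hy)
            filter_upwards [this] with z hz using bq_zero one_pos hz.le
          rw [ev.deriv.deriv_eq, ev.eq_of_nhds]; simp)
  refine ⟨ε, ε0, d, d0, fun x hx hxd => (mul_le_mul_of_nonneg_left ?_ ε0.le).trans (key x y0 hx)⟩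
  simp only [hφ, hα]
  rw [χ1 x (by rw [abs_of_pos hx]; exact hxd), mul_one]
  have : bq y0 1 y0 = 1 := by simp [bq]
  rw [this]
  have : 0 ≤ M * x ^ 3 := by positivity
  linarith
end

section
open MeasureTheory Filter Topology Set

/-- The nonlinearity `f s = k s - W' s`. -/
structure FK (k : ℝ) (f : ℝ → ℝ) : Prop where
  hk : 0 < k
  cont : Continuous f
  odd : ∀ s, f (-s) = -f s
  one : f 1 = k
  mono : StrictMonoOn f (Icc (-1) 1)

/-- The resolvent composed with the nonlinearity. -/
noncomputable def TF (k : ℝ) (f : ℝ → ℝ) (u : ℝ × ℝ → ℝ) : ℝ × ℝ → ℝ := TT k fun q => f (u q)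

namespace FK
variable {k : ℝ} {f : ℝ → ℝ} {u v : ℝ × ℝ → ℝ}

theorem le (F : FK k f) {a b : ℝ} (ha : |a| ≤ 1) (hb : |b| ≤ 1) (h : a ≤ b) : f a ≤ f b :=
  F.mono.monotoneOn (abs_le.1 ha) (abs_le.1 hb) h

theorem lt (F : FK k f) {a b : ℝ} (ha : |a| ≤ 1) (hb : |b| ≤ 1) (h : a < b) : f a < f b :=
  F.mono (abs_le.1 ha) (abs_le.1 hb) h

theorem bd (F : FK k f) {a : ℝ} (ha : |a| ≤ 1) : |f a| ≤ k := by
  have h1 := F.le ha (b := 1) (by simp) (abs_le.1 ha).2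
  have h2 := F.le (a := -1) (by simp) ha (abs_le.1 ha).1
  rw [F.odd, F.one] at h2
  rw [F.one] at h1
  exact abs_le.2 ⟨h2, h1⟩

theorem bm (F : FK k f) (hm : Measurable u) (hb : ∀ p, |u p| ≤ 1) : BM (fun q => f (u q)) k :=
  ⟨F.cont.measurable.comp hm, fun p => F.bd (hb p)⟩

theorem TF_bd (F : FK k f) (hm : Measurable u) (hb : ∀ p, |u p| ≤ 1) (p : ℝ × ℝ) : |TF k f u p| ≤ 1 := by
  have := (TT_spec F.hk (F.bm hm hb)).bd p
  rwa [div_self F.hk.ne'] at this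

theorem TF_cont (F : FK k f) (hm : Measurable u) (hb : ∀ p, |u p| ≤ 1) : Continuous (TF k f u) := TT_cont F.hk (F.bm hm hb)

theorem TF_mono (F : FK k f) (hm : Measurable u) (hb : ∀ p, |u p| ≤ 1) (hm' : Measurable v) (hb' : ∀ p, |v p| ≤ 1) (h : ∀ p, u p ≤ v p) (p : ℝ × ℝ) :
    TF k f u p ≤ TF k f v p := TT_mono F.hk (F.bm hm hb) (F.bm hm' hb') (fun q => F.le (hb q) (hb' q) (h q)) p

theorem TF_lt (F : FK k f) (hm : Continuous u) (hb : ∀ p, |u p| ≤ 1) (hm' : Continuous v) (hb' : ∀ p, |v p| ≤ 1) (h : ∀ p, u p ≤ v p)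
    (h1 : ∃ p, u p < v p) (p : ℝ × ℝ) : TF k f u p < TF k f v p := by
  have B1 := F.bm hm.measurable hb
  have B2 := F.bm hm'.measurable hb'
  have := TT_pos F.hk (B2.sub B1) ((F.cont.comp hm').sub (F.cont.comp hm)) (fun q => sub_nonneg.2 (F.le (hb q) (hb' q) (h q)))
    (h1.imp fun q hq => (sub_pos.2 (F.lt (hb q) (hb' q) hq)).ne') p
  rw [TT_sub F.hk B2 B1] at this
  exact sub_pos.1 this

theorem TF_y (F : FK k f) (hm : Measurable u) (hb : ∀ p, |u p| ≤ 1) (τ : ℝ) (p : ℝ × ℝ) :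
    TF k f (fun q => u (q.1, q.2 + τ)) p = TF k f u (p.1, p.2 + τ) := by
  have := TT_aff F.hk (F.bm hm hb) 1 1 τ (by norm_num) (by norm_num) p
  simpa [TF] using this

theorem TF_rho (F : FK k f) (hm : Measurable u) (hb : ∀ p, |u p| ≤ 1) (p : ℝ × ℝ) :
    TF k f (fun q => u (-q.1, q.2)) p = TF k f u (-p.1, p.2) := by
  have := TT_aff F.hk (F.bm hm hb) (-1) 1 0 (by norm_num) (by norm_num) p
  simpa [TF] using this

theorem TF_neg (F : FK k f) (hm : Measurable u) (hb : ∀ p, |u p| ≤ 1) (p : ℝ × ℝ) :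
    TF k f (fun q => -u (-q.1, -q.2)) p = -TF k f u (-p.1, -p.2) := by
  have h := TT_aff F.hk (F.bm hm hb) (-1) (-1) 0 (by norm_num) (by norm_num) p
  have h2 := TT_smul F.hk ((F.bm hm hb).aff (-1) (-1) 0 0) (-1) p
  simp only [neg_mul, one_mul, add_zero] at h h2
  simp only [TF, F.odd]
  rw [h2, h]

theorem TF_RP (F : FK k f) (hm : Measurable u) (hb : ∀ p, |u p| ≤ 1) (h : ∀ x y, 0 < x → u (-x, y) ≤ u (x, y)) (x y : ℝ) (hx : 0 < x) :
    TF k f u (-x, y) ≤ TF k f u (x, y) := by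
  have B := F.bm hm hb
  have m2 : Measurable fun q : ℝ × ℝ => u (-q.1, q.2) := hm.comp (by fun_prop)
  have B2 := F.bm m2 (fun q => hb _)
  have := TT_RP F.hk (B.sub B2) (fun x y => by simp) (fun x y hx => sub_nonneg.2 (F.le (hb _) (hb _) (h x y hx))) x y hx
  rw [TT_sub F.hk B B2] at this
  have e := F.TF_rho hm hb (x, y)
  simp only [TF] at e ⊢
  rw [e] at this
  linarith

theorem TF_RP_lt (F : FK k f) (hm : Continuous u) (hb : ∀ p, |u p| ≤ 1) (h : ∀ x y, 0 < x → u (-x, y) ≤ u (x, y))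
    (h1 : ∃ x y, 0 < x ∧ u (-x, y) < u (x, y)) (x y : ℝ) (hx : 0 < x) :
    TF k f u (-x, y) < TF k f u (x, y) := by
  have B := F.bm hm.measurable hb
  have m2 : Continuous fun q : ℝ × ℝ => u (-q.1, q.2) := hm.comp (by fun_prop)
  have B2 := F.bm m2.measurable (fun q => hb _)
  have := TT_pos_half F.hk (B.sub B2) ((F.cont.comp hm).sub (F.cont.comp m2)) (fun x y => by simp)
    (fun x y hx => sub_nonneg.2 (F.le (hb _) (hb _) (h x y hx)))
    (by obtain ⟨a, b, ha, hab⟩ := h1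
        exact ⟨a, b, ha, (sub_pos.2 (F.lt (hb _) (hb _) hab)).ne'⟩) x y hx
  rw [TT_sub F.hk B B2] at this
  have e := F.TF_rho hm.measurable hb (x, y)
  simp only [TF] at e ⊢
  rw [e] at this
  linarith

theorem TF_lim (F : FK k f) {un : ℕ → ℝ × ℝ → ℝ} (hm : ∀ n, Measurable (un n)) (hb : ∀ n p, |un n p| ≤ 1)
    (hl : ∀ p, Tendsto (fun n => un n p) atTop (𝓝 (u p))) (p : ℝ × ℝ) : Tendsto (fun n => TF k f (un n) p) atTop (𝓝 (TF k f u p)) :=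
  TT_lim F.hk (fun n => F.bm (hm n) (hb n)) (fun q => (F.cont.tendsto _).comp (hl q)) p
end FK

/-- Truncated fixed-point map. -/
noncomputable def BB (k : ℝ) (f : ℝ → ℝ) (lo hi u : ℝ × ℝ → ℝ) : ℝ × ℝ → ℝ := fun p => max (lo p) (min (hi p) (TF k f u p))

/-- Solutions of the double obstacle problem. -/
structure OB (k : ℝ) (f : ℝ → ℝ) (lo hi u : ℝ × ℝ → ℝ) : Prop where
  cont : Continuous u
  bd : ∀ p, |u p| ≤ 1
  fp : ∀ p, u p = BB k f lo hi u p

/-- Admissible obstacles. -/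
structure OO (lo hi : ℝ × ℝ → ℝ) : Prop where
  clo : Continuous lo
  chi : Continuous hi
  blo : ∀ p, |lo p| ≤ 1
  bhi : ∀ p, |hi p| ≤ 1
  le : ∀ p, lo p ≤ hi p

section
variable {k : ℝ} {f : ℝ → ℝ} {lo hi u v : ℝ × ℝ → ℝ}

theorem BB_bd (F : FK k f) (O : OO lo hi) (hm : Measurable u) (hb : ∀ p, |u p| ≤ 1) (p : ℝ × ℝ) : |BB k f lo hi u p| ≤ 1 := by
  have h1 := abs_le.1 (O.blo p)
  have h2 := abs_le.1 (O.bhi p)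
  have h3 := abs_le.1 (F.TF_bd hm hb p)
  exact abs_le.2 ⟨h1.1.trans (le_max_left _ _), max_le h1.2 ((min_le_left _ _).trans h2.2)⟩

theorem BB_cont (F : FK k f) (O : OO lo hi) (hm : Measurable u) (hb : ∀ p, |u p| ≤ 1) : Continuous (BB k f lo hi u) :=
  O.clo.max (O.chi.min (F.TF_cont hm hb))

theorem OB.lo_le (U : OB k f lo hi u) (p : ℝ × ℝ) : lo p ≤ u p := by rw [U.fp]; exact le_max_left _ _

theorem OB.le_hi (U : OB k f lo hi u) (O : OO lo hi) (p : ℝ × ℝ) : u p ≤ hi p := by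
  rw [U.fp]; exact max_le (O.le p) (min_le_left _ _)

theorem min_exists (F : FK k f) (O : OO lo hi) : ∃ u, OB k f lo hi u ∧
    (∀ v, Continuous v → (∀ p, |v p| ≤ 1) → (∀ p, BB k f lo hi v p ≤ v p) → ∀ p, u p ≤ v p) ∧
    ((∀ x y, 0 < x → lo (-x, y) ≤ lo (x, y)) → (∀ x y, 0 < x → hi (-x, y) ≤ hi (x, y)) → ∀ x y, 0 < x → u (-x, y) ≤ u (x, y)) := by
  set un : ℕ → ℝ × ℝ → ℝ := fun n => (BB k f lo hi)^[n] lo with hun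
  have us : ∀ n, un (n + 1) = BB k f lo hi (un n) := fun n => Function.iterate_succ_apply' _ _ _
  have ub : ∀ n, Continuous (un n) ∧ ∀ p, |un n p| ≤ 1 := by
    intro n
    induction n with
    | zero => exact ⟨O.clo, O.blo⟩
    | succ n ih => rw [us]; exact ⟨BB_cont F O ih.1.measurable ih.2, BB_bd F O ih.1.measurable ih.2⟩
  have um : ∀ p, Monotone fun n => un n p := by
    have : ∀ n p, un n p ≤ un (n + 1) p := by
      intro n
      induction n with
      | zero => intro p; rw [us]; exact le_max_left _ _
      | succ n ih =>
        intro p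
        rw [us, us (n + 1)]
        exact max_le_max le_rfl (min_le_min le_rfl (F.TF_mono (ub _).1.measurable (ub _).2 (ub _).1.measurable (ub _).2 ih p))
    exact fun p => monotone_nat_of_le_succ fun n => this n p
  have hl : ∀ p, ∃ l, Tendsto (fun n => un n p) atTop (𝓝 l) := fun p =>
    ⟨_, tendsto_atTop_ciSup (um p) ⟨1, by rintro _ ⟨n, rfl⟩; exact (abs_le.1 ((ub n).2 p)).2⟩⟩
  choose u hu using hl
  have mu : Measurable u := measurable_of_tendsto_metrizable (fun n => (ub n).1.measurable) (tendsto_pi_nhds.2 hu)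
  have bu : ∀ p, |u p| ≤ 1 := fun p => le_of_tendsto (hu p).abs (Eventually.of_forall fun n => (ub n).2 p)
  have fp : ∀ p, u p = BB k f lo hi u p := fun p => by
    refine tendsto_nhds_unique ((tendsto_add_atTop_iff_nat 1).2 (hu p)) ?_
    simp only [us]
    exact tendsto_const_nhds.max (tendsto_const_nhds.min (F.TF_lim (fun n => (ub n).1.measurable) (fun n => (ub n).2) hu p))
  refine ⟨u, ⟨?_, bu, fp⟩, fun v cv bv hv p => ?_, fun h1 h2 x y hx => ?_⟩
  · rw [funext fp]; exact BB_cont F O mu bu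
  · refine le_of_tendsto (hu p) (Eventually.of_forall fun n => ?_)
    have : ∀ n p, un n p ≤ v p := by
      intro n
      induction n with
      | zero => intro p; exact (le_max_left _ _).trans (hv p)
      | succ n ih =>
        intro p
        rw [us]
        exact (max_le_max le_rfl (min_le_min le_rfl (F.TF_mono (ub _).1.measurable (ub _).2 cv.measurable bv ih p))).trans (hv p)
    exact this n p
  · have : ∀ n x y, 0 < x → un n (-x, y) ≤ un n (x, y) := by
      intro n
      induction n with
      | zero => exact h1
      | succ n ih =>
        intro x y hx
        rw [us]
        exact max_le_max (h1 x y hx) (min_le_min (h2 x y hx) (F.TF_RP (ub _).1.measurable (ub _).2 ih x y hx))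
    exact le_of_tendsto_of_tendsto' (hu _) (hu _) fun n => this n x y hx

theorem fp_limit (F : FK k f) (O : OO lo hi) {lon hin un : ℕ → ℝ × ℝ → ℝ}
    (hlo : ∀ p, Tendsto (fun n => lon n p) atTop (𝓝 (lo p))) (hhi : ∀ p, Tendsto (fun n => hin n p) atTop (𝓝 (hi p)))
    (hu : ∀ n, OB k f (lon n) (hin n) (un n)) :
    ∃ φ : ℕ → ℕ, StrictMono φ ∧ ∃ u, OB k f lo hi u ∧ ∀ p, Tendsto (fun n => un (φ n) p) atTop (𝓝 (u p)) := by
  obtain ⟨L, hL⟩ := TT_modulus F.hk k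
  obtain ⟨φ, hφ, v, cv, hv⟩ := compactness (un := fun n => TF k f (un n)) (D := 1) (L := L)
    (fun n => F.TF_bd (hu n).cont.measurable (hu n).bd) (fun n p q => hL _ (F.bm (hu n).cont.measurable (hu n).bd) p q)
  have l : ∀ p, Tendsto (fun n => un (φ n) p) atTop (𝓝 (max (lo p) (min (hi p) (v p)))) := fun p => by
    have := ((hlo p).comp hφ.tendsto_atTop).max (((hhi p).comp hφ.tendsto_atTop).min (hv p))
    refine this.congr fun n => ?_
    rw [(hu (φ n)).fp]; rfl
  refine ⟨φ, hφ, _, ⟨O.clo.max (O.chi.min cv), fun p => le_of_tendsto (l p).abs (Eventually.of_forall fun n => (hu _).bd p), fun p => ?_⟩, l⟩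
  have := F.TF_lim (fun n => (hu (φ n)).cont.measurable) (fun n => (hu (φ n)).bd) l p
  have := tendsto_nhds_unique this (hv p)
  simp only [BB]
  rw [this]

theorem sliding (F : FK k f) (O : OO lo hi) (U : OB k f lo hi u) (V : OB k f lo hi v) (e1 e2 : ℝ)
    (HT : ∀ s p, TF k f (fun q => u (q.1 + s * e1, q.2 + s * e2)) p = TF k f u (p.1 + s * e1, p.2 + s * e2))
    (alo : ∀ s p, 0 ≤ s → lo p ≤ lo (p.1 + s * e1, p.2 + s * e2)) (ahi : ∀ s p, 0 ≤ s → hi p ≤ hi (p.1 + s * e1, p.2 + s * e2))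
    (S : ℝ) (hS : 0 ≤ S) (bS : ∀ s p, S ≤ s → hi p ≤ lo (p.1 + s * e1, p.2 + s * e2))
    {K : Set (ℝ × ℝ)} (hK : IsCompact K)
    (cK : ∀ p, hi p ≤ lo p ∨ ∃ q ∈ K, ∀ s, TF k f u (p.1 + s * e1, p.2 + s * e2) - TF k f v p = TF k f u (q.1 + s * e1, q.2 + s * e2) - TF k f v q)
    (p0 : ℝ × ℝ) (h0 : hi p0 = -1) (h1 : ∀ s, 0 < s → -1 < hi (p0.1 + s * e1, p0.2 + s * e2)) :
    (∀ p, v p ≤ u p) ∧ ∀ s, 0 < s → ∀ p, TF k f v p < TF k f u (p.1 + s * e1, p.2 + s * e2) := by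
  have tc : ∀ s : ℝ, Continuous fun q : ℝ × ℝ => (q.1 + s * e1, q.2 + s * e2) := fun s => by fun_prop
  have uT : ∀ p, -1 < TF k f u p := fun p => by
    have := F.TF_lt (u := fun _ => -1) (v := u) continuous_const (by simp) U.cont U.bd (fun p => (abs_le.1 (U.bd p)).1)
      ⟨_, (h1 1 one_pos).trans_le ((bS S _ le_rfl).trans (U.lo_le _))⟩ p
    rwa [TF, TT_const F.hk, F.odd, F.one, neg_div, div_self F.hk.ne'] at this
  have str : ∀ s, 0 < s → (∀ p, v p ≤ u (p.1 + s * e1, p.2 + s * e2)) → ∀ p, TF k f v p < TF k f u (p.1 + s * e1, p.2 + s * e2) := fun s hs h p => by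
    rw [← HT]
    refine F.TF_lt V.cont V.bd (U.cont.comp (tc s)) (fun p => U.bd _) h ⟨p0, ?_⟩ p
    have := V.le_hi O p0
    rw [h0] at this
    refine this.trans_lt ?_
    show -1 < u _
    rw [U.fp]
    exact lt_max_of_lt_right (lt_min (h1 s hs) (uT _))
  have cl : ∀ {s : ℝ} {l : Filter ℝ} [l.NeBot], Tendsto id l (𝓝 s) → (∀ᶠ t in l, ∀ p, v p ≤ u (p.1 + t * e1, p.2 + t * e2)) →
      ∀ p, v p ≤ u (p.1 + s * e1, p.2 + s * e2) := fun {s l _} hl h p => by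
    refine ge_of_tendsto (f := fun t => u (p.1 + t * e1, p.2 + t * e2)) (x := l) ?_ (h.mono fun t ht => ht p)
    have : Continuous fun t => u (p.1 + t * e1, p.2 + t * e2) := U.cont.comp (by fun_prop)
    exact (this.tendsto s).comp hl
  set A : Set ℝ := {s | 0 ≤ s ∧ ∀ t, s ≤ t → ∀ p, v p ≤ u (p.1 + t * e1, p.2 + t * e2)} with hA
  have A1 : S ∈ A := ⟨hS, fun t ht p => (V.le_hi O p).trans ((bS t p ht).trans (U.lo_le _))⟩
  have Ab : BddBelow A := ⟨0, fun s hs => hs.1⟩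
  set s0 := sInf A with hs0
  have s00 : 0 ≤ s0 := le_csInf ⟨S, A1⟩ fun s hs => hs.1
  have P1 : ∀ t, s0 < t → ∀ p, v p ≤ u (p.1 + t * e1, p.2 + t * e2) := fun t ht => by
    obtain ⟨s, hs, hst⟩ := exists_lt_of_csInf_lt ⟨S, A1⟩ ht
    exact hs.2 t hst.le
  have P0 : ∀ p, v p ≤ u (p.1 + s0 * e1, p.2 + s0 * e2) :=
    cl (l := 𝓝[>] s0) (tendsto_id.mono_left nhdsWithin_le_nhds) (eventually_mem_nhdsWithin.mono fun t ht => P1 t ht)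
  have z : s0 = 0 := by
    by_contra hne
    have pos : 0 < s0 := lt_of_le_of_ne s00 (Ne.symm hne)
    have st := str s0 pos P0
    have cG : Continuous fun z : ℝ × (ℝ × ℝ) => TF k f u (z.2.1 + z.1 * e1, z.2.2 + z.1 * e2) - TF k f v z.2 := by
      have c1 := F.TF_cont U.cont.measurable U.bd
      have c2 := F.TF_cont V.cont.measurable V.bd
      exact (c1.comp (by fun_prop)).sub (c2.comp continuous_snd)
    have ev : ∀ᶠ s in 𝓝 s0, ∀ q ∈ K, 0 < TF k f u (q.1 + s * e1, q.2 + s * e2) - TF k f v q := by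
      refine hK.eventually_forall_of_forall_eventually fun q hq => ?_
      exact cG.continuousAt.eventually (lt_mem_nhds (sub_pos.2 (st q)))
    obtain ⟨ε, ε0, hε⟩ := Metric.eventually_nhds_iff.1 ev
    have key : max (s0 - ε / 2) 0 ∈ A := by
      refine ⟨le_max_right _ _, fun t ht p => ?_⟩
      have t0 := (le_max_right _ _).trans ht
      have t1 := (le_max_left _ _).trans ht
      by_cases h : s0 < t
      · exact P1 t h p
      have hd : dist t s0 < ε := by rw [Real.dist_eq, abs_lt]; constructor <;> linarith
      rcases cK p with h | ⟨q, hq, e⟩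
      · exact (V.le_hi O p).trans (h.trans ((alo t p t0).trans (U.lo_le _)))
      · have := hε hd q hq
        rw [← e, sub_pos] at this
        rw [V.fp, U.fp]
        exact max_le_max (alo t p t0) (min_le_min (ahi t p t0) this.le)
    have := csInf_le Ab key
    rw [← hs0] at this
    rcases max_choice (s0 - ε / 2) 0 with h | h <;> rw [h] at this <;> linarith
  rw [z] at P0 P1
  exact ⟨fun p => by simpa using P0 p, fun s hs => str s hs (P1 s hs)⟩
end
end

section
open MeasureTheory Filter Topology Set

/-- Clamp to `[-1,1]`. -/
noncomputable def clp (t : ℝ) : ℝ := max (-1) (min 1 t)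
/-- Half-width of the obstacles. -/
noncomputable def rr (R x : ℝ) : ℝ := max (R - |x|) 0
/-- Linear profile. -/
noncomputable def ell (σ : ℝ) (p : ℝ × ℝ) : ℝ := (1 - σ) * p.2 + σ * p.1
/-- Lower obstacle. -/
noncomputable def LO (R σ : ℝ) (p : ℝ × ℝ) : ℝ := clp (ell σ p - rr R p.1)
/-- Upper obstacle. -/
noncomputable def HI (R σ : ℝ) (p : ℝ × ℝ) : ℝ := clp (ell σ p + rr R p.1)

theorem clp_mono {a b : ℝ} (h : a ≤ b) : clp a ≤ clp b := max_le_max le_rfl (min_le_min le_rfl h)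
theorem clp_bd (a : ℝ) : |clp a| ≤ 1 := abs_le.2 ⟨le_max_left _ _, max_le (by norm_num) (min_le_left _ _)⟩
theorem clp_cont : Continuous clp := by unfold clp; fun_prop
theorem clp_one {a : ℝ} (h : 1 ≤ a) : clp a = 1 := by rw [clp, min_eq_left h, max_eq_right (by norm_num)]
theorem clp_neg_one {a : ℝ} (h : a ≤ -1) : clp a = -1 := by
  rw [clp, max_eq_left (by rw [min_eq_right (by linarith)]; exact h)]
theorem clp_neg (a : ℝ) : clp (-a) = -clp a := by
  simp only [clp]
  rcases le_total a (-1) with h | h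
  · rw [min_eq_left (by linarith), min_eq_right (by linarith), max_eq_left h, max_eq_right (by norm_num)]; norm_num
  rcases le_total a 1 with h' | h'
  · rw [min_eq_right (by linarith), min_eq_right h', max_eq_right h, max_eq_right (by linarith)]
  · rw [min_eq_right (by linarith), min_eq_left h', max_eq_left (by linarith), max_eq_right (by norm_num)]
theorem clp_gt {a : ℝ} (h : -1 < a) : -1 < clp a := lt_max_of_lt_right (lt_min (by norm_num) h)
theorem clp_pos {a : ℝ} (h : 0 < a) : 0 < clp a := lt_max_of_lt_right (lt_min (by norm_num) h)
theorem rr_nn (R x : ℝ) : 0 ≤ rr R x := le_max_right _ _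
theorem rr_neg (R x : ℝ) : rr R (-x) = rr R x := by rw [rr, abs_neg, rr]
theorem rr_le {R : ℝ} (hR : 0 ≤ R) (x : ℝ) : rr R x ≤ R := max_le (by linarith [abs_nonneg x]) hR
theorem rr_zero {R x : ℝ} (h : R ≤ |x|) : rr R x = 0 := max_eq_right (by linarith)
theorem rr_lip (R x s : ℝ) (hs : 0 ≤ s) : |rr R (x + s) - rr R x| ≤ s := by
  refine (abs_max_sub_max_le_max _ _ _ _).trans (max_le ?_ (by simpa using hs))
  have := abs_abs_sub_abs_le_abs_sub (x) (x + s)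
  rw [show R - |x + s| - (R - |x|) = |x| - |x + s| by ring]
  refine this.trans ?_
  rw [sub_add_cancel_left, abs_neg, abs_of_nonneg hs]

theorem ell_neg (σ : ℝ) (p : ℝ × ℝ) : ell σ (-p.1, -p.2) = -ell σ p := by simp only [ell]; ring

theorem OO_LH (R σ : ℝ) : OO (LO R σ) (HI R σ) where
  clo := clp_cont.comp (by unfold ell rr; fun_prop)
  chi := clp_cont.comp (by unfold ell rr; fun_prop)
  blo _ := clp_bd _
  bhi _ := clp_bd _
  le p := clp_mono (by linarith [rr_nn R p.1])

theorem LO_neg (R σ : ℝ) (p : ℝ × ℝ) : LO R σ (-p.1, -p.2) = -HI R σ p := by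
  rw [LO, HI, ell_neg, rr_neg, ← clp_neg]; congr 1; ring
theorem HI_neg (R σ : ℝ) (p : ℝ × ℝ) : HI R σ (-p.1, -p.2) = -LO R σ p := by
  rw [LO, HI, ell_neg, rr_neg, ← clp_neg]; congr 1; ring

theorem neg_aux {a b t : ℝ} (h : a ≤ b) : -max (-b) (min (-a) t) = max a (min b (-t)) := by
  rcases le_total t (-b) with h1 | h1
  · rw [min_eq_right (by linarith), max_eq_left h1, min_eq_left (by linarith), max_eq_right h, neg_neg]
  rcases le_total t (-a) with h2 | h2
  · rw [min_eq_right h2, max_eq_right h1, min_eq_right (by linarith), max_eq_right (by linarith)]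
  · rw [min_eq_left h2, max_eq_right (by linarith), min_eq_right (by linarith), max_eq_left (by linarith), neg_neg]

section
variable {k : ℝ} {f : ℝ → ℝ}

theorem OB.neg (F : FK k f) {R σ : ℝ} {u : ℝ × ℝ → ℝ} (U : OB k f (LO R σ) (HI R σ) u) :
    OB k f (LO R σ) (HI R σ) (fun p => -u (-p.1, -p.2)) where
  cont := (U.cont.comp (by fun_prop)).neg
  bd p := by rw [abs_neg]; exact U.bd _
  fp p := by
    rw [BB, F.TF_neg U.cont.measurable U.bd, U.fp, BB, LO_neg, HI_neg]
    exact neg_aux ((OO_LH R σ).le p)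

theorem ob_sol (F : FK k f) {R σ : ℝ} (hR : 3 ≤ R) (h0 : 0 ≤ σ) (h1 : σ ≤ 1) : ∃ u, OB k f (LO R σ) (HI R σ) u ∧
    (∀ v, OB k f (LO R σ) (HI R σ) v → v = u) ∧ (∀ p, u (-p.1, -p.2) = -u p) ∧ (∀ τ p, 0 ≤ τ → u p ≤ u (p.1, p.2 + τ)) ∧
    (∀ x y, 0 < x → u (-x, y) ≤ u (x, y)) ∧ (σ < 1 → ∀ s, 0 < s → ∀ p, TF k f u p < TF k f u (p.1, p.2 + s)) ∧
    (σ = 1 → (∀ p, u p = u (p.1, 0)) ∧ ∀ s, 0 < s → ∀ p, TF k f u p < TF k f u (p.1 + s, p.2)) := by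
  have O := OO_LH R σ
  obtain ⟨u, U, um, ur⟩ := min_exists F O
  have V := U.neg F
  have rp := ur (fun x y hx => clp_mono (by simp only [rr_neg, ell]; nlinarith)) (fun x y hx => clp_mono (by simp only [rr_neg, ell]; nlinarith))
  have ty : ∀ τ, (∀ p : ℝ × ℝ, LO R σ p ≤ LO R σ (p.1, p.2 + τ)) → (∀ p : ℝ × ℝ, HI R σ p ≤ HI R σ (p.1, p.2 + τ)) → ∀ p, u p ≤ u (p.1, p.2 + τ) := fun τ h1 h2 p => by
    refine um (fun p => u (p.1, p.2 + τ)) (U.cont.comp (by fun_prop)) (fun p => U.bd _) (fun p => ?_) p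
    rw [BB, F.TF_y U.cont.measurable U.bd, U.fp]
    exact max_le_max (h1 p) (min_le_min (h2 p) le_rfl)
  have lm : ∀ τ p, 0 ≤ τ → ell σ p ≤ ell σ (p.1, p.2 + τ) := fun τ p h => by simp only [ell]; nlinarith
  have ym : ∀ τ p, 0 ≤ τ → u p ≤ u (p.1, p.2 + τ) := fun τ p h => ty τ (fun p => clp_mono (by simp only; linarith [lm τ p h])) (fun p => clp_mono (by simp only; linarith [lm τ p h])) p
  have yi : σ = 1 → ∀ p, u p = u (p.1, 0) := fun e => by
    have : ∀ τ p, u p ≤ u (p.1, p.2 + τ) := fun τ p => ty τ (fun p => by simp [LO, ell, e]) (fun p => by simp [HI, ell, e]) p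
    exact fun p => le_antisymm (by simpa using this (-p.2) p) (by simpa using this p.2 (p.1, 0))
  have main : (∀ p, -u (-p.1, -p.2) ≤ u p) ∧ (σ < 1 → ∀ s, 0 < s → ∀ p, TF k f (fun p => -u (-p.1, -p.2)) p < TF k f u (p.1, p.2 + s)) ∧
    (σ = 1 → ∀ s, 0 < s → ∀ p, TF k f (fun p => -u (-p.1, -p.2)) p < TF k f u (p.1 + s, p.2)) := by
    rcases h1.lt_or_eq with h | rfl
    · have h' : 0 < 1 - σ := by linarith
      have := sliding F O U V 0 1 (fun s p => by simpa using F.TF_y U.cont.measurable U.bd s p)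
        (fun s p hs => clp_mono (by simp only [mul_zero, add_zero, mul_one]; linarith [lm s p hs]))
        (fun s p hs => clp_mono (by simp only [mul_zero, add_zero, mul_one]; linarith [lm s p hs])) (2 * R / (1 - σ)) (by positivity)
        (fun s p hs => clp_mono (by
          rw [div_le_iff₀ h'] at hs
          simp only [mul_zero, add_zero, mul_one, ell]
          nlinarith [rr_le (by linarith : 0 ≤ R) p.1]))
        (K := Icc (-R) R ×ˢ Icc (-((2 * R + 1) / (1 - σ))) ((2 * R + 1) / (1 - σ))) (isCompact_Icc.prod isCompact_Icc)
        (fun p => by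
          by_cases hp : p ∈ Icc (-R) R ×ˢ Icc (-((2 * R + 1) / (1 - σ))) ((2 * R + 1) / (1 - σ))
          · exact Or.inr ⟨p, hp, fun s => rfl⟩
          left
          by_cases hx : R ≤ |p.1|
          · rw [LO, HI, rr_zero hx, add_zero, sub_zero]
          have hx' := abs_lt.1 (not_le.1 hx)
          have r := rr_le (by linarith : 0 ≤ R) p.1
          have hσ : σ * |p.1| ≤ R := by nlinarith [abs_nonneg p.1]
          have hσ' := abs_le.1 (show |σ * p.1| ≤ R by rwa [abs_mul, abs_of_nonneg h0])
          by_cases hy : p.2 < -((2 * R + 1) / (1 - σ))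
          · rw [lt_neg, div_lt_iff₀ h'] at hy
            rw [HI, clp_neg_one (by simp only [ell]; linarith)]
            exact le_max_left _ _
          by_cases hy2 : (2 * R + 1) / (1 - σ) < p.2
          · rw [div_lt_iff₀ h'] at hy2
            rw [LO, clp_one (by simp only [ell]; linarith)]
            exact (abs_le.1 (clp_bd _)).2
          exact absurd ⟨⟨hx'.1.le, hx'.2.le⟩, ⟨not_lt.1 hy, not_lt.1 hy2⟩⟩ hp)
        (R, (-1 - σ * R) / (1 - σ))
        (by rw [HI, rr_zero (le_abs_self _), add_zero, clp_neg_one]; simp only [ell]; field_simp; linarith)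
        (fun s hs => by
          simp only [mul_zero, add_zero, mul_one, HI]
          rw [rr_zero (le_abs_self _), add_zero]
          refine clp_gt ?_
          have : ell σ (R, (-1 - σ * R) / (1 - σ) + s) = -1 + (1 - σ) * s := by simp only [ell]; field_simp; ring
          rw [this]; nlinarith)
      simp only [mul_zero, add_zero, mul_one] at this
      exact ⟨this.1, fun _ => this.2, fun e => absurd e h.ne⟩
    · have yi := yi rfl
      have ti : ∀ {w : ℝ × ℝ → ℝ}, Measurable w → (∀ p, |w p| ≤ 1) → (∀ p, w p = w (p.1, 0)) → ∀ x y, TF k f w (x, y) = TF k f w (x, 0) := fun {w} hm hb hw x y =>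
        TT_indep F.hk (F.bm hm hb) (fun x y => by rw [hw]) x y
      have t1 := ti U.cont.measurable U.bd yi
      have t2 := ti V.cont.measurable V.bd (fun p => by rw [yi]; rw [yi (_, -(p.1, (0:ℝ)).2)])
      have := sliding F O U V 1 0 (fun s p => by
          have := TT_transX F.hk (F.bm U.cont.measurable U.bd) (F.cont.comp U.cont) (fun x y => by rw [yi]) s p
          simpa [TF] using this)
        (fun s p hs => clp_mono (by simp only [mul_one, mul_zero, add_zero, ell]; linarith [(abs_le.1 (rr_lip R p.1 s hs)).2]))
        (fun s p hs => clp_mono (by simp only [mul_one, mul_zero, add_zero, ell]; linarith [(abs_le.1 (rr_lip R p.1 s hs)).1])) (2 * R) (by positivity)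
        (fun s p hs => clp_mono (by
          simp only [mul_zero, add_zero, mul_one, ell]
          linarith [rr_le (by linarith : 0 ≤ R) p.1, rr_le (by linarith : 0 ≤ R) (p.1 + s)]))
        (K := Icc (-R) R ×ˢ {0}) (isCompact_Icc.prod isCompact_singleton)
        (fun p => by
          by_cases hx : R ≤ |p.1|
          · left; rw [LO, HI, rr_zero hx, add_zero, sub_zero]
          have hx' := abs_lt.1 (not_le.1 hx)
          refine Or.inr ⟨(p.1, 0), ⟨⟨hx'.1.le, hx'.2.le⟩, rfl⟩, fun s => ?_⟩
          rw [t1, t1 _ ((p.1, (0:ℝ)).2 + s * 0), t2 p.1 p.2])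
        (-(R + 1) / 2, 0)
        (by
          rw [HI, rr, abs_of_nonpos (by simp only; linarith), max_eq_left (by simp only; linarith), clp_neg_one]; simp only [ell]; linarith)
        (fun s hs => by
          refine clp_gt ?_
          simp only [ell, mul_one]
          rcases le_total (-(R + 1) / 2 + s) 0 with h | h
          · rw [rr, abs_of_nonpos h]; linarith [le_max_left (R - -(-(R + 1) / 2 + s)) 0]
          · linarith [rr_nn R (-(R + 1) / 2 + s)])
      simp only [mul_zero, add_zero, mul_one] at this
      exact ⟨this.1, fun e => absurd e (lt_irrefl _), fun _ => this.2⟩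
  have an : ∀ p, -u (-p.1, -p.2) = u p := fun p => le_antisymm (main.1 p) (um _ V.cont V.bd (fun p => (V.fp p).ge) p)
  have an' := funext an
  rw [an'] at main
  refine ⟨u, U, fun w hw => funext fun p => le_antisymm ?_ (um _ hw.cont hw.bd (fun p => (hw.fp p).ge) p), fun p => ?_, ym, rp, main.2.1, fun e => ⟨yi e, main.2.2 e⟩⟩
  · have Wn := hw.neg F
    have := um _ Wn.cont Wn.bd (fun p => (Wn.fp p).ge) (-p.1, -p.2)
    simp only [neg_neg] at this
    linarith [an p]
  · linarith [an p]
end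
end

section
open MeasureTheory Filter Topology Set

section
variable {k : ℝ} {f : ℝ → ℝ}

theorem ivt_sol (F : FK k f) {R : ℝ} (hR : 3 ≤ R) : ∃ σ u, OB k f (LO R σ) (HI R σ) u ∧ (∀ p, u (-p.1, -p.2) = -u p) ∧
    (∀ τ p, 0 ≤ τ → u p ≤ u (p.1, p.2 + τ)) ∧ (∀ x y, 0 < x → u (-x, y) ≤ u (x, y)) ∧ u (1, 0) = u (0, 1) ∧ 0 ≤ σ ∧ σ ≤ 1 ∧
    ∀ x y, 0 < x → TF k f u (-x, y) < TF k f u (x, y) := by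
  choose! u hu using fun σ (h : σ ∈ Icc (0:ℝ) 1) => ob_sol F hR h.1 h.2
  have cont : ∀ p, ContinuousOn (fun σ => u σ p) (Icc 0 1) := fun p => by
    rw [continuousOn_iff_continuous_domRestrict]
    refine SeqContinuous.continuous fun xn x hx => ?_
    refine tendsto_of_subseq_tendsto fun ns hns => ?_
    have hx' : Tendsto (fun n => (xn (ns n) : ℝ)) atTop (𝓝 x) := (continuous_subtype_val.tendsto _).comp (hx.comp hns)
    have cl : ∀ p, Continuous fun σ => LO R σ p := fun p => clp_cont.comp (by unfold ell rr; fun_prop)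
    have ch : ∀ p, Continuous fun σ => HI R σ p := fun p => clp_cont.comp (by unfold ell rr; fun_prop)
    obtain ⟨φ, hφ, w, W, hw⟩ := fp_limit F (OO_LH R x) (fun p => ((cl p).tendsto _).comp hx') (fun p => ((ch p).tendsto _).comp hx')
      (fun n => (hu _ (xn (ns n)).2).1)
    refine ⟨φ, ?_⟩
    rw [(hu _ x.2).2.1 w W] at hw
    exact hw p
  have m0 : (0:ℝ) ∈ Icc (0:ℝ) 1 := by simp
  have m1 : (1:ℝ) ∈ Icc (0:ℝ) 1 := by simp
  have T0 : ∀ σ ∈ Icc (0:ℝ) 1, u σ (0, 0) = 0 ∧ TF k f (u σ) (0, 0) = 0 := fun σ hσ => by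
    obtain ⟨U, -, an, -⟩ := hu σ hσ
    have h1 := an (0, 0)
    have h2 := F.TF_neg U.cont.measurable U.bd (0, 0)
    simp only [an, neg_neg, neg_zero] at h1 h2
    exact ⟨by linarith, by linarith⟩
  have zero : u 0 (1, 0) < u 0 (0, 1) := by
    obtain ⟨U, un, an, ym, rp, st, -⟩ := hu 0 m0
    have ev : (fun p : ℝ × ℝ => u 0 (-p.1, p.2)) = u 0 := by
      refine un _ ⟨U.cont.comp (by fun_prop), fun p => U.bd _, fun p => ?_⟩
      rw [BB, F.TF_rho U.cont.measurable U.bd, U.fp]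
      simp only [BB, LO, HI, ell, rr_neg, zero_mul, add_zero]
    have e1 := an (1, 0)
    have e2 := congrFun ev (1, 0)
    simp only [neg_zero] at e1 e2
    have h := st one_pos 1 one_pos (0, 0)
    rw [(T0 0 m0).2, zero_add] at h
    have : 0 < u 0 (0, 1) := by
      rw [U.fp]
      exact lt_max_of_lt_right (lt_min (clp_pos (by simp only [ell]; linarith [rr_nn R 0])) h)
    linarith
  have one : u 1 (0, 1) < u 1 (1, 0) := by
    obtain ⟨U, un, an, ym, rp, -, st⟩ := hu 1 m1
    obtain ⟨yi, st⟩ := st rfl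
    have e := yi (0, 1)
    rw [(T0 1 m1).1] at e
    have h := st 1 one_pos (0, 0)
    rw [(T0 1 m1).2, zero_add] at h
    have : 0 < u 1 (1, 0) := by
      rw [U.fp]
      exact lt_max_of_lt_right (lt_min (clp_pos (by simp only [ell]; linarith [rr_nn R 1])) h)
    linarith
  obtain ⟨σ, hσ, e⟩ := intermediate_value_Icc zero_le_one ((cont (1, 0)).sub (cont (0, 1))) (⟨by linarith, by linarith⟩ :
    (0:ℝ) ∈ Icc (u 0 (1, 0) - u 0 (0, 1)) (u 1 (1, 0) - u 1 (0, 1)))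
  replace e : u σ (1, 0) - u σ (0, 1) = 0 := e
  obtain ⟨U, un, an, ym, rp, st, -⟩ := hu σ hσ
  refine ⟨σ, u σ, U, an, ym, rp, by linarith, hσ.1, hσ.2, ?_⟩
  have σ0 : 0 < σ := lt_of_le_of_ne hσ.1 fun h => by rw [← h] at e; linarith
  refine F.TF_RP_lt U.cont U.bd rp ⟨R, 0, by linarith, ?_⟩
  have r0 : rr R R = 0 := rr_zero (le_abs_self _)
  have h1 := U.le_hi (OO_LH R σ) (-R, 0)
  have h2 := U.lo_le (R, 0)
  simp only [HI, LO, rr_neg, r0, ell, mul_zero, zero_add, add_zero, sub_zero, mul_neg, clp_neg] at h1 h2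
  have := clp_pos (show 0 < σ * R by nlinarith)
  linarith

theorem unif_small {un : ℕ → ℝ × ℝ → ℝ} {L : ℝ} (hL : ∀ n p q, |un n p - un n q| ≤ L * md p q)
    (hl : ∀ p, Tendsto (fun n => un n p) atTop (𝓝 0)) {K : Set (ℝ × ℝ)} (hK : IsCompact K) {ε : ℝ} (hε : 0 < ε) :
    ∀ᶠ n in atTop, ∀ p ∈ K, |un n p| < ε := by
  by_contra hn
  rw [not_eventually] at hn
  obtain ⟨ψ, hψ, h⟩ := extraction_of_frequently_atTop hn
  push Not at h
  choose q hq hqe using h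
  obtain ⟨p, hp, θ, hθ, hl2⟩ := hK.tendsto_subseq hq
  have t1 : Tendsto (fun n => |un (ψ (θ n)) p|) atTop (𝓝 0) := by
    have := ((hl p).comp (hψ.comp hθ).tendsto_atTop).abs
    simpa using this
  have t2 : Tendsto (fun n => L * md (q (θ n)) p) atTop (𝓝 0) := by
    have := ((md_lim p).comp hl2).const_mul L
    simpa using this
  have t3 := t1.add t2
  rw [add_zero] at t3
  have := ge_of_tendsto t3 (Eventually.of_forall fun n => (show ε ≤ _ from by
    have h1 := hqe (θ n)
    have h2 := hL (ψ (θ n)) (q (θ n)) p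
    have h3 := abs_sub_abs_le_abs_sub (un (ψ (θ n)) (q (θ n))) (un (ψ (θ n)) p)
    linarith))
  linarith
end
end

section
open MeasureTheory Filter Topology Set

section
variable {k : ℝ} {f : ℝ → ℝ}

theorem inact {σ R : ℝ} (h0 : 0 ≤ σ) (h1 : σ ≤ 1) {p : ℝ × ℝ} (h : 2 * |p.1| + |p.2| + 1 ≤ R) : LO R σ p = -1 ∧ HI R σ p = 1 := by
  have hr : R - |p.1| ≤ rr R p.1 := le_max_left _ _
  have a1 := neg_abs_le p.1
  have a2 := le_abs_self p.1
  have a3 := neg_abs_le p.2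
  have a4 := le_abs_self p.2
  have e1 : ell σ p ≤ |p.2| + |p.1| := by simp only [ell]; nlinarith [abs_nonneg p.1, abs_nonneg p.2]
  have e2 : -(|p.2| + |p.1|) ≤ ell σ p := by simp only [ell]; nlinarith [abs_nonneg p.1, abs_nonneg p.2]
  exact ⟨clp_neg_one (by linarith), clp_one (by linarith)⟩

theorem small_contra (F : FK k f) {κ ε : ℝ} (hκ : 0 < κ)
    (hf : ∀ a b, |a| < ε → |b| < ε → a ≤ b → (k + κ) * (b - a) ≤ f b - f a) {L B : ℝ} (hL : L = √(40 / κ)) (hB : B = 3 * L * L)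
    {u : ℝ × ℝ → ℝ} (cu : Continuous u) (bu : ∀ p, |u p| ≤ 1) (st : ∀ x y, 0 < x → TF k f u (-x, y) < TF k f u (x, y))
    (he : ∀ p : ℝ × ℝ, p ∈ Icc (-(3 * L)) (3 * L) ×ˢ Icc (-B) B → u p = TF k f u p ∧ |TF k f u p| < ε) : False := by
  have L0 : 0 < L := by rw [hL]; positivity
  have L2 : 10 / L ^ 2 = κ / 4 := by rw [hL, Real.sq_sqrt (by positivity)]; field_simp; norm_num
  have B0 : 0 < B := by rw [hB]; positivity
  have LB : (3 * L) ^ 2 * (10 / B ^ 2) = κ / 4 := by rw [← L2, hB]; field_simp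
  set α := bq (2 * L) L with hα
  set β := bq 0 B with hβ
  set φ : ℝ × ℝ → ℝ := fun p => α p.1 * β p.2 with hφ
  have cφ : ContDiff ℝ 2 φ := ((bq_cd _ _).comp contDiff_fst).mul ((bq_cd _ _).comp contDiff_snd)
  have α0 : ∀ x, x ≤ L ∨ 3 * L ≤ x → α x = 0 := fun x hx => bq_zero L0 (by rw [le_abs]; rcases hx with h | h; right; linarith; left; linarith)
  have β0 : ∀ y, B ≤ |y| → β y = 0 := fun y hy => bq_zero B0 (by simpa using hy)
  have φ0 : ∀ p, 0 ≤ φ p := fun p => mul_nonneg (bq_nonneg _ _ _) (bq_nonneg _ _ _)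
  have supp : ∀ p, p ∉ Icc L (3 * L) ×ˢ Icc (-B) B → φ p = 0 := fun p hp => by
    simp only [hφ]
    by_cases h1 : p.1 ≤ L ∨ 3 * L ≤ p.1
    · rw [α0 _ h1, zero_mul]
    · push Not at h1
      rw [β0, mul_zero]
      by_contra hn
      exact hp ⟨⟨h1.1.le, h1.2.le⟩, abs_le.1 (not_le.1 hn).le⟩
  have kφ : HasCompactSupport φ := HasCompactSupport.intro (isCompact_Icc.prod isCompact_Icc) supp
  have lap1 : ∀ x y, 0 < x → -(κ / 2) * φ (x, y) ≤ grushinLap φ (x, y) := fun x y hx => by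
    rw [hφ, lap_prod]
    have d1 := mul_le_mul_of_nonneg_right (bq_dd (b := 2 * L) L0 x) (bq_nonneg 0 B y)
    have d2 := mul_le_mul_of_nonneg_left (bq_dd (b := 0) B0 y) (mul_nonneg (sq_nonneg x) (bq_nonneg (2 * L) L x))
    rw [← hα, ← hβ] at d1 d2
    rw [L2] at d1
    have ab : 0 ≤ α x * β y := φ0 (x, y)
    have d3 : x ^ 2 * (10 / B ^ 2) * (α x * β y) ≤ κ / 4 * (α x * β y) := by
      by_cases h : 3 * L ≤ x
      · rw [α0 x (Or.inr h)]; simp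
      · rw [← LB]; gcongr; exact (not_le.1 h).le
    simp only
    nlinarith
  have lap2 : ∀ x y, x ≤ 0 → grushinLap φ (x, y) = 0 := fun x y hx => by
    rw [hφ, lap_prod, α0 x (Or.inl (by linarith))]
    have : α =ᶠ[𝓝 x] fun _ => 0 := by
      filter_upwards [gt_mem_nhds (show x < L by linarith)] with z hz
      exact α0 z (Or.inl hz.le)
    rw [this.deriv.deriv_eq]; simp
  have B1 := F.bm cu.measurable bu
  have c2 : Continuous fun q : ℝ × ℝ => u (-q.1, q.2) := cu.comp (by fun_prop)
  have B2 := F.bm c2.measurable (fun q => bu _)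
  have S := TT_spec F.hk (B1.sub B2)
  have ew : ∀ p, TT k (fun p => f (u p) - f (u (-p.1, p.2))) p = TF k f u p - TF k f u (-p.1, p.2) := fun p => by
    rw [TT_sub F.hk B1 B2, ← F.TF_rho cu.measurable bu]; rfl
  set w := TT k (fun p => f (u p) - f (u (-p.1, p.2))) with hw
  have cw : Continuous w := S.cont
  have wp : ∀ x y, 0 < x → 0 < w (x, y) := fun x y hx => by rw [ew]; exact sub_pos.2 (st x y hx)
  have ds := S.ds φ cφ kφ
  have cl := continuous_lap cφ
  have i1 : Integrable fun p => w p * grushinLap φ p := int_of_cc (cw.mul cl) ((hcs_lap cφ kφ).mul_left)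
  have i2 : Integrable fun p => (k * w p - (f (u p) - f (u (-p.1, p.2)))) * φ p :=
    int_of_cc (((continuous_const.mul cw).sub ((F.cont.comp cu).sub (F.cont.comp c2))).mul cφ.continuous) kφ.mul_left
  have i3 : Integrable fun p => w p * φ p := int_of_cc (cw.mul cφ.continuous) kφ.mul_left
  have in1 : -(κ / 2) * ∫ p, w p * φ p ≤ ∫ p, w p * grushinLap φ p := by
    rw [← integral_const_mul]
    refine integral_mono (i3.const_mul _) i1 fun p => ?_
    obtain ⟨x, y⟩ := p
    simp only
    rcases le_or_gt x 0 with h | h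
    · rw [lap2 x y h, supp (x, y) (fun hp => by have := hp.1.1; simp only at this; linarith)]; simp
    · nlinarith [lap1 x y h, wp x y h]
  have in2 : ∫ p, (k * w p - (f (u p) - f (u (-p.1, p.2)))) * φ p ≤ -κ * ∫ p, w p * φ p := by
    rw [← integral_const_mul]
    refine integral_mono i2 (i3.const_mul _) fun p => ?_
    simp only
    by_cases hp : p ∈ Icc L (3 * L) ×ˢ Icc (-B) B
    · obtain ⟨⟨h1, h2⟩, h3⟩ := hp
      obtain ⟨e1, l1⟩ := he p ⟨⟨by linarith, h2⟩, h3⟩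
      obtain ⟨e2, l2⟩ := he (-p.1, p.2) ⟨⟨by simp only; linarith, by simp only; linarith⟩, h3⟩
      have hwp := wp p.1 p.2 (by linarith)
      have e := ew p
      have := hf (u (-p.1, p.2)) (u p) (by rwa [e2]) (by rwa [e1]) (by rw [e1, e2]; linarith [show 0 < w p from hwp])
      rw [e1, e2, ← e, ← e1, ← e2] at this
      nlinarith [φ0 p]
    · rw [supp p hp]; simp
  have pos : 0 < ∫ p, w p * φ p := by
    refine (cw.mul cφ.continuous).integral_pos_of_hasCompactSupport_nonneg_nonzero kφ.mul_left (fun p => ?_) (x := (2 * L, 0)) ?_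
    · by_cases hp : p ∈ Icc L (3 * L) ×ˢ Icc (-B) B
      · exact mul_nonneg (wp p.1 p.2 (by linarith [hp.1.1])).le (φ0 p)
      · simp [supp p hp]
    · exact (mul_pos (wp _ _ (by linarith)) (mul_pos (bq_pos L0 (by simpa using L0)) (bq_pos B0 (by simpa using B0)))).ne'
  rw [ds] at in1
  nlinarith

theorem entire_pre (F : FK k f) {κ ε : ℝ} (hκ : 0 < κ) (hε : 0 < ε)
    (hf : ∀ a b, |a| < ε → |b| < ε → a ≤ b → (k + κ) * (b - a) ≤ f b - f a) :
    ∃ u, Continuous u ∧ (∀ p, |u p| ≤ 1) ∧ TF k f u = u ∧ (∀ p, u (-p.1, -p.2) = -u p) ∧ (∀ τ p, 0 ≤ τ → u p ≤ u (p.1, p.2 + τ)) ∧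
    (∀ x y, 0 < x → u (-x, y) ≤ u (x, y)) ∧ u (1, 0) = u (0, 1) ∧ ∃ p, u p ≠ 0 := by
  choose σ u U an ym rp eq s0 s1 st using fun n : ℕ => ivt_sol F (R := n + 3) (by linarith [n.cast_nonneg (α := ℝ)])
  have O : OO (fun _ : ℝ × ℝ => -1) (fun _ => 1) := ⟨continuous_const, continuous_const, by simp, by simp, by intro p; norm_num⟩
  have ev : ∀ c : ℝ, ∀ᶠ n : ℕ in atTop, c ≤ (n:ℝ) + 3 := fun c => by
    filter_upwards [eventually_ge_atTop ⌈c⌉₊] with n hn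
    linarith [Nat.ceil_le.1 hn]
  obtain ⟨φ, hφ, v, V, hv⟩ := fp_limit F O
    (fun p => tendsto_const_nhds.congr' ((ev (2 * |p.1| + |p.2| + 1)).mono fun n hn => (inact (s0 n) (s1 n) hn).1.symm))
    (fun p => tendsto_const_nhds.congr' ((ev (2 * |p.1| + |p.2| + 1)).mono fun n hn => (inact (s0 n) (s1 n) hn).2.symm)) U
  have bb : ∀ w : ℝ × ℝ → ℝ, Continuous w → (∀ p, |w p| ≤ 1) → ∀ p, max (-1) (min 1 (TF k f w p)) = TF k f w p := fun w hw hb p => by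
    have := abs_le.1 (F.TF_bd hw.measurable hb p)
    rw [min_eq_right this.2, max_eq_right this.1]
  have fp : ∀ p, v p = TF k f v p := fun p => (V.fp p).trans (bb v V.cont V.bd p)
  refine ⟨v, V.cont, V.bd, (funext fp).symm, fun p => ?_, fun τ p hτ => ?_, fun x y hx => ?_, ?_, ?_⟩
  · exact tendsto_nhds_unique (hv _) ((hv p).neg.congr fun n => (an _ p).symm)
  · exact le_of_tendsto_of_tendsto' (hv _) (hv _) fun n => ym _ τ p hτ
  · exact le_of_tendsto_of_tendsto' (hv _) (hv _) fun n => rp _ x y hx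
  · exact tendsto_nhds_unique (hv _) ((hv _).congr fun n => (eq _).symm)
  · by_contra hn
    push Not at hn
    obtain ⟨M, hM⟩ := TT_modulus F.hk k
    have tl : ∀ p, Tendsto (fun n => TF k f (u (φ n)) p) atTop (𝓝 0) := fun p => by
      have := F.TF_lim (fun n => (U (φ n)).cont.measurable) (fun n => (U (φ n)).bd) hv p
      rwa [← fp, hn] at this
    set L := √(40 / κ) with hL
    set B := 3 * L * L with hB
    have e1 := unif_small (un := fun n => TF k f (u (φ n))) (L := M) (fun n p q => hM _ (F.bm (U _).cont.measurable (U _).bd) p q) tl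
      (isCompact_Icc.prod isCompact_Icc : IsCompact (Icc (-(3 * L)) (3 * L) ×ˢ Icc (-B) B)) hε
    have e2 := hφ.tendsto_atTop.eventually (ev (6 * L + B + 1))
    obtain ⟨n, h1, h2⟩ := (e1.and e2).exists
    refine small_contra F hκ hf hL hB (U (φ n)).cont (U _).bd (st _) fun p hp => ⟨?_, h1 p hp⟩
    have a1 := abs_le.2 hp.1
    have a2 := abs_le.2 hp.2
    have := inact (s0 (φ n)) (s1 (φ n)) (p := p) (R := φ n + 3) (by linarith)
    rw [(U (φ n)).fp, BB, this.1, this.2, bb _ (U _).cont (U _).bd]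

theorem entire (F : FK k f) {κ ε : ℝ} (hκ : 0 < κ) (hε : 0 < ε)
    (hf : ∀ a b, |a| < ε → |b| < ε → a ≤ b → (k + κ) * (b - a) ≤ f b - f a) :
    ∃ u, Continuous u ∧ (∀ p, |u p| ≤ 1) ∧ TF k f u = u ∧ (∀ τ p, 0 < τ → u p < u (p.1, p.2 + τ)) ∧
    (∀ x y, 0 < x → u (-x, y) < u (x, y)) := by
  obtain ⟨u, cu, bu, fp, an, ym, rp, eq, p0, hp0⟩ := entire_pre F hκ hε hf
  have w0 : u (1, 0) = 0 → ∀ x y, 0 < x → u (-x, y) = u (x, y) := fun h x y hx => by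
    by_contra hne
    have := F.TF_RP_lt cu bu rp ⟨x, y, hx, lt_of_le_of_ne (rp x y hx) hne⟩ 1 0 one_pos
    rw [fp, h] at this
    have e := an (1, 0)
    simp only [neg_zero] at e
    rw [e, h] at this
    simp at this
  have u0 : u (0, 0) = 0 := by have := an (0, 0); simp only [neg_zero] at this; linarith
  have sy : ∀ τ p, 0 < τ → u p < u (p.1, p.2 + τ) := fun τ p hτ => by
    by_contra hn
    have cT : Continuous fun q : ℝ × ℝ => u (q.1, q.2 + τ) := cu.comp (by fun_prop)
    have per : ∀ q : ℝ × ℝ, u (q.1, q.2 + τ) = u q := fun q => by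
      by_contra hne
      refine hn ?_
      have := F.TF_lt cu bu cT (fun q => bu _) (fun q => ym τ q hτ.le) ⟨q, lt_of_le_of_ne (ym τ q hτ.le) (Ne.symm hne)⟩ p
      rwa [F.TF_y cu.measurable bu, fp] at this
    have pern : ∀ (n : ℕ) (q : ℝ × ℝ), u (q.1, q.2 + n * τ) = u q := fun n q => by
      induction n with
      | zero => simp
      | succ n ih => rw [← ih, ← per (q.1, q.2 + n * τ)]; push_cast; congr 2; ring
    have yc : ∀ x y z, y ≤ z → u (x, y) = u (x, z) := fun x y z h => by
      refine le_antisymm (by simpa using ym (z - y) (x, y) (by linarith)) ?_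
      obtain ⟨n, hn⟩ := exists_nat_gt ((z - y) / τ)
      rw [div_lt_iff₀ hτ] at hn
      have := ym (y + n * τ - z) (x, z) (by linarith)
      have h2 := pern n (x, y)
      simp only at this h2
      rw [add_sub_cancel, h2] at this
      exact this
    have h10 : u (1, 0) = 0 := by rw [eq, ← yc 0 0 1 zero_le_one, u0]
    have ys : ∀ x y, u (x, -y) = u (x, y) := fun x y => by
      rcases le_total (-y) y with h | h
      · exact yc _ _ _ h
      · exact (yc _ _ _ h).symm
    have ev : ∀ x y, u (-x, y) = u (x, y) := fun x y => by
      rcases lt_trichotomy x 0 with h | h | h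
      · have := w0 h10 (-x) y (by linarith)
        rw [neg_neg] at this; exact this.symm
      · rw [h, neg_zero]
      · exact w0 h10 x y h
    have := an p0
    rw [ev, ys] at this
    exact hp0 (by linarith [show u (p0.1, p0.2) = u p0 from rfl])
  refine ⟨u, cu, bu, fp, sy, fun x y hx => lt_of_le_of_ne (rp x y hx) fun he => ?_⟩
  have ex : ¬∃ x y, 0 < x ∧ u (-x, y) < u (x, y) := fun h => by
    have := F.TF_RP_lt cu bu rp h x y hx
    rw [fp] at this
    exact this.ne he
  push Not at ex
  have e := an (1, 0)
  have e2 := ex 1 0 one_pos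
  have e3 := rp 1 0 one_pos
  have e4 := sy 1 (0, 0) one_pos
  simp only [neg_zero, zero_add] at e e4
  linarith
end
end

section
open MeasureTheory Filter Topology Set

/-- Continuous, bounded and uniformly Hölder in the second variable. -/
structure HB (h : ℝ × ℝ → ℝ) (γ : ℝ) : Prop where
  cont : Continuous h
  bd : ∃ A, ∀ p, |h p| ≤ A
  hol : ∃ L, HolY h γ L

theorem HolY.nn {h : ℝ × ℝ → ℝ} {γ L : ℝ} (H : HolY h γ L) : 0 ≤ L := by
  have := (abs_nonneg _).trans (H 0 0 1); simpa using this

namespace HB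
variable {g h : ℝ × ℝ → ℝ} {γ : ℝ}

theorem bm (H : HB h γ) : ∃ A, BM h A := by
  obtain ⟨A, hA⟩ := H.bd
  exact ⟨A, H.cont.measurable, hA⟩

theorem mul (H : HB g γ) (K : HB h γ) : HB (fun p => g p * h p) γ := by
  obtain ⟨A, hA⟩ := H.bd
  obtain ⟨B, hB⟩ := K.bd
  obtain ⟨L, hL⟩ := H.hol
  obtain ⟨P, hP⟩ := K.hol
  have hA0 := (abs_nonneg _).trans (hA 0)
  refine ⟨H.cont.mul K.cont, ⟨A * B, fun p => ?_⟩, ⟨A * P + B * L, fun x y τ => ?_⟩⟩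
  · rw [abs_mul]
    exact mul_le_mul (hA p) (hB p) (abs_nonneg _) hA0
  · have e : g (x, y + τ) * h (x, y + τ) - g (x, y) * h (x, y)
        = g (x, y + τ) * (h (x, y + τ) - h (x, y)) + h (x, y) * (g (x, y + τ) - g (x, y)) := by ring
    rw [e]
    refine (abs_add_le _ _).trans ?_
    rw [abs_mul, abs_mul, add_mul, mul_assoc, mul_assoc]
    have hB0 := (abs_nonneg _).trans (hB 0)
    gcongr
    · exact hA _
    · exact hP x y τ
    · exact hB _
    · exact hL x y τ

theorem add (H : HB g γ) (K : HB h γ) : HB (fun p => g p + h p) γ := by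
  obtain ⟨A, hA⟩ := H.bd
  obtain ⟨B, hB⟩ := K.bd
  obtain ⟨L, hL⟩ := H.hol
  obtain ⟨P, hP⟩ := K.hol
  refine ⟨H.cont.add K.cont, ⟨A + B, fun p => (abs_add_le _ _).trans (add_le_add (hA p) (hB p))⟩,
    ⟨L + P, fun x y τ => ?_⟩⟩
  have e : g (x, y + τ) + h (x, y + τ) - (g (x, y) + h (x, y))
        = (g (x, y + τ) - g (x, y)) + (h (x, y + τ) - h (x, y)) := by ring
  rw [e, add_mul]
  exact (abs_add_le _ _).trans (add_le_add (hL x y τ) (hP x y τ))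

theorem of_x {c : ℝ → ℝ} (hc : Continuous c) {A : ℝ} (hA : ∀ x, |c x| ≤ A) : HB (fun p => c p.1) γ :=
  ⟨hc.comp continuous_fst, ⟨A, fun p => hA _⟩, 0, fun x y τ => by simp⟩

theorem lip {φ : ℝ → ℝ} {C A : ℝ} (hC : ∀ s t, |s| ≤ A → |t| ≤ A → |φ s - φ t| ≤ C * |s - t|) (hφ : Continuous φ)
    (H : HB h γ) (hA : ∀ p, |h p| ≤ A) : HB (fun p => φ (h p)) γ := by
  obtain ⟨L, hL⟩ := H.hol
  have hA0 := (abs_nonneg _).trans (hA 0)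
  have hC0 : ∀ s, |s| ≤ A → |φ s| ≤ |φ 0| + |C| * A := by
    intro s hs
    have h1 := hC s 0 hs (by simpa using hA0)
    have h2 : C * |s - 0| ≤ |C| * A := by
      rw [sub_zero]; exact mul_le_mul (le_abs_self _) hs (abs_nonneg _) (abs_nonneg _)
    have := abs_sub_abs_le_abs_sub (φ s) (φ 0)
    linarith
  refine ⟨hφ.comp H.cont, ⟨_, fun p => hC0 _ (hA p)⟩, ⟨|C| * L, fun x y τ => ?_⟩⟩
  refine (hC _ _ (hA _) (hA _)).trans ?_
  rw [mul_assoc]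
  exact mul_le_mul (le_abs_self _) (hL x y τ) (abs_nonneg _) (abs_nonneg _)

theorem mono (H : HB h (3/4)) : HB h (1/4) := by
  obtain ⟨A, hA⟩ := H.bd
  obtain ⟨L, hL⟩ := H.hol
  have hA0 := (abs_nonneg _).trans (hA 0)
  refine ⟨H.cont, ⟨A, hA⟩, 2 * A + L, fun x y τ => ?_⟩
  have h0 := hL.nn
  rcases le_or_gt |τ| 1 with ht | ht
  · refine (hL x y τ).trans ?_
    rcases eq_or_ne τ 0 with h1 | h1
    · subst h1; simp
    · have := Real.rpow_le_rpow_of_exponent_ge (abs_pos.2 h1) ht (show (1/4:ℝ) ≤ 3/4 by norm_num)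
      have h2 := Real.rpow_nonneg (abs_nonneg τ) (1/4)
      nlinarith
  · have h2 : (1:ℝ) ≤ |τ| ^ (1/4:ℝ) := Real.one_le_rpow ht.le (by norm_num)
    have h3 := abs_sub (h (x, y + τ)) (h (x, y))
    have := hA (x, y + τ)
    have := hA (x, y)
    nlinarith
end HB

theorem theta_ex {t0 : ℝ} (h0 : 0 < t0) : ∃ θ θ' : ℝ → ℝ, (∀ t, HasDerivAt θ (θ' t) t) ∧ (∃ C, ∀ s t, |θ s - θ t| ≤ C * |s - t|) ∧
    (∃ C, ∀ s t, |θ' s - θ' t| ≤ C * |s - t|) ∧ Continuous θ' ∧ ∀ t, |t - t0| ≤ t0 / 4 → t * θ t = 1 := by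
  let χ : ContDiffBump t0 := ⟨t0 / 4, t0 / 2, by linarith, by linarith⟩
  have hc : ContDiff ℝ 2 fun t => χ t / t := by
    rw [contDiff_iff_contDiffAt]
    intro t
    rcases eq_or_ne t 0 with h | h
    · subst h
      have : (fun t => χ t / t) =ᶠ[𝓝 0] fun _ => 0 := by
        filter_upwards [Metric.ball_mem_nhds (0:ℝ) (show 0 < t0 / 2 by linarith)] with s hs
        rw [Metric.mem_ball, dist_zero_right, Real.norm_eq_abs] at hs
        rw [χ.zero_of_le_dist, zero_div]
        show t0 / 2 ≤ dist s t0
        rw [Real.dist_eq]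
        have := le_abs_self s
        have := neg_abs_le (s - t0)
        linarith
      exact contDiffAt_const.congr_of_eventuallyEq this
    · exact χ.contDiff.contDiffAt.div contDiffAt_id h
  have hs : HasCompactSupport fun t => χ t / t := by
    simp only [div_eq_mul_inv]
    exact χ.hasCompactSupport.mul_right (f' := fun t => t⁻¹)
  have hd : ContDiff ℝ 1 (deriv fun t => χ t / t) := ((contDiff_succ_iff_deriv (n := 1)).1 hc).2.2
  obtain ⟨C, hC⟩ := hc.lipschitzWith_of_hasCompactSupport hs (by norm_num)
  obtain ⟨D, hD⟩ := hd.lipschitzWith_of_hasCompactSupport hs.deriv (by norm_num)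
  refine ⟨_, _, fun t => (hc.differentiable (by norm_num) t).hasDerivAt, ⟨C, fun s t => ?_⟩, ⟨D, fun s t => ?_⟩, hd.continuous, fun t ht => ?_⟩
  · simpa [Real.dist_eq] using hC.dist_le_mul s t
  · simpa [Real.dist_eq] using hD.dist_le_mul s t
  · have : χ t = 1 := χ.one_of_mem_closedBall (by rw [Metric.mem_closedBall, Real.dist_eq]; exact ht)
    have h1 : t ≠ 0 := by rintro rfl; rw [zero_sub, abs_neg, abs_of_pos h0] at ht; linarith
    rw [this]; field_simp

/-- Exchange of derivatives. -/
theorem swap_xy {u ux v vx : ℝ × ℝ → ℝ} {M : ℝ} (hx : ∀ x y, HasDerivAt (fun x => u (x, y)) (ux (x, y)) x)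
    (hy : ∀ x y, HasDerivAt (fun y => u (x, y)) (v (x, y)) y) (cv : Continuous v)
    (hvx : ∀ x y, HasDerivAt (fun x => v (x, y)) (vx (x, y)) x) (cvx : Continuous vx) (hM : ∀ p, |vx p| ≤ M) (x y : ℝ) :
    HasDerivAt (fun y => ux (x, y)) (vx (x, y)) y := by
  have cl : ∀ {w : ℝ × ℝ → ℝ}, Continuous w → ∀ x, Continuous fun t => w (x, t) := fun h x => h.comp (by fun_prop)
  have key : ∀ y, ux (x, y) = ux (x, 0) + ∫ t in (0:ℝ)..y, vx (x, t) := by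
    intro y
    have h1 : ∀ x, u (x, y) = u (x, 0) + ∫ t in (0:ℝ)..y, v (x, t) := by
      intro x
      rw [intervalIntegral.integral_eq_sub_of_hasDerivAt (fun t _ => hy x t) ((cl cv x).intervalIntegrable _ _)]
      ring
    have h2 := (intervalIntegral.hasDerivAt_integral_of_dominated_loc_of_deriv_le (μ := volume) (a := 0) (b := y) (𝕜 := ℝ)
      (F := fun x t => v (x, t)) (F' := fun x t => vx (x, t)) (x₀ := x) (s := univ) (bound := fun _ => M) univ_mem
      (Eventually.of_forall fun x => (cl cv x).aestronglyMeasurable) ((cl cv x).intervalIntegrable _ _)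
      (cl cvx x).aestronglyMeasurable (Eventually.of_forall fun t _ x _ => hM _) intervalIntegrable_const
      (Eventually.of_forall fun t _ x _ => hvx x t)).2
    have h3 := (hx x 0).add h2
    have h4 : (fun x => u (x, y)) = (fun x => u (x, 0)) + fun x => ∫ t in (0:ℝ)..y, v (x, t) := funext h1
    rw [← h4] at h3
    exact (hx x y).unique h3
  rw [funext key]
  exact ((cl cvx x).integral_hasStrictDerivAt 0 y).hasDerivAt.const_add _

theorem CK_loc {δ r y0 : ℝ} (hδ : 0 < δ) (hr : 0 < r) (hr1 : r ≤ 1) (hδr : δ = r ^ 4 / 16) {g h : ℝ × ℝ → ℝ}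
    (e : ∀ x y, |x| < 2 * r → |y - y0| < 4 * r → g (x, y) = h (x, y)) (p : ℝ × ℝ) (h1 : |p.1| < r) (h2 : |p.2 - y0| < r) :
    CK (k0 δ 0) g p = CK (k0 δ 0) h p := by
  unfold CK
  congr 1; funext q
  rcases lt_or_ge δ (NN 0 q) with hq | hq
  · have : k0 δ 0 q = 0 := H0_zero hδ hq
    rw [this, mul_zero, mul_zero]
  · congr 1
    unfold NN at hq
    rw [hδr] at hq
    have a0 := sq_nonneg q.2.2
    have r2 : r ^ 2 ≤ r := by nlinarith
    have a1 : q.1 ^ 2 + q.2.1 ^ 2 ≤ (r / 2) ^ 2 := by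
      refine le_of_sq_le_sq ?_ (by positivity)
      nlinarith
    have a2 : |q.1| ≤ r / 2 := abs_le_of_sq_le_sq (by nlinarith [sq_nonneg q.2.1]) (by positivity)
    have a3 : |q.2.1| ≤ r / 2 := abs_le_of_sq_le_sq (by nlinarith [sq_nonneg q.1]) (by positivity)
    have a4 : |q.2.2| ≤ r := by
      refine abs_le_of_sq_le_sq ?_ hr.le
      have : 0 ≤ (q.1 ^ 2 + q.2.1 ^ 2 + 0 ^ 2) ^ 2 := sq_nonneg _
      nlinarith [sq_nonneg r]
    unfold shf
    apply e
    · have := abs_add_le p.1 q.1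
      linarith
    · have b1 : |(2 * p.1 + q.1) * q.2.1 / 2| ≤ r := by
        rw [abs_div, abs_mul, abs_two]
        have : |2 * p.1 + q.1| ≤ 3 * r := by
          have := abs_add_le (2 * p.1) q.1
          rw [abs_mul, abs_two] at this
          linarith
        have := mul_le_mul this a3 (abs_nonneg _) (by positivity)
        nlinarith
      have b2 := abs_add_le ((p.2 - y0) + q.2.2) ((2 * p.1 + q.1) * q.2.1 / 2)
      have b3 := abs_add_le (p.2 - y0) q.2.2
      have e : p.2 + q.2.2 + (2 * p.1 + q.1) * q.2.1 / 2 - y0 = ((p.2 - y0) + q.2.2) + ((2 * p.1 + q.1) * q.2.1 / 2) := by ring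
      rw [e]
      linarith

theorem vy_local {v G b bx F Fx : ℝ × ℝ → ℝ} {M N A r y0 : ℝ} (hv : CS v G M N) (hb : HB (fun p => b p * F p) (3/4))
    (hbx : HB (fun p => bx p * F p) (1/4)) (hbF : BM (fun p => b p * Fx p) A)
    (db : ∀ x y, HasDerivAt (fun x => b (x, y)) (bx (x, y)) x) (dF : ∀ x y, HasDerivAt (fun x => F (x, y)) (Fx (x, y)) x)
    (hr : 0 < r) (hr1 : r ≤ 1) (e : ∀ x y, |x| < 2 * r → |y - y0| < 4 * r → G (x, y) = b (x, y) * Fx (x, y)) :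
    ∃ vy : ℝ × ℝ → ℝ, Continuous vy ∧ ∀ x y, |x| < r → |y - y0| < r → HasDerivAt (fun y => v (x, y)) (vy (x, y)) y := by
  obtain ⟨δ, hδr⟩ : ∃ δ, δ = r ^ 4 / 16 := ⟨_, rfl⟩
  have hδ : 0 < δ := by rw [hδr]; positivity
  have hδ1 : δ ≤ 1 := by
    have := pow_le_one₀ hr.le hr1 (n := 4)
    linarith
  obtain ⟨C, hC⟩ := k0_KF hδ hδ1
  obtain ⟨C3, hC3⟩ := k3_KF hδ hδ1
  obtain ⟨B, hB⟩ := hb.bm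
  obtain ⟨Bx, hBx⟩ := hbx.bm
  obtain ⟨L, hL⟩ := hb.hol
  obtain ⟨Lx, hLx⟩ := hbx.hol
  have ksm : ContDiff ℝ 1 (ke δ 0) := contDiff_infty.1 (ke0_sm hδ) 1
  have kcs := (ke_BS hδ hδ1 0).hcs
  have key : ∀ x y, |x| < r → |y - y0| < r → v (x, y) =
      (CK (ke δ 0) v (x, y) - (-CK (k3 δ 0) (fun p => b p * F p) (x, y) - CK (k0 δ 0) (fun p => bx p * F p) (x, y))) / C0 δ := by
    intro x y h1 h2
    rw [hv.rep hδ hδ1 (x, y), CK_loc hδ hr hr1 hδr (h := fun p => b p * Fx p) e (x, y) h1 h2]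
    have h3 := CK0_hx hδ hδ1 hB (hBx.add hbF) (fun x y => (db x y).mul (dF x y)) (x, y)
    have h4 := CK_add_h (k0_int hδ hδ1) hBx hbF (x, y)
    rw [← h3, h4]
    ring
  refine ⟨fun p => (-CK (fun q => fderiv ℝ (ke δ 0) q (0, 0, 1)) v p - (-(-DK (k3t δ 0) (fun p => b p * F p) p) - -DK (kt δ 0) (fun p => bx p * F p) p)) / C0 δ, ?_, fun x y h1 h2 => ?_⟩
  · have c1 : Continuous (CK (fun q => fderiv ℝ (ke δ 0) q (0, 0, 1)) v) := CK_cont ((fd_cont ksm continuous_const).integrable_of_hasCompactSupport (fd_hcs kcs _)) hv.bm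
    have c2 := hC3.DK_cont (by norm_num) (by norm_num) (by norm_num) hB hL
    have c3 := hC.DK_cont (by norm_num) (by norm_num) (by norm_num) hBx hLx
    exact ((c1.neg).sub ((c2.neg.neg).sub c3.neg)).div_const _
  · have d1 := hd_CK_y ksm kcs (fun q => rfl) hv.bm x y
    have d2 := hC3.CK_dy (by norm_num) (by norm_num) (by norm_num) (by norm_num) (by norm_num) hB hL x y
    have d3 := hC.CK_dy (by norm_num) (by norm_num) (by norm_num) (by norm_num) (by norm_num) hBx hLx x y
    refine ((d1.sub (d2.neg.sub d3)).div_const (C0 δ)).congr_of_eventuallyEq ?_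
    have : ∀ᶠ t in 𝓝 y, |t - y0| < r := (by fun_prop : Continuous fun t => |t - y0|).continuousAt.eventually_lt continuousAt_const h2
    filter_upwards [this] with t ht using key x t h1 ht
end

section
open MeasureTheory Filter Topology Set

theorem dw_facts {W : ℝ → ℝ} (hW : DoubleWell W) : ∃ k, FK k (fun s => k * s - deriv W s) ∧
    (∀ s, |s| ≤ 1 → |deriv (deriv W) s| < k) ∧ ∃ κ > 0, ∃ ε > 0, ∀ a b, |a| < ε → |b| < ε → a ≤ b →
      (k + κ) * (b - a) ≤ (k * b - deriv W b) - (k * a - deriv W a) := by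
  obtain ⟨h2, hev, w1, -, wnn, hd0, -, -, hz⟩ := hW
  have hw : ContDiff ℝ 1 (deriv W) := ((contDiff_succ_iff_deriv (n := 1)).1 h2).2.2
  have cw := hw.continuous
  have dw : Differentiable ℝ (deriv W) := hw.differentiable (by norm_num)
  have cd : Continuous (deriv (deriv W)) := (contDiff_one_iff_deriv.1 hw).2
  have dneg : deriv (deriv W) 0 < 0 := by
    by_contra hn
    have hpos : 0 < deriv (deriv W) 0 := lt_of_le_of_ne (not_lt.1 hn) hd0.symm
    obtain ⟨ε, hε, hb⟩ := Metric.eventually_nhds_iff.1 (continuousAt_const.eventually_lt cd.continuousAt hpos)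
    set e := min (ε / 2) (1 / 2) with he
    have e0 : 0 < e := by positivity
    have e1 : e ≤ ε / 2 := min_le_left _ _
    have e2 : e ≤ 1 / 2 := min_le_right _ _
    have hm : StrictMonoOn (deriv W) (Icc 0 e) := by
      refine strictMonoOn_of_deriv_pos (convex_Icc _ _) cw.continuousOn fun x hx => ?_
      rw [interior_Icc] at hx
      refine hb ?_
      rw [Real.dist_eq, sub_zero, abs_of_pos hx.1]
      linarith [hx.2]
    have p0 : 0 < deriv W e := by
      have := hm ⟨le_rfl, e0.le⟩ ⟨e0.le, le_rfl⟩ e0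
      rwa [(hz 0).2 (by simp)] at this
    have pos : ∀ s ∈ Ioo (0:ℝ) 1, 0 < deriv W s := by
      intro s hs
      by_contra hn
      have := isPreconnected_Ioo.intermediate_value hs (show e ∈ Ioo (0:ℝ) 1 from ⟨e0, by linarith⟩) cw.continuousOn
      obtain ⟨z, hz1, hz2⟩ := this ⟨not_lt.1 hn, p0.le⟩
      rcases (hz z).1 hz2 with h | h | h <;> subst h <;> norm_num at hz1
    have := strictMonoOn_of_deriv_pos (convex_Icc (0:ℝ) 1) h2.continuous.continuousOn (by rwa [interior_Icc])
      ⟨le_rfl, zero_le_one⟩ ⟨zero_le_one, le_rfl⟩ zero_lt_one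
    linarith [wnn 0]
  obtain ⟨B, hB⟩ := (isCompact_Icc (a := (-1:ℝ)) (b := 1)).exists_bound_of_continuousOn cd.continuousOn
  have hBs : ∀ s, |s| ≤ 1 → |deriv (deriv W) s| < |B| + 1 := fun s hs => by
    have := hB s (abs_le.1 hs)
    rw [Real.norm_eq_abs] at this
    linarith [le_abs_self B]
  refine ⟨|B| + 1, ⟨by positivity, by fun_prop, fun s => ?_, ?_, ?_⟩, hBs, ?_⟩
  · have h1 : (fun r => W (-r)) = W := funext hev
    have h3 := deriv_comp_neg W s
    rw [h1] at h3
    beta_reduce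
    rw [h3]; ring
  · beta_reduce; rw [(hz 1).2 (by simp)]; ring
  · refine strictMonoOn_of_deriv_pos (convex_Icc _ _) (by fun_prop) fun x hx => ?_
    rw [interior_Icc] at hx
    have h3 : HasDerivAt (fun s => (|B| + 1) * s - deriv W s) ((|B| + 1) * 1 - deriv (deriv W) x) x :=
      ((hasDerivAt_id x).const_mul _).sub (dw x).hasDerivAt
    rw [h3.deriv]
    have := (abs_lt.1 (hBs x (abs_le.2 ⟨hx.1.le, hx.2.le⟩))).2
    linarith
  · set κ := -deriv (deriv W) 0 / 2 with hκ
    obtain ⟨ε, hε, hb⟩ := Metric.eventually_nhds_iff.1 (cd.continuousAt.eventually_lt (continuousAt_const (y := -κ)) (by linarith : deriv (deriv W) 0 < -κ))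
    refine ⟨κ, by linarith, ε, hε, fun a b ha hb' hab => ?_⟩
    have := Convex.image_sub_le_mul_sub_of_deriv_le (convex_Ioo (-ε) ε) cw.continuousOn dw.differentiableOn (C := -κ)
      (fun x hx => (hb (by rw [interior_Ioo] at hx; rw [Real.dist_eq, sub_zero]; exact abs_lt.2 hx)).le) a (abs_lt.1 ha) b (abs_lt.1 hb') hab
    linarith

theorem fd_of_partials {u a b : ℝ × ℝ → ℝ} (ca : Continuous a) (cb : Continuous b)
    (hx : ∀ x y, HasDerivAt (fun x => u (x, y)) (a (x, y)) x) (hy : ∀ x y, HasDerivAt (fun y => u (x, y)) (b (x, y)) y) (p : ℝ × ℝ) :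
    HasFDerivAt u (a p • ContinuousLinearMap.fst ℝ ℝ ℝ + b p • ContinuousLinearMap.snd ℝ ℝ ℝ) p := by
  have := (hasStrictFDerivAt_uncurry_coprod (𝕜 := ℝ) (u := p) (f := fun x y => u (x, y))
    (f₁ := fun x y => ContinuousLinearMap.toSpanSingleton ℝ (a (x, y))) (f₂ := fun x y => ContinuousLinearMap.toSpanSingleton ℝ (b (x, y)))
    (Eventually.of_forall fun q => (hx q.1 q.2).hasFDerivAt) (Eventually.of_forall fun q => (hy q.1 q.2).hasFDerivAt)
    (by
      refine Continuous.continuousAt ?_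
      exact (ContinuousLinearMap.toSpanSingletonCLE (𝕜 := ℝ) (E := ℝ)).continuous.comp ca)
    (by
      refine Continuous.continuousAt ?_
      exact (ContinuousLinearMap.toSpanSingletonCLE (𝕜 := ℝ) (E := ℝ)).continuous.comp cb)).hasFDerivAt
  refine this.congr_fderiv ?_
  ext <;> simp [Function.HasUncurry.uncurry]

theorem c1_of_partials {u a b : ℝ × ℝ → ℝ} (ca : Continuous a) (cb : Continuous b)
    (hx : ∀ x y, HasDerivAt (fun x => u (x, y)) (a (x, y)) x) (hy : ∀ x y, HasDerivAt (fun y => u (x, y)) (b (x, y)) y) :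
    ContDiff ℝ 1 u := by
  have h := fd_of_partials ca cb hx hy
  rw [contDiff_one_iff_fderiv]
  refine ⟨fun p => (h p).differentiableAt, ?_⟩
  rw [funext fun p => (h p).fderiv]
  fun_prop

theorem c2_of_partials {u a b : ℝ × ℝ → ℝ} (ca : ContDiff ℝ 1 a) (cb : ContDiff ℝ 1 b)
    (hx : ∀ x y, HasDerivAt (fun x => u (x, y)) (a (x, y)) x) (hy : ∀ x y, HasDerivAt (fun y => u (x, y)) (b (x, y)) y) :
    ContDiff ℝ 2 u := by
  have h := fd_of_partials ca.continuous cb.continuous hx hy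
  rw [show (2 : WithTop ℕ∞) = 1 + 1 by norm_num, contDiff_succ_iff_fderiv]
  refine ⟨fun p => (h p).differentiableAt, by simp, ?_⟩
  rw [funext fun p => (h p).fderiv]
  exact (ca.smul contDiff_const).add (cb.smul contDiff_const)

theorem not_oned {w : ℝ → ℝ} (hw : ∀ s, w s = 0 → s = -1 ∨ s = 0 ∨ s = 1) {u ux v vy : ℝ × ℝ → ℝ}
    (hx : ∀ x y, HasDerivAt (fun x => u (x, y)) (ux (x, y)) x) (hy : ∀ x y, HasDerivAt (fun y => u (x, y)) (v (x, y)) y)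
    (hxx : ∀ x y, HasDerivAt (fun x => ux (x, y)) (w (u (x, y)) - x * (x * vy (x, y))) x)
    (hyy : ∀ x y, HasDerivAt (fun y => v (x, y)) (vy (x, y)) y) (hm : ∀ x y z, y < z → u (x, y) < u (x, z)) :
    ¬ ∃ (g : ℝ → ℝ) (a b : ℝ), ∀ p : ℝ × ℝ, u p = g (a * p.1 + b * p.2) := by
  rintro ⟨g, a, b, hg⟩
  have hb : b ≠ 0 := by
    rintro rfl
    have := hm 0 0 1 one_pos
    rw [hg, hg (0, 1)] at this
    simp at this
  obtain ⟨m, hm'⟩ : ∃ m, m = a / b := ⟨_, rfl⟩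
  have e1 : ∀ x y, u (x, y) = u (0, y + m * x) := by
    intro x y
    rw [hg, hg (0, _)]
    congr 1
    rw [hm']
    field_simp
    ring
  have lin : ∀ y x, HasDerivAt (fun x => y + m * x) m x := fun y x => by
    simpa using ((hasDerivAt_id x).const_mul m).const_add y
  have ev : ∀ x y, v (x, y) = v (0, y + m * x) := by
    intro x y
    have h1 := hy x y
    rw [funext fun y => e1 x y] at h1
    exact h1.unique (HasDerivAt.comp_add_const y (m * x) (hy 0 _))
  have evy : ∀ x y, vy (x, y) = vy (0, y + m * x) := by
    intro x y
    have h1 := hyy x y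
    rw [funext fun y => ev x y] at h1
    exact h1.unique (HasDerivAt.comp_add_const y (m * x) (hyy 0 _))
  have eux : ∀ x y, ux (x, y) = v (0, y + m * x) * m := by
    intro x y
    have h1 := hx x y
    rw [funext fun x => e1 x y] at h1
    exact h1.unique (HasDerivAt.comp x (h₂ := fun y => u (0, y)) (hy 0 _) (lin y x))
  have euxx : ∀ x y, w (u (x, y)) - x * (x * vy (x, y)) = vy (0, y + m * x) * m * m := by
    intro x y
    have h1 := hxx x y
    rw [funext fun x => eux x y] at h1
    exact h1.unique ((HasDerivAt.comp x (h₂ := fun y => v (0, y)) (hyy 0 _) (lin y x)).mul_const m)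
  have hz : ∀ t, u (0, t) = -1 ∨ u (0, t) = 0 ∨ u (0, t) = 1 := by
    intro t
    apply hw
    have h1 := euxx 0 t
    have h2 := euxx 1 (t - m)
    rw [e1, evy] at h2
    simp only [mul_one, sub_add_cancel, mul_zero, add_zero, zero_mul, sub_zero, one_mul] at h1 h2
    have : vy (0, t) = 0 := by linarith
    rw [h1, this]; ring
  have a1 := hm 0 0 1 (by norm_num)
  have a2 := hm 0 1 2 (by norm_num)
  have a3 := hm 0 2 3 (by norm_num)
  rcases hz 0 with h | h | h <;> rcases hz 1 with h' | h' | h' <;> rcases hz 2 with i | i | i <;> rcases hz 3 with j | j | j <;> linarith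
end

section
open MeasureTheory Filter Topology Set

theorem S_cut {v S : ℝ × ℝ → ℝ} {M A : ℝ} (cS : Continuous S) (hM : ∀ p, |v p| ≤ M)
    (hS : ∀ x y, HasDerivAt (fun y => x * v (x, y)) (S (x, y)) y)
    (hA : ∀ x y τ, |S (x, y + τ) - S (x, y)| ≤ A * (1 + |x|) * |τ| ^ (1/4 : ℝ))
    {ζ : ℝ → ℝ} (cζ : Continuous ζ) (h1 : ∀ x, |ζ x| ≤ 1) (h3 : ∀ x, 3 ≤ |x| → ζ x = 0) : HB (fun p => ζ p.1 * p.1 * S p) (1/4) := by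
  have hM0 := (abs_nonneg _).trans (hM 0)
  have hA0 : 0 ≤ A := by
    have := (abs_nonneg _).trans (hA 0 0 1)
    simpa using this
  have hz : ∀ x, |ζ x * x| ≤ 3 := by
    intro x
    rcases le_or_gt 3 |x| with h | h
    · rw [h3 x h]; simp
    · rw [abs_mul]
      nlinarith [h1 x, abs_nonneg (ζ x), abs_nonneg x]
  have hSb : ∀ x y, |x| ≤ 3 → |S (x, y)| ≤ 6 * M + 4 * A := by
    intro x y hx
    obtain ⟨c, hc, e⟩ := exists_hasDerivAt_eq_slope (fun y => x * v (x, y)) (fun y => S (x, y)) (show y < y + 1 by linarith)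
      (fun t _ => (hS x t).continuousAt.continuousWithinAt) (fun t _ => hS x t)
    rw [add_sub_cancel_left, div_one] at e
    have e1 := hA x y (c - y)
    rw [add_sub_cancel] at e1
    have e2 : |c - y| ^ (1/4:ℝ) ≤ 1 := by
      refine Real.rpow_le_one (abs_nonneg _) ?_ (by norm_num)
      rw [abs_of_pos (by linarith [hc.1])]; linarith [hc.2]
    have e3 : |S (x, c)| ≤ 6 * M := by
      rw [e, ← mul_sub, abs_mul]
      have := abs_sub (v (x, y + 1)) (v (x, y))
      have := hM (x, y + 1)
      have := hM (x, y)
      nlinarith [abs_nonneg x]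
    have e4 : A * (1 + |x|) * |c - y| ^ (1/4:ℝ) ≤ 4 * A := by
      have : A * (1 + |x|) ≤ 4 * A := by nlinarith
      have h5 : 0 ≤ A * (1 + |x|) := by positivity
      nlinarith [Real.rpow_nonneg (abs_nonneg (c - y)) (1/4)]
    have e5 := abs_sub_abs_le_abs_sub (S (x, y)) (S (x, c))
    rw [abs_sub_comm] at e5
    linarith
  refine ⟨by fun_prop, ⟨3 * (6 * M + 4 * A), fun p => ?_⟩, ⟨3 * (4 * A), fun x y τ => ?_⟩⟩
  · rcases le_or_gt 3 |p.1| with h | h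
    · rw [h3 _ h]; simp; positivity
    · rw [abs_mul]
      exact mul_le_mul (hz _) (hSb _ _ h.le) (abs_nonneg _) (by norm_num)
  · beta_reduce
    rw [← mul_sub]
    rcases le_or_gt 3 |x| with h | h
    · rw [h3 _ h]; simp; positivity
    · rw [abs_mul, mul_assoc]
      refine mul_le_mul (hz _) ((hA x y τ).trans ?_) (abs_nonneg _) (by norm_num)
      exact mul_le_mul_of_nonneg_right (by nlinarith) (Real.rpow_nonneg (abs_nonneg _) _)

theorem hb_lipf {h : ℝ × ℝ → ℝ} {γ : ℝ} (H : HB h γ) {φ : ℝ → ℝ} (hφ : Continuous φ) (hC : ∃ C, ∀ s t, |φ s - φ t| ≤ C * |s - t|) :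
    HB (fun p => φ (h p)) γ := by
  obtain ⟨C, hC⟩ := hC
  obtain ⟨A, hA⟩ := H.bd
  exact H.lip (fun s t _ _ => hC s t) hφ hA

/-- Local second derivative in `y` near a point of the degenerate line where `∂ₓu > 0`. -/
theorem vy_near {u ux v vx S F Fd : ℝ × ℝ → ℝ} {M N y0 : ℝ} (hv : CS v (fun p => Fd p * v p) M N)
    (hx : ∀ x y, HasDerivAt (fun x => ux (x, y)) (F (x, y) - x * S (x, y)) x)
    (hFx : ∀ x y, HasDerivAt (fun x => F (x, y)) (Fd (x, y) * ux (x, y)) x)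
    (hvx : ∀ x y, HasDerivAt (fun x => v (x, y)) (vx (x, y)) x)
    (Hux : HB ux (3/4)) (HF : HB F (3/4)) (Hv : HB v (3/4)) (Hvx : HB vx (1/4)) (cFd : Continuous Fd) (bFd : ∃ A, ∀ p, |Fd p| ≤ A)
    (cS : Continuous S) (hS : ∀ x y, HasDerivAt (fun y => x * v (x, y)) (S (x, y)) y)
    (hA : ∃ A, ∀ x y τ, |S (x, y + τ) - S (x, y)| ≤ A * (1 + |x|) * |τ| ^ (1/4 : ℝ)) (hp : 0 < ux (0, y0)) :
    ∃ r > 0, ∃ vy : ℝ × ℝ → ℝ, Continuous vy ∧ ∀ x y, |x| < r → |y - y0| < r → HasDerivAt (fun y => v (x, y)) (vy (x, y)) y := by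
  obtain ⟨A, hA⟩ := hA
  obtain ⟨B, hB⟩ := bFd
  obtain ⟨θ, θ', dθ, Lθ, Lθ', cθ', hθ⟩ := theta_ex hp
  have cθ : Continuous θ := continuous_iff_continuousAt.2 fun t => (dθ t).continuousAt
  let ζ : ContDiffBump (0:ℝ) := ⟨2, 3, by norm_num, by norm_num⟩
  have ζ1 : ∀ x, |ζ x| ≤ 1 := fun x => by rw [abs_of_nonneg ζ.nonneg]; exact ζ.le_one
  have ζ3 : ∀ x : ℝ, 3 ≤ |x| → ζ x = 0 := fun x h => ζ.zero_of_le_dist (by rw [Real.dist_eq, sub_zero]; exact h)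
  have ζc : ContDiff ℝ 1 ζ := ζ.contDiff
  have cζ : Continuous ζ := ζc.continuous
  have cζ' : Continuous (deriv ζ) := (contDiff_one_iff_deriv.1 ζc).2
  obtain ⟨Z, hZ⟩ := cζ'.bounded_above_of_compact_support ζ.hasCompactSupport.deriv
  have Hζ : ∀ γ, HB (fun p => ζ p.1) γ := fun γ => HB.of_x cζ ζ1
  have Hζ' : HB (fun p => deriv ζ p.1) (1/4) := HB.of_x cζ' hZ
  have Hθ : HB (fun p => θ (ux p)) (3/4) := hb_lipf Hux cθ Lθ
  have Hθ' : HB (fun p => θ' (ux p)) (3/4) := hb_lipf Hux cθ' Lθ'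
  have HS := S_cut cS hv.bd hS hA cζ ζ1 ζ3
  have Hb : HB (fun p => ζ p.1 * (v p * θ (ux p))) (3/4) := (Hζ _).mul (Hv.mul Hθ)
  have Hm : HB (fun p => (-1 : ℝ)) (1/4) := HB.of_x (c := fun _ => -1) continuous_const (A := 1) (by simp)
  have Hbx : HB (fun p => deriv ζ p.1 * (v p * θ (ux p)) + ζ p.1 * (vx p * θ (ux p) + v p * (θ' (ux p) * (F p - p.1 * S p)))) (1/4) := by
    have h1 := ((Hζ'.mul (Hv.mul Hθ).mono).add ((Hζ _).mul (Hvx.mul Hθ.mono))).add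
      ((Hv.mul Hθ').mono.mul (((Hζ _).mul HF.mono).add (Hm.mul HS)))
    convert h1 using 1
    funext p; ring
  obtain ⟨D, hD⟩ := Hb.bd
  obtain ⟨U, hU⟩ := Hux.bd
  have hbF : BM (fun p => ζ p.1 * (v p * θ (ux p)) * (Fd p * ux p)) (D * (B * U)) := by
    refine ⟨(Hb.cont.mul (cFd.mul Hux.cont)).measurable, fun p => ?_⟩
    rw [abs_mul, abs_mul (Fd p)]
    have := (abs_nonneg _).trans (hB p)
    have := (abs_nonneg _).trans (hD p)
    exact mul_le_mul (hD p) (mul_le_mul (hB p) (hU p) (abs_nonneg _) (by assumption)) (by positivity) (by assumption)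
  have hev : ∀ᶠ p in 𝓝 ((0:ℝ), y0), |ux p - ux (0, y0)| < ux (0, y0) / 4 :=
    (Hux.cont.sub continuous_const).abs.continuousAt.eventually_lt continuousAt_const (by simpa using hp)
  obtain ⟨ε, hε, hb⟩ := Metric.eventually_nhds_iff.1 hev
  set r := min (ε / 4) 1 with hr
  have r0 : 0 < r := by positivity
  have r1 : r ≤ 1 := min_le_right _ _
  have r2 : r ≤ ε / 4 := min_le_left _ _
  obtain ⟨vy, c, h⟩ := vy_local (r := r) (y0 := y0) hv (Hb.mul HF) (Hbx.mul HF.mono) hbF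
    (fun x y => ((ζc.differentiable (by norm_num) x).hasDerivAt).mul ((hvx x y).mul ((dθ _).comp x (hx x y))))
    hFx r0 r1 (fun x y h1 h2 => by
      have z1 : ζ x = 1 := ζ.one_of_mem_closedBall (by
        rw [Metric.mem_closedBall, Real.dist_eq, sub_zero]
        show |x| ≤ 2
        linarith)
      have t1 := hθ (ux (x, y)) (hb (y := (x, y)) (by
        rw [Prod.dist_eq, Real.dist_eq, Real.dist_eq, sub_zero]
        exact max_lt (by linarith) (by linarith))).le
      show Fd (x, y) * v (x, y) = ζ x * (v (x, y) * θ (ux (x, y))) * (Fd (x, y) * ux (x, y))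
      rw [z1]
      linear_combination (-(Fd (x, y) * v (x, y))) * t1)
  exact ⟨r, r0, vy, c, h⟩

/-- Gluing the local derivatives. -/
theorem vy_glue {v S : ℝ × ℝ → ℝ} (cS : Continuous S) (hS : ∀ x y, HasDerivAt (fun y => x * v (x, y)) (S (x, y)) y)
    (h : ∀ y0, ∃ r > 0, ∃ vy : ℝ × ℝ → ℝ, Continuous vy ∧ ∀ x y, |x| < r → |y - y0| < r → HasDerivAt (fun y => v (x, y)) (vy (x, y)) y) :
    ∃ vy : ℝ × ℝ → ℝ, Continuous vy ∧ (∀ x y, HasDerivAt (fun y => v (x, y)) (vy (x, y)) y) ∧ ∀ x y, S (x, y) = x * vy (x, y) := by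
  have loc : ∀ p : ℝ × ℝ, ∃ g : ℝ × ℝ → ℝ, ContinuousAt g p ∧ ∀ᶠ q in 𝓝 p, HasDerivAt (fun y => v (q.1, y)) (g q) q.2 := by
    rintro ⟨x, y⟩
    rcases eq_or_ne x 0 with h0 | h0
    · subst h0
      obtain ⟨r, hr, vy, c, hd⟩ := h y
      refine ⟨vy, c.continuousAt, ?_⟩
      filter_upwards [Metric.ball_mem_nhds ((0:ℝ), y) hr] with q hq
      rw [Metric.mem_ball, Prod.dist_eq, Real.dist_eq, Real.dist_eq, sub_zero] at hq
      exact hd q.1 q.2 (lt_of_le_of_lt (le_max_left _ _) hq) (lt_of_le_of_lt (le_max_right _ _) hq)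
    · refine ⟨fun q => q.1⁻¹ * S q, (continuousAt_fst.inv₀ h0).mul cS.continuousAt, ?_⟩
      filter_upwards [continuousAt_fst.eventually_ne h0] with q hq
      have := (hS q.1 q.2).const_mul q.1⁻¹
      simpa only [inv_mul_cancel_left₀ hq] using this
  have hd : ∀ x y, HasDerivAt (fun y => v (x, y)) (deriv (fun y => v (x, y)) y) y := by
    intro x y
    obtain ⟨g, -, hg⟩ := loc (x, y)
    exact hg.self_of_nhds.differentiableAt.hasDerivAt
  refine ⟨fun p => deriv (fun y => v (p.1, y)) p.2, ?_, hd, fun x y => (hS x y).unique ((hd x y).const_mul x)⟩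
  rw [continuous_iff_continuousAt]
  intro p
  obtain ⟨g, cg, hg⟩ := loc p
  refine cg.congr ?_
  filter_upwards [hg] with q hq using hq.deriv.symm
end

section
open MeasureTheory Filter Topology Set

/-- Hopf: the `x`-derivative is positive on the degenerate line. -/
theorem ux_pos {k : ℝ} {f : ℝ → ℝ} (K : FK k f) {u ux : ℝ × ℝ → ℝ} (cu : Continuous u) (bu : ∀ p, |u p| ≤ 1) (hT : TF k f u = u)
    (hr : ∀ x y, 0 < x → u (-x, y) < u (x, y)) (hx : ∀ x y, HasDerivAt (fun x => u (x, y)) (ux (x, y)) x) (y : ℝ) : 0 < ux (0, y) := by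
  have cr : Continuous fun q : ℝ × ℝ => u (-q.1, q.2) := by fun_prop
  have b1 := K.bm cu.measurable bu
  have b2 := K.bm cr.measurable fun p => bu _
  have cf := K.cont
  obtain ⟨c, hc, d, hd, h⟩ := TT_hopf K.hk (b1.sub b2) ((cf.comp cu).sub (cf.comp cr)) (fun x y => by simp)
    (fun x y h0 => by
      have := K.lt (bu _) (bu _) (hr x y h0)
      simpa using this) y
  have h1 : ∀ x, 0 < x → x < d → c * x ≤ u (x, y) - u (-x, y) := by
    intro x x0 xd
    have e := h x x0 xd
    rw [TT_sub K.hk b1 b2] at e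
    have e1 : TT k (fun q => f (u q)) (x, y) = u (x, y) := congrFun hT (x, y)
    have e2 := K.TF_rho cu.measurable bu (x, y)
    rw [hT] at e2
    have e3 : TT k (fun q => f (u (-q.1, q.2))) (x, y) = u (-x, y) := e2
    rwa [e1, e3] at e
  have h2 : HasDerivAt (fun x => u (x, y) - u (-x, y)) (ux (0, y) - ux (0, y) * -1) 0 := by
    refine (hx 0 y).sub ?_
    have h3 : HasDerivAt (fun x => u (x, y)) (ux (0, y)) (-0) := by rw [neg_zero]; exact hx 0 y
    exact HasDerivAt.comp (0:ℝ) h3 (hasDerivAt_neg 0)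
  have h3 := ge_of_tendsto (b := c) h2.tendsto_slope_zero_right (by
    filter_upwards [Ioo_mem_nhdsGT hd] with x hx
    have := h1 x hx.1 hx.2
    simp only [zero_add, neg_zero, sub_self, sub_zero, smul_eq_mul]
    rw [inv_mul_eq_div, le_div_iff₀ hx.1]
    exact this)
  linarith

theorem main_aux (W : ℝ → ℝ) (hW : DoubleWell W) :
    ∃ u : ℝ × ℝ → ℝ, ContDiff ℝ 2 u ∧ (∀ p : ℝ × ℝ, |u p| ≤ 1) ∧
      (∀ p : ℝ × ℝ, grushinLap u p - deriv W (u p) = 0) ∧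
      (∀ p : ℝ × ℝ, 0 < pY u p) ∧
      ¬ ∃ (g : ℝ → ℝ) (a b : ℝ), ∀ p : ℝ × ℝ, u p = g (a * p.1 + b * p.2) := by
  obtain ⟨k, K, hk2, κ, hκ, ε, hε, hf⟩ := dw_facts hW
  obtain ⟨u, cu, bu, hT, hmono, hrho⟩ := entire K hκ hε hf
  obtain ⟨h2, -, -, -, -, -, -, -, hz⟩ := hW
  have hw : ContDiff ℝ 1 (deriv W) := ((contDiff_succ_iff_deriv (n := 1)).1 h2).2.2
  have cw := hw.continuous
  have dw : ∀ s, HasDerivAt (deriv W) (deriv (deriv W) s) s := fun s => (hw.differentiable (by norm_num) s).hasDerivAt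
  have cd : Continuous (deriv (deriv W)) := (contDiff_one_iff_deriv.1 hw).2
  have hm : ∀ x y z, y < z → u (x, y) < u (x, z) := fun x y z h => by
    have := hmono (z - y) (x, y) (by linarith)
    simpa using this
  have hu : CS u (fun p => deriv W (u p)) (k / k) (k + k) := by
    refine cs_of_eq (TT_spec K.hk (K.bm cu.measurable bu)) hT ?_
    funext p
    have : TT k (fun q => k * u q - deriv W (u q)) p = u p := congrFun hT p
    show k * TT k (fun q => k * u q - deriv W (u q)) p - (k * u p - deriv W (u p)) = deriv W (u p)
    rw [this]; ring
  obtain ⟨A1, -, rY⟩ := CS.regY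
  obtain ⟨A2, -, rX⟩ := CS.regX
  have Hu : HB u (3/4) := ⟨cu, ⟨1, bu⟩, _, rY _ _ _ _ hu⟩
  have HF : HB (fun p => deriv W (u p)) (3/4) := by
    refine Hu.lip (C := k) (A := 1) (fun s t hs ht => ?_) cw bu
    have := (convex_Icc (-1:ℝ) 1).norm_image_sub_le_of_norm_hasDerivWithin_le (f := deriv W) (C := k)
      (fun x _ => (dw x).hasDerivWithinAt) (fun x hx => (hk2 x (abs_le.2 hx)).le) (abs_le.1 ht) (abs_le.1 hs)
    simpa [Real.norm_eq_abs] using this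
  obtain ⟨L, hL⟩ := HF.hol
  obtain ⟨v, cv, dv, M, hM⟩ := hu.regYd (by norm_num) (by norm_num) hL
  have bFd : ∀ p, |deriv (deriv W) (u p)| ≤ k := fun p => (hk2 _ (bu p)).le
  have cFd : Continuous fun p => deriv (deriv W) (u p) := cd.comp cu
  have hG : BM (fun p => deriv (deriv W) (u p) * v p) (k * M) := ⟨(cFd.mul cv).measurable, fun p => by
    rw [abs_mul]; exact mul_le_mul (bFd p) (hM p) (abs_nonneg _) K.hk.le⟩
  have hv : CS v (fun p => deriv (deriv W) (u p) * v p) M (k * M) :=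
    hu.dy cv hM hG dv fun x y => HasDerivAt.comp y (dw _) (dv x y)
  have vnn : ∀ p, 0 ≤ v p := fun p => by
    have h1 : Monotone fun y => u (p.1, y) := (show StrictMono fun y => u (p.1, y) from fun y z h => hm p.1 y z h).monotone
    have := h1.deriv_nonneg (x := p.2)
    rwa [(dv p.1 p.2).deriv] at this
  have vne : ∃ p, v p ≠ 0 := by
    by_contra hn
    push Not at hn
    have h1 := hm 0 0 1 one_pos
    have := mvt_y (M := 0) dv (fun p => by rw [hn p, abs_zero]) 0 0 1
    rw [zero_mul, zero_add, abs_nonpos_iff] at this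
    linarith
  have vpos : ∀ p, 0 < v p := by
    have hg : BM (fun p => k * v p - deriv (deriv W) (u p) * v p) (|k| * M + k * M) := (hv.bm.smul k).sub hG
    have e : TT k (fun p => k * v p - deriv (deriv W) (u p) * v p) = v :=
      TT_eq K.hk hg (cs_of_eq hv rfl (by funext p; ring))
    intro p
    rw [← e]
    refine TT_pos K.hk hg ((cv.const_mul k).sub (cFd.mul cv)) (fun p => ?_) ?_ p
    · have := (abs_lt.1 (hk2 _ (bu p))).2
      nlinarith [vnn p]
    · obtain ⟨p, hp⟩ := vne
      refine ⟨p, ?_⟩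
      have := (abs_lt.1 (hk2 _ (bu p))).2
      rw [← sub_mul]
      exact mul_ne_zero (by linarith) hp
  obtain ⟨ux, cux, hx, hBx, -⟩ := rX _ _ _ _ hu
  obtain ⟨vx, cvx, hvx, hBvx, hLvx⟩ := rX _ _ _ _ hv
  obtain ⟨S, cS, hS, hA⟩ := hv.regS
  have hxx := xx_lemma cu cux cv HF.cont cS hx dv hS hu.ds
  have hxy := swap_xy hx dv cv hvx cvx hBvx
  have Hux : HB ux (3/4) := ⟨cux, ⟨_, hBx⟩, _, holY_of_deriv hBx hxy hBvx (by norm_num) (by norm_num)⟩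
  have Hv : HB v (3/4) := ⟨cv, ⟨_, hM⟩, _, rY _ _ _ _ hv⟩
  have Hvx : HB vx (1/4) := ⟨cvx, ⟨_, hBvx⟩, _, hLvx⟩
  obtain ⟨vy, cvy, hyy, hSe⟩ := vy_glue cS hS fun y0 => vy_near (Fd := fun p => deriv (deriv W) (u p)) (u := u) hv hxx
    (fun x y => HasDerivAt.comp x (dw _) (hx x y)) hvx Hux HF Hv Hvx cFd ⟨k, bFd⟩ cS hS hA (ux_pos K cu bu hT hrho hx y0)
  have hxx' : ∀ x y, HasDerivAt (fun x => ux (x, y)) (deriv W (u (x, y)) - x * (x * vy (x, y))) x := fun x y => by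
    rw [← hSe]; exact hxx x y
  have c1 : ContDiff ℝ 1 ux := c1_of_partials (a := fun p => deriv W (u p) - p.1 * S p) (HF.cont.sub (continuous_fst.mul cS)) cvx hxx hxy
  refine ⟨u, c2_of_partials c1 (c1_of_partials cvx cvy hvx hyy) hx dv, bu, fun p => ?_, fun p => ?_, not_oned (fun s h => (hz s).1 h) hx dv hxx' hyy hm⟩
  · unfold grushinLap pXX pYY
    rw [funext fun x => (hx x p.2).deriv, funext fun y => (dv p.1 y).deriv, (hxx' p.1 p.2).deriv, (hyy p.1 p.2).deriv]
    ring
  · unfold pY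
    rw [(dv p.1 p.2).deriv]
    exact vpos p
end

/-- the counter-example (Theorem 5.2 of the paper). There is an entire
solution `u` of the Grushin Allen–Cahn equation `Δ_G u − W'(u) = 0`, with `|u| ≤ 1`,
which is monotone (`∂_y u > 0`) but NOT one-dimensional: there are no `g : ℝ → ℝ` and
`a, b ∈ ℝ` with `u(x,y) = g(ax + by)` for all `(x,y)`. -/
theorem monotone_not_one_dimensional (W : ℝ → ℝ) (hW : DoubleWell W) :
    ∃ u : ℝ × ℝ → ℝ, ContDiff ℝ 2 u ∧ (∀ p : ℝ × ℝ, |u p| ≤ 1) ∧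
      (∀ p : ℝ × ℝ, grushinLap u p - deriv W (u p) = 0) ∧
      (∀ p : ℝ × ℝ, 0 < pY u p) ∧
      ¬ ∃ (g : ℝ → ℝ) (a b : ℝ), ∀ p : ℝ × ℝ, u p = g (a * p.1 + b * p.2) := by
  exact main_aux W hW
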